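/- Let D ⊂ ℂⁿ be a bounded domain of class C² that is strongly pseudoconvex, and let 𝒦 : D × D → ℂ be the Bergman kernel function of D, i.e., for every z ∈ D the function w ↦ conj(𝒦(z, w)) lies in the Bergman space 𝒪L²(D) and f(z) = ∫_D 𝒦(z, w) f(w) dV(w) for every f ∈ 𝒪L²(D). Then for every 1 < p < ∞ there is a constant C_p such that for every f ∈ L^p(D, dV) the function z ↦ ∫_D |𝒦(z, w)| |f(w)| dV(w) lies in L^p(D, dV) with norm at most C_p ‖f‖_{L^p(D,dV)}. -/

import Mathlib

open MeasureTheory Complex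

noncomputable section

/-- ℂⁿ with the Euclidean norm. -/
abbrev Cn (n : ℕ) := EuclideanSpace ℂ (Fin n)

instance (n : ℕ) : MeasurableSpace (Cn n) := borel _
instance (n : ℕ) : BorelSpace (Cn n) := ⟨rfl⟩

/-- Wirtinger derivative ∂f/∂ζⱼ of `f : ℂⁿ → ℂ` at `w`. -/
def wderiv {n : ℕ} (f : Cn n → ℂ) (w : Cn n) (j : Fin n) : ℂ :=
  (1/2) * (fderiv ℝ f w (EuclideanSpace.single j (1:ℂ))
            - Complex.I * fderiv ℝ f w (EuclideanSpace.single j Complex.I))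

/-- Conjugate Wirtinger derivative ∂f/∂ζ̄ⱼ of `f : ℂⁿ → ℂ` at `w`. -/
def wderivBar {n : ℕ} (f : Cn n → ℂ) (w : Cn n) (j : Fin n) : ℂ :=
  (1/2) * (fderiv ℝ f w (EuclideanSpace.single j (1:ℂ))
            + Complex.I * fderiv ℝ f w (EuclideanSpace.single j Complex.I))

/-- A real-valued function regarded as complex valued. -/
def realToC {n : ℕ} (ρ : Cn n → ℝ) : Cn n → ℂ := fun w => (ρ w : ℂ)

/-- ⟨∂ρ(w), ξ⟩ = Σⱼ (∂ρ/∂ζⱼ)(w) ξⱼ. -/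
def delPair {n : ℕ} (ρ : Cn n → ℝ) (w ξ : Cn n) : ℂ :=
  ∑ j, wderiv (realToC ρ) w j * ξ j

/-- Second Wirtinger derivative ∂²ρ/∂ζⱼ∂ζₖ. -/
def wderiv2 {n : ℕ} (ρ : Cn n → ℝ) (w : Cn n) (j k : Fin n) : ℂ :=
  wderiv (fun v => wderiv (realToC ρ) v j) w k

/-- The Levi form L_w(ρ)(ξ) = Σ_{j,k} (∂²ρ/∂ζⱼ∂ζ̄ₖ)(w) ξⱼ ξ̄ₖ (a real number). -/
def leviForm {n : ℕ} (ρ : Cn n → ℝ) (w ξ : Cn n) : ℝ :=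
  (∑ j, ∑ k, wderivBar (fun v => wderiv (realToC ρ) v j) w k * ξ j * (starRingEnd ℂ) (ξ k)).re

/-- Surface measure σ on bD: (2n−1)-dimensional Hausdorff measure restricted to the boundary. -/
def bSigma {n : ℕ} (D : Set (Cn n)) : Measure (Cn n) :=
  (μH[(2*(n:ℝ) - 1)]).restrict (frontier D)

/-- Lebesgue measure dV on ℂⁿ ≅ ℝ²ⁿ, realized as 2n-dimensional Hausdorff measure. -/
def dVol (n : ℕ) : Measure (Cn n) := μH[(2*(n:ℝ))]

local notation "conj" => starRingEnd ℂ

section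
instance dVol_haar (n : ℕ) : (dVol n).IsAddHaarMeasure := by
  have h : (2*(n:ℝ)) = ((Module.finrank ℝ (Cn n) : ℕ) : ℝ) := by
    rw [← Module.finrank_mul_finrank ℝ ℂ (Cn n)]; simp
  unfold dVol
  rw [h]; infer_instance

lemma dVol_rot (n : ℕ) (c : ℂ) (hc : ‖c‖ = 1) :
    MeasurePreserving (fun x : Cn n => c • x) (dVol n) (dVol n) := by
  have h0 : c ≠ 0 := by intro h; simp [h] at hc
  let e : Cn n ≃ₗᵢ[ℂ] Cn n :=
    { LinearEquiv.smulOfNeZero ℂ (Cn n) c h0 with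
      norm_map' := by intro x; simp [norm_smul, hc] }
  exact e.toIsometryEquiv.measurePreserving_hausdorffMeasure _

lemma circle_mv {n : ℕ} {Ω : Set (Cn n)} (hΩ : IsOpen Ω)
    (hbal : ∀ x ∈ Ω, ∀ c : ℂ, ‖c‖ ≤ 1 → c • x ∈ Ω) {h : Cn n → ℂ}
    (hh : DifferentiableOn ℂ h Ω) {x : Cn n} (hx : x ∈ Ω) :
    ∫ θ in (0:ℝ)..(2*Real.pi), h (circleMap 0 1 θ • x) = (2*Real.pi : ℝ) • h 0 := by
  have hd : ∀ c ∈ Metric.closedBall (0:ℂ) 1, DifferentiableAt ℂ (fun c : ℂ => h (c • x)) c := by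
    intro c hc
    have hm : c • x ∈ Ω := hbal x hx c (by simpa using hc)
    have := (hh.differentiableAt (hΩ.mem_nhds hm))
    exact DifferentiableAt.comp (𝕜 := ℂ) c this (by fun_prop)
  have := circleAverage_of_differentiable_on_off_countable (f := fun c : ℂ => h (c • x)) (c := 0) (R := 1)
    Set.countable_empty (by intro c hc; exact (hd c (by simpa using hc)).continuousAt.continuousWithinAt)
    (by intro z hz; exact hd z (Metric.ball_subset_closedBall (by simpa using hz.1)))
  rw [Real.circleAverage_def] at this
  simp only [zero_smul] at this
  rw [← this, smul_smul, mul_inv_cancel₀ (by positivity), one_smul]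

/-- weighted mean value property on balanced open sets -/
lemma balanced_mv {n : ℕ} {Ω : Set (Cn n)} (hΩ : IsOpen Ω)
    (hbal : ∀ x ∈ Ω, ∀ c : ℂ, ‖c‖ ≤ 1 → c • x ∈ Ω) {h : Cn n → ℂ}
    (hh : DifferentiableOn ℂ h Ω) {m : Cn n → ℂ} (hm : Measurable m)
    (hmi : ∀ x, ∀ c : ℂ, ‖c‖ = 1 → m (c • x) = m x)
    (hintg : IntegrableOn (fun x => m x * h x) Ω (dVol n)) :
    ∫ x in Ω, m x * h x ∂(dVol n) = h 0 * ∫ x in Ω, m x ∂(dVol n) := by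
  set g : Cn n → ℂ := Ω.indicator (fun x => m x * h x) with hg
  have hgm : Measurable g := by
    have h1 : Measurable (Ω.indicator h) := by
      classical
      rw [← Set.piecewise_eq_indicator]
      exact hh.continuousOn.measurable_piecewise continuousOn_const hΩ.measurableSet
    have : g = fun x => m x * Ω.indicator h x := by
      ext x; by_cases hx : x ∈ Ω <;> simp [g, hx]
    rw [this]; exact hm.mul h1
  have hgi : Integrable g (dVol n) := hintg.integrable_indicator hΩ.measurableSet
  have hrot : ∀ θ : ℝ, ∫ x, g (circleMap 0 1 θ • x) ∂(dVol n) = ∫ x, g x ∂(dVol n) := by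
    intro θ
    have hc : ‖circleMap 0 1 θ‖ = 1 := by simp
    have h0 : circleMap 0 1 θ ≠ 0 := by intro h; simp [h] at hc
    exact (dVol_rot n _ hc).integral_comp
      (Homeomorph.smulOfNeZero (circleMap 0 1 θ) h0).measurableEmbedding g
  have hrot' : ∀ θ : ℝ, ∫ x, ‖g (circleMap 0 1 θ • x)‖ ∂(dVol n) = ∫ x, ‖g x‖ ∂(dVol n) := by
    intro θ
    have hc : ‖circleMap 0 1 θ‖ = 1 := by simp
    have h0 : circleMap 0 1 θ ≠ 0 := by intro h; simp [h] at hc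
    exact (dVol_rot n _ hc).integral_comp
      (Homeomorph.smulOfNeZero (circleMap 0 1 θ) h0).measurableEmbedding (fun x => ‖g x‖)
  have hjm : Measurable (fun p : ℝ × Cn n => g (circleMap 0 1 p.1 • p.2)) := by
    apply hgm.comp
    exact Measurable.smul ((continuous_circleMap 0 1).measurable.comp measurable_fst) measurable_snd
  have hprod : Integrable (Function.uncurry fun (θ : ℝ) (x : Cn n) => g (circleMap 0 1 θ • x))
      ((volume.restrict (Set.uIoc 0 (2*Real.pi))).prod (dVol n)) := by
    rw [integrable_prod_iff (by exact hjm.aestronglyMeasurable)]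
    constructor
    · refine Filter.Eventually.of_forall fun θ => ?_
      have hc : ‖circleMap 0 1 θ‖ = 1 := by simp
      exact (dVol_rot n _ hc).integrable_comp_of_integrable hgi
    · simp only [Function.uncurry]
      simp only [hrot']
      rw [Set.uIoc_of_le (by positivity)]
      exact integrable_const _
  have hswap := intervalIntegral_integral_swap hprod
  simp only [hrot] at hswap
  have hpt : ∀ x, ∫ θ in (0:ℝ)..(2*Real.pi), g (circleMap 0 1 θ • x)
      = (2*Real.pi : ℝ) • (Ω.indicator (fun x => m x * h 0) x) := by
    intro x
    by_cases hx : x ∈ Ω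
    · have : ∀ θ : ℝ, g (circleMap 0 1 θ • x) = m x * h (circleMap 0 1 θ • x) := by
        intro θ
        have hmem : circleMap 0 1 θ • x ∈ Ω := hbal x hx _ (by simp)
        simp only [g, Set.indicator_of_mem hmem]
        rw [hmi x _ (by simp)]
      simp only [this, Set.indicator_of_mem hx]
      rw [intervalIntegral.integral_const_mul, circle_mv hΩ hbal hh hx]
      simp; ring
    · have : ∀ θ : ℝ, g (circleMap 0 1 θ • x) = 0 := by
        intro θ
        apply Set.indicator_of_notMem
        intro hmem
        apply hx
        have h0 : circleMap 0 1 θ ≠ 0 := by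
          intro h; have : ‖circleMap 0 1 θ‖ = 1 := by simp
          simp [h] at this
        have := hbal _ hmem (circleMap 0 1 θ)⁻¹ (by simp)
        rwa [smul_smul, inv_mul_cancel₀ h0, one_smul] at this
      simp [this, hx]
  simp only [hpt] at hswap
  rw [integral_smul, integral_indicator hΩ.measurableSet] at hswap
  rw [intervalIntegral.integral_const, sub_zero] at hswap
  have h2 : (2*Real.pi : ℝ) ≠ 0 := by positivity
  have := smul_right_injective ℂ h2 hswap
  refine this.trans ?_
  rw [integral_indicator hΩ.measurableSet, integral_mul_const, mul_comm]
end

section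
lemma real_det_complex {n : ℕ} (A : Cn n →L[ℂ] Cn n) :
    (A.restrictScalars ℝ).det = ‖LinearMap.det (A : Cn n →ₗ[ℂ] Cn n)‖^2 := by
  have := LinearMap.det_restrictScalars (R := ℝ) (S := ℂ) (A := Cn n) (f := (A : Cn n →ₗ[ℂ] Cn n))
  rw [Algebra.norm_complex_apply, Complex.normSq_eq_norm_sq] at this
  rw [← this]; rfl

lemma det_rank_one {n : ℕ} (a : ℂ) (ha : a ≠ 0) (l : Cn n →L[ℂ] ℂ) (v : Cn n) :
    LinearMap.det ((a • ContinuousLinearMap.id ℂ (Cn n) + l.smulRight v : Cn n →L[ℂ] Cn n) : Cn n →ₗ[ℂ] Cn n)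
      = a^n * (1 + a⁻¹ * l v) := by
  have h : ((a • ContinuousLinearMap.id ℂ (Cn n) + l.smulRight v : Cn n →L[ℂ] Cn n) : Cn n →ₗ[ℂ] Cn n)
      = a • LinearMap.transvection (l : Cn n →ₗ[ℂ] ℂ) (a⁻¹ • v) := by
    ext x : 1
    simp [LinearMap.transvection, smul_smul, ha]
    rw [mul_left_comm, mul_inv_cancel₀ ha, mul_one]
  rw [h, LinearMap.det_smul, LinearMap.transvection.det]
  simp

/-- data for the local biholomorphism -/
def Gmap {n : ℕ} (l : Cn n →L[ℂ] ℂ) (ν : Cn n) (H : Cn n → ℂ) (s : ℝ) (η : Cn n) : Cn n :=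
  ((s:ℂ) / (s + l η)) • η - H (((s:ℂ) / (s + l η)) • (η - l η • ν)) • ν

def prl {n : ℕ} (l : Cn n →L[ℂ] ℂ) (ν : Cn n) : Cn n →L[ℂ] Cn n :=
  ContinuousLinearMap.id ℂ _ - l.smulRight ν

lemma prl_apply {n : ℕ} (l : Cn n →L[ℂ] ℂ) (ν x : Cn n) : prl l ν x = x - l x • ν := by
  simp [prl]

def Pfun {n : ℕ} (l : Cn n →L[ℂ] ℂ) (ν : Cn n) (H : Cn n → ℂ) (ξ : Cn n) : ℂ :=
  l ξ + H (prl l ν ξ)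

def Eset {n : ℕ} (l : Cn n →L[ℂ] ℂ) (ν : Cn n) (Nf : Cn n → ℝ) (s M : ℝ) : Set (Cn n) :=
  {η | (1/s + M) * ‖l η‖^2 + Nf (prl l ν η) < s}

def Bset {n : ℕ} (l : Cn n →L[ℂ] ℂ) (ν : Cn n) (H : Cn n → ℂ) (Nf : Cn n → ℝ) (s M : ℝ) : Set (Cn n) :=
  {ξ | 2 * (Pfun l ν H ξ).re + M * ‖Pfun l ν H ξ‖^2 + Nf (prl l ν ξ) < s}

lemma Gmap_eq {n : ℕ} (l : Cn n →L[ℂ] ℂ) (ν : Cn n) (H : Cn n → ℂ) (s : ℝ) (η : Cn n) :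
    Gmap l ν H s η = ((s:ℂ) / (s + l η)) • η - H (((s:ℂ) / (s + l η)) • prl l ν η) • ν := by
  simp [Gmap, prl_apply]

section
variable {n : ℕ} {l : Cn n →L[ℂ] ℂ} {ν : Cn n} {H : Cn n → ℂ} {Nf : Cn n → ℝ} {s M : ℝ}

lemma prl_nu (hν : l ν = 1) : prl l ν ν = 0 := by simp [prl_apply, hν]

lemma Gmap_prl (hν : l ν = 1) (η : Cn n) :
    prl l ν (Gmap l ν H s η) = ((s:ℂ) / (s + l η)) • prl l ν η := by
  rw [Gmap_eq, map_sub, map_smul, map_smul, prl_nu hν]; simp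

lemma Gmap_P (hν : l ν = 1) (η : Cn n) :
    Pfun l ν H (Gmap l ν H s η) = ((s:ℂ) / (s + l η)) * l η := by
  rw [Pfun, Gmap_prl hν, Gmap_eq, map_sub, map_smul, map_smul, hν]; simp

lemma E_lt (hs : 0 < s) (hM : 0 ≤ M) (hN0 : ∀ x, 0 ≤ Nf x) {η : Cn n} (h : η ∈ Eset l ν Nf s M) :
    ‖l η‖ < s := by
  have h1 : (1/s + M) * ‖l η‖^2 + Nf (prl l ν η) < s := h
  have h2 := hN0 (prl l ν η)
  have h3 : 0 ≤ M * ‖l η‖^2 := by positivity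
  have h4 : 1/s * ‖l η‖^2 < s := by linarith [add_mul (1/s) M (‖l η‖^2)]
  have h5 : ‖l η‖^2 < s^2 := by
    rw [div_mul_eq_mul_div, one_mul, div_lt_iff₀ hs] at h4; linarith [sq s]
  exact lt_of_pow_lt_pow_left₀ 2 hs.le h5

lemma E_ne (hs : 0 < s) (hM : 0 ≤ M) (hN0 : ∀ x, 0 ≤ Nf x) {η : Cn n} (h : η ∈ Eset l ν Nf s M) :
    (s:ℂ) + l η ≠ 0 := by
  intro h0
  have h1 := E_lt hs hM hN0 h
  have : l η = -(s:ℂ) := by linear_combination h0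
  rw [this] at h1; simp [abs_of_pos hs] at h1

lemma key_id (hs : 0 < s) (a : ℂ) (ha : (s:ℂ) + a ≠ 0) (N : ℝ) :
    s - (2 * ((s:ℂ) / (s + a) * a).re + M * ‖(s:ℂ) / (s + a) * a‖^2 + ‖(s:ℂ) / (s + a)‖^2 * N)
    = ‖(s:ℂ) / (s + a)‖^2 * (s - ((1/s + M) * ‖a‖^2 + N)) := by
  have h0 : 0 < ‖(s:ℂ) + a‖^2 := by positivity
  have e : s - 2 * ((s:ℂ) / (s + a) * a).re = ‖(s:ℂ) / (s + a)‖^2 * (s - 1/s*‖a‖^2) := by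
    have h1 : ((s:ℂ) / (s + a) * a).re = s * (s * a.re + ‖a‖^2) / ‖(s:ℂ) + a‖^2 := by
      rw [div_mul_eq_mul_div, Complex.div_re, ← Complex.normSq_eq_norm_sq, ← Complex.normSq_eq_norm_sq]
      simp [Complex.normSq_apply]
      ring
    rw [h1, norm_div, div_pow]
    have h2 : ‖(s:ℂ) + a‖^2 = s^2 + 2 * s * a.re + ‖a‖^2 := by
      rw [← Complex.normSq_eq_norm_sq, ← Complex.normSq_eq_norm_sq]
      simp [Complex.normSq_apply]; ring
    have h3 : ‖(s:ℂ)‖^2 = s^2 := by simp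
    rw [h3]
    field_simp
    rw [h2]; ring
  rw [norm_mul, mul_pow]
  linear_combination e

lemma G_mem (hν : l ν = 1) (hs : 0 < s) (hM : 0 ≤ M) (hN0 : ∀ x, 0 ≤ Nf x)
    (hN : ∀ (c : ℂ) x, Nf (c • x) = ‖c‖^2 * Nf x) {η : Cn n} (h0 : (s:ℂ) + l η ≠ 0) :
    Gmap l ν H s η ∈ Bset l ν H Nf s M ↔ η ∈ Eset l ν Nf s M := by
  simp only [Bset, Eset, Set.mem_ofPred_eq]
  rw [Gmap_P hν, Gmap_prl hν, hN, ← sub_pos, key_id hs _ h0, ← sub_pos (b := _ + Nf (prl l ν η))]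
  have : 0 < ‖(s:ℂ) / (s + l η)‖^2 := by
    have : (s:ℂ) ≠ 0 := by exact_mod_cast hs.ne'
    exact pow_pos (norm_pos_iff.2 (div_ne_zero this h0)) 2
  exact mul_pos_iff_of_pos_left this

lemma G_inj (hν : l ν = 1) (hs : 0 < s) {η η' : Cn n} (h0 : (s:ℂ) + l η ≠ 0) (h0' : (s:ℂ) + l η' ≠ 0)
    (h : Gmap l ν H s η = Gmap l ν H s η') : η = η' := by
  have hs' : (s:ℂ) ≠ 0 := by exact_mod_cast hs.ne'
  have h1 := Gmap_P (H := H) (s := s) hν η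
  have h2 := Gmap_P (H := H) (s := s) hν η'
  rw [h, h2] at h1
  have h3 : l η = l η' := by
    field_simp at h1
    have : (s:ℂ) * (l η - l η') = 0 := by linear_combination -h1
    simpa [hs', sub_eq_zero] using this
  have h4 := Gmap_prl (H := H) (s := s) hν η
  have h5 := Gmap_prl (H := H) (s := s) hν η'
  rw [h, h5, ← h3] at h4
  have h6 := smul_right_injective (Cn n) (div_ne_zero hs' h0) h4
  simp only [prl_apply] at h6
  rw [h3] at h6
  simpa using h6.symm

lemma G_surj (hν : l ν = 1) (hs : 0 < s) (hM : 0 ≤ M) (hN0 : ∀ x, 0 ≤ Nf x) {ξ : Cn n}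
    (hξ : ξ ∈ Bset l ν H Nf s M) : ∃ η, (s:ℂ) + l η ≠ 0 ∧ Gmap l ν H s η = ξ := by
  have hs' : (s:ℂ) ≠ 0 := by exact_mod_cast hs.ne'
  set p := Pfun l ν H ξ with hp
  have hne : (s:ℂ) - p ≠ 0 := by
    intro h0
    have h1 : p = (s:ℂ) := by linear_combination -h0
    have h2 : 2 * p.re + M * ‖p‖^2 + Nf (prl l ν ξ) < s := hξ
    have h3 := hN0 (prl l ν ξ)
    have h4 : 0 ≤ M * ‖p‖^2 := by positivity
    rw [h1] at h2 h4; simp at h2 h4; linarith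
  set ζ : Cn n := ξ + H (prl l ν ξ) • ν with hζ
  have hlζ : l ζ = p := by simp [hζ, hν, hp, Pfun]
  have hprζ : prl l ν ζ = prl l ν ξ := by simp [hζ, prl_nu hν]
  refine ⟨((s:ℂ) / (s - p)) • ζ, ?_, ?_⟩
  · rw [map_smul, hlζ, smul_eq_mul]
    have : (s:ℂ) + s / (s - p) * p = s * s / (s - p) := by field_simp; ring
    rw [this]; positivity
  · have : (s:ℂ) + s / (s - p) * p = s * s / (s - p) := by field_simp; ring
    rw [Gmap_eq, map_smul, hlζ, smul_eq_mul, map_smul, hprζ, this, smul_smul, smul_smul]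
    have h1 : (s:ℂ) / (s * s / (s - p)) * (s / (s - p)) = 1 := by field_simp
    rw [h1, one_smul, one_smul, hζ]; simp

lemma G_image (hν : l ν = 1) (hs : 0 < s) (hM : 0 ≤ M) (hN0 : ∀ x, 0 ≤ Nf x)
    (hN : ∀ (c : ℂ) x, Nf (c • x) = ‖c‖^2 * Nf x) :
    Gmap l ν H s '' Eset l ν Nf s M = Bset l ν H Nf s M := by
  ext ξ; constructor
  · rintro ⟨η, hη, rfl⟩
    exact (G_mem hν hs hM hN0 hN (E_ne hs hM hN0 hη)).2 hη
  · intro hξ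
    obtain ⟨η, h0, rfl⟩ := G_surj hν hs hM hN0 hξ
    exact ⟨η, (G_mem hν hs hM hN0 hN h0).1 hξ, rfl⟩
lemma G_deriv (hν : l ν = 1) (hs : 0 < s) (hH : Differentiable ℂ H) {η : Cn n} (h0 : (s:ℂ) + l η ≠ 0) :
    ∃ A : Cn n →L[ℂ] Cn n, HasFDerivAt (Gmap l ν H s) A η ∧
      LinearMap.det (A : Cn n →ₗ[ℂ] Cn n) = ((s:ℂ) / (s + l η))^(n+1) := by
  have hs' : (s:ℂ) ≠ 0 := by exact_mod_cast hs.ne'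
  set c : ℂ := (s:ℂ) / (s + l η) with hc
  have hc0 : c ≠ 0 := div_ne_zero hs' h0
  have hdc : HasFDerivAt (fun x : Cn n => (s:ℂ) / (s + l x)) ((-((s:ℂ) / (s + l η)^2)) • l) η := by
    have h1 : HasFDerivAt (fun x : Cn n => (s:ℂ) + l x) l η := l.hasFDerivAt.const_add _
    have h2 := (hasDerivAt_inv h0).comp_hasFDerivAt η h1
    have h3 := h2.const_mul (s:ℂ)
    refine (h3.congr_fderiv ?_)
    ext x; simp; field_simp
  have hΦ : HasFDerivAt (fun x : Cn n => ((s:ℂ) / (s + l x)) • x)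
      (c • ContinuousLinearMap.id ℂ (Cn n) + ((-((s:ℂ) / (s + l η)^2)) • l).smulRight η) η :=
    hdc.smul (hasFDerivAt_id η)
  set ζ := c • η
  have hsh : HasFDerivAt (fun x : Cn n => x - H (prl l ν x) • ν)
      ((1:ℂ) • ContinuousLinearMap.id ℂ (Cn n) +
        (-((fderiv ℂ H (prl l ν ζ)).comp (prl l ν))).smulRight ν) ζ := by
    have h1 := ((hH (prl l ν ζ)).hasFDerivAt.comp ζ (prl l ν).hasFDerivAt).smul_const ν
    refine ((hasFDerivAt_id ζ).sub h1).congr_fderiv ?_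
    ext x; simp [sub_eq_add_neg]
  have hcomp := hsh.comp η hΦ
  refine ⟨_, hcomp.congr_of_eventuallyEq (Filter.Eventually.of_forall fun x => ?_), ?_⟩
  · simp [Gmap_eq, Function.comp]
  · rw [ContinuousLinearMap.toLinearMap_comp, LinearMap.det_comp, det_rank_one _ one_ne_zero, det_rank_one _ hc0]
    simp [prl_nu hν]
    rw [pow_succ]
    congr 1
    rw [hc]; field_simp; ring

lemma E_open (hNc : Continuous Nf) : IsOpen (Eset l ν Nf s M) := by
  apply isOpen_lt <;> fun_prop

lemma B_open (hNc : Continuous Nf) (hH : Continuous H) : IsOpen (Bset l ν H Nf s M) := by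
  have : Continuous (Pfun l ν H) := by unfold Pfun; fun_prop
  apply isOpen_lt <;> fun_prop

lemma B_ne (hs : 0 < s) (hM : 0 ≤ M) (hN0 : ∀ x, 0 ≤ Nf x) {ξ : Cn n}
    (hξ : ξ ∈ Bset l ν H Nf s M) : (s:ℂ) - Pfun l ν H ξ ≠ 0 := by
  intro h0
  have h1 : Pfun l ν H ξ = (s:ℂ) := by linear_combination -h0
  have h2 : 2 * (Pfun l ν H ξ).re + M * ‖Pfun l ν H ξ‖^2 + Nf (prl l ν ξ) < s := hξ
  have h3 := hN0 (prl l ν ξ)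
  have h4 : 0 ≤ M * ‖Pfun l ν H ξ‖^2 := by positivity
  rw [h1] at h2 h4; simp at h2 h4; linarith

/-- The reproducing formula. -/
theorem repro_formula (hν : l ν = 1) (hs : 0 < s) (hM : 0 ≤ M) (hN0 : ∀ x, 0 ≤ Nf x)
    (hN : ∀ (c : ℂ) x, Nf (c • x) = ‖c‖^2 * Nf x) (hNc : Continuous Nf)
    (hH : Differentiable ℂ H) (hH0 : H 0 = 0) {f : Cn n → ℂ} {z : Cn n}
    (hf : DifferentiableOn ℂ (fun ξ => f (z + ξ)) (Bset l ν H Nf s M))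
    (hfi : IntegrableOn (fun ξ => (s:ℂ)^(n+1) * ((starRingEnd ℂ) (s - Pfun l ν H ξ))⁻¹^(n+1) * f (z + ξ))
      (Bset l ν H Nf s M) (dVol n)) :
    ∫ ξ in Bset l ν H Nf s M, (s:ℂ)^(n+1) * ((starRingEnd ℂ) (s - Pfun l ν H ξ))⁻¹^(n+1) * f (z + ξ) ∂(dVol n)
      = f z * (dVol n).real (Eset l ν Nf s M) := by
  have hs' : (s:ℂ) ≠ 0 := by exact_mod_cast hs.ne'
  set E := Eset l ν Nf s M with hE
  have hEo : IsOpen E := E_open hNc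
  choose! A hA hdet using fun (η : Cn n) (h0 : (s:ℂ) + l η ≠ 0) => G_deriv (H := H) hν hs hH h0
  have hne : ∀ η ∈ E, (s:ℂ) + l η ≠ 0 := fun η h => E_ne hs hM hN0 h
  have hinj : Set.InjOn (Gmap l ν H s) E := fun x hx y hy h => G_inj hν hs (hne x hx) (hne y hy) h
  have hderiv : ∀ x ∈ E, HasFDerivWithinAt (Gmap l ν H s) ((A x).restrictScalars ℝ) E x :=
    fun x hx => ((hA x (hne x hx)).restrictScalars ℝ).hasFDerivWithinAt
  set h : Cn n → ℂ := fun η => ((s:ℂ) / (s + l η))^(n+1) * f (z + Gmap l ν H s η) with hh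
  have himg : Bset l ν H Nf s M = Gmap l ν H s '' E := (G_image hν hs hM hN0 hN).symm
  have hcongr : ∀ η ∈ E, |((A η).restrictScalars ℝ).det| • ((s:ℂ)^(n+1) *
      ((starRingEnd ℂ) (s - Pfun l ν H (Gmap l ν H s η)))⁻¹^(n+1) * f (z + Gmap l ν H s η)) = 1 * h η := by
    intro η hη
    have h0 := hne η hη
    have h0' : (starRingEnd ℂ) ((s:ℂ) + l η) ≠ 0
      := (map_ne_zero _).2 h0
    rw [real_det_complex, hdet η h0, Gmap_P hν, abs_of_nonneg (by positivity), hh]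
    have e1 : (s:ℂ) - s / (s + l η) * l η = s * s / (s + l η) := by field_simp; ring
    rw [e1, norm_pow, ← pow_mul, mul_comm (n+1) 2, pow_mul]
    have e2 : ((‖(s:ℂ) / (s + l η)‖ ^ 2 : ℝ) : ℂ) = (s:ℂ) / (s + l η) * (starRingEnd ℂ) ((s:ℂ) / (s + l η)) := by
      rw [Complex.mul_conj, Complex.normSq_eq_norm_sq]
    rw [Complex.real_smul, Complex.ofReal_pow, e2, one_mul, ← mul_assoc, ← mul_assoc]
    congr 1
    rw [← mul_pow, ← mul_pow]
    congr 1
    simp only [map_div₀, map_mul, Complex.conj_ofReal]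
    field_simp
  have hintg : IntegrableOn (fun x => (1:ℂ) * h x) E (dVol n) := by
    rw [himg, integrableOn_image_iff_integrableOn_abs_det_fderiv_smul _ hEo.measurableSet hderiv hinj] at hfi
    exact hfi.congr_fun hcongr hEo.measurableSet
  have hhol : DifferentiableOn ℂ h E := by
    intro η hη
    have h0 := hne η hη
    refine DifferentiableWithinAt.mul ?_ ?_
    · apply DifferentiableWithinAt.pow
      have h2 : DifferentiableAt ℂ (fun x : Cn n => (s:ℂ) + l x) η := l.differentiableAt.const_add _
      simp only [div_eq_mul_inv]
      exact ((h2.fun_inv h0).const_mul (s:ℂ)).differentiableWithinAt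
    · have hmem : Gmap l ν H s η ∈ Bset l ν H Nf s M := (G_mem hν hs hM hN0 hN h0).2 hη
      have h1 := (hf _ hmem).differentiableAt ((B_open hNc hH.continuous).mem_nhds hmem)
      exact (DifferentiableAt.comp (𝕜 := ℂ) η h1 (hA η h0).differentiableAt).differentiableWithinAt
  have hbal : ∀ x ∈ E, ∀ c : ℂ, ‖c‖ ≤ 1 → c • x ∈ E := by
    intro x hx c hc
    have hx' : (1/s + M) * ‖l x‖^2 + Nf (prl l ν x) < s := hx
    show (1/s + M) * ‖l (c • x)‖^2 + Nf (prl l ν (c • x)) < s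
    rw [map_smul, map_smul, hN, norm_smul, mul_pow]
    have h1 : ‖c‖^2 ≤ 1 := pow_le_one₀ (norm_nonneg _) hc
    have h2 : 0 ≤ (1/s + M) * ‖l x‖^2 + Nf (prl l ν x) := by have := hN0 (prl l ν x); positivity
    nlinarith
  have hmv := balanced_mv hEo hbal hhol (m := fun _ => 1) measurable_const (by simp) hintg
  rw [himg, integral_image_eq_integral_abs_det_fderiv_smul _ hEo.measurableSet hderiv hinj]
  rw [setIntegral_congr_fun hEo.measurableSet hcongr, hmv]
  have hG0 : h 0 = f z := by simp [hh, Gmap_eq, hH0, hs']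
  rw [hG0]
  simp [Measure.real]
end
end

section
def Amap {n : ℕ} (l : Cn n →L[ℂ] ℂ) (ν : Cn n) (s : ℝ) : Cn n →L[ℂ] Cn n :=
  ((Real.sqrt s : ℝ) : ℂ) • ContinuousLinearMap.id ℂ (Cn n) + (((s - Real.sqrt s : ℝ) : ℂ) • l).smulRight ν

lemma Amap_det {n : ℕ} {l : Cn n →L[ℂ] ℂ} {ν : Cn n} (hν : l ν = 1) {s : ℝ} (hs : 0 < s) :
    ((Amap l ν s).restrictScalars ℝ).det = s^(n+1) := by
  have h0 : Real.sqrt s ≠ 0 := (Real.sqrt_pos.2 hs).ne'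
  have h0' : ((Real.sqrt s : ℝ) : ℂ) ≠ 0 := by exact_mod_cast h0
  rw [real_det_complex, Amap, det_rank_one _ h0']
  have : ((Real.sqrt s : ℝ) : ℂ)^n * (1 + ((Real.sqrt s : ℝ) : ℂ)⁻¹ * ((((s - Real.sqrt s : ℝ) : ℂ) • l) ν))
      = (((Real.sqrt s)^(n+1) * (s / (Real.sqrt s)^2) : ℝ) : ℂ) := by
    simp [hν]; field_simp; ring
  rw [this, Real.sq_sqrt hs.le, div_self hs.ne', mul_one]
  rw [Complex.norm_real, Real.norm_of_nonneg (by positivity), ← pow_mul, mul_comm, pow_mul, Real.sq_sqrt hs.le]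

lemma Amap_apply {n : ℕ} (l : Cn n →L[ℂ] ℂ) (ν : Cn n) (s : ℝ) (x : Cn n) :
    Amap l ν s x = ((Real.sqrt s : ℝ) : ℂ) • prl l ν x + ((s:ℂ) * l x) • ν := by
  simp only [Amap, prl_apply, ContinuousLinearMap.add_apply, ContinuousLinearMap.smul_apply,
    ContinuousLinearMap.id_apply, ContinuousLinearMap.smulRight_apply, smul_eq_mul]
  push_cast; module

lemma prl_l {n : ℕ} {l : Cn n →L[ℂ] ℂ} {ν : Cn n} (hν : l ν = 1) (x : Cn n) : l (prl l ν x) = 0 := by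
  simp [prl_apply, hν]

lemma prl_prl {n : ℕ} {l : Cn n →L[ℂ] ℂ} {ν : Cn n} (hν : l ν = 1) (x : Cn n) :
    prl l ν (prl l ν x) = prl l ν x := by
  rw [prl_apply l ν (prl l ν x), prl_l hν]; simp

lemma prl_norm_le {n : ℕ} (l : Cn n →L[ℂ] ℂ) (ν x : Cn n) : ‖prl l ν x‖ ≤ (1 + ‖l‖ * ‖ν‖) * ‖x‖ := by
  rw [prl_apply]
  calc ‖x - l x • ν‖ ≤ ‖x‖ + ‖l x • ν‖ := norm_sub_le _ _
    _ ≤ ‖x‖ + (‖l‖ * ‖x‖) * ‖ν‖ := by rw [norm_smul]; gcongr; exact l.le_opNorm x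
    _ = _ := by ring

lemma Amap_image_measure {n : ℕ} {l : Cn n →L[ℂ] ℂ} {ν : Cn n} (hν : l ν = 1) {s : ℝ} (hs : 0 < s)
    (S : Set (Cn n)) : dVol n (Amap l ν s '' S) = ENNReal.ofReal (s^(n+1)) * dVol n S := by
  have := Measure.addHaar_image_continuousLinearMap (dVol n) ((Amap l ν s).restrictScalars ℝ) S
  have h2 := Amap_det hν hs
  rw [ContinuousLinearMap.det] at h2
  rw [h2, abs_of_nonneg (by positivity)] at this
  exact this

lemma vol_box {n : ℕ} {l : Cn n →L[ℂ] ℂ} {ν : Cn n} (hν : l ν = 1) {τ a b R : ℝ} (hτ : 0 < τ)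
    (hR : (1 + ‖l‖ * ‖ν‖) * a + b * ‖ν‖ ≤ R) :
    dVol n {ξ | ‖ξ‖ ≤ a * Real.sqrt τ ∧ ‖l ξ‖ ≤ b * τ} ≤ ENNReal.ofReal (τ^(n+1)) * dVol n (Metric.closedBall 0 R) := by
  rw [← Amap_image_measure hν hτ]
  apply measure_mono
  rintro ξ ⟨h1, h2⟩
  have hq : 0 < Real.sqrt τ := Real.sqrt_pos.2 hτ
  have hq' : ((Real.sqrt τ : ℝ) : ℂ) ≠ 0 := by exact_mod_cast hq.ne'
  have hτ' : (τ : ℂ) ≠ 0 := by exact_mod_cast hτ.ne'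
  refine ⟨((Real.sqrt τ : ℝ) : ℂ)⁻¹ • prl l ν ξ + ((τ:ℂ)⁻¹ * l ξ) • ν, ?_, ?_⟩
  · rw [mem_closedBall_zero_iff]
    refine le_trans (norm_add_le _ _) (le_trans ?_ hR)
    rw [norm_smul, norm_smul, norm_mul, norm_inv, norm_inv, Complex.norm_real, Complex.norm_real,
      Real.norm_of_nonneg hq.le, Real.norm_of_nonneg hτ.le]
    have h3 := prl_norm_le l ν ξ
    gcongr ?_ + ?_ * _
    · rw [inv_mul_le_iff₀ hq]
      calc _ ≤ _ := h3
        _ ≤ (1 + ‖l‖ * ‖ν‖) * (a * Real.sqrt τ) := by gcongr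
        _ = _ := by ring
    · rw [inv_mul_le_iff₀ hτ]; linarith
  · rw [Amap_apply, map_add, map_smul, map_smul, prl_prl hν, prl_nu hν, map_add, map_smul, map_smul, prl_l hν, hν,
      smul_zero, add_zero, smul_smul, mul_inv_cancel₀ hq']
    simp [prl_apply, hτ']

lemma E_lower {n : ℕ} {l : Cn n →L[ℂ] ℂ} {ν : Cn n} (hν : l ν = 1) {Nf : Cn n → ℝ} {s M C r : ℝ} (hs : 0 < s)
    (hM : M * s ≤ 1)
    (hN : ∀ (c : ℂ) x, Nf (c • x) = ‖c‖^2 * Nf x) (hNC : ∀ x, Nf x ≤ C * ‖x‖^2) (hC : 0 ≤ C)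
    (hr : (2 * ‖l‖^2 + C * (1 + ‖l‖ * ‖ν‖)^2) * r^2 < 1) :
    ENNReal.ofReal (s^(n+1)) * dVol n (Metric.closedBall 0 r) ≤ dVol n (Eset l ν Nf s M) := by
  rw [← Amap_image_measure hν hs]
  apply measure_mono
  rintro _ ⟨ξ, hξ, rfl⟩
  rw [mem_closedBall_zero_iff] at hξ
  show (1/s + M) * ‖l (Amap l ν s ξ)‖^2 + Nf (prl l ν (Amap l ν s ξ)) < s
  have e1 : l (Amap l ν s ξ) = s * l ξ := by
    rw [Amap_apply, map_add, map_smul, map_smul, prl_l hν, hν]; simp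
  have e2 : prl l ν (Amap l ν s ξ) = ((Real.sqrt s : ℝ) : ℂ) • prl l ν ξ := by
    rw [Amap_apply, map_add, map_smul, map_smul, prl_prl hν, prl_nu hν]; simp
  rw [e1, e2, hN, norm_mul, Complex.norm_real, Complex.norm_real, Real.norm_of_nonneg hs.le,
    Real.norm_of_nonneg (Real.sqrt_nonneg _), Real.sq_sqrt hs.le]
  have h1 : ‖l ξ‖^2 ≤ ‖l‖^2 * r^2 := by
    rw [← mul_pow]; gcongr; exact (l.le_opNorm ξ).trans (by gcongr)
  have h2 : Nf (prl l ν ξ) ≤ C * ((1 + ‖l‖ * ‖ν‖)^2 * r^2) := by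
    refine (hNC _).trans ?_
    rw [← mul_pow]; gcongr; exact (prl_norm_le l ν ξ).trans (by gcongr)
  have h3 : (1/s + M) * (s * ‖l ξ‖)^2 + s * Nf (prl l ν ξ) = s * ((1 + M * s) * ‖l ξ‖^2 + Nf (prl l ν ξ)) := by
    field_simp
  rw [h3]
  have h4 : (1 + M * s) * ‖l ξ‖^2 ≤ 2 * (‖l‖^2 * r^2) := by
    have : 0 ≤ ‖l ξ‖^2 := by positivity
    nlinarith
  nlinarith

lemma E_bounded {n : ℕ} {l : Cn n →L[ℂ] ℂ} {ν : Cn n} (hν : l ν = 1) {Nf : Cn n → ℝ} {s M c : ℝ} (hs : 0 < s)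
    (hM : 0 ≤ M) (hc : 0 < c) (hN0 : ∀ x, 0 ≤ Nf x)
    (hNc : ∀ x, l x = 0 → c * ‖x‖^2 ≤ Nf x) : dVol n (Eset l ν Nf s M) < ⊤ := by
  have hsub : Eset l ν Nf s M ⊆ Metric.closedBall 0 (Real.sqrt (s/c) + s * ‖ν‖) := by
    intro η hη
    rw [mem_closedBall_zero_iff]
    have h1 := E_lt hs hM hN0 hη
    have h2 : (1/s + M) * ‖l η‖^2 + Nf (prl l ν η) < s := hη
    have h3 := hNc _ (prl_l hν η)
    have h4 : 0 ≤ (1/s + M) * ‖l η‖^2 := by positivity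
    have h5 : ‖prl l ν η‖ ≤ Real.sqrt (s/c) := by
      apply Real.le_sqrt_of_sq_le
      rw [le_div_iff₀ hc]; linarith
    have h6 : η = prl l ν η + l η • ν := by simp [prl_apply]
    calc ‖η‖ = ‖prl l ν η + l η • ν‖ := by rw [← h6]
      _ ≤ _ := norm_add_le _ _
      _ ≤ _ := by rw [norm_smul]; gcongr
  exact (measure_mono hsub).trans_lt measure_closedBall_lt_top

lemma layer_measure {n : ℕ} {S Q : Set (Cn n)} (hS : MeasurableSet S) (hQ : MeasurableSet Q) (ν : Cn n) {τ lam : ℝ} (hτ : 0 < τ)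
    (h1 : ∀ w ∈ S, ∀ t : ℝ, 0 ≤ t → t ≤ τ → w - t • ν ∈ Q)
    (h2 : ∀ x ∈ S, ∀ t : ℝ, 0 ≤ t → x + t • ν ∈ S → t ≤ lam) :
    ENNReal.ofReal τ * dVol n S ≤ ENNReal.ofReal lam * dVol n Q := by
  have hm : Measurable (fun p : ℝ × Cn n => S.indicator (fun _ => (1:ENNReal)) (p.2 + p.1 • ν)) := by
    exact (measurable_const.indicator hS).comp (by fun_prop)
  have e1 : ∀ t : ℝ, ∫⁻ w, S.indicator (fun _ => (1:ENNReal)) (w + t • ν) ∂(dVol n) = dVol n S := by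
    intro t
    rw [lintegral_add_right_eq_self (fun w => S.indicator (fun _ => (1:ENNReal)) w) (t • ν)]
    simp [hS]
  have e2 : ENNReal.ofReal τ * dVol n S =
      ∫⁻ t in Set.Icc 0 τ, ∫⁻ w, S.indicator (fun _ => (1:ENNReal)) (w + t • ν) ∂(dVol n) := by
    simp only [e1]; simp [mul_comm]
  rw [e2, lintegral_lintegral_swap (by exact hm.aemeasurable)]
  calc _ ≤ ∫⁻ w, Q.indicator (fun _ => ENNReal.ofReal lam) w ∂(dVol n) := by
        apply lintegral_mono
        intro w
        have hset : MeasurableSet {t : ℝ | w + t • ν ∈ S} :=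
          hS.preimage (by fun_prop : Measurable fun t : ℝ => w + t • ν)
        have e3 : (fun t : ℝ => S.indicator (fun _ => (1:ENNReal)) (w + t • ν))
            = {t : ℝ | w + t • ν ∈ S}.indicator (fun _ => (1:ENNReal)) := by
          ext t; simp [Set.indicator]
        show ∫⁻ t in Set.Icc 0 τ, S.indicator (fun _ => (1:ENNReal)) (w + t • ν) ≤ _
        rw [e3, lintegral_indicator hset, setLIntegral_one, Measure.restrict_apply hset]
        by_cases hw : w ∈ Q
        · rw [Set.indicator_of_mem hw]
          refine (Real.volume_le_diam _).trans ?_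
          apply Metric.ediam_le
          intro a ha b hb
          rw [edist_dist, Real.dist_eq]
          apply ENNReal.ofReal_le_ofReal
          wlog hab : a ≤ b generalizing a b
          · rw [abs_sub_comm]; exact this b hb a ha (le_of_not_ge hab)
          rw [abs_sub_comm, abs_of_nonneg (by linarith)]
          refine h2 _ ha.1 _ (by linarith) ?_
          have : w + a • ν + (b - a) • ν = w + b • ν := by module
          rw [this]; exact hb.1
        · have : {t : ℝ | w + t • ν ∈ S} ∩ Set.Icc 0 τ = ∅ := by
            ext t; simp only [Set.mem_inter_iff, Set.mem_empty_iff_false, iff_false]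
            rintro ⟨h, h'⟩
            apply hw
            have := h1 _ h t h'.1 h'.2
            simpa using this
          rw [this]; simp
    _ = _ := by rw [lintegral_indicator hQ]; simp
end

section
open scoped ENNReal in
theorem schur_test {X : Type*} [MeasurableSpace X] {μ : Measure X} [SFinite μ] {k : X → X → ℝ≥0∞}
    (hk : Measurable (Function.uncurry k)) {φ : X → ℝ≥0∞} (hφ : Measurable φ)
    (hφ0 : ∀ᵐ x ∂μ, φ x ≠ 0) (hφt : ∀ᵐ x ∂μ, φ x ≠ ⊤) {p q : ℝ} (hpq : p.HolderConjugate q) {A B : ℝ≥0∞}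
    (hA : ∀ᵐ x ∂μ, ∫⁻ y, k x y * φ y ^ q ∂μ ≤ A * φ x ^ q)
    (hB : ∀ᵐ y ∂μ, ∫⁻ x, k x y * φ x ^ p ∂μ ≤ B * φ y ^ p)
    {f : X → ℝ≥0∞} (hf : Measurable f) :
    ∫⁻ x, (∫⁻ y, k x y * f y ∂μ)^p ∂μ ≤ A^(p/q) * B * ∫⁻ x, f x ^ p ∂μ := by
  have hp0 := hpq.pos
  have hq0 := hpq.symm.pos
  have hkx : ∀ x, Measurable (fun y => k x y) := fun x => hk.comp measurable_prodMk_left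
  have hky : ∀ y, Measurable (fun x => k x y) := fun y => hk.comp measurable_prodMk_right
  have step1 : ∀ᵐ x ∂μ, (∫⁻ y, k x y * f y ∂μ)^p ≤
      A^(p/q) * (∫⁻ y, φ x ^ p * (k x y * ((φ y)⁻¹ * f y)^p) ∂μ) := by
    filter_upwards [hA] with x hx
    have h1 : ∫⁻ y, k x y * f y ∂μ ≤ (∫⁻ y, ((k x y)^(1/q) * φ y)^q ∂μ)^(1/q) *
        (∫⁻ y, ((k x y)^(1/p) * ((φ y)⁻¹ * f y))^p ∂μ)^(1/p) := by
      refine le_trans (lintegral_mono_ae ?_) (ENNReal.lintegral_mul_le_Lp_mul_Lq μ hpq.symm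
        (((hkx x).pow_const _).mul hφ).aemeasurable (((hkx x).pow_const _).mul (hφ.inv.mul hf)).aemeasurable)
      filter_upwards [hφ0, hφt] with y h0 ht
      simp only [Pi.mul_apply]
      have e1 : (k x y)^(1/q) * (k x y)^(1/p) = k x y := by
        rw [← ENNReal.rpow_add_of_nonneg _ _ (by positivity) (by positivity)]
        have : 1/q + 1/p = 1 := by have := hpq.inv_add_inv_eq_one; simp only [one_div]; linarith
        rw [this, ENNReal.rpow_one]
      calc k x y * f y = ((k x y)^(1/q) * (k x y)^(1/p)) * ((φ y * (φ y)⁻¹) * f y) := by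
            rw [e1, ENNReal.mul_inv_cancel h0 ht, one_mul]
        _ ≤ _ := le_of_eq (by ring)
    have e2 : ∀ y, ((k x y)^(1/q) * φ y)^q = k x y * φ y ^ q := by
      intro y
      rw [ENNReal.mul_rpow_of_nonneg _ _ hq0.le, ← ENNReal.rpow_mul, one_div_mul_cancel hq0.ne', ENNReal.rpow_one]
    have e3 : ∀ y, ((k x y)^(1/p) * ((φ y)⁻¹ * f y))^p = k x y * ((φ y)⁻¹ * f y) ^ p := by
      intro y
      rw [ENNReal.mul_rpow_of_nonneg _ _ hp0.le, ← ENNReal.rpow_mul, one_div_mul_cancel hp0.ne', ENNReal.rpow_one]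
    simp only [e2, e3] at h1
    calc (∫⁻ y, k x y * f y ∂μ)^p ≤ ((A * φ x ^ q)^(1/q) *
        (∫⁻ y, k x y * ((φ y)⁻¹ * f y)^p ∂μ)^(1/p))^p := by
          refine ENNReal.rpow_le_rpow (h1.trans ?_) hp0.le
          gcongr
      _ = A^(p/q) * (φ x ^ p * (∫⁻ y, k x y * ((φ y)⁻¹ * f y)^p ∂μ)) := by
          rw [ENNReal.mul_rpow_of_nonneg _ _ hp0.le, ← ENNReal.rpow_mul, ← ENNReal.rpow_mul,
            one_div_mul_cancel hp0.ne', ENNReal.rpow_one, ENNReal.mul_rpow_of_nonneg _ _ (by positivity),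
            ← ENNReal.rpow_mul]
          have e4 : q * (1/q*p) = p := by field_simp
          have e5 : 1/q*p = p/q := by ring
          rw [e4, e5, mul_assoc]
      _ = _ := by
          rw [lintegral_const_mul (φ x ^ p) (f := fun y => k x y * ((φ y)⁻¹ * f y)^p) ((hkx x).mul ((hφ.inv.mul hf).pow_const _))]
  calc _ ≤ ∫⁻ x, A^(p/q) * (∫⁻ y, φ x ^ p * (k x y * ((φ y)⁻¹ * f y)^p) ∂μ) ∂μ := lintegral_mono_ae step1
    _ = A^(p/q) * ∫⁻ y, ((φ y)⁻¹ * f y)^p * ∫⁻ x, k x y * φ x ^ p ∂μ ∂μ := by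
        have hm : Measurable (Function.uncurry fun x y => φ x ^ p * (k x y * ((φ y)⁻¹ * f y)^p)) :=
          ((hφ.comp measurable_fst).pow_const p).mul (hk.mul
            (((hφ.inv.mul hf).comp measurable_snd).pow_const p))
        rw [lintegral_const_mul _ hm.lintegral_prod_right, lintegral_lintegral_swap hm.aemeasurable]
        congr 1
        apply lintegral_congr; intro y
        rw [← lintegral_const_mul _ (f := fun x => k x y * φ x ^ p) ((hky y).mul (hφ.pow_const _))]
        apply lintegral_congr; intro x; ring
    _ ≤ A^(p/q) * ∫⁻ y, B * f y ^ p ∂μ := by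
        refine mul_le_mul_right (lintegral_mono_ae ?_) _
        filter_upwards [hB, hφ0, hφt] with y hy h0 ht
        calc _ ≤ ((φ y)⁻¹ * f y)^p * (B * φ y ^ p) := by gcongr
          _ = B * (((φ y)⁻¹ * f y)^p * φ y ^ p) := by ring
          _ = B * ((φ y)⁻¹ * f y * φ y)^p := by rw [← ENNReal.mul_rpow_of_nonneg _ _ hp0.le]
          _ = B * f y ^ p := by
            rw [mul_right_comm, ENNReal.inv_mul_cancel h0 ht, one_mul]
    _ = _ := by rw [lintegral_const_mul _ (hf.pow_const p), mul_assoc]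

lemma dyadic_pt {τ δ d a : ℝ} {m : ℕ} (hτ : 0 < τ) (hδ : 0 < δ) (hδd : δ ≤ d) (hd : τ ≤ d) (ha : 0 < a) :
    ∃ i j : ℕ, d ≤ 2^(j+1)*τ ∧ δ ≤ (1/2)^i * (2^(j+1)*τ) ∧
      δ^(-a) * (1/d)^m ≤ ((1/2)^(i+1) * (2^(j+1)*τ))^(-a) * (1/(2^j*τ))^m := by
  obtain ⟨j, hj1, hj2⟩ := exists_nat_pow_near (x := d/τ) (y := 2) (by rwa [le_div_iff₀ hτ, one_mul]) (by norm_num)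
  rw [le_div_iff₀ hτ] at hj1
  rw [div_lt_iff₀ hτ] at hj2
  obtain ⟨i, hi1, hi2⟩ := exists_nat_pow_near (x := (2^(j+1)*τ)/δ) (y := 2)
    (by rw [le_div_iff₀ hδ, one_mul]; linarith) (by norm_num)
  rw [le_div_iff₀ hδ] at hi1
  rw [div_lt_iff₀ hδ] at hi2
  refine ⟨i, j, hj2.le, ?_, ?_⟩
  · rw [one_div, inv_pow, le_inv_mul_iff₀ (by positivity)]; exact hi1
  · have h0 : 0 < d := by linarith
    refine mul_le_mul ?_ ?_ (by positivity) (by positivity)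
    · apply Real.rpow_le_rpow_of_nonpos (by positivity) _ (by linarith)
      rw [one_div, inv_pow, inv_mul_le_iff₀ (by positivity)]; exact hi2.le
    · gcongr

open scoped ENNReal in
lemma dyadic_int {X : Type*} [MeasurableSpace X] {μ : Measure X} {δ d : X → ℝ} {A : Set X} (hA : MeasurableSet A)
    (hδm : Measurable δ) (hdm : Measurable d)
    {τ a C : ℝ} (m : ℕ) (hτ : 0 < τ) (hC : 0 ≤ C) (ha : 0 < a) (ha1 : a < 1)
    (hδ : ∀ x ∈ A, 0 < δ x) (hδd : ∀ x ∈ A, δ x ≤ d x) (hd : ∀ x ∈ A, τ ≤ d x)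
    (hvol : ∀ t κ : ℝ, 0 < t → 0 < κ → κ ≤ 1 → μ {x ∈ A | d x ≤ t ∧ δ x ≤ κ * t} ≤ ENNReal.ofReal (C * κ * t^m)) :
    ∫⁻ x in A, ENNReal.ofReal (δ x ^ (-a) * (1/d x)^m) ∂μ
      ≤ ENNReal.ofReal (C * (2^(m+a) * ((1 - (1/2:ℝ)^(1-a))⁻¹ * (1 - (1/2:ℝ)^a)⁻¹)) * τ^(-a)) := by
  set S : ℕ × ℕ → Set X := fun p => {x ∈ A | d x ≤ 2^(p.2+1)*τ ∧ δ x ≤ (1/2)^p.1 * (2^(p.2+1)*τ)} with hS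
  have hSm : ∀ p, MeasurableSet (S p) := fun p =>
    hA.inter ((measurableSet_le hdm measurable_const).inter (measurableSet_le hδm measurable_const))
  set c : ℕ × ℕ → ℝ := fun p => ((1/2)^(p.1+1) * (2^(p.2+1)*τ))^(-a) * (1/(2^p.2*τ))^m with hc
  have hc0 : ∀ p, 0 ≤ c p := fun p => by positivity
  have h1 : ∫⁻ x in A, ENNReal.ofReal (δ x ^ (-a) * (1/d x)^m) ∂μ
      ≤ ∫⁻ x, ∑' p, (S p).indicator (fun _ => ENNReal.ofReal (c p)) x ∂μ := by
    rw [← lintegral_indicator hA]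
    apply lintegral_mono
    intro x
    by_cases hx : x ∈ A
    · rw [Set.indicator_of_mem hx]
      obtain ⟨i, j, h1, h2, h3⟩ := dyadic_pt (m := m) hτ (hδ x hx) (hδd x hx) (hd x hx) ha
      refine le_trans ?_ (ENNReal.le_tsum (i, j))
      have : x ∈ S (i, j) := ⟨hx, h1, h2⟩
      rw [Set.indicator_of_mem this]
      exact ENNReal.ofReal_le_ofReal h3
    · rw [Set.indicator_of_notMem hx]; exact bot_le
  refine h1.trans ?_
  rw [lintegral_tsum (fun p => (measurable_const.indicator (hSm p)).aemeasurable)]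
  set r1 : ℝ := (1/2:ℝ)^(1-a) with hr1
  set r2 : ℝ := (1/2:ℝ)^a with hr2
  have hr1' : 0 ≤ r1 ∧ r1 < 1 := ⟨by positivity, Real.rpow_lt_one (by norm_num) (by norm_num) (by linarith)⟩
  have hr2' : 0 ≤ r2 ∧ r2 < 1 := ⟨by positivity, Real.rpow_lt_one (by norm_num) (by norm_num) (by linarith)⟩
  set K := C * 2^(m+a) * τ^(-a) with hK
  have hterm : ∀ p : ℕ × ℕ, ∫⁻ x, (S p).indicator (fun _ => ENNReal.ofReal (c p)) x ∂μ
      ≤ ENNReal.ofReal (K * (r1^p.1 * r2^p.2)) := by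
    intro p
    rw [lintegral_indicator (hSm p), setLIntegral_const]
    refine (mul_le_mul_right (hvol (2^(p.2+1)*τ) ((1/2)^p.1) (by positivity) (by positivity)
      (pow_le_one₀ (by norm_num) (by norm_num))) _).trans ?_
    rw [← ENNReal.ofReal_mul (hc0 p)]
    apply ENNReal.ofReal_le_ofReal
    have t2 : (2:ℝ) = (1/2:ℝ)^(-1:ℝ) := by rw [Real.rpow_neg_one]; norm_num
    have h2 : ((1/2:ℝ)^(p.1+1) * (2^(p.2+1)*τ))^(-a) = (1/2:ℝ)^(-a * p.1) * (r2 ^ p.2) * τ^(-a) := by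
      have : (1/2:ℝ)^(p.1+1) * (2^(p.2+1)*τ) = (1/2)^p.1 * (2^p.2 * τ) := by
        rw [pow_succ, pow_succ]; ring
      rw [this, Real.mul_rpow (by positivity) (by positivity), Real.mul_rpow (by positivity) (by positivity)]
      rw [← Real.rpow_natCast (1/2:ℝ) p.1, ← Real.rpow_mul (by norm_num), mul_comm (p.1:ℝ)]
      rw [hr2, ← Real.rpow_natCast ((1/2:ℝ)^a), ← Real.rpow_mul (by norm_num)]
      have : ((2:ℝ)^p.2)^(-a) = (1/2:ℝ)^(a * p.2) := by
        rw [← Real.rpow_natCast, ← Real.rpow_mul (by norm_num), one_div, Real.inv_rpow (by norm_num),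
          ← Real.rpow_neg (by norm_num)]
        congr 1; ring
      rw [this]; ring
    have h3 : (1/2:ℝ)^(-a * p.1) * (1/2)^p.1 = r1^p.1 := by
      rw [hr1, ← Real.rpow_natCast, ← Real.rpow_natCast, ← Real.rpow_mul (by norm_num), ← Real.rpow_add (by norm_num)]
      congr 1; ring
    have h4 : (1/(2^p.2*τ))^m * (2^(p.2+1)*τ)^m = 2^m := by
      rw [← mul_pow]; congr 1; field_simp; ring
    have h5 : (2:ℝ)^(m + a) = 2^m * 2^a := by rw [Real.rpow_add (by norm_num), Real.rpow_natCast]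
    have h6 : (1:ℝ) ≤ 2^a := Real.one_le_rpow (by norm_num) ha.le
    calc c p * (C * (1/2)^p.1 * (2^(p.2+1)*τ)^m)
        = C * τ^(-a) * r2^p.2 * ((1/2:ℝ)^(-a * p.1) * (1/2)^p.1) * ((1/(2^p.2*τ))^m * (2^(p.2+1)*τ)^m) := by
          rw [hc]; simp only; rw [h2]; ring
      _ = C * τ^(-a) * r2^p.2 * r1^p.1 * 2^m * 1 := by rw [h3, h4]; ring
      _ ≤ C * τ^(-a) * r2^p.2 * r1^p.1 * 2^m * 2^a := by gcongr
      _ = _ := by rw [hK, h5]; ring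
  have hs1 := hasSum_geometric_of_lt_one hr1'.1 hr1'.2
  have hs2 := hasSum_geometric_of_lt_one hr2'.1 hr2'.2
  have hs : HasSum (fun p : ℕ × ℕ => r1^p.1 * r2^p.2) ((1 - r1)⁻¹ * (1 - r2)⁻¹) :=
    hs1.mul hs2 (hs1.summable.mul_of_nonneg hs2.summable (fun i => pow_nonneg hr1'.1 i) (fun i => pow_nonneg hr2'.1 i))
  have hsK := hs.mul_left K
  refine (ENNReal.tsum_le_tsum hterm).trans ?_
  rw [← ENNReal.ofReal_tsum_of_nonneg (fun p => by have := hr1'.1; have := hr2'.1; positivity) hsK.summable, hsK.tsum_eq]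
  apply ENNReal.ofReal_le_ofReal
  rw [hK]; apply le_of_eq; ring
end

section
open scoped ENNReal

lemma fixpt {X : Type*} [MeasurableSpace X] {μ : Measure X} [SFinite μ] {M : X → X → ℝ≥0∞}
    (hM : Measurable (Function.uncurry M)) {f : X → ℝ≥0∞} (hf : Measurable f) :
    ∃ F : X → ℝ≥0∞, Measurable F ∧ (∀ x, F x = f x + ∫⁻ y, M x y * F y ∂μ) ∧
      ∀ p : ℝ, 1 ≤ p → (∀ g : X → ℝ≥0∞, Measurable g →
        ∫⁻ x, (∫⁻ y, M x y * g y ∂μ)^p ∂μ ≤ (1/2:ℝ≥0∞)^p * ∫⁻ x, g x ^ p ∂μ) →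
        ∫⁻ x, F x ^ p ∂μ ≤ 2^p * ∫⁻ x, f x ^ p ∂μ := by
  have hMx : ∀ x, Measurable (fun y => M x y) := fun x => hM.comp measurable_prodMk_left
  let T : (X → ℝ≥0∞) → (X → ℝ≥0∞) := fun g x => f x + ∫⁻ y, M x y * g y ∂μ
  have hTm : ∀ g, Measurable g → Measurable (T g) := fun g hg =>
    hf.add (Measurable.lintegral_prod_right (f := fun x y => M x y * g y) (hM.mul (hg.comp measurable_snd)))
  let F : ℕ → X → ℝ≥0∞ := fun m => T^[m] 0
  have hF0 : F 0 = 0 := rfl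
  have hFs : ∀ m, F (m+1) = T (F m) := fun m => Function.iterate_succ_apply' T m 0
  have hFm : ∀ m, Measurable (F m) := by
    intro m; induction m with
    | zero => exact measurable_zero
    | succ m ih => rw [hFs]; exact hTm _ ih
  have hTmono : ∀ g h : X → ℝ≥0∞, g ≤ h → T g ≤ T h := by
    intro g h hgh x
    show f x + _ ≤ f x + _
    gcongr with y; exact hgh y
  have hmono : Monotone F := by
    apply monotone_nat_of_le_succ
    intro m; induction m with
    | zero => rw [hF0]; intro x; exact bot_le
    | succ m ih => rw [hFs, hFs (m+1)]; exact hTmono _ _ ih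
  refine ⟨fun x => ⨆ m, F m x, Measurable.iSup hFm, ?_, ?_⟩
  · intro x
    have h1 : ∫⁻ y, M x y * ⨆ m, F m y ∂μ = ⨆ m, ∫⁻ y, M x y * F m y ∂μ := by
      rw [← lintegral_iSup (f := fun m y => M x y * F m y) (fun m => (hMx x).mul (hFm m))]
      · simp only [ENNReal.mul_iSup]
      · intro a b hab y; exact mul_le_mul_right (hmono hab y) _
    rw [h1, ENNReal.add_iSup]
    apply le_antisymm
    · apply iSup_le; intro m
      refine le_trans ?_ (le_iSup _ m)
      have := hmono (Nat.le_succ m) x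
      rw [Nat.succ_eq_add_one, hFs] at this
      exact this
    · apply iSup_le; intro m
      refine le_trans ?_ (le_iSup _ (m+1))
      rw [hFs]
  · intro p hp hM2
    have hp0 : 0 < p := by linarith
    by_cases hfin : ∫⁻ x, f x ^ p ∂μ = ⊤
    · rw [hfin, ENNReal.mul_top (by simp [hp0.le])]; exact le_top
    have key : ∀ m, ∫⁻ x, F m x ^ p ∂μ ≤ 2^p * ∫⁻ x, f x ^ p ∂μ := by
      intro m; induction m with
      | zero => simp [hF0, hp0]
      | succ m ih =>
        have hm1 : Measurable (fun x => ∫⁻ y, M x y * F m y ∂μ) :=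
          Measurable.lintegral_prod_right (f := fun x y => M x y * F m y) (hM.mul ((hFm m).comp measurable_snd))
        have h1 := ENNReal.lintegral_Lp_add_le (μ := μ) hf.aemeasurable hm1.aemeasurable hp
        have h2 : (∫⁻ x, (∫⁻ y, M x y * F m y ∂μ)^p ∂μ)^(1/p) ≤ (∫⁻ x, f x ^ p ∂μ)^(1/p) := by
          apply ENNReal.rpow_le_rpow _ (by positivity)
          refine (hM2 _ (hFm m)).trans ((mul_le_mul_right ih _).trans ?_)
          rw [← mul_assoc, ← ENNReal.mul_rpow_of_nonneg _ _ hp0.le]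
          rw [one_div, ENNReal.inv_mul_cancel (by simp) (by simp)]; simp
        rw [hFs]
        have h3 : (∫⁻ x, T (F m) x ^ p ∂μ)^(1/p) ≤ 2 * (∫⁻ x, f x ^ p ∂μ)^(1/p) := by
          rw [two_mul]
          exact h1.trans (by gcongr)
        have h4 := ENNReal.rpow_le_rpow h3 hp0.le
        rw [ENNReal.mul_rpow_of_nonneg _ _ hp0.le, ← ENNReal.rpow_mul, ← ENNReal.rpow_mul,
          one_div_mul_cancel hp0.ne', ENNReal.rpow_one, ENNReal.rpow_one] at h4
        exact h4
    have : ∀ x, (⨆ m, F m x)^p = ⨆ m, F m x ^ p := fun x =>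
      (ENNReal.orderIsoRpow p hp0).map_iSup (fun m => F m x)
    simp only [this]
    rw [lintegral_iSup (fun m => (hFm m).pow_const p)]
    · exact iSup_le key
    · intro a b hab x; exact ENNReal.rpow_le_rpow (hmono hab x) hp0.le

lemma minkowski_e {X : Type*} [MeasurableSpace X] {μ : Measure X} [IsFiniteMeasure μ] {e : X → X → ℝ≥0∞}
    (he : Measurable (Function.uncurry e)) {Ce : ℝ≥0∞}
    (hCe : ∀ᵐ w ∂μ, ∫⁻ z, e z w ^ (2:ℝ) ∂μ ≤ Ce) {p : ℝ} (hp : 1 ≤ p) (hp2 : p ≤ 2)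
    {F : X → ℝ≥0∞} (hF : Measurable F) :
    ∫⁻ z, (∫⁻ w, e z w * F w ∂μ)^p ∂μ ≤ Ce^(p/2) * (μ Set.univ)^(p/2) * ∫⁻ w, F w ^ p ∂μ := by
  have hp0 : 0 < p := by linarith
  have hex : ∀ x, Measurable (fun y => e x y) := fun x => he.comp measurable_prodMk_left
  have hey : ∀ x, Measurable (fun y => e y x) := fun x => he.comp measurable_prodMk_right
  have hm : Measurable (fun z => ∫⁻ w, e z w * F w ∂μ) :=
    Measurable.lintegral_prod_right (f := fun x y => e x y * F y) (he.mul (hF.comp measurable_snd))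
  have jensen : ∀ (r : ℝ), 1 ≤ r → ∀ g : X → ℝ≥0∞, Measurable g →
      ∫⁻ x, g x ∂μ ≤ (∫⁻ x, g x ^ r ∂μ)^(1/r) * (μ Set.univ)^(1-1/r) := by
    intro r hr g hg
    rcases hr.eq_or_lt with rfl | hr
    · simp
    · have hc : r.HolderConjugate (r.conjExponent) := Real.HolderConjugate.conjExponent hr
      have := ENNReal.lintegral_mul_le_Lp_mul_Lq μ hc hg.aemeasurable (g := fun _ => 1) aemeasurable_const
      simp at this
      have e1 : 1 - r⁻¹ = (r.conjExponent)⁻¹ := by have := hc.inv_add_inv_eq_one; linarith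
      rw [one_div, e1]; exact this
  have h2 : ∫⁻ z, (∫⁻ w, e z w * F w ∂μ)^(2:ℝ) ∂μ ≤ Ce * (∫⁻ w, F w ∂μ)^(2:ℝ) := by
    have hpt : ∀ z, (∫⁻ w, e z w * F w ∂μ)^(2:ℝ) ≤ (∫⁻ w, e z w ^ (2:ℝ) * F w ∂μ) * ∫⁻ w, F w ∂μ := by
      intro z
      have h := ENNReal.lintegral_mul_le_Lp_mul_Lq μ Real.HolderConjugate.two_two
        (f := fun w => e z w * F w ^ (1/2:ℝ)) (g := fun w => F w ^ (1/2:ℝ))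
        ((hex z).mul (hF.pow_const _)).aemeasurable (hF.pow_const _).aemeasurable
      have e1 : ∀ w, F w ^ (1/2:ℝ) * F w ^ (1/2:ℝ) = F w := by
        intro w; rw [← ENNReal.rpow_add_of_nonneg _ _ (by norm_num) (by norm_num)]; norm_num
      have e2 : ∀ w, (F w ^ (1/2:ℝ))^(2:ℝ) = F w := by intro w; rw [← ENNReal.rpow_mul]; norm_num
      simp only [Pi.mul_apply, mul_assoc, e1, e2, ENNReal.mul_rpow_of_nonneg _ _ (zero_le_two : (0:ℝ) ≤ 2)] at h
      have h' := ENNReal.rpow_le_rpow h (zero_le_two : (0:ℝ) ≤ 2)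
      rw [ENNReal.mul_rpow_of_nonneg _ _ (zero_le_two : (0:ℝ) ≤ 2), ← ENNReal.rpow_mul, ← ENNReal.rpow_mul] at h'
      norm_num at h' ⊢
      exact h'
    calc _ ≤ ∫⁻ z, (∫⁻ w, e z w ^ (2:ℝ) * F w ∂μ) * ∫⁻ w, F w ∂μ ∂μ := lintegral_mono hpt
      _ = (∫⁻ w, F w * ∫⁻ z, e z w ^ (2:ℝ) ∂μ ∂μ) * ∫⁻ w, F w ∂μ := by
          have hm2 : Measurable (Function.uncurry fun z w => e z w ^ (2:ℝ) * F w) :=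
            (he.pow_const _).mul (hF.comp measurable_snd)
          rw [lintegral_mul_const _ hm2.lintegral_prod_right, lintegral_lintegral_swap hm2.aemeasurable]
          congr 1; apply lintegral_congr; intro w
          rw [lintegral_mul_const _ ((hey w).pow_const _), mul_comm]
      _ ≤ (∫⁻ w, F w * Ce ∂μ) * ∫⁻ w, F w ∂μ := by
          refine mul_le_mul_left (lintegral_mono_ae ?_) _
          filter_upwards [hCe] with w hw; gcongr
      _ = _ := by rw [lintegral_mul_const _ hF, ENNReal.rpow_two]; ring
  have h3 := jensen (2/p) (by rw [le_div_iff₀ hp0]; linarith) _ (hm.pow_const p)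
  simp only [← ENNReal.rpow_mul] at h3
  have e3 : p * (2/p) = 2 := by field_simp
  have e4 : 1/(2/p) = p/2 := by field_simp
  rw [e3, e4] at h3
  have h4 := jensen p hp F hF
  calc _ ≤ _ := h3
    _ ≤ (Ce * ((∫⁻ w, F w ^ p ∂μ)^(1/p) * (μ Set.univ)^(1-1/p))^(2:ℝ))^(p/2) * (μ Set.univ)^(1-p/2) := by
        gcongr
        exact h2.trans (by gcongr)
    _ = Ce^(p/2) * ((μ Set.univ)^(p-1) * (μ Set.univ)^(1-p/2)) * ∫⁻ w, F w ^ p ∂μ := by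
        rw [ENNReal.mul_rpow_of_nonneg _ _ (by positivity), ← ENNReal.rpow_mul]
        have : 2 * (p/2) = p := by ring
        rw [this, ENNReal.mul_rpow_of_nonneg _ _ hp0.le, ← ENNReal.rpow_mul, ← ENNReal.rpow_mul,
          one_div_mul_cancel hp0.ne', ENNReal.rpow_one]
        have : (1 - 1/p) * p = p - 1 := by field_simp
        rw [this]; ring
    _ = _ := by
        rw [← ENNReal.rpow_add_of_nonneg _ _ (by linarith) (by linarith)]
        congr 3; ring
end

section
open scoped ENNReal

lemma kint_meas {X : Type*} [MeasurableSpace X] {μ : Measure X} [SFinite μ] {k : X → X → ℝ≥0∞}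
    (hk : Measurable (Function.uncurry k)) {f : X → ℝ≥0∞} (hf : Measurable f) :
    Measurable (fun x => ∫⁻ y, k x y * f y ∂μ) :=
  Measurable.lintegral_prod_right (f := fun x y => k x y * f y) (hk.mul (hf.comp measurable_snd))

lemma iter_bdd {X : Type*} [MeasurableSpace X] {μ : Measure X} [IsFiniteMeasure μ] {k N M e : X → X → ℝ≥0∞}
    (hk : Measurable (Function.uncurry k)) (hN : Measurable (Function.uncurry N))
    (hM : Measurable (Function.uncurry M)) (he : Measurable (Function.uncurry e))
    (hker : ∀ᵐ z ∂μ, ∀ᵐ w ∂μ, k z w ≤ N z w + e z w + ∫⁻ u, k z u * M u w ∂μ)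
    (hk2 : ∀ᵐ z ∂μ, ∫⁻ w, k z w ^ (2:ℝ) ∂μ ≠ ⊤)
    {Ce CN : ℝ≥0∞} (hCe : ∀ᵐ w ∂μ, ∫⁻ z, e z w ^ (2:ℝ) ∂μ ≤ Ce) {p : ℝ} (hp : 1 ≤ p) (hp2 : p ≤ 2)
    (hCN : ∀ g : X → ℝ≥0∞, Measurable g → ∫⁻ x, (∫⁻ y, N x y * g y ∂μ)^p ∂μ ≤ CN * ∫⁻ x, g x ^ p ∂μ)
    (hMp : ∀ g : X → ℝ≥0∞, Measurable g →
      ∫⁻ x, (∫⁻ y, M x y * g y ∂μ)^p ∂μ ≤ (1/2:ℝ≥0∞)^p * ∫⁻ x, g x ^ p ∂μ)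
    (hM2 : ∀ g : X → ℝ≥0∞, Measurable g →
      ∫⁻ x, (∫⁻ y, M x y * g y ∂μ)^(2:ℝ) ∂μ ≤ (1/2:ℝ≥0∞)^(2:ℝ) * ∫⁻ x, g x ^ (2:ℝ) ∂μ)
    {f : X → ℝ≥0∞} (hf : Measurable f) {m : ℕ} (hfm : ∀ x, f x ≤ m) :
    ∫⁻ x, (∫⁻ y, k x y * f y ∂μ)^p ∂μ ≤
      2^(p-1) * (CN + Ce^(p/2) * (μ Set.univ)^(p/2)) * 2^p * ∫⁻ x, f x ^ p ∂μ := by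
  have hp0 : 0 < p := by linarith
  have hkx : ∀ x, Measurable (fun y => k x y) := fun x => hk.comp measurable_prodMk_left
  have hNx : ∀ x, Measurable (fun y => N x y) := fun x => hN.comp measurable_prodMk_left
  have hex : ∀ x, Measurable (fun y => e x y) := fun x => he.comp measurable_prodMk_left
  obtain ⟨F, hFm, hFeq, hFp⟩ := fixpt (μ := μ) hM hf
  have hF2 : ∫⁻ x, F x ^ (2:ℝ) ∂μ ≠ ⊤ := by
    have h1 := hFp 2 (by norm_num) hM2
    have h2 : ∫⁻ x, f x ^ (2:ℝ) ∂μ ≤ ∫⁻ x, (m:ℝ≥0∞)^(2:ℝ) ∂μ :=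
      lintegral_mono fun x => ENNReal.rpow_le_rpow (hfm x) (by norm_num)
    rw [lintegral_const] at h2
    refine ne_top_of_le_ne_top ?_ (h1.trans (mul_le_mul_right h2 _))
    exact ENNReal.mul_ne_top (by simp) (ENNReal.mul_ne_top (by simp) (measure_ne_top _ _))
  have hpt : ∀ᵐ z ∂μ, ∫⁻ w, k z w * f w ∂μ ≤ (∫⁻ w, N z w * F w ∂μ) + ∫⁻ w, e z w * F w ∂μ := by
    filter_upwards [hker, hk2] with z hz hz2
    have hMF : Measurable (fun x => ∫⁻ y, M x y * F y ∂μ) := kint_meas hM hFm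
    have hfin : ∫⁻ w, k z w * F w ∂μ ≠ ⊤ := by
      have := ENNReal.lintegral_mul_le_Lp_mul_Lq μ Real.HolderConjugate.two_two (hkx z).aemeasurable hFm.aemeasurable
      refine ne_top_of_le_ne_top ?_ this
      exact ENNReal.mul_ne_top (ENNReal.rpow_ne_top_of_nonneg (by norm_num) hz2)
        (ENNReal.rpow_ne_top_of_nonneg (by norm_num) hF2)
    have e1 : ∫⁻ w, k z w * F w ∂μ = (∫⁻ w, k z w * f w ∂μ) + ∫⁻ w, k z w * ∫⁻ y, M w y * F y ∂μ ∂μ := by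
      rw [← lintegral_add_left (f := fun w => k z w * f w) ((hkx z).mul hf)]
      apply lintegral_congr; intro w; rw [← mul_add, ← hFeq]
    have e2 : ∫⁻ w, (∫⁻ u, k z u * M u w ∂μ) * F w ∂μ = ∫⁻ w, k z w * ∫⁻ y, M w y * F y ∂μ ∂μ := by
      have hm3 : Measurable (Function.uncurry fun w u => k z u * M u w * F w) :=
        (((hkx z).comp measurable_snd).mul (hM.comp measurable_swap)).mul (hFm.comp measurable_fst)
      calc _ = ∫⁻ w, ∫⁻ u, k z u * M u w * F w ∂μ ∂μ := by
            apply lintegral_congr; intro w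
            rw [lintegral_mul_const (f := fun u => k z u * M u w) _ ((hkx z).mul (hM.comp measurable_prodMk_right))]
        _ = ∫⁻ u, ∫⁻ w, k z u * M u w * F w ∂μ ∂μ := lintegral_lintegral_swap hm3.aemeasurable
        _ = _ := by
            apply lintegral_congr; intro u
            rw [← lintegral_const_mul (f := fun w => M u w * F w) _ ((hM.comp measurable_prodMk_left).mul hFm)]
            apply lintegral_congr; intro w; ring
    have e3 : ∫⁻ w, k z w * F w ∂μ ≤ (∫⁻ w, N z w * F w ∂μ) + (∫⁻ w, e z w * F w ∂μ) +
        ∫⁻ w, k z w * ∫⁻ y, M w y * F y ∂μ ∂μ := by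
      rw [← e2, ← lintegral_add_left (f := fun w => N z w * F w) ((hNx z).mul hFm),
        ← lintegral_add_left (f := fun w => N z w * F w + e z w * F w) (((hNx z).mul hFm).add ((hex z).mul hFm))]
      apply lintegral_mono_ae
      filter_upwards [hz] with w hw
      rw [← add_mul, ← add_mul]; gcongr
    have hfin2 : ∫⁻ w, k z w * ∫⁻ y, M w y * F y ∂μ ∂μ ≠ ⊤ := by
      intro h; rw [h] at e1; simp at e1; exact hfin e1
    rw [e1] at e3
    exact (ENNReal.add_le_add_iff_right hfin2).1 e3
  calc _ ≤ ∫⁻ z, ((∫⁻ w, N z w * F w ∂μ) + ∫⁻ w, e z w * F w ∂μ)^p ∂μ := by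
        apply lintegral_mono_ae; filter_upwards [hpt] with z hz; exact ENNReal.rpow_le_rpow hz hp0.le
    _ ≤ ∫⁻ z, 2^(p-1) * ((∫⁻ w, N z w * F w ∂μ)^p + (∫⁻ w, e z w * F w ∂μ)^p) ∂μ :=
        lintegral_mono fun z => ENNReal.rpow_add_le_mul_rpow_add_rpow _ _ hp
    _ = 2^(p-1) * ((∫⁻ z, (∫⁻ w, N z w * F w ∂μ)^p ∂μ) + ∫⁻ z, (∫⁻ w, e z w * F w ∂μ)^p ∂μ) := by
        have h1 := (kint_meas (μ := μ) hN hFm).pow_const p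
        have h2 := (kint_meas (μ := μ) he hFm).pow_const p
        rw [lintegral_const_mul (f := fun z => (∫⁻ w, N z w * F w ∂μ)^p + (∫⁻ w, e z w * F w ∂μ)^p) _ (h1.add h2),
          lintegral_add_left h1]
    _ ≤ 2^(p-1) * (CN * ∫⁻ x, F x ^ p ∂μ + Ce^(p/2) * (μ Set.univ)^(p/2) * ∫⁻ x, F x ^ p ∂μ) := by
        gcongr
        · exact hCN _ hFm
        · exact minkowski_e he hCe hp hp2 hFm
    _ = 2^(p-1) * (CN + Ce^(p/2) * (μ Set.univ)^(p/2)) * ∫⁻ x, F x ^ p ∂μ := by ring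
    _ ≤ 2^(p-1) * (CN + Ce^(p/2) * (μ Set.univ)^(p/2)) * (2^p * ∫⁻ x, f x ^ p ∂μ) := by
        gcongr; exact hFp p hp hMp
    _ = _ := by ring

lemma bdd_to_all {X : Type*} [MeasurableSpace X] {μ : Measure X} [SFinite μ] {k : X → X → ℝ≥0∞}
    (hk : Measurable (Function.uncurry k)) {p : ℝ} (hp : 1 ≤ p) {C : ℝ≥0∞}
    (h : ∀ f : X → ℝ≥0∞, Measurable f → ∀ m : ℕ, (∀ x, f x ≤ m) →
      ∫⁻ x, (∫⁻ y, k x y * f y ∂μ)^p ∂μ ≤ C * ∫⁻ x, f x ^ p ∂μ)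
    {f : X → ℝ≥0∞} (hf : Measurable f) (hft : ∀ x, f x ≠ ⊤) :
    ∫⁻ x, (∫⁻ y, k x y * f y ∂μ)^p ∂μ ≤ C * ∫⁻ x, f x ^ p ∂μ := by
  have hp0 : 0 < p := by linarith
  have hkx : ∀ x, Measurable (fun y => k x y) := fun x => hk.comp measurable_prodMk_left
  let g : ℕ → X → ℝ≥0∞ := fun m x => min (f x) m
  have hgm : ∀ m, Measurable (g m) := fun m => hf.min measurable_const
  have hgmono : Monotone g := fun a b hab x => min_le_min le_rfl (by exact_mod_cast hab)
  have hsup : ∀ x, ⨆ m, g m x = f x := by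
    intro x; apply le_antisymm (iSup_le fun m => min_le_left _ _)
    obtain ⟨m, hm⟩ := ENNReal.exists_nat_gt (hft x)
    exact le_trans (le_min le_rfl hm.le) (le_iSup (fun m => g m x) m)
  have h1 : ∀ x, ∫⁻ y, k x y * f y ∂μ = ⨆ m, ∫⁻ y, k x y * g m y ∂μ := by
    intro x
    rw [← lintegral_iSup (f := fun m y => k x y * g m y) (fun m => (hkx x).mul (hgm m))]
    · apply lintegral_congr; intro y; rw [← ENNReal.mul_iSup, hsup]
    · intro a b hab y; exact mul_le_mul_right (hgmono hab y) _
  have h2 : ∀ x, (∫⁻ y, k x y * f y ∂μ)^p = ⨆ m, (∫⁻ y, k x y * g m y ∂μ)^p := by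
    intro x; rw [h1]; exact (ENNReal.orderIsoRpow p hp0).map_iSup _
  simp only [h2]
  rw [lintegral_iSup (fun m => (kint_meas hk (hgm m)).pow_const p)]
  · apply iSup_le; intro m
    refine (h _ (hgm m) m (fun x => min_le_right _ _)).trans ?_
    gcongr with x; exact min_le_left _ _
  · intro a b hab x
    exact ENNReal.rpow_le_rpow (lintegral_mono fun y => mul_le_mul_right (hgmono hab y) _) hp0.le

lemma dual_bound {X : Type*} [MeasurableSpace X] {μ : Measure X} [IsFiniteMeasure μ] {k : X → X → ℝ≥0∞}
    (hk : Measurable (Function.uncurry k)) (hsym : ∀ᵐ z ∂μ, ∀ᵐ w ∂μ, k w z = k z w) {p q : ℝ}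
    (hpq : p.HolderConjugate q) {C : ℝ≥0∞}
    (h : ∀ f : X → ℝ≥0∞, Measurable f → (∀ x, f x ≠ ⊤) →
      ∫⁻ x, (∫⁻ y, k x y * f y ∂μ)^q ∂μ ≤ C * ∫⁻ x, f x ^ q ∂μ)
    {f : X → ℝ≥0∞} (hf : Measurable f) :
    ∫⁻ x, (∫⁻ y, k x y * f y ∂μ)^p ∂μ ≤ C^(p/q) * ∫⁻ x, f x ^ p ∂μ := by
  have hp0 := hpq.pos
  have hq0 := hpq.symm.pos
  set Φ : X → ℝ≥0∞ := fun x => ∫⁻ y, k x y * f y ∂μ with hΦ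
  have hΦm : Measurable Φ := kint_meas hk hf
  let Ψ : ℕ → X → ℝ≥0∞ := fun m x => min (Φ x) m
  have hΨm : ∀ m, Measurable (Ψ m) := fun m => hΦm.min measurable_const
  have hΨmono : Monotone Ψ := fun a b hab x => min_le_min le_rfl (by exact_mod_cast hab)
  have hsup : ∀ x, ⨆ m, Ψ m x = Φ x := by
    intro x; apply le_antisymm (iSup_le fun m => min_le_left _ _)
    by_cases hx : Φ x = ⊤
    · have : ∀ m : ℕ, Ψ m x = m := fun m => by simp [Ψ, hx]
      simp only [this, hx, ENNReal.iSup_natCast, le_refl]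
    · obtain ⟨m, hm⟩ := ENNReal.exists_nat_gt hx
      exact le_trans (le_min le_rfl hm.le) (le_iSup (fun m => Ψ m x) m)
  have key : ∀ m, ∫⁻ x, Ψ m x ^ p ∂μ ≤ C^(p/q) * ∫⁻ x, f x ^ p ∂μ := by
    intro m
    have hΨt : ∀ x, Ψ m x ≠ ⊤ := fun x => ne_top_of_le_ne_top (ENNReal.natCast_ne_top m) (min_le_right _ _)
    set g : X → ℝ≥0∞ := fun x => Ψ m x ^ (p-1) with hg
    have hgm : Measurable g := (hΨm m).pow_const _
    have hp1 : 0 < p - 1 := by linarith [hpq.lt]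
    have hgt : ∀ x, g x ≠ ⊤ := fun x => ENNReal.rpow_ne_top_of_nonneg hp1.le (hΨt x)
    have hgq : ∀ x, g x ^ q = Ψ m x ^ p := by
      intro x; rw [hg, ← ENNReal.rpow_mul, hpq.sub_one_mul_conj]
    set I := ∫⁻ x, Ψ m x ^ p ∂μ with hI
    have hIt : I ≠ ⊤ := by
      have : I ≤ ∫⁻ x, (m:ℝ≥0∞)^p ∂μ := lintegral_mono fun x => ENNReal.rpow_le_rpow (min_le_right _ _) hp0.le
      rw [lintegral_const] at this
      exact ne_top_of_le_ne_top (ENNReal.mul_ne_top (by simp [hp0.le]) (measure_ne_top _ _)) this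
    have h1 : I ≤ (∫⁻ x, f x ^ p ∂μ)^(1/p) * (C * I)^(1/q) := by
      calc I ≤ ∫⁻ x, Φ x * g x ∂μ := by
            apply lintegral_mono; intro x
            calc Ψ m x ^ p = Ψ m x ^ (1:ℝ) * Ψ m x ^ (p-1) := by
                  rw [← ENNReal.rpow_add_of_nonneg _ _ zero_le_one hp1.le]; congr 1; ring
              _ ≤ _ := by rw [ENNReal.rpow_one]; exact mul_le_mul_left (min_le_left _ _) _
        _ = ∫⁻ x, ∫⁻ y, k x y * f y * g x ∂μ ∂μ := by
            apply lintegral_congr; intro x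
            rw [lintegral_mul_const (f := fun y => k x y * f y) _ ((hk.comp measurable_prodMk_left).mul hf)]
        _ = ∫⁻ y, ∫⁻ x, k x y * f y * g x ∂μ ∂μ := by
            refine lintegral_lintegral_swap (Measurable.aemeasurable ?_)
            exact (hk.mul (hf.comp measurable_snd)).mul (hgm.comp measurable_fst)
        _ = ∫⁻ y, f y * ∫⁻ x, k y x * g x ∂μ ∂μ := by
            apply lintegral_congr_ae
            filter_upwards [hsym] with y hy
            rw [← lintegral_const_mul (f := fun x => k y x * g x) _ ((hk.comp measurable_prodMk_left).mul hgm)]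
            apply lintegral_congr_ae
            filter_upwards [hy] with x hx
            rw [hx]; ring
        _ ≤ (∫⁻ x, f x ^ p ∂μ)^(1/p) * (∫⁻ y, (∫⁻ x, k y x * g x ∂μ)^q ∂μ)^(1/q) :=
            ENNReal.lintegral_mul_le_Lp_mul_Lq μ hpq hf.aemeasurable (kint_meas hk hgm).aemeasurable
        _ ≤ _ := by
            gcongr
            refine (h g hgm hgt).trans ?_
            simp only [hgq, hI, le_refl]
    by_cases hI0 : I = 0
    · rw [hI0]; exact bot_le
    have hIq0 : I^(1/q) ≠ 0 := by simp [hI0, hIt]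
    have hIqt : I^(1/q) ≠ ⊤ := ENNReal.rpow_ne_top_of_nonneg (by positivity) hIt
    have e1 : I = I^(1/p) * I^(1/q) := by
      rw [← ENNReal.rpow_add_of_nonneg _ _ (by positivity) (by positivity)]
      have : 1/p + 1/q = 1 := by have := hpq.inv_add_inv_eq_one; simp only [one_div]; linarith
      rw [this, ENNReal.rpow_one]
    have h2 : I^(1/p) * I^(1/q) ≤ ((∫⁻ x, f x ^ p ∂μ)^(1/p) * C^(1/q)) * I^(1/q) := by
      rw [← e1, mul_assoc, ← ENNReal.mul_rpow_of_nonneg _ _ (by positivity)]; exact h1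
    have h3 := (ENNReal.mul_le_mul_iff_left hIq0 hIqt).1 h2
    have h4 := ENNReal.rpow_le_rpow h3 hp0.le
    rw [ENNReal.mul_rpow_of_nonneg _ _ hp0.le, ← ENNReal.rpow_mul, ← ENNReal.rpow_mul, ← ENNReal.rpow_mul,
      one_div_mul_cancel hp0.ne', ENNReal.rpow_one, ENNReal.rpow_one, mul_comm] at h4
    rwa [one_div_mul_eq_div] at h4
  have h2 : ∀ x, Φ x ^ p = ⨆ m, Ψ m x ^ p := by
    intro x; rw [← hsup]; exact (ENNReal.orderIsoRpow p hp0).map_iSup _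
  show ∫⁻ x, Φ x ^ p ∂μ ≤ _
  rw [lintegral_congr h2, lintegral_iSup (fun m => (hΨm m).pow_const p)]
  · exact iSup_le key
  · intro a b hab x; exact ENNReal.rpow_le_rpow (hΨmono hab x) hp0.le
end

section


lemma wderiv_mul {n : ℕ} {f g : Cn n → ℂ} {x : Cn n} (hf : DifferentiableAt ℝ f x) (hg : DifferentiableAt ℝ g x)
    (j : Fin n) : wderiv (fun y => f y * g y) x j = wderiv f x j * g x + f x * wderiv g x j := by
  unfold wderiv; rw [fderiv_fun_mul hf hg]; simp; ring

lemma wderivBar_mul {n : ℕ} {f g : Cn n → ℂ} {x : Cn n} (hf : DifferentiableAt ℝ f x) (hg : DifferentiableAt ℝ g x)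
    (j : Fin n) : wderivBar (fun y => f y * g y) x j = wderivBar f x j * g x + f x * wderivBar g x j := by
  unfold wderivBar; rw [fderiv_fun_mul hf hg]; simp; ring

lemma wderiv_add {n : ℕ} {f g : Cn n → ℂ} {x : Cn n} (hf : DifferentiableAt ℝ f x) (hg : DifferentiableAt ℝ g x)
    (j : Fin n) : wderiv (fun y => f y + g y) x j = wderiv f x j + wderiv g x j := by
  unfold wderiv; rw [fderiv_fun_add hf hg]; simp; ring

lemma wderivBar_add {n : ℕ} {f g : Cn n → ℂ} {x : Cn n} (hf : DifferentiableAt ℝ f x) (hg : DifferentiableAt ℝ g x)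
    (j : Fin n) : wderivBar (fun y => f y + g y) x j = wderivBar f x j + wderivBar g x j := by
  unfold wderivBar; rw [fderiv_fun_add hf hg]; simp; ring

lemma wderiv_neg {n : ℕ} {f : Cn n → ℂ} {x : Cn n}
    (j : Fin n) : wderiv (fun y => - f y) x j = - wderiv f x j := by
  unfold wderiv; rw [fderiv_fun_neg]; simp; ring

lemma wderivBar_neg {n : ℕ} {f : Cn n → ℂ} {x : Cn n}
    (j : Fin n) : wderivBar (fun y => - f y) x j = - wderivBar f x j := by
  unfold wderivBar; rw [fderiv_fun_neg]; simp; ring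

lemma fderiv_conj' {n : ℕ} {f : Cn n → ℂ} {x : Cn n} (hf : DifferentiableAt ℝ f x) (v : Cn n) :
    fderiv ℝ (fun y => conj (f y)) x v = conj (fderiv ℝ f x v) := by
  have := (Complex.conjCLE.toContinuousLinearMap.hasFDerivAt (x := f x)).comp x hf.hasFDerivAt
  have h2 := this.fderiv
  have h3 : (fun y => conj (f y)) = (Complex.conjCLE.toContinuousLinearMap : ℂ → ℂ) ∘ f := by
    ext y; simp
  rw [h3, h2]; simp

lemma wderiv_conj {n : ℕ} {f : Cn n → ℂ} {x : Cn n} (hf : DifferentiableAt ℝ f x) (j : Fin n) :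
    wderiv (fun y => conj (f y)) x j = conj (wderivBar f x j) := by
  unfold wderiv wderivBar; rw [fderiv_conj' hf, fderiv_conj' hf]; simp [map_ofNat]; ring

lemma wderivBar_conj {n : ℕ} {f : Cn n → ℂ} {x : Cn n} (hf : DifferentiableAt ℝ f x) (j : Fin n) :
    wderivBar (fun y => conj (f y)) x j = conj (wderiv f x j) := by
  unfold wderiv wderivBar; rw [fderiv_conj' hf, fderiv_conj' hf]; simp [map_ofNat]

lemma wderiv_cd {n : ℕ} {f : Cn n → ℂ} {D : Set (Cn n)} (hD : IsOpen D) {m : ℕ} (hf : ContDiffOn ℝ (m+1) f D) (j : Fin n) :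
    ContDiffOn ℝ m (fun x => wderiv f x j) D := by
  unfold wderiv
  have := hf.fderiv_of_isOpen hD (m := m) le_rfl
  fun_prop

lemma wderivBar_cd {n : ℕ} {f : Cn n → ℂ} {D : Set (Cn n)} (hD : IsOpen D) {m : ℕ} (hf : ContDiffOn ℝ (m+1) f D) (j : Fin n) :
    ContDiffOn ℝ m (fun x => wderivBar f x j) D := by
  unfold wderivBar
  have := hf.fderiv_of_isOpen hD (m := m) le_rfl
  fun_prop

lemma wderiv_C {n : ℕ} {f : Cn n → ℂ} {m : ℕ} (hf : ContDiff ℝ (m+1) f) (j : Fin n) :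
    ContDiff ℝ m (fun x => wderiv f x j) := by
  rw [← contDiffOn_univ] at *; exact wderiv_cd isOpen_univ hf j

lemma wderivBar_C {n : ℕ} {f : Cn n → ℂ} {m : ℕ} (hf : ContDiff ℝ (m+1) f) (j : Fin n) :
    ContDiff ℝ m (fun x => wderivBar f x j) := by
  rw [← contDiffOn_univ] at *; exact wderivBar_cd isOpen_univ hf j

lemma wderiv_supp {n : ℕ} {f : Cn n → ℂ} (j : Fin n) : tsupport (fun x => wderiv f x j) ⊆ tsupport f := by
  refine closure_minimal ?_ (isClosed_tsupport _)
  intro x hx; by_contra h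
  have : fderiv ℝ f x = 0 := by
    by_contra h2
    exact h (support_fderiv_subset ℝ (Function.mem_support.2 h2))
  simp [wderiv, this] at hx

lemma wderivBar_supp {n : ℕ} {f : Cn n → ℂ} (j : Fin n) : tsupport (fun x => wderivBar f x j) ⊆ tsupport f := by
  refine closure_minimal ?_ (isClosed_tsupport _)
  intro x hx; by_contra h
  have : fderiv ℝ f x = 0 := by
    by_contra h2
    exact h (support_fderiv_subset ℝ (Function.mem_support.2 h2))
  simp [wderivBar, this] at hx

/-- product of a function continuous on `D` and a continuous function compactly supported in `D` -/
lemma cont_mul {n : ℕ} {f g : Cn n → ℂ} {D : Set (Cn n)} (hD : IsOpen D) (hf : ContinuousOn f D) (hg : Continuous g)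
    (hs : tsupport g ⊆ D) : Continuous (fun x => f x * g x) :=
  (hf.mul hg.continuousOn).continuous_of_tsupport_subset hD ((tsupport_mul_subset_right).trans hs)

lemma int_mul {n : ℕ} {f g : Cn n → ℂ} {D : Set (Cn n)} (hD : IsOpen D) (hf : ContinuousOn f D) (hg : Continuous g)
    (hgc : HasCompactSupport g) (hs : tsupport g ⊆ D) : Integrable (fun x => f x * g x) (dVol n) :=
  (cont_mul hD hf hg hs).integrable_of_hasCompactSupport (HasCompactSupport.mul_left hgc)

lemma ibp_dir {n : ℕ} {f g : Cn n → ℂ} {D : Set (Cn n)} (hD : IsOpen D) (hf : ContDiffOn ℝ 1 f D) (hg : ContDiff ℝ 1 g)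
    (hgc : HasCompactSupport g) (hs : tsupport g ⊆ D) (v : Cn n) :
    ∫ x, f x * fderiv ℝ g x v ∂(dVol n) = - ∫ x, fderiv ℝ f x v * g x ∂(dVol n) ∧
    Integrable (fun x => f x * fderiv ℝ g x v) (dVol n) ∧ Integrable (fun x => fderiv ℝ f x v * g x) (dVol n) := by
  have hgv : Continuous (fun x => fderiv ℝ g x v) := (hg.continuous_fderiv one_ne_zero).clm_apply continuous_const
  have hgs : tsupport (fun x => fderiv ℝ g x v) ⊆ tsupport g := by
    refine closure_minimal ?_ (isClosed_tsupport _)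
    intro x hx
    refine support_fderiv_subset ℝ (Function.mem_support.2 ?_)
    intro h; simp [h] at hx
  have hgvc : HasCompactSupport (fun x => fderiv ℝ g x v) := hgc.mono' (subset_closure.trans hgs)
  have hfv : ContinuousOn (fun x => fderiv ℝ f x v) D :=
    (hf.continuousOn_fderiv_of_isOpen hD le_rfl).clm_apply continuousOn_const
  have i1 := int_mul hD hf.continuousOn hgv hgvc (hgs.trans hs)
  have i2 := int_mul hD hfv hg.continuous hgc hs
  refine ⟨?_, i1, i2⟩
  apply integral_mul_fderiv_eq_neg_fderiv_mul_of_integrable i2 i1 (int_mul hD hf.continuousOn hg.continuous hgc hs)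
  · intro x hx; exact (hf.differentiableOn one_ne_zero).differentiableAt (hD.mem_nhds (hs hx))
  · intro x _; exact (hg.differentiable one_ne_zero) x

lemma ibp {n : ℕ} {f g : Cn n → ℂ} {D : Set (Cn n)} (hD : IsOpen D) (hf : ContDiffOn ℝ 1 f D) (hg : ContDiff ℝ 1 g)
    (hgc : HasCompactSupport g) (hs : tsupport g ⊆ D) (j : Fin n) :
    ∫ x, f x * wderiv g x j ∂(dVol n) = - ∫ x, wderiv f x j * g x ∂(dVol n) := by
  obtain ⟨a1, a2, a3⟩ := ibp_dir hD hf hg hgc hs (EuclideanSpace.single j (1:ℂ))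
  obtain ⟨b1, b2, b3⟩ := ibp_dir hD hf hg hgc hs (EuclideanSpace.single j I)
  have e1 : ∀ x, f x * wderiv g x j = (1/2) * (f x * fderiv ℝ g x (EuclideanSpace.single j (1:ℂ)) -
      I * (f x * fderiv ℝ g x (EuclideanSpace.single j I))) := fun x => by unfold wderiv; ring
  have e2 : ∀ x, wderiv f x j * g x = (1/2) * (fderiv ℝ f x (EuclideanSpace.single j (1:ℂ)) * g x -
      I * (fderiv ℝ f x (EuclideanSpace.single j I) * g x)) := fun x => by unfold wderiv; ring
  simp_rw [e1, e2]
  rw [integral_const_mul, integral_const_mul, integral_sub a2 (b2.const_mul _), integral_sub a3 (b3.const_mul _),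
    integral_const_mul, integral_const_mul, a1, b1]; ring

lemma ibpBar {n : ℕ} {f g : Cn n → ℂ} {D : Set (Cn n)} (hD : IsOpen D) (hf : ContDiffOn ℝ 1 f D) (hg : ContDiff ℝ 1 g)
    (hgc : HasCompactSupport g) (hs : tsupport g ⊆ D) (j : Fin n) :
    ∫ x, f x * wderivBar g x j ∂(dVol n) = - ∫ x, wderivBar f x j * g x ∂(dVol n) := by
  obtain ⟨a1, a2, a3⟩ := ibp_dir hD hf hg hgc hs (EuclideanSpace.single j (1:ℂ))
  obtain ⟨b1, b2, b3⟩ := ibp_dir hD hf hg hgc hs (EuclideanSpace.single j I)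
  have e1 : ∀ x, f x * wderivBar g x j = (1/2) * (f x * fderiv ℝ g x (EuclideanSpace.single j (1:ℂ)) +
      I * (f x * fderiv ℝ g x (EuclideanSpace.single j I))) := fun x => by unfold wderivBar; ring
  have e2 : ∀ x, wderivBar f x j * g x = (1/2) * (fderiv ℝ f x (EuclideanSpace.single j (1:ℂ)) * g x +
      I * (fderiv ℝ f x (EuclideanSpace.single j I) * g x)) := fun x => by unfold wderivBar; ring
  simp_rw [e1, e2]
  rw [integral_const_mul, integral_const_mul, integral_add a2 (b2.const_mul _), integral_add a3 (b3.const_mul _),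
    integral_const_mul, integral_const_mul, a1, b1]; ring

/-- second derivatives: mixed directional derivatives -/
lemma fderiv_fderiv_apply {n : ℕ} {F : Type*} [NormedAddCommGroup F] [NormedSpace ℝ F] {f : Cn n → F} {D : Set (Cn n)} (hD : IsOpen D) (hf : ContDiffOn ℝ 2 f D) {x : Cn n}
    (hx : x ∈ D) (u v : Cn n) : fderiv ℝ (fun y => fderiv ℝ f y u) x v = fderiv ℝ (fderiv ℝ f) x v u := by
  have : DifferentiableAt ℝ (fderiv ℝ f) x :=
    ((hf.fderiv_of_isOpen hD (m := 1) (by norm_num)).differentiableOn one_ne_zero).differentiableAt (hD.mem_nhds hx)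
  rw [fderiv_clm_apply this (by fun_prop)]; simp

lemma fderiv2_symm {n : ℕ} {F : Type*} [NormedAddCommGroup F] [NormedSpace ℝ F] {f : Cn n → F} {D : Set (Cn n)} (hD : IsOpen D) (hf : ContDiffOn ℝ 2 f D) {x : Cn n}
    (hx : x ∈ D) (u v : Cn n) : fderiv ℝ (fderiv ℝ f) x v u = fderiv ℝ (fderiv ℝ f) x u v :=
  ((hf.contDiffAt (hD.mem_nhds hx)).isSymmSndFDerivAt (by simp)) v u

lemma wderiv_diff_dir {n : ℕ} {f : Cn n → ℂ} {D : Set (Cn n)} (hD : IsOpen D) (hf : ContDiffOn ℝ 2 f D) {x : Cn n}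
    (hx : x ∈ D) (u : Cn n) : DifferentiableAt ℝ (fun y => fderiv ℝ f y u) x := by
  have : DifferentiableAt ℝ (fderiv ℝ f) x :=
    ((hf.fderiv_of_isOpen hD (m := 1) (by norm_num)).differentiableOn one_ne_zero).differentiableAt (hD.mem_nhds hx)
  fun_prop

lemma fderiv_wderiv {n : ℕ} {f : Cn n → ℂ} {D : Set (Cn n)} (hD : IsOpen D) (hf : ContDiffOn ℝ 2 f D) {x : Cn n}
    (hx : x ∈ D) (j : Fin n) (v : Cn n) : fderiv ℝ (fun y => wderiv f y j) x v =
      (1/2) * (fderiv ℝ (fderiv ℝ f) x v (EuclideanSpace.single j (1:ℂ)) -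
        I * fderiv ℝ (fderiv ℝ f) x v (EuclideanSpace.single j I)) := by
  unfold wderiv
  have a := wderiv_diff_dir hD hf hx (EuclideanSpace.single j (1:ℂ))
  have b := wderiv_diff_dir hD hf hx (EuclideanSpace.single j I)
  have := ((a.hasFDerivAt.sub (b.hasFDerivAt.const_mul I)).const_mul (1/2)).fderiv
  refine (DFunLike.congr_fun this v).trans ?_
  simp [fderiv_fderiv_apply hD hf hx]

lemma fderiv_wderivBar {n : ℕ} {f : Cn n → ℂ} {D : Set (Cn n)} (hD : IsOpen D) (hf : ContDiffOn ℝ 2 f D) {x : Cn n}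
    (hx : x ∈ D) (j : Fin n) (v : Cn n) : fderiv ℝ (fun y => wderivBar f y j) x v =
      (1/2) * (fderiv ℝ (fderiv ℝ f) x v (EuclideanSpace.single j (1:ℂ)) +
        I * fderiv ℝ (fderiv ℝ f) x v (EuclideanSpace.single j I)) := by
  unfold wderivBar
  have a := wderiv_diff_dir hD hf hx (EuclideanSpace.single j (1:ℂ))
  have b := wderiv_diff_dir hD hf hx (EuclideanSpace.single j I)
  have := ((a.hasFDerivAt.add (b.hasFDerivAt.const_mul I)).const_mul (1/2)).fderiv
  refine (DFunLike.congr_fun this v).trans ?_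
  simp [fderiv_fderiv_apply hD hf hx]; ring

lemma wderiv_comm {n : ℕ} {f : Cn n → ℂ} {D : Set (Cn n)} (hD : IsOpen D) (hf : ContDiffOn ℝ 2 f D) {x : Cn n}
    (hx : x ∈ D) (j k : Fin n) : wderivBar (fun y => wderiv f y j) x k = wderiv (fun y => wderivBar f y k) x j := by
  rw [wderivBar, wderiv]
  simp only [fderiv_wderiv hD hf hx, fderiv_wderivBar hD hf hx]
  rw [fderiv2_symm hD hf hx (EuclideanSpace.single k (1:ℂ)) (EuclideanSpace.single j (1:ℂ)),
   fderiv2_symm hD hf hx (EuclideanSpace.single k (1:ℂ)) (EuclideanSpace.single j I),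
   fderiv2_symm hD hf hx (EuclideanSpace.single k I) (EuclideanSpace.single j (1:ℂ)),
   fderiv2_symm hD hf hx (EuclideanSpace.single k I) (EuclideanSpace.single j I)]
  ring

lemma wderivBar_comm {n : ℕ} {f : Cn n → ℂ} {D : Set (Cn n)} (hD : IsOpen D) (hf : ContDiffOn ℝ 2 f D) {x : Cn n}
    (hx : x ∈ D) (j k : Fin n) : wderivBar (fun y => wderivBar f y j) x k = wderivBar (fun y => wderivBar f y k) x j := by
  rw [wderivBar, wderivBar]
  simp only [fderiv_wderivBar hD hf hx]
  rw [fderiv2_symm hD hf hx (EuclideanSpace.single k (1:ℂ)) (EuclideanSpace.single j (1:ℂ)),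
   fderiv2_symm hD hf hx (EuclideanSpace.single k (1:ℂ)) (EuclideanSpace.single j I),
   fderiv2_symm hD hf hx (EuclideanSpace.single k I) (EuclideanSpace.single j (1:ℂ)),
   fderiv2_symm hD hf hx (EuclideanSpace.single k I) (EuclideanSpace.single j I)]
  ring
end

section

/-- the weight -/
def Wt {n : ℕ} (φ : Cn n → ℝ) (x : Cn n) : ℂ := (Real.exp (-φ x) : ℝ)

/-- the formal adjoint of `∂̄_j` -/
def del {n : ℕ} (φ : Cn n → ℝ) (j : Fin n) (a : Cn n → ℂ) (x : Cn n) : ℂ :=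
  - wderiv a x j + wderiv (realToC φ) x j * a x

lemma realToC_cd {n : ℕ} {φ : Cn n → ℝ} {D : Set (Cn n)} {m : ℕ} (h : ContDiffOn ℝ m φ D) : ContDiffOn ℝ m (realToC φ) D :=
  Complex.ofRealCLM.contDiff.comp_contDiffOn h

lemma Wt_cd {n : ℕ} {φ : Cn n → ℝ} {D : Set (Cn n)} {m : ℕ} (h : ContDiffOn ℝ m φ D) : ContDiffOn ℝ m (Wt φ) D :=
  Complex.ofRealCLM.contDiff.comp_contDiffOn (Real.contDiff_exp.comp_contDiffOn h.neg)

lemma fderiv_realToC {n : ℕ} {φ : Cn n → ℝ} {x : Cn n} (h : DifferentiableAt ℝ φ x) (v : Cn n) :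
    fderiv ℝ (realToC φ) x v = (fderiv ℝ φ x v : ℝ) := by
  have := (Complex.ofRealCLM.hasFDerivAt (x := φ x)).comp x h.hasFDerivAt
  have h2 : fderiv ℝ (realToC φ) x = _ := this.fderiv
  rw [h2]; simp

lemma wderiv_Wt {n : ℕ} {φ : Cn n → ℝ} {x : Cn n} (h : DifferentiableAt ℝ φ x) (j : Fin n) :
    wderiv (Wt φ) x j = - wderiv (realToC φ) x j * Wt φ x := by
  have h1 : HasFDerivAt (fun y => Real.exp (-φ y)) _ x := h.hasFDerivAt.neg.exp
  have h3 : Wt φ = realToC (fun y => Real.exp (-φ y)) := rfl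
  rw [wderiv, wderiv, h3, fderiv_realToC h1.differentiableAt, fderiv_realToC h1.differentiableAt, h1.fderiv,
    fderiv_realToC h, fderiv_realToC h, realToC]
  simp; ring

lemma contDiff_mul_supp {n : ℕ} {f g : Cn n → ℂ} {D : Set (Cn n)} (hD : IsOpen D) {m : ℕ} (hf : ContDiffOn ℝ m f D)
    (hg : ContDiff ℝ m g) (hs : tsupport g ⊆ D) : ContDiff ℝ m (fun x => f x * g x) := by
  rw [contDiff_iff_contDiffAt]
  intro x
  by_cases hx : x ∈ tsupport (fun x => f x * g x)
  swap
  · exact (contDiffAt_const (c := (0:ℂ))).congr_of_eventuallyEq (notMem_tsupport_iff_eventuallyEq.1 hx)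
  have hxD : x ∈ D := hs ((tsupport_mul_subset_right) hx)
  exact (hf.contDiffAt (hD.mem_nhds hxD)).mul hg.contDiffAt

lemma del_C {n : ℕ} {φ : Cn n → ℝ} {D : Set (Cn n)} (hD : IsOpen D) (hφ : ContDiffOn ℝ 2 φ D) {a : Cn n → ℂ}
    (ha : ContDiff ℝ 2 a) (hs : tsupport a ⊆ D) (j : Fin n) : ContDiff ℝ 1 (del φ j a) := by
  unfold del
  refine (wderiv_C (m := 1) (by simpa [one_add_one_eq_two] using ha) j).neg.add (contDiff_mul_supp hD (m := 1) ?_ (ha.of_le (by norm_num)) hs)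
  exact wderiv_cd hD (m := 1) (realToC_cd (m := 2) hφ) j

lemma del_C0 {n : ℕ} {φ : Cn n → ℝ} {D : Set (Cn n)} (hD : IsOpen D) (hφ : ContDiffOn ℝ 2 φ D) {a : Cn n → ℂ}
    (ha : ContDiff ℝ 1 a) (hs : tsupport a ⊆ D) (j : Fin n) : Continuous (del φ j a) := by
  unfold del
  refine (wderiv_C (m := 0) (by simpa using ha) j).continuous.neg.add (cont_mul hD ?_ ha.continuous hs)
  exact (wderiv_cd hD (m := 1) (realToC_cd (m := 2) hφ) j).continuousOn

lemma del_supp {n : ℕ} {φ : Cn n → ℝ} {a : Cn n → ℂ} (j : Fin n) : tsupport (del φ j a) ⊆ tsupport a := by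
  refine closure_minimal ?_ (isClosed_tsupport _)
  intro x hx; by_contra h
  have h1 : wderiv a x j = 0 := by
    by_contra h2; exact h (wderiv_supp j (subset_tsupport _ h2))
  have h3 : a x = 0 := image_eq_zero_of_notMem_tsupport h
  simp [del, h1, h3] at hx

lemma conj_supp {n : ℕ} {a : Cn n → ℂ} : tsupport (fun x => conj (a x)) = tsupport a := by
  unfold tsupport; congr 1; ext x; simp

lemma conj_cd {n : ℕ} {a : Cn n → ℂ} {m : ℕ} (h : ContDiff ℝ m a) : ContDiff ℝ m (fun x => conj (a x)) :=
  Complex.conjCLE.contDiff.comp h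

/-- adjoint relation -/
lemma adj {n : ℕ} {φ : Cn n → ℝ} {D : Set (Cn n)} (hD : IsOpen D) (hφ : ContDiffOn ℝ 2 φ D) {a c : Cn n → ℂ}
    (ha : ContDiff ℝ 1 a) (hac : HasCompactSupport a) (hs : tsupport a ⊆ D) (hc : ContDiff ℝ 1 c) (j : Fin n) :
    ∫ x, Wt φ x * (del φ j a x * conj (c x)) ∂(dVol n) = ∫ x, Wt φ x * (a x * conj (wderivBar c x j)) ∂(dVol n) := by
  have hcc := conj_cd (m := 1) hc
  have hW := Wt_cd (m := 1) (hφ.of_le (by norm_num))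
  have hWc : ContinuousOn (Wt φ) D := hW.continuousOn
  have hsc : tsupport (fun x => a x * conj (c x)) ⊆ tsupport a := tsupport_mul_subset_left
  have key := ibp hD hW (ha.mul hcc) (g := fun x => a x * conj (c x)) hac.mul_right (hsc.trans hs) j
  have hd : ∀ x, wderiv (fun x => a x * conj (c x)) x j = wderiv a x j * conj (c x) + a x * conj (wderivBar c x j) := by
    intro x
    rw [wderiv_mul (ha.differentiable one_ne_zero x) (hcc.differentiable one_ne_zero x),
      wderiv_conj (hc.differentiable one_ne_zero x)]
  have hcb : Continuous (fun x => conj (wderivBar c x j)) :=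
    (conj_cd (m := 0) (wderivBar_C (m := 0) (by simpa using hc) j)).continuous
  have hcd : Continuous (fun x => wderiv a x j) := (wderiv_C (m := 0) (by simpa using ha) j).continuous
  have hcdc : HasCompactSupport (fun x => wderiv a x j) := hac.mono' (subset_closure.trans (wderiv_supp j))
  have i1 : Integrable (fun x => Wt φ x * (wderiv a x j * conj (c x))) (dVol n) :=
    int_mul hD hWc (hcd.mul hcc.continuous) hcdc.mul_right ((tsupport_mul_subset_left).trans ((wderiv_supp j).trans hs))
  have i2 : Integrable (fun x => Wt φ x * (a x * conj (wderivBar c x j))) (dVol n) :=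
    int_mul hD hWc (ha.continuous.mul hcb) hac.mul_right ((tsupport_mul_subset_left).trans hs)
  have i3 : Integrable (fun x => Wt φ x * (del φ j a x * conj (c x))) (dVol n) :=
    int_mul hD hWc ((del_C0 hD hφ ha hs j).mul hcc.continuous)
      (HasCompactSupport.mul_right (hac.mono' (subset_closure.trans (del_supp j))))
      ((tsupport_mul_subset_left).trans ((del_supp j).trans hs))
  have e1 : ∀ x, - (wderiv (Wt φ) x j * (a x * conj (c x))) =
      Wt φ x * (wderiv a x j * conj (c x)) + Wt φ x * (del φ j a x * conj (c x)) := by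
    intro x
    by_cases hx : x ∈ D
    · rw [wderiv_Wt ((hφ.differentiableOn two_ne_zero).differentiableAt (hD.mem_nhds hx)), del]; ring
    · have h3 : a x = 0 := image_eq_zero_of_notMem_tsupport (fun h => hx (hs h))
      have h1 : wderiv a x j = 0 := by
        by_contra h2; exact hx (hs (wderiv_supp j (subset_tsupport _ h2)))
      simp [h3, h1, del]
  rw [← integral_neg] at key
  simp_rw [e1, hd, mul_add] at key
  rw [integral_add i1 i2, integral_add i1 i3] at key
  exact (add_left_cancel key).symm

lemma levi_symm {n : ℕ} {φ : Cn n → ℝ} {D : Set (Cn n)} (hD : IsOpen D) (hφ : ContDiffOn ℝ 2 φ D) {x : Cn n} (hx : x ∈ D)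
    (j k : Fin n) : conj (wderivBar (fun v => wderiv (realToC φ) v k) x j) = wderivBar (fun v => wderiv (realToC φ) v j) x k := by
  have h2 := realToC_cd (m := 2) hφ
  have hr : (fun y => conj (realToC φ y)) = realToC φ := by ext y; simp [realToC]
  rw [wderiv_comm hD h2 hx j k]
  have e : (fun y => wderivBar (realToC φ) y k) =ᶠ[nhds x] fun y => conj (wderiv (realToC φ) y k) := by
    filter_upwards [hD.mem_nhds hx] with y hy
    rw [← wderivBar_conj ((h2.differentiableOn two_ne_zero).differentiableAt (hD.mem_nhds hy)), hr]
  have hd : DifferentiableAt ℝ (fun y => wderiv (realToC φ) y k) x :=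
    ((wderiv_cd hD (m := 1) h2 k).differentiableOn one_ne_zero).differentiableAt (hD.mem_nhds hx)
  rw [← wderiv_conj hd, wderiv, wderiv, e.fderiv_eq]

lemma BI_jk {n : ℕ} {φ : Cn n → ℝ} {D : Set (Cn n)} (hD : IsOpen D) (hφ : ContDiffOn ℝ 2 φ D) {a c : Cn n → ℂ}
    (ha : ContDiff ℝ 2 a) (hac : HasCompactSupport a) (has : tsupport a ⊆ D)
    (hc : ContDiff ℝ 2 c) (hcc : HasCompactSupport c) (hcs : tsupport c ⊆ D) (j k : Fin n) :
    ∫ x, Wt φ x * (del φ j a x * conj (del φ k c x)) ∂(dVol n) =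
      ∫ x, Wt φ x * (wderivBar a x k * conj (wderivBar c x j)) ∂(dVol n) +
      ∫ x, Wt φ x * (wderivBar (fun v => wderiv (realToC φ) v j) x k * a x * conj (c x)) ∂(dVol n) := by
  have h12 : (1:WithTop ℕ∞) ≤ 2 := by norm_num
  have ha1 := ha.of_le h12
  have hc1 := hc.of_le h12
  have hWc : ContinuousOn (Wt φ) D := (Wt_cd (m := 2) hφ).continuousOn
  have hcb : ContDiff ℝ 1 (fun x => wderivBar c x j) := wderivBar_C (m := 1) (by simpa [one_add_one_eq_two] using hc) j
  have hcbs := (wderivBar_supp (f := c) j).trans hcs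
  have hcbc : HasCompactSupport (fun x => wderivBar c x j) := hcc.mono' (subset_closure.trans (wderivBar_supp j))
  rw [adj hD hφ ha1 hac has (del_C hD hφ hc hcs k)]
  have s2 := adj hD hφ hcb hcbc hcbs ha1 k
  have s3 := congrArg conj s2
  rw [← integral_conj, ← integral_conj] at s3
  have hWr : ∀ x, conj (Wt φ x) = Wt φ x := fun x => by unfold Wt; exact Complex.conj_ofReal _
  simp only [map_mul, hWr, Complex.conj_conj] at s3
  have e0 : ∀ x, Wt φ x * (wderivBar a x k * conj (wderivBar c x j)) = Wt φ x * (conj (wderivBar c x j) * wderivBar a x k) :=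
    fun x => by ring
  simp_rw [e0]
  rw [← s3, ← integral_add]
  · apply integral_congr_ae; refine Filter.Eventually.of_forall fun x => ?_
    dsimp only
    by_cases hx : x ∈ D
    · have h2 := realToC_cd (m := 2) hφ
      have d1 : DifferentiableAt ℝ (fun y => wderiv (realToC φ) y k) x :=
        ((wderiv_cd hD (m := 1) h2 k).differentiableOn one_ne_zero).differentiableAt (hD.mem_nhds hx)
      have d2 : DifferentiableAt ℝ (fun y => wderiv c y k) x :=
        ((wderiv_C (m := 1) (by simpa [one_add_one_eq_two] using hc) k).differentiable one_ne_zero) x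
      have d3 := hc1.differentiable one_ne_zero x
      have : wderivBar (del φ k c) x j = del φ k (fun x => wderivBar c x j) x +
          wderivBar (fun v => wderiv (realToC φ) v k) x j * c x := by
        have e1 : del φ k c = fun y => (-wderiv c y k) + wderiv (realToC φ) y k * c y := rfl
        rw [e1, wderivBar_add (f := fun y => -wderiv c y k) (g := fun y => wderiv (realToC φ) y k * c y) d2.neg (d1.mul d3), wderivBar_neg, wderivBar_mul d1 d3,
          wderiv_comm isOpen_univ hc.contDiffOn (Set.mem_univ x), del]; ring
      rw [this, map_add, map_mul, levi_symm hD hφ hx]; ring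
    · have h3 : a x = 0 := image_eq_zero_of_notMem_tsupport (fun h => hx (has h))
      simp [h3]
  · have hcont : Continuous (fun x => conj (del φ k (fun x => wderivBar c x j) x) * a x) :=
      (conj_cd (m := 0) (by simpa using (del_C0 hD hφ hcb hcbs k))).continuous.mul ha.continuous
    exact int_mul hD hWc hcont (HasCompactSupport.mul_left hac) ((tsupport_mul_subset_right).trans has)
  · have hl : ContinuousOn (fun x => wderivBar (fun v => wderiv (realToC φ) v j) x k) D :=
      (wderivBar_cd hD (m := 0) (wderiv_cd hD (m := 1) (realToC_cd (m := 2) hφ) j) k).continuousOn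
    have := int_mul hD (hWc.mul hl) (ha.continuous.mul (conj_cd (m := 2) hc).continuous) hac.mul_right
      ((tsupport_mul_subset_left).trans has)
    refine this.congr (Filter.Eventually.of_forall fun x => ?_)
    simp only [Pi.mul_apply]; ring
end

section

/-- the basic inequality -/
lemma BI {n : ℕ} {φ : Cn n → ℝ} {D : Set (Cn n)} (hD : IsOpen D) (hφ : ContDiffOn ℝ 2 φ D) {b : Fin n → Cn n → ℂ}
    (hb : ∀ j, ContDiff ℝ 2 (b j)) (hbc : ∀ j, HasCompactSupport (b j)) (hbs : ∀ j, tsupport (b j) ⊆ D) :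
    ∫ x, Real.exp (-φ x) * leviForm φ x (WithLp.toLp 2 (fun j => b j x)) ∂(dVol n) ≤
      ∫ x, Real.exp (-φ x) * ‖∑ j, del φ j (b j) x‖^2 ∂(dVol n) +
      (1/2) * ∑ j, ∑ k, ∫ x, Real.exp (-φ x) * ‖wderivBar (b k) x j - wderivBar (b j) x k‖^2 ∂(dVol n) := by
  have h12 : (1:WithTop ℕ∞) ≤ 2 := by norm_num
  have hWc : ContinuousOn (Wt φ) D := (Wt_cd (m := 2) hφ).continuousOn
  have hdel : ∀ j, Continuous (del φ j (b j)) := fun j => del_C0 hD hφ ((hb j).of_le h12) (hbs j) j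
  have hdels : ∀ j, tsupport (del φ j (b j)) ⊆ D := fun j => (del_supp j).trans (hbs j)
  have hdelc : ∀ j, HasCompactSupport (del φ j (b j)) := fun j => (hbc j).mono' (subset_closure.trans (del_supp j))
  have hwb : ∀ j k, Continuous (fun x => wderivBar (b k) x j) := fun j k =>
    (wderivBar_C (m := 1) (by simpa [one_add_one_eq_two] using hb k) j).continuous
  have hwbs : ∀ j k, tsupport (fun x => wderivBar (b k) x j) ⊆ D := fun j k => (wderivBar_supp j).trans (hbs k)
  have hwbc : ∀ j k, HasCompactSupport (fun x => wderivBar (b k) x j) := fun j k =>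
    (hbc k).mono' (subset_closure.trans (wderivBar_supp j))
  have conjc : ∀ {a : Cn n → ℂ}, Continuous a → Continuous (fun x => conj (a x)) := fun h => Complex.continuous_conj.comp h
  have i1 : ∀ j k, Integrable (fun x => Wt φ x * (del φ j (b j) x * conj (del φ k (b k) x))) (dVol n) := fun j k =>
    int_mul hD hWc ((hdel j).mul (conjc (hdel k))) (hdelc j).mul_right ((tsupport_mul_subset_left).trans (hdels j))
  have i2 : ∀ j k, Integrable (fun x => Wt φ x * (wderivBar (b j) x k * conj (wderivBar (b k) x j))) (dVol n) := fun j k =>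
    int_mul hD hWc ((hwb k j).mul (conjc (hwb j k))) (hwbc k j).mul_right ((tsupport_mul_subset_left).trans (hwbs k j))
  have i3 : ∀ j k, Integrable (fun x => Wt φ x * (wderivBar (fun v => wderiv (realToC φ) v j) x k * b j x * conj (b k x))) (dVol n) := by
    intro j k
    have hl : ContinuousOn (fun x => wderivBar (fun v => wderiv (realToC φ) v j) x k) D :=
      (wderivBar_cd hD (m := 0) (wderiv_cd hD (m := 1) (realToC_cd (m := 2) hφ) j) k).continuousOn
    have := int_mul hD (hWc.mul hl) ((hb j).continuous.mul (conjc (hb k).continuous)) (hbc j).mul_right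
      ((tsupport_mul_subset_left).trans (hbs j))
    refine this.congr (Filter.Eventually.of_forall fun x => ?_)
    simp only [Pi.mul_apply]; ring
  have i4 : ∀ j k, Integrable (fun x => Real.exp (-φ x) * ‖wderivBar (b k) x j - wderivBar (b j) x k‖^2) (dVol n) := by
    intro j k
    have hc := (hwb j k).sub (hwb k j)
    have := int_mul hD hWc (hc.mul (conjc hc)) ((hwbc j k).sub (hwbc k j)).mul_right
      ((tsupport_mul_subset_left).trans ((tsupport_sub _ _).trans (Set.union_subset (hwbs j k) (hwbs k j))))
    refine this.re.congr (Filter.Eventually.of_forall fun x => ?_)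
    simp only [Pi.mul_apply, Pi.sub_apply, Complex.mul_conj, Wt, ← Complex.ofReal_mul, RCLike.re_to_complex, Complex.ofReal_re, Complex.normSq_eq_norm_sq]
  have hre : ∀ (x : Cn n) (z : ℂ), (Wt φ x * z).re = Real.exp (-φ x) * z.re := fun x z => by
    unfold Wt; rw [Complex.re_ofReal_mul]
  -- sum of identities
  have hsum : ∑ j, ∑ k, (∫ x, Wt φ x * (del φ j (b j) x * conj (del φ k (b k) x)) ∂(dVol n)) =
      ∑ j, ∑ k, (∫ x, Wt φ x * (wderivBar (b j) x k * conj (wderivBar (b k) x j)) ∂(dVol n)) +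
      ∑ j, ∑ k, ∫ x, Wt φ x * (wderivBar (fun v => wderiv (realToC φ) v j) x k * b j x * conj (b k x)) ∂(dVol n) := by
    simp_rw [← Finset.sum_add_distrib]
    exact Finset.sum_congr rfl fun j _ => Finset.sum_congr rfl fun k _ =>
      BI_jk hD hφ (hb j) (hbc j) (hbs j) (hb k) (hbc k) (hbs k) j k
  have hre1 := congrArg Complex.re hsum
  rw [Complex.add_re] at hre1
  have eL : (∑ j, ∑ k, (∫ x, Wt φ x * (del φ j (b j) x * conj (del φ k (b k) x)) ∂(dVol n))).re =
      ∫ x, Real.exp (-φ x) * ‖∑ j, del φ j (b j) x‖^2 ∂(dVol n) := by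
    have : ∑ j, ∑ k, (∫ x, Wt φ x * (del φ j (b j) x * conj (del φ k (b k) x)) ∂(dVol n)) =
        ∫ x, ∑ j, ∑ k, Wt φ x * (del φ j (b j) x * conj (del φ k (b k) x)) ∂(dVol n) := by
      rw [integral_finsetSum _ (fun j _ => integrable_finsetSum _ fun k _ => i1 j k)]
      exact Finset.sum_congr rfl fun j _ => (integral_finsetSum _ (fun k _ => i1 j k)).symm
    rw [this, ← RCLike.re_to_complex, ← integral_re (integrable_finsetSum _ (fun j _ => integrable_finsetSum _ fun k _ => i1 j k))]
    congr 1; ext x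
    have : ∑ j, ∑ k, Wt φ x * (del φ j (b j) x * conj (del φ k (b k) x)) =
        Wt φ x * ((∑ j, del φ j (b j) x) * conj (∑ j, del φ j (b j) x)) := by
      rw [map_sum, Finset.sum_mul_sum, Finset.mul_sum]
      exact Finset.sum_congr rfl fun j _ => by rw [Finset.mul_sum]
    rw [this, RCLike.re_to_complex, hre, Complex.mul_conj, Complex.ofReal_re, Complex.normSq_eq_norm_sq]
  have eR : (∑ j, ∑ k, ∫ x, Wt φ x * (wderivBar (fun v => wderiv (realToC φ) v j) x k * b j x * conj (b k x)) ∂(dVol n)).re =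
      ∫ x, Real.exp (-φ x) * leviForm φ x (WithLp.toLp 2 (fun j => b j x)) ∂(dVol n) := by
    have : ∑ j, ∑ k, ∫ x, Wt φ x * (wderivBar (fun v => wderiv (realToC φ) v j) x k * b j x * conj (b k x)) ∂(dVol n) =
        ∫ x, ∑ j, ∑ k, Wt φ x * (wderivBar (fun v => wderiv (realToC φ) v j) x k * b j x * conj (b k x)) ∂(dVol n) := by
      rw [integral_finsetSum _ (fun j _ => integrable_finsetSum _ fun k _ => i3 j k)]
      exact Finset.sum_congr rfl fun j _ => (integral_finsetSum _ (fun k _ => i3 j k)).symm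
    rw [this, ← RCLike.re_to_complex, ← integral_re (integrable_finsetSum _ (fun j _ => integrable_finsetSum _ fun k _ => i3 j k))]
    congr 1; ext x
    rw [leviForm, ← hre, RCLike.re_to_complex, Finset.mul_sum]
    congr 1
    exact Finset.sum_congr rfl fun j _ => by rw [Finset.mul_sum]
  have eM : - ((1/2) * ∑ j, ∑ k, ∫ x, Real.exp (-φ x) * ‖wderivBar (b k) x j - wderivBar (b j) x k‖^2 ∂(dVol n)) ≤
      (∑ j, ∑ k, (∫ x, Wt φ x * (wderivBar (b j) x k * conj (wderivBar (b k) x j)) ∂(dVol n))).re := by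
    rw [Complex.re_sum, Finset.mul_sum, ← Finset.sum_neg_distrib]
    refine Finset.sum_le_sum fun j _ => ?_
    rw [Complex.re_sum, Finset.mul_sum, ← Finset.sum_neg_distrib]
    refine Finset.sum_le_sum fun k _ => ?_
    rw [← RCLike.re_to_complex, ← integral_re (i2 j k), ← integral_const_mul, ← integral_neg]
    refine integral_mono ((i4 j k).const_mul _).neg (i2 j k).re fun x => ?_
    simp only [RCLike.re_to_complex]
    rw [hre]
    have h1 : ∀ z w : ℂ, -(1/2 * ‖z - w‖^2) ≤ (w * conj z).re := by
      intro z w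
      simp only [← Complex.normSq_eq_norm_sq, Complex.normSq_apply, Complex.sub_re, Complex.sub_im, Complex.mul_re, Complex.conj_re, Complex.conj_im]
      nlinarith [sq_nonneg z.re, sq_nonneg z.im, sq_nonneg w.re, sq_nonneg w.im]
    have := mul_le_mul_of_nonneg_left (h1 (wderivBar (b k) x j) (wderivBar (b j) x k)) (Real.exp_pos (-φ x)).le
    linarith
  rw [eL, eR] at hre1
  linarith
end

section
open scoped ENNReal Topology

/-- unnormalised radial bump -/
def bump0 {n : ℕ} (ε : ℝ) (x : Cn n) : ℝ := expNegInvGlue (ε^2 - ‖x‖^2)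

lemma bump0_cd {n : ℕ} (ε : ℝ) {m : ℕ∞} : ContDiff ℝ m (bump0 (n := n) ε) := by
  unfold bump0
  exact expNegInvGlue.contDiff.comp (contDiff_const.sub (contDiff_norm_sq ℝ))

lemma bump0_nonneg {n : ℕ} (ε : ℝ) (x : Cn n) : 0 ≤ bump0 ε x := expNegInvGlue.nonneg _

lemma bump0_zero {n : ℕ} {ε : ℝ} (hε : 0 < ε) {x : Cn n} (hx : ε ≤ ‖x‖) : bump0 ε x = 0 :=
  expNegInvGlue.zero_of_nonpos (by nlinarith)

lemma bump0_supp {n : ℕ} {ε : ℝ} (hε : 0 < ε) : tsupport (bump0 (n := n) ε) ⊆ Metric.closedBall 0 ε := by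
  refine closure_minimal ?_ Metric.isClosed_closedBall
  intro x hx
  by_contra h
  exact hx (bump0_zero hε (by simpa using (not_le.1 (by simpa using h)).le))

lemma bump0_comp {n : ℕ} {ε : ℝ} (hε : 0 < ε) : HasCompactSupport (bump0 (n := n) ε) :=
  (isCompact_closedBall 0 ε).of_isClosed_subset (isClosed_tsupport _) (bump0_supp hε)

lemma bump0_int {n : ℕ} {ε : ℝ} (hε : 0 < ε) : Integrable (bump0 (n := n) ε) (dVol n) :=
  (bump0_cd (m := 1) ε).continuous.integrable_of_hasCompactSupport (bump0_comp hε)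

lemma bump0_pos {n : ℕ} {ε : ℝ} (hε : 0 < ε) : 0 < ∫ x, bump0 (n := n) ε x ∂(dVol n) := by
  rw [integral_pos_iff_support_of_nonneg (bump0_nonneg ε) (bump0_int hε)]
  have : Metric.ball (0 : Cn n) ε ⊆ Function.support (bump0 ε) := by
    intro x hx
    have : ‖x‖ < ε := by simpa using hx
    exact (expNegInvGlue.pos_of_pos (by nlinarith [norm_nonneg x])).ne'
  exact lt_of_lt_of_le (Metric.measure_ball_pos _ _ hε) (measure_mono this)

/-- radial mollifier -/
def moll {n : ℕ} (ε : ℝ) (x : Cn n) : ℝ := bump0 ε x / ∫ x, bump0 (n := n) ε x ∂(dVol n)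

lemma moll_cd {n : ℕ} (ε : ℝ) {m : ℕ∞} : ContDiff ℝ m (moll (n := n) ε) := (bump0_cd ε).div_const _
lemma moll_nonneg {n : ℕ} {ε : ℝ} (hε : 0 < ε) (x : Cn n) : 0 ≤ moll ε x := div_nonneg (bump0_nonneg _ _) (bump0_pos hε).le
lemma moll_zero {n : ℕ} {ε : ℝ} (hε : 0 < ε) {x : Cn n} (hx : ε ≤ ‖x‖) : moll ε x = 0 := by simp [moll, bump0_zero hε hx]
lemma moll_int {n : ℕ} {ε : ℝ} (hε : 0 < ε) : Integrable (moll (n := n) ε) (dVol n) := (bump0_int hε).div_const _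
lemma moll_one {n : ℕ} {ε : ℝ} (hε : 0 < ε) : ∫ x, moll (n := n) ε x ∂(dVol n) = 1 := by
  unfold moll; rw [integral_div, div_self (bump0_pos hε).ne']
lemma moll_comp {n : ℕ} {ε : ℝ} (hε : 0 < ε) : HasCompactSupport (moll (n := n) ε) := by
  unfold moll; simp_rw [div_eq_mul_inv]; exact (bump0_comp hε).mul_right
lemma moll_norm {n : ℕ} (ε : ℝ) {x y : Cn n} (h : ‖x‖ = ‖y‖) : moll ε x = moll ε y := by simp [moll, bump0, h]

/-- complexified mollifier -/
def mollC {n : ℕ} (ε : ℝ) (x : Cn n) : ℂ := (moll ε x : ℂ)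
lemma mollC_cd {n : ℕ} (ε : ℝ) {m : ℕ∞} : ContDiff ℝ m (mollC (n := n) ε) := Complex.ofRealCLM.contDiff.comp (moll_cd ε)
lemma mollC_comp {n : ℕ} {ε : ℝ} (hε : 0 < ε) : HasCompactSupport (mollC (n := n) ε) := (moll_comp hε).comp_left (g := Complex.ofReal) rfl

/-- mollification -/
def mo {n : ℕ} (ε : ℝ) (f : Cn n → ℂ) (x : Cn n) : ℂ := ∫ t, f t * mollC ε (x - t) ∂(dVol n)

lemma mo_conv {n : ℕ} (ε : ℝ) (f : Cn n → ℂ) : mo ε f = MeasureTheory.convolution f (mollC ε) (ContinuousLinearMap.mul ℝ ℂ) (dVol n) := rfl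

lemma mo_cd {n : ℕ} {ε : ℝ} (hε : 0 < ε) {f : Cn n → ℂ} (hf : LocallyIntegrable f (dVol n)) {m : ℕ∞} : ContDiff ℝ m (mo ε f) := by
  rw [mo_conv]; exact (mollC_comp hε).contDiff_convolution_right _ hf (mollC_cd ε)

lemma mo_fderiv {n : ℕ} {ε : ℝ} (hε : 0 < ε) {f : Cn n → ℂ} (hf : LocallyIntegrable f (dVol n)) (x v : Cn n) :
    fderiv ℝ (mo ε f) x v = ∫ t, f t * fderiv ℝ (mollC ε) (x - t) v ∂(dVol n) := by
  rw [mo_conv, ((mollC_comp hε).hasFDerivAt_convolution_right _ hf (mollC_cd ε (m := 1)) x).fderiv,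
   convolution, ContinuousLinearMap.integral_apply]
  · rfl
  · have := HasCompactSupport.convolutionExists_right ((ContinuousLinearMap.mul ℝ ℂ).precompR (Cn n)) ((mollC_comp hε).fderiv ℝ) hf
      ((mollC_cd ε (m := 1)).continuous_fderiv one_ne_zero) x
    exact this

/-- reflected translate of the mollifier -/
def tm {n : ℕ} (ε : ℝ) (x t : Cn n) : ℂ := mollC ε (x - t)

lemma tm_cd {n : ℕ} (ε : ℝ) (x : Cn n) {m : ℕ∞} : ContDiff ℝ m (tm ε x) := (mollC_cd ε).comp (contDiff_const.sub contDiff_id)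
lemma tm_supp {n : ℕ} {ε : ℝ} (hε : 0 < ε) (x : Cn n) : tsupport (tm ε x) ⊆ Metric.closedBall x ε := by
  refine closure_minimal ?_ Metric.isClosed_closedBall
  intro t ht
  by_contra h
  apply ht
  have : ε ≤ ‖x - t‖ := by
    rw [Metric.mem_closedBall, dist_comm, dist_eq_norm] at h; exact (not_le.1 h).le
  simp [tm, mollC, moll_zero hε this]
lemma tm_comp {n : ℕ} {ε : ℝ} (hε : 0 < ε) (x : Cn n) : HasCompactSupport (tm ε x) :=
  (isCompact_closedBall x ε).of_isClosed_subset (isClosed_tsupport _) (tm_supp hε x)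

lemma tm_fderiv {n : ℕ} (ε : ℝ) (x t v : Cn n) : fderiv ℝ (tm ε x) t v = - fderiv ℝ (mollC ε) (x - t) v := by
  have h1 : HasFDerivAt (fun t : Cn n => x - t) (-ContinuousLinearMap.id ℝ (Cn n)) t := (hasFDerivAt_id t).const_sub x
  have h2 := ((mollC_cd (n := n) ε (m := 1)).differentiable one_ne_zero (x - t)).hasFDerivAt.comp t h1
  have h3 : fderiv ℝ (tm ε x) t = _ := h2.fderiv
  rw [h3]; simp

lemma locint_mul {n : ℕ} {f g : Cn n → ℂ} (hf : LocallyIntegrable f (dVol n)) (hg : Continuous g) (hc : HasCompactSupport g) :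
    Integrable (fun t => f t * g t) (dVol n) := by
  have := hf.integrable_smul_right_of_hasCompactSupport hg hc
  simpa [mul_comm] using this

lemma mo_wderiv {n : ℕ} {ε : ℝ} (hε : 0 < ε) {f : Cn n → ℂ} (hf : LocallyIntegrable f (dVol n)) (x : Cn n) (j : Fin n) :
    wderiv (mo ε f) x j = - ∫ t, f t * wderiv (tm ε x) t j ∂(dVol n) := by
  have hintg : ∀ v, Integrable (fun t => f t * fderiv ℝ (tm ε x) t v) (dVol n) := fun v =>
    locint_mul hf (((tm_cd ε x (m := 1)).continuous_fderiv one_ne_zero).clm_apply continuous_const)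
      ((tm_comp hε x).fderiv_apply ℝ v)
  have e1 : ∀ v, fderiv ℝ (mo ε f) x v = - ∫ t, f t * fderiv ℝ (tm ε x) t v ∂(dVol n) := by
    intro v; rw [mo_fderiv hε hf, ← integral_neg]; simp_rw [tm_fderiv]; simp
  rw [wderiv, e1, e1]
  simp_rw [wderiv]
  have e2 : ∀ t, f t * (1 / 2 * (fderiv ℝ (tm ε x) t (EuclideanSpace.single j (1:ℂ)) - I * fderiv ℝ (tm ε x) t (EuclideanSpace.single j I)))
    = (1/2) * (f t * fderiv ℝ (tm ε x) t (EuclideanSpace.single j (1:ℂ)) - I * (f t * fderiv ℝ (tm ε x) t (EuclideanSpace.single j I))) := fun t => by ring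
  simp_rw [e2]
  rw [integral_const_mul, integral_sub (hintg _) ((hintg _).const_mul _), integral_const_mul]; ring

lemma mo_wderivBar {n : ℕ} {ε : ℝ} (hε : 0 < ε) {f : Cn n → ℂ} (hf : LocallyIntegrable f (dVol n)) (x : Cn n) (j : Fin n) :
    wderivBar (mo ε f) x j = - ∫ t, f t * wderivBar (tm ε x) t j ∂(dVol n) := by
  have hintg : ∀ v, Integrable (fun t => f t * fderiv ℝ (tm ε x) t v) (dVol n) := fun v =>
    locint_mul hf (((tm_cd ε x (m := 1)).continuous_fderiv one_ne_zero).clm_apply continuous_const)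
      ((tm_comp hε x).fderiv_apply ℝ v)
  have e1 : ∀ v, fderiv ℝ (mo ε f) x v = - ∫ t, f t * fderiv ℝ (tm ε x) t v ∂(dVol n) := by
    intro v; rw [mo_fderiv hε hf, ← integral_neg]; simp_rw [tm_fderiv]; simp
  rw [wderivBar, e1, e1]
  simp_rw [wderivBar]
  have e2 : ∀ t, f t * (1 / 2 * (fderiv ℝ (tm ε x) t (EuclideanSpace.single j (1:ℂ)) + I * fderiv ℝ (tm ε x) t (EuclideanSpace.single j I)))
    = (1/2) * (f t * fderiv ℝ (tm ε x) t (EuclideanSpace.single j (1:ℂ)) + I * (f t * fderiv ℝ (tm ε x) t (EuclideanSpace.single j I))) := fun t => by ring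
  simp_rw [e2]
  rw [integral_const_mul, integral_add (hintg _) ((hintg _).const_mul _), integral_const_mul]; ring

lemma mo_zero {n : ℕ} {ε : ℝ} (hε : 0 < ε) {f : Cn n → ℂ} {x : Cn n} (h : ∀ t, ‖x - t‖ < ε → f t = 0) : mo ε f x = 0 := by
  unfold mo
  rw [← integral_zero (Cn n) ℂ (μ := dVol n)]
  congr 1; ext t
  by_cases ht : ‖x - t‖ < ε
  · simp [h t ht]
  · simp [mollC, moll_zero hε (not_lt.1 ht)]

lemma mo_flip {n : ℕ} (ε : ℝ) (f : Cn n → ℂ) (x : Cn n) : mo ε f x = ∫ t, f (x - t) * mollC ε t ∂(dVol n) := by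
  unfold mo
  rw [← integral_sub_left_eq_self _ (dVol n) x]; simp
end

section
open scoped ENNReal Topology

lemma moll_lint {n : ℕ} {ε : ℝ} (hε : 0 < ε) : ∫⁻ x, ENNReal.ofReal (moll (n := n) ε x) ∂(dVol n) = 1 := by
  rw [← ofReal_integral_eq_lintegral_ofReal (moll_int hε) (ae_of_all _ (moll_nonneg hε)), moll_one hε]; simp

lemma mo_L2 {n : ℕ} {ε : ℝ} (hε : 0 < ε) {f : Cn n → ℂ} (hf : MemLp f 2 (dVol n)) :
    eLpNorm (mo ε f) 2 (dVol n) ≤ eLpNorm f 2 (dVol n) := by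
  have key : ∀ g : Cn n → ℂ, Measurable g → eLpNorm (mo ε g) 2 (dVol n) ≤ eLpNorm g 2 (dVol n) := by
    intro g hg
    rw [eLpNorm_eq_lintegral_rpow_enorm_toReal (by norm_num) (by norm_num), eLpNorm_eq_lintegral_rpow_enorm_toReal (by norm_num) (by norm_num)]
    refine ENNReal.rpow_le_rpow ?_ (by norm_num)
    have hS := schur_test (μ := dVol n) (k := fun x y => ENNReal.ofReal (moll ε (x - y))) (φ := fun _ => 1) (p := 2) (q := 2)
      (by
        have : Measurable (moll (n := n) ε) := (moll_cd ε (m := 1)).continuous.measurable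
        exact (this.comp (measurable_fst.sub measurable_snd)).ennreal_ofReal)
      measurable_const (by simp) (by simp) Real.HolderConjugate.two_two (A := 1) (B := 1)
      (by
        refine ae_of_all _ fun x => ?_
        simp only [ENNReal.one_rpow, mul_one]
        rw [lintegral_sub_left_eq_self (fun y => ENNReal.ofReal (moll ε y)) x, moll_lint hε])
      (by
        refine ae_of_all _ fun x => ?_
        simp only [ENNReal.one_rpow, mul_one]
        rw [lintegral_sub_right_eq_self (fun y => ENNReal.ofReal (moll ε y)) x, moll_lint hε])
      (f := fun x => ‖g x‖ₑ) hg.enorm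
    simp only [ENNReal.one_rpow, one_mul] at hS
    refine le_trans (lintegral_mono fun x => ?_) hS
    refine ENNReal.rpow_le_rpow ?_ (by norm_num)
    refine (enorm_integral_le_lintegral_enorm _).trans (lintegral_mono fun y => ?_)
    rw [enorm_mul, mul_comm]
    refine le_of_eq ?_
    congr 1
    rw [mollC, ← ofReal_norm, Complex.norm_real, Real.norm_of_nonneg (moll_nonneg hε _)]
  have h1 := key (hf.1.mk f) hf.1.stronglyMeasurable_mk.measurable
  have e1 : mo ε f = mo ε (hf.1.mk f) := by
    ext x; unfold mo
    refine integral_congr_ae ?_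
    filter_upwards [hf.1.ae_eq_mk] with t ht
    rw [ht]
  rw [e1]
  exact h1.trans_eq (eLpNorm_congr_ae hf.1.ae_eq_mk.symm)

lemma mo_sub {n : ℕ} {ε : ℝ} (hε : 0 < ε) {f g : Cn n → ℂ} (hf : LocallyIntegrable f (dVol n)) (hg : LocallyIntegrable g (dVol n)) :
    mo ε (f - g) = mo ε f - mo ε g := by
  ext x; simp only [mo, Pi.sub_apply, sub_mul]
  exact integral_sub (locint_mul hf (tm_cd ε x (m := 1)).continuous (tm_comp hε x)) (locint_mul hg (tm_cd ε x (m := 1)).continuous (tm_comp hε x))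

lemma mo_unif {n : ℕ} {ε : ℝ} (hε : 0 < ε) {g : Cn n → ℂ} (hg : Continuous g) {x : Cn n} {η : ℝ} (hη : 0 ≤ η)
    (h : ∀ y, ‖y - x‖ < ε → ‖g y - g x‖ ≤ η) : ‖mo ε g x - g x‖ ≤ η := by
  have := dist_convolution_le (μ := dVol n) (f := moll ε) (x₀ := x) (R := ε) (z₀ := g x) (g := g) hη
    (by
      intro y hy; by_contra h'
      exact hy (moll_zero hε (by simpa using h'))) (moll_nonneg hε) (moll_one hε) hg.aestronglyMeasurable
      (by intro y hy; rw [dist_eq_norm]; exact h y (by simpa [dist_eq_norm] using hy))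
  rw [dist_eq_norm] at this
  have e : mo ε g x = convolution (moll ε) g (ContinuousLinearMap.lsmul ℝ ℝ) (dVol n) x := by
    rw [mo_flip, convolution]
    simp [mollC, mul_comm]
  rw [e]; exact this

lemma mo_close {n : ℕ} {f : Cn n → ℂ} (hf : MemLp f 2 (dVol n)) {η : ℝ≥0∞} (hη : η ≠ 0) :
    ∃ ε₀ > 0, ∀ ε, 0 < ε → ε ≤ ε₀ → eLpNorm (mo ε f - f) 2 (dVol n) ≤ η := by
  have hη3 : η / 3 ≠ 0 := by simp [hη]
  obtain ⟨g, gc, hfg, gcont, gL⟩ := hf.exists_hasCompactSupport_eLpNorm_sub_le (by norm_num) hη3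
  -- big compact set
  set K := Metric.cthickening 1 (tsupport g) with hK
  have hKc : IsCompact K := gc.cthickening
  have hKm : dVol n K ≠ ⊤ := hKc.measure_lt_top.ne
  -- choose tolerance
  obtain ⟨τ, hτ0, hτ⟩ : ∃ τ : ℝ, 0 < τ ∧ (dVol n K)^((2:ℝ≥0∞).toReal⁻¹) * ENNReal.ofReal τ ≤ η/3 := by
    have h1 : Filter.Tendsto (fun τ : ℝ => (dVol n K)^((2:ℝ≥0∞).toReal⁻¹) * ENNReal.ofReal τ) (𝓝[>] 0) (𝓝 ((dVol n K)^((2:ℝ≥0∞).toReal⁻¹) * ENNReal.ofReal 0)) := by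
      refine ENNReal.Tendsto.const_mul ?_ (Or.inr (ENNReal.rpow_ne_top_of_nonneg (by norm_num) hKm))
      exact (ENNReal.tendsto_ofReal (Filter.tendsto_id)).mono_left nhdsWithin_le_nhds
    simp only [ENNReal.ofReal_zero, mul_zero] at h1
    have h2 := (h1.eventually (ge_mem_nhds (pos_iff_ne_zero.2 hη3))).and self_mem_nhdsWithin
    obtain ⟨τ, h3, h4⟩ := h2.exists
    exact ⟨τ, h4, h3⟩
  have huc : UniformContinuous g := gc.uniformContinuous_of_continuous gcont
  obtain ⟨r, hr0, hr⟩ := Metric.uniformContinuous_iff.1 huc τ hτ0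
  refine ⟨min r 1, by positivity, fun ε hε hε0 => ?_⟩
  have hgε : eLpNorm (mo ε g - g) 2 (dVol n) ≤ η/3 := by
    have hz : ∀ x ∉ K, (mo ε g - g) x = 0 := by
      intro x hx
      have h0 : g x = 0 := by
        by_contra h; exact hx (Metric.self_subset_cthickening _ (subset_tsupport _ h))
      have h1 : mo ε g x = 0 := by
        refine mo_zero hε fun t ht => ?_
        by_contra h
        apply hx
        refine Metric.mem_cthickening_of_dist_le x t 1 _ (subset_tsupport _ h) ?_
        rw [dist_eq_norm]; exact (ht.le.trans hε0).trans (min_le_right _ _)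
      simp [h0, h1]
    have hb : ∀ x, ‖(mo ε g - g) x‖ ≤ τ := fun x => mo_unif hε gcont hτ0.le fun y hy => by
      have := hr (a := y) (b := x) (by rw [dist_eq_norm]; exact hy.trans_le (hε0.trans (min_le_left _ _)))
      rw [dist_eq_norm] at this; exact this.le
    have e : mo ε g - g = K.indicator (mo ε g - g) := by
      symm; rw [Set.indicator_eq_self]; intro x hx; by_contra h; exact hx (hz x h)
    rw [e, eLpNorm_indicator_eq_eLpNorm_restrict hKc.measurableSet]
    refine (eLpNorm_le_of_ae_bound (C := τ) (ae_of_all _ hb)).trans ?_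
    simpa using hτ
  have hfl : LocallyIntegrable f (dVol n) := hf.locallyIntegrable (by norm_num)
  have hgl : LocallyIntegrable g (dVol n) := gcont.locallyIntegrable
  have m1 : AEStronglyMeasurable (mo ε f) (dVol n) := (mo_cd hε hfl (m := 1)).continuous.aestronglyMeasurable
  have m2 : AEStronglyMeasurable (mo ε g) (dVol n) := (mo_cd hε hgl (m := 1)).continuous.aestronglyMeasurable
  have e : mo ε f - f = (mo ε (f - g) + (mo ε g - g)) + (g - f) := by rw [mo_sub hε hfl hgl]; abel
  rw [e]
  calc _ ≤ _ := eLpNorm_add_le ((by rw [mo_sub hε hfl hgl]; exact m1.sub m2 : AEStronglyMeasurable (mo ε (f-g)) _).add (m2.sub gL.1)) (gL.1.sub hf.1) (by norm_num)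
    _ ≤ (η/3 + η/3) + η/3 := by
        gcongr
        · refine (eLpNorm_add_le (by rw [mo_sub hε hfl hgl]; exact m1.sub m2) (m2.sub gL.1) (by norm_num)).trans ?_
          gcongr
          exact (mo_L2 hε (hf.sub gL)).trans hfg
        · rw [eLpNorm_sub_comm]; exact hfg
    _ = η := ENNReal.add_thirds η

/-- the sequence of mollification radii -/
def eps (m : ℕ) : ℝ := 1/((m:ℝ)+1)
lemma eps_pos (m : ℕ) : 0 < eps m := by unfold eps; positivity
lemma eps_tendsto : Filter.Tendsto eps Filter.atTop (𝓝 0) := tendsto_one_div_add_atTop_nhds_zero_nat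

lemma mo_tendsto {n : ℕ} {f : Cn n → ℂ} (hf : MemLp f 2 (dVol n)) :
    Filter.Tendsto (fun m => eLpNorm (mo (eps m) f - f) 2 (dVol n)) Filter.atTop (𝓝 0) := by
  rw [ENNReal.tendsto_nhds_zero]
  intro η hη
  obtain ⟨ε₀, h0, h⟩ := mo_close hf hη.ne'
  filter_upwards [eps_tendsto.eventually (ge_mem_nhds h0)] with m hm
  exact h _ (eps_pos m) hm
end

section
open scoped ENNReal Topology

lemma sq_int {X : Type*} [MeasurableSpace X] {μ : Measure X} {f : X → ℂ} (hf : MemLp f 2 μ) :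
    ∫ x, ‖f x‖^2 ∂μ = (eLpNorm f 2 μ).toReal^2 := by
  rw [hf.eLpNorm_eq_integral_rpow_norm (by norm_num) (by norm_num)]
  have h0 : 0 ≤ ∫ x, ‖f x‖^2 ∂μ := integral_nonneg fun x => by positivity
  rw [ENNReal.toReal_ofReal (by positivity), ← Real.rpow_natCast, ← Real.rpow_mul (by simpa using h0)]
  simp

/-- L² convergence -/
def Cv {X : Type*} [MeasurableSpace X] (μ : Measure X) (f : ℕ → X → ℂ) (g : X → ℂ) : Prop :=
  (∀ m, MemLp (f m) 2 μ) ∧ MemLp g 2 μ ∧ Filter.Tendsto (fun m => eLpNorm (f m - g) 2 μ) Filter.atTop (𝓝 0)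

lemma Cv.add {X : Type*} [MeasurableSpace X] {μ : Measure X} {f f' : ℕ → X → ℂ} {g g' : X → ℂ} (h : Cv μ f g) (h' : Cv μ f' g') :
    Cv μ (fun m x => f m x + f' m x) (fun x => g x + g' x) := by
  refine ⟨fun m => (h.1 m).add (h'.1 m), h.2.1.add h'.2.1, ?_⟩
  refine tendsto_of_tendsto_of_tendsto_of_le_of_le tendsto_const_nhds (by simpa using h.2.2.add h'.2.2) (fun _ => bot_le) fun m => ?_
  have : (fun x => f m x + f' m x) - (fun x => g x + g' x) = (f m - g) + (f' m - g') := by ext x; simp; ring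
  show eLpNorm ((fun x => f m x + f' m x) - (fun x => g x + g' x)) 2 μ ≤ _
  rw [this]
  exact eLpNorm_add_le ((h.1 m).1.sub h.2.1.1) ((h'.1 m).1.sub h'.2.1.1) (by norm_num)

lemma Cv.sum {X ι : Type*} [MeasurableSpace X] {μ : Measure X} (s : Finset ι) {f : ι → ℕ → X → ℂ} {g : ι → X → ℂ} (h : ∀ i, Cv μ (f i) (g i)) :
    Cv μ (fun m x => ∑ i ∈ s, f i m x) (fun x => ∑ i ∈ s, g i x) := by
  classical
  induction s using Finset.induction_on with
  | empty => refine ⟨fun m => by simp, by simp, ?_⟩; simp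
  | insert a s ha ih => simp_rw [Finset.sum_insert ha]; exact (h a).add ih

lemma Cv.mul {X : Type*} [MeasurableSpace X] {μ : Measure X} {f : ℕ → X → ℂ} {g : X → ℂ} (h : Cv μ f g) {a : X → ℂ}
    (ha : AEStronglyMeasurable a μ) {C : ℝ} (hC : ∀ᵐ x ∂μ, ‖a x‖ ≤ C) : Cv μ (fun m x => a x * f m x) (fun x => a x * g x) := by
  have hb : ∀ u : X → ℂ, MemLp u 2 μ → MemLp (fun x => a x * u x) 2 μ ∧ eLpNorm (fun x => a x * u x) 2 μ ≤ ENNReal.ofReal C * eLpNorm u 2 μ := by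
    intro u hu
    have h2 : ∀ᵐ x ∂μ, ‖a x * u x‖ ≤ C * ‖u x‖ := by
      filter_upwards [hC] with x hx; rw [norm_mul]; gcongr
    exact ⟨hu.of_le_mul (c := C) (ha.mul hu.1) h2, eLpNorm_le_mul_eLpNorm_of_ae_le_mul h2 2⟩
  refine ⟨fun m => (hb _ (h.1 m)).1, (hb _ h.2.1).1, ?_⟩
  have h3 : Filter.Tendsto (fun m => ENNReal.ofReal C * eLpNorm (f m - g) 2 μ) Filter.atTop (𝓝 0) := by
    simpa using ENNReal.Tendsto.const_mul h.2.2 (Or.inr ENNReal.ofReal_ne_top)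
  refine tendsto_of_tendsto_of_tendsto_of_le_of_le tendsto_const_nhds h3 (fun _ => bot_le) fun m => ?_
  have : (fun x => a x * f m x) - (fun x => a x * g x) = fun x => a x * (f m - g) x := by ext x; simp; ring
  show eLpNorm ((fun x => a x * f m x) - (fun x => a x * g x)) 2 μ ≤ _
  rw [this]
  exact (hb _ ((h.1 m).sub h.2.1)).2

lemma Cv.sq {X : Type*} [MeasurableSpace X] {μ : Measure X} {f : ℕ → X → ℂ} {g : X → ℂ} (h : Cv μ f g) :
    Filter.Tendsto (fun m => ∫ x, ‖f m x‖^2 ∂μ) Filter.atTop (𝓝 (∫ x, ‖g x‖^2 ∂μ)) := by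
  simp_rw [fun m => sq_int (h.1 m), sq_int h.2.1]
  refine Filter.Tendsto.pow ?_ 2
  have h1 : Filter.Tendsto (fun m => (h.1 m).toLp) Filter.atTop (𝓝 h.2.1.toLp) := (Lp.tendsto_Lp_iff_tendsto_eLpNorm'' _ _ _ _).2 h.2.2
  have := h1.norm
  simpa [Lp.norm_toLp] using this

lemma Cv_mo {n : ℕ} {K : Set (Cn n)} {f : Cn n → ℂ} (hf : MemLp f 2 (dVol n)) : Cv ((dVol n).restrict K) (fun m => mo (eps m) f) f := by
  have hl : LocallyIntegrable f (dVol n) := hf.locallyIntegrable (by norm_num)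
  refine ⟨fun m => MemLp.restrict _ ⟨(mo_cd (eps_pos m) hl (m := 1)).continuous.aestronglyMeasurable, (mo_L2 (eps_pos m) hf).trans_lt hf.2⟩, hf.restrict _, ?_⟩
  refine tendsto_of_tendsto_of_tendsto_of_le_of_le tendsto_const_nhds (mo_tendsto hf) (fun _ => bot_le) fun m => ?_
  exact eLpNorm_mono_measure _ Measure.restrict_le_self

lemma toLp_sq {n : ℕ} (v : Fin n → ℂ) : ‖(WithLp.toLp 2 v : Cn n)‖^2 = ∑ j, ‖v j‖^2 := by
  rw [EuclideanSpace.norm_sq_eq]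

lemma levi_cont {n : ℕ} {φ : Cn n → ℝ} {D : Set (Cn n)} (hD : IsOpen D) (hφ : ContDiffOn ℝ 2 φ D) {b : Fin n → Cn n → ℂ}
    (hb : ∀ j, Continuous (b j)) : ContinuousOn (fun x => leviForm φ x (WithLp.toLp 2 (fun j => b j x))) D := by
  unfold leviForm
  refine Complex.continuous_re.comp_continuousOn ?_
  refine continuousOn_finsetSum _ fun j _ => continuousOn_finsetSum _ fun k _ => ?_
  have h1 : ContDiffOn ℝ 1 (fun x => wderiv (realToC φ) x j) D := wderiv_cd hD (m := 1) (realToC_cd (m := 2) hφ) j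
  have h2 : ContinuousOn (fun x => wderivBar (fun v => wderiv (realToC φ) v j) x k) D := (wderivBar_cd hD (m := 0) (by simpa using h1) k).continuousOn
  have h3 : Continuous (fun x => conj (b k x)) := Complex.continuous_conj.comp (hb k)
  exact (h2.mul (hb j).continuousOn).mul h3.continuousOn

lemma BI_L2 {n : ℕ} {φ lam : Cn n → ℝ} {D K : Set (Cn n)} (hD : IsOpen D) (hφ : ContDiffOn ℝ 2 φ D) (hl : ContinuousOn lam D)
    (hl0 : ∀ x ∈ D, 0 ≤ lam x) (hlev : ∀ x ∈ D, ∀ ξ, lam x * ‖ξ‖^2 ≤ leviForm φ x ξ) (hK : IsCompact K) (hKD : K ⊆ D)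
    {b : Fin n → Cn n → ℂ} {Q : Cn n → ℂ} {R : Fin n → Fin n → Cn n → ℂ} (hb : ∀ j, MemLp (b j) 2 (dVol n)) (hbK : ∀ j, ∀ x ∉ K, b j x = 0)
    (hQ : MemLp Q 2 (dVol n)) (hQK : ∀ x ∉ K, Q x = 0)
    (hR : ∀ j k, MemLp (R j k) 2 (dVol n)) (hRK : ∀ j k, ∀ x ∉ K, R j k x = 0)
    (hQw : ∀ w : Cn n → ℂ, ContDiff ℝ 2 w → HasCompactSupport w → ∫ x, Q x * w x ∂(dVol n) = ∑ j, ∫ x, b j x * wderiv w x j ∂(dVol n))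
    (hRw : ∀ w : Cn n → ℂ, ContDiff ℝ 2 w → HasCompactSupport w → ∀ j k, ∫ x, R j k x * w x ∂(dVol n) =
      - (∫ x, b k x * wderivBar w x j ∂(dVol n) - ∫ x, b j x * wderivBar w x k ∂(dVol n))) :
    ∫ x, Real.exp (-φ x) * (lam x * ∑ j, ‖b j x‖^2) ∂(dVol n) ≤
      ∫ x, Real.exp (-φ x) * ‖Q x + ∑ j, wderiv (realToC φ) x j * b j x‖^2 ∂(dVol n)
      + (1/2) * ∑ j, ∑ k, ∫ x, Real.exp (-φ x) * ‖R j k x‖^2 ∂(dVol n) := by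
  obtain ⟨r, hr0, hrD⟩ := hK.exists_cthickening_subset_open hD hKD
  set K' := Metric.cthickening r K with hK'
  have hKK' : K ⊆ K' := Metric.self_subset_cthickening _
  have hKc : IsCompact K' := hK.cthickening
  have hz : ∀ ε, 0 < ε → ε ≤ r → ∀ f : Cn n → ℂ, (∀ x ∉ K, f x = 0) → ∀ x ∉ K', mo ε f x = 0 := by
    intro ε hε her f hf x hx
    refine mo_zero hε fun t ht => ?_
    by_contra h
    apply hx
    refine Metric.mem_cthickening_of_dist_le x t r _ (by by_contra h'; exact h (hf t h')) ?_
    rw [dist_eq_norm]; exact ht.le.trans her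
  have hlb : ∀ j, LocallyIntegrable (b j) (dVol n) := fun j => (hb j).locallyIntegrable (by norm_num)
  have hlQ : LocallyIntegrable Q (dVol n) := hQ.locallyIntegrable (by norm_num)
  -- restriction to K'
  have hres : ∀ f : Cn n → ℝ, (∀ x ∉ K', f x = 0) → ∫ x, f x ∂(dVol n) = ∫ x in K', f x ∂(dVol n) := by
    intro f hf; exact (setIntegral_eq_integral_of_forall_compl_eq_zero hf).symm
  have hφc : ContinuousOn φ K' := hφ.continuousOn.mono hrD
  have hlc : ContinuousOn lam K' := hl.mono hrD
  -- half weights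
  set h : Cn n → ℂ := fun x => (Real.exp (-φ x / 2) : ℂ) with hh
  have hhc : ContinuousOn h K' := Complex.continuous_ofReal.comp_continuousOn (Real.continuous_exp.comp_continuousOn (hφc.neg.div_const 2))
  have hhn : ∀ x (v : ℂ), Real.exp (-φ x) * ‖v‖^2 = ‖h x * v‖^2 := by
    intro x v
    rw [norm_mul, mul_pow, hh]
    simp only [Complex.norm_real, Real.norm_eq_abs, Real.abs_exp]
    rw [← Real.exp_nat_mul]; congr 2; push_cast; ring
  set sl : Cn n → ℂ := fun x => (Real.sqrt (lam x) : ℂ) with hsl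
  have hslc : ContinuousOn sl K' := Complex.continuous_ofReal.comp_continuousOn (Real.continuous_sqrt.comp_continuousOn hlc)
  have hsln : ∀ x ∈ K', ∀ (v : ℂ), lam x * ‖v‖^2 = ‖sl x * v‖^2 := by
    intro x hx v
    rw [norm_mul, mul_pow, hsl]
    simp only [Complex.norm_real, Real.norm_eq_abs, sq_abs]
    rw [Real.sq_sqrt (hl0 x (hrD hx))]
  have hmul : ∀ {f : ℕ → Cn n → ℂ} {g a : Cn n → ℂ}, Cv ((dVol n).restrict K') f g → ContinuousOn a K' →
      Cv ((dVol n).restrict K') (fun m x => a x * f m x) (fun x => a x * g x) := by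
    intro f g a hfg ha
    obtain ⟨C, hC⟩ := hKc.exists_bound_of_continuousOn ha
    exact hfg.mul (ha.aestronglyMeasurable hKc.measurableSet) ((ae_restrict_iff' hKc.measurableSet).2 (ae_of_all _ fun x hx => hC x hx))
  have hφj : ∀ j, ContinuousOn (fun x => wderiv (realToC φ) x j) K' := fun j =>
    (wderiv_cd hD (m := 1) (realToC_cd (m := 2) hφ) j).continuousOn.mono hrD
  -- inequality for each m
  have hm : ∀ ε, 0 < ε → ε ≤ r → ∑ j, ∫ x in K', ‖h x * (sl x * mo ε (b j) x)‖^2 ∂(dVol n) ≤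
      ∫ x in K', ‖h x * (mo ε Q x + ∑ j, wderiv (realToC φ) x j * mo ε (b j) x)‖^2 ∂(dVol n) +
      (1/2) * ∑ j, ∑ k, ∫ x in K', ‖h x * mo ε (R j k) x‖^2 ∂(dVol n) := by
    intro ε hε her
    have hts : ∀ j, tsupport (mo ε (b j)) ⊆ K' := fun j => closure_minimal (by
      intro x hx; by_contra h'; exact hx (hz ε hε her (b j) (hbK j) x h')) hKc.isClosed
    have hcs : ∀ j, HasCompactSupport (mo ε (b j)) := fun j => hKc.of_isClosed_subset (isClosed_tsupport _) (hts j)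
    have hcd : ∀ j, ContDiff ℝ 2 (mo ε (b j)) := fun j => mo_cd hε (hlb j) (m := 2)
    have hBI := BI hD hφ (b := fun j => mo ε (b j)) hcd hcs (fun j => (hts j).trans hrD)
    have eQ : ∀ x, ∑ j, del φ j (mo ε (b j)) x = mo ε Q x + ∑ j, wderiv (realToC φ) x j * mo ε (b j) x := by
      intro x
      simp only [del, Finset.sum_add_distrib, mo_wderiv hε (hlb _), neg_neg]
      congr 1
      exact (hQw (tm ε x) (tm_cd ε x (m := 2)) (tm_comp hε x)).symm
    have eR : ∀ x j k, wderivBar (mo ε (b k)) x j - wderivBar (mo ε (b j)) x k = mo ε (R j k) x := by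
      intro x j k
      rw [mo_wderivBar hε (hlb _), mo_wderivBar hε (hlb _)]
      have := hRw (tm ε x) (tm_cd ε x (m := 2)) (tm_comp hε x) j k
      rw [show mo ε (R j k) x = ∫ t, R j k t * tm ε x t ∂(dVol n) from rfl, this]; ring
    simp_rw [eQ, eR, hhn] at hBI
    rw [hres _ (fun x hx => by simp [leviForm, fun j => hz ε hε her (b j) (hbK j) x hx]),
      hres _ (fun x hx => by simp [hz ε hε her Q hQK x hx, fun j => hz ε hε her (b j) (hbK j) x hx])] at hBI
    simp_rw [fun j k => hres (fun x => ‖h x * mo ε (R j k) x‖^2) (fun x hx => by simp [hz ε hε her (R j k) (hRK j k) x hx])] at hBI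
    refine le_trans ?_ hBI
    have hi : ∀ j, IntegrableOn (fun x => ‖h x * (sl x * mo ε (b j) x)‖^2) K' (dVol n) := fun j =>
      ContinuousOn.integrableOn_compact hKc (((hhc.mul (hslc.mul (hcd j).continuous.continuousOn)).norm.pow 2))
    rw [← integral_finsetSum _ (fun j _ => hi j)]
    refine setIntegral_mono_on (integrable_finsetSum _ fun j _ => hi j)
      (ContinuousOn.integrableOn_compact hKc ?_) hKc.measurableSet ?_
    · exact (Real.continuous_exp.comp_continuousOn hφc.neg).mul ((levi_cont hD hφ (fun j => (hcd j).continuous)).mono hrD)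
    · intro x hx
      simp_rw [← hhn, ← Finset.mul_sum, ← hsln x hx, ← Finset.mul_sum]
      refine mul_le_mul_of_nonneg_left ?_ (Real.exp_pos _).le
      have := hlev x (hrD hx) (WithLp.toLp 2 (fun j => mo ε (b j) x))
      rwa [toLp_sq] at this
  -- limits
  have L1 : Filter.Tendsto (fun m => ∑ j, ∫ x in K', ‖h x * (sl x * mo (eps m) (b j) x)‖^2 ∂(dVol n)) Filter.atTop
      (𝓝 (∑ j, ∫ x in K', ‖h x * (sl x * b j x)‖^2 ∂(dVol n))) :=
    tendsto_finsetSum _ fun j _ => (hmul (hmul (Cv_mo (hb j)) hslc) hhc).sq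
  have L2 : Filter.Tendsto (fun m => ∫ x in K', ‖h x * (mo (eps m) Q x + ∑ j, wderiv (realToC φ) x j * mo (eps m) (b j) x)‖^2 ∂(dVol n)) Filter.atTop
      (𝓝 (∫ x in K', ‖h x * (Q x + ∑ j, wderiv (realToC φ) x j * b j x)‖^2 ∂(dVol n))) :=
    (hmul ((Cv_mo hQ).add (Cv.sum _ fun j => hmul (Cv_mo (hb j)) (hφj j))) hhc).sq
  have L3 : Filter.Tendsto (fun m => ∑ j, ∑ k, ∫ x in K', ‖h x * mo (eps m) (R j k) x‖^2 ∂(dVol n)) Filter.atTop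
      (𝓝 (∑ j, ∑ k, ∫ x in K', ‖h x * R j k x‖^2 ∂(dVol n))) :=
    tendsto_finsetSum _ fun j _ => tendsto_finsetSum _ fun k _ => (hmul (Cv_mo (hR j k)) hhc).sq
  have hfin := le_of_tendsto_of_tendsto L1 (L2.add (L3.const_mul (1/2))) (by
    filter_upwards [eps_tendsto.eventually (ge_mem_nhds hr0)] with m hmr
    exact hm _ (eps_pos m) hmr)
  have hbz : ∀ j, ∀ x ∉ K', b j x = 0 := fun j x hx => hbK j x (fun h => hx (hKK' h))
  have hQz : ∀ x ∉ K', Q x = 0 := fun x hx => hQK x (fun h => hx (hKK' h))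
  have hRz : ∀ j k, ∀ x ∉ K', R j k x = 0 := fun j k x hx => hRK j k x (fun h => hx (hKK' h))
  simp_rw [hhn]
  rw [hres _ (fun x hx => by simp [hbz _ x hx]), hres _ (fun x hx => by simp [hbz _ x hx, hQz x hx])]
  simp_rw [fun j k => hres (fun x => ‖h x * R j k x‖^2) (fun x hx => by simp [hRz j k x hx])]
  refine le_of_eq_of_le ?_ hfin
  rw [← integral_finsetSum _ (fun j _ => ?_)]
  · refine setIntegral_congr_fun hKc.measurableSet fun x hx => ?_
    simp_rw [← hhn, ← Finset.mul_sum, ← hsln x hx, ← Finset.mul_sum]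
  · have := (hmul (hmul (Cv_mo (hb j) (K := K')) hslc) hhc).2.1
    exact (memLp_two_iff_integrable_sq_norm this.1).1 this
end

section
open scoped ENNReal Topology

lemma memLp_toLp {n : ℕ} {X : Type*} [MeasurableSpace X] {μ : Measure X} {f : Fin n → X → ℂ} (hf : ∀ j, MemLp (f j) 2 μ) :
    MemLp (fun x => (WithLp.toLp 2 (fun j => f j x) : Cn n)) 2 μ := by
  have h : (fun x => (WithLp.toLp 2 (fun j => f j x) : Cn n)) = fun x => ∑ j, f j x • (EuclideanSpace.single j (1:ℂ)) := by
    ext x i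
    simp only [WithLp.ofLp_sum, Finset.sum_apply, PiLp.smul_apply, PiLp.single_apply, smul_eq_mul]
    simp
  rw [h]
  refine memLp_finsetSum _ fun j _ => ?_
  refine (hf j).of_le_mul (c := 1) ((hf j).1.smul_const _) (ae_of_all _ fun x => ?_)
  rw [norm_smul]; simp

lemma memLp_coord {n : ℕ} {X : Type*} [MeasurableSpace X] {μ : Measure X} {f : X → Cn n} (hf : MemLp f 2 μ) (j : Fin n) :
    MemLp (fun x => f x j) 2 μ := by
  refine hf.of_le_mul (c := 1) ?_ (ae_of_all _ fun x => ?_)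
  · exact (EuclideanSpace.proj j : Cn n →L[ℂ] ℂ).continuous.comp_aestronglyMeasurable hf.1
  · rw [one_mul]; exact PiLp.norm_apply_le _ _

lemma inner_toLp {n : ℕ} {X : Type*} [MeasurableSpace X] {μ : Measure X} {f g : X → Cn n} (hf : MemLp f 2 μ) (hg : MemLp g 2 μ) :
    inner ℂ hf.toLp hg.toLp = ∫ x, ∑ j, conj (f x j) * g x j ∂μ := by
  rw [L2.inner_def]
  refine integral_congr_ae ?_
  filter_upwards [hf.coeFn_toLp, hg.coeFn_toLp] with x h1 h2
  rw [h1, h2, PiLp.inner_apply]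
  simp [mul_comm]

/-- test functions -/
def TF {n : ℕ} (D : Set (Cn n)) (w : Cn n → ℂ) : Prop := ContDiff ℝ 2 w ∧ HasCompactSupport w ∧ tsupport w ⊆ D

lemma memLp_cs {n : ℕ} {D : Set (Cn n)} (hD : IsOpen D) {f g : Cn n → ℂ} (hf : ContinuousOn f D) (hg : Continuous g)
   (hgc : HasCompactSupport g) (hs : tsupport g ⊆ D) : MemLp (fun x => f x * g x) 2 (dVol n) :=
  (cont_mul hD hf hg hs).memLp_of_hasCompactSupport (HasCompactSupport.mul_left hgc)

lemma proj_exists {n : ℕ} {D : Set (Cn n)} (hD : IsOpen D) {φ : Cn n → ℝ} (hφ : ContinuousOn φ D)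
    {γ : Fin n → Cn n → ℂ} (hγ : ∀ j, Continuous (γ j)) (hγc : ∀ j, HasCompactSupport (γ j)) (hγs : ∀ j, tsupport (γ j) ⊆ D) :
    ∃ β : Fin n → Cn n → ℂ, (∀ j, MemLp (fun x => (Real.exp (-φ x / 2) : ℂ) * β j x) 2 ((dVol n).restrict D)) ∧
      (∀ W, TF D W → ∀ j k, ∫ x in D, β j x * wderivBar W x k - β k x * wderivBar W x j ∂(dVol n) = 0) ∧
      (∀ α : Fin n → Cn n → ℂ, (∀ j, MemLp (fun x => (Real.exp (-φ x / 2) : ℂ) * α j x) 2 ((dVol n).restrict D)) →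
        (∀ W, TF D W → ∀ j k, ∫ x in D, α j x * wderivBar W x k - α k x * wderivBar W x j ∂(dVol n) = 0) →
        ∫ x in D, ∑ j, (Real.exp (-φ x / 2) : ℂ) * α j x * conj ((Real.exp (-φ x / 2) : ℂ) * β j x) ∂(dVol n) =
          ∫ x in D, ∑ j, α j x * conj (γ j x) ∂(dVol n)) := by
  set μ := (dVol n).restrict D with hμ
  have hc : ContinuousOn (fun x => (Real.exp (φ x / 2) : ℂ)) D :=
    Complex.continuous_ofReal.comp_continuousOn (Real.continuous_exp.comp_continuousOn (hφ.div_const 2))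
  have hgL : ∀ j, MemLp (fun x => (Real.exp (φ x / 2) : ℂ) * γ j x) 2 μ := fun j => (memLp_cs hD hc (hγ j) (hγc j) (hγs j)).restrict _
  have hwL : ∀ W, TF D W → ∀ k, MemLp (fun x => (Real.exp (φ x / 2) : ℂ) * conj (wderivBar W x k)) 2 μ := by
    intro W hW k
    have h1 : Continuous (fun x => conj (wderivBar W x k)) :=
      Complex.continuous_conj.comp (wderivBar_C (m := 1) (by simpa [one_add_one_eq_two] using hW.1) k).continuous
    have h2 : tsupport (fun x => conj (wderivBar W x k)) ⊆ tsupport W := by rw [conj_supp]; exact wderivBar_supp k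
    exact (memLp_cs hD hc h1 (hW.2.1.of_isClosed_subset (isClosed_tsupport _) h2) (h2.trans hW.2.2)).restrict _
  -- the vector fields
  set sv : (Cn n → ℂ) → Fin n → Fin n → Fin n → Cn n → ℂ := fun W j k i x =>
    (if i = j then (Real.exp (φ x / 2) : ℂ) * conj (wderivBar W x k) else 0) - (if i = k then (Real.exp (φ x / 2) : ℂ) * conj (wderivBar W x j) else 0) with hsv
  have hsvL : ∀ W, TF D W → ∀ j k i, MemLp (sv W j k i) 2 μ := by
    intro W hW j k i
    refine MemLp.sub ?_ ?_
    · split_ifs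
      · exact hwL W hW k
      · simp
    · split_ifs
      · exact hwL W hW j
      · simp
  set S : Set (Lp (Cn n) 2 μ) := {s | ∃ (W : Cn n → ℂ) (hW : TF D W) (j k : Fin n), s = (memLp_toLp (hsvL W hW j k)).toLp} with hS
  set N := (Submodule.span ℂ S)ᗮ with hN
  have expc : ∀ x, (Real.exp (φ x / 2) : ℂ) * (Real.exp (-φ x / 2) : ℂ) = 1 := by
    intro x; rw [← Complex.ofReal_mul, ← Real.exp_add]; simp [neg_div]
  -- membership criterion
  have hmem : ∀ (a : Fin n → Cn n → ℂ) (ha : ∀ j, MemLp (fun x => (Real.exp (-φ x / 2) : ℂ) * a j x) 2 μ),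
      (memLp_toLp ha).toLp ∈ N ↔ (∀ W, TF D W → ∀ j k, ∫ x in D, a j x * wderivBar W x k - a k x * wderivBar W x j ∂(dVol n) = 0) := by
    intro a ha
    have hin : ∀ W (hW : TF D W) j k, inner ℂ (memLp_toLp (hsvL W hW j k)).toLp (memLp_toLp ha).toLp = ∫ x in D, a j x * wderivBar W x k - a k x * wderivBar W x j ∂(dVol n) := by
      intro W hW j k
      rw [inner_toLp]
      refine integral_congr_ae (ae_of_all _ fun x => ?_)
      simp only [hsv, map_sub, sub_mul, Finset.sum_sub_distrib, apply_ite conj, map_mul, Complex.conj_conj, map_zero, ite_mul, zero_mul,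
        Finset.sum_ite_eq', Finset.mem_univ, if_true, Complex.conj_ofReal]
      linear_combination (a j x * wderivBar W x k - a k x * wderivBar W x j) * expc x
    constructor
    · intro h W hW j k
      rw [← hin W hW]
      exact (Submodule.mem_orthogonal _ _).1 h _ (Submodule.subset_span ⟨W, hW, j, k, rfl⟩)
    · intro h
      rw [hN, Submodule.mem_orthogonal]
      intro u hu
      induction hu using Submodule.span_induction with
      | mem u hu => obtain ⟨W, hW, j, k, rfl⟩ := hu; rw [hin W hW]; exact h W hW j k
      | zero => simp
      | add u v _ _ h1 h2 => rw [inner_add_left, h1, h2, add_zero]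
      | smul c u _ h1 => rw [inner_smul_left, h1, mul_zero]
  set b0 := (memLp_toLp hgL).toLp with hb0
  obtain ⟨B, hBN, hBp⟩ : ∃ B ∈ N, b0 - B ∈ Nᗮ := by
    haveI : N.HasOrthogonalProjection := by rw [hN]; infer_instance
    exact ⟨N.starProjection b0, Submodule.starProjection_apply_mem _ _, Submodule.sub_starProjection_mem_orthogonal (K := N) b0⟩
  have hBm : MemLp B 2 μ := Lp.memLp B
  set β : Fin n → Cn n → ℂ := fun j x => (Real.exp (φ x / 2) : ℂ) * B x j with hβ
  have eβ : ∀ j x, (Real.exp (-φ x / 2) : ℂ) * β j x = B x j := by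
    intro j x; rw [hβ]; linear_combination B x j * expc x
  have hβL : ∀ j, MemLp (fun x => (Real.exp (-φ x / 2) : ℂ) * β j x) 2 μ := by
    intro j; simp_rw [eβ]; exact memLp_coord hBm j
  have eB : (memLp_toLp hβL).toLp = B := by
    conv_rhs => rw [← Lp.toLp_coeFn B (Lp.memLp B)]
    refine MemLp.toLp_congr _ _ (ae_of_all _ fun x => ?_)
    simp only [eβ]
  refine ⟨β, hβL, ?_, ?_⟩
  · rw [← hmem β hβL, eB]; exact hBN
  · intro α hα hαN
    have hα1 := (hmem α hα).2 hαN
    have h1 : inner ℂ B (memLp_toLp hα).toLp = inner ℂ b0 (memLp_toLp hα).toLp := by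
      have : inner ℂ (b0 - B) (memLp_toLp hα).toLp = 0 :=
        (Submodule.mem_orthogonal' _ _).1 hBp _ hα1
      rw [inner_sub_left] at this
      exact (sub_eq_zero.1 this).symm
    rw [← eB, hb0, inner_toLp, inner_toLp] at h1
    convert h1 using 3 with x x
    · refine Finset.sum_congr rfl fun j _ => ?_
      simp only; ring
    · refine Finset.sum_congr rfl fun j _ => ?_
      simp only [map_mul, Complex.conj_ofReal]
      linear_combination (-α j x * conj (γ j x)) * expc x
end

section
open scoped ENNReal Topology

lemma TF.conj' {n : ℕ} {D : Set (Cn n)} {W : Cn n → ℂ} (h : TF D W) : TF D (fun x => conj (W x)) := by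
  refine ⟨conj_cd (m := 2) h.1, ?_, ?_⟩
  · exact h.2.1.of_isClosed_subset (isClosed_tsupport _) (by rw [conj_supp])
  · rw [conj_supp]; exact h.2.2

lemma TF.cd1 {n : ℕ} {D : Set (Cn n)} {W : Cn n → ℂ} (h : TF D W) : ContDiff ℝ 1 W := h.1.of_le (by norm_num)
lemma TF.diff {n : ℕ} {D : Set (Cn n)} {W : Cn n → ℂ} (h : TF D W) (x : Cn n) : DifferentiableAt ℝ W x := h.1.differentiable (by norm_num) x
lemma TF.w1 {n : ℕ} {D : Set (Cn n)} {W : Cn n → ℂ} (h : TF D W) (j : Fin n) : ContDiff ℝ 1 (fun x => wderiv W x j) :=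
  wderiv_C (m := 1) (by simpa [one_add_one_eq_two] using h.1) j
lemma TF.wb1 {n : ℕ} {D : Set (Cn n)} {W : Cn n → ℂ} (h : TF D W) (j : Fin n) : ContDiff ℝ 1 (fun x => wderivBar W x j) :=
  wderivBar_C (m := 1) (by simpa [one_add_one_eq_two] using h.1) j
lemma TF.wz {n : ℕ} {D : Set (Cn n)} {W : Cn n → ℂ} (h : TF D W) (j : Fin n) {x : Cn n} (hx : x ∉ D) : wderiv W x j = 0 := by
  by_contra h'; exact hx (h.2.2 (wderiv_supp j (subset_tsupport _ h')))
lemma TF.wbz {n : ℕ} {D : Set (Cn n)} {W : Cn n → ℂ} (h : TF D W) (j : Fin n) {x : Cn n} (hx : x ∉ D) : wderivBar W x j = 0 := by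
  by_contra h'; exact hx (h.2.2 (wderivBar_supp j (subset_tsupport _ h')))

/-- second derivatives commute: exact forms are closed -/
lemma closed_of_exact {n : ℕ} {D : Set (Cn n)} (hD : IsOpen D) {v W : Cn n → ℂ} (hv : ContDiffOn ℝ 2 v D) (hW : TF D W) (j k : Fin n) :
    ∫ x in D, wderivBar v x j * wderivBar W x k - wderivBar v x k * wderivBar W x j ∂(dVol n) = 0 := by
  have hd : ∀ j, ContDiffOn ℝ 1 (fun x => wderivBar v x j) D := fun j => wderivBar_cd hD (m := 1) (by simpa [one_add_one_eq_two] using hv) j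
  have hI : ∀ j k, Integrable (fun x => wderivBar v x j * wderivBar W x k) (dVol n) := fun j k =>
    int_mul hD (hd j).continuousOn (hW.wb1 k).continuous (hW.2.1.of_isClosed_subset (isClosed_tsupport _) (wderivBar_supp k)) ((wderivBar_supp k).trans hW.2.2)
  rw [setIntegral_eq_integral_of_forall_compl_eq_zero (fun x hx => by simp [hW.wbz _ hx]), integral_sub (hI j k) (hI k j),
    ibpBar hD (hd j) hW.cd1 hW.2.1 hW.2.2, ibpBar hD (hd k) hW.cd1 hW.2.1 hW.2.2, sub_eq_zero]
  congr 1
  refine integral_congr_ae (ae_of_all _ fun x => ?_)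
  by_cases hx : x ∈ D
  · have := wderivBar_comm hD hv hx j k
    simp only [this]
  · have : W x = 0 := by by_contra h; exact hx (hW.2.2 (subset_tsupport _ h))
    simp [this]

lemma pt_alg {n : ℕ} (k β : Fin n → ℂ) (a : ℂ) :
    ‖a - ∑ j, k j * β j‖^2 + (1/2) * ∑ j, ∑ l, ‖conj (k j) * β l - conj (k l) * β j‖^2 ≤
      2 * ‖a‖^2 + 4 * ((∑ j, ‖k j‖^2) * ∑ j, ‖β j‖^2) := by
  have h1 : ‖∑ j, k j * β j‖^2 ≤ (∑ j, ‖k j‖^2) * ∑ j, ‖β j‖^2 := by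
    calc _ ≤ (∑ j, ‖k j‖ * ‖β j‖)^2 := by
          gcongr; exact (norm_sum_le _ _).trans (Finset.sum_le_sum fun j _ => (norm_mul _ _).le)
      _ ≤ _ := Finset.sum_mul_sq_le_sq_mul_sq _ _ _
  have h2 : ‖a - ∑ j, k j * β j‖^2 ≤ 2 * ‖a‖^2 + 2 * ‖∑ j, k j * β j‖^2 := by
    have := norm_sub_le a (∑ j, k j * β j)
    nlinarith [sq_nonneg (‖a‖ - ‖∑ j, k j * β j‖), norm_nonneg (a - ∑ j, k j * β j)]
  have h3 : ∑ j, ∑ l, ‖conj (k j) * β l - conj (k l) * β j‖^2 ≤ ∑ j, ∑ l, (2 * (‖k j‖^2 * ‖β l‖^2) + 2 * (‖k l‖^2 * ‖β j‖^2)) := by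
    refine Finset.sum_le_sum fun j _ => Finset.sum_le_sum fun l _ => ?_
    have := norm_sub_le (conj (k j) * β l) (conj (k l) * β j)
    simp only [norm_mul, RCLike.norm_conj] at this
    nlinarith [sq_nonneg (‖k j‖ * ‖β l‖ - ‖k l‖ * ‖β j‖), norm_nonneg (conj (k j) * β l - conj (k l) * β j)]
  have h4 : ∑ j, ∑ l, (2 * (‖k j‖^2 * ‖β l‖^2) + 2 * (‖k l‖^2 * ‖β j‖^2)) = 4 * ((∑ j, ‖k j‖^2) * ∑ j, ‖β j‖^2) := by
    have e1 : ∑ j, ∑ l, (‖k j‖^2 * ‖β l‖^2) = (∑ j, ‖k j‖^2) * ∑ j, ‖β j‖^2 := by rw [Finset.sum_mul_sum]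
    have e2 : ∑ j, ∑ l, (‖k l‖^2 * ‖β j‖^2) = (∑ j, ‖k j‖^2) * ∑ j, ‖β j‖^2 := by rw [Finset.sum_comm, e1]
    have e3 : ∑ j, ∑ l, (2 * (‖k j‖^2 * ‖β l‖^2) + 2 * (‖k l‖^2 * ‖β j‖^2)) = 2 * ∑ j, ∑ l, (‖k j‖^2 * ‖β l‖^2) + 2 * ∑ j, ∑ l, (‖k l‖^2 * ‖β j‖^2) := by
      rw [Finset.mul_sum, Finset.mul_sum, ← Finset.sum_add_distrib]
      refine Finset.sum_congr rfl fun j _ => ?_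
      rw [Finset.mul_sum, Finset.mul_sum, ← Finset.sum_add_distrib]
    rw [e3, e1, e2]; ring
  linarith

/-- the adjoint relation for the projected field -/
lemma adj_proj {n : ℕ} {D : Set (Cn n)} (hD : IsOpen D) {φ : Cn n → ℝ} (hφ : ContinuousOn φ D) {γ β : Fin n → Cn n → ℂ} (hγ : ∀ j, TF D (γ j))
    (h3 : ∀ α : Fin n → Cn n → ℂ, (∀ j, MemLp (fun x => (Real.exp (-φ x / 2) : ℂ) * α j x) 2 ((dVol n).restrict D)) →
        (∀ W, TF D W → ∀ j k, ∫ x in D, α j x * wderivBar W x k - α k x * wderivBar W x j ∂(dVol n) = 0) →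
        ∫ x in D, ∑ j, (Real.exp (-φ x / 2) : ℂ) * α j x * conj ((Real.exp (-φ x / 2) : ℂ) * β j x) ∂(dVol n) =
          ∫ x in D, ∑ j, α j x * conj (γ j x) ∂(dVol n)) {W : Cn n → ℂ} (hW : TF D W) :
    ∫ x in D, ∑ j, (Real.exp (-φ x) : ℂ) * β j x * wderiv W x j ∂(dVol n) = - ∫ x in D, (∑ j, wderiv (γ j) x j) * W x ∂(dVol n) := by
  have hc : ContinuousOn (fun x => (Real.exp (-φ x / 2) : ℂ)) D :=
    Complex.continuous_ofReal.comp_continuousOn (Real.continuous_exp.comp_continuousOn (hφ.neg.div_const 2))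
  have h := h3 (fun j x => wderivBar (fun y => conj (W y)) x j)
    (fun j => (memLp_cs hD hc (hW.conj'.wb1 j).continuous (hW.conj'.2.1.of_isClosed_subset (isClosed_tsupport _) (wderivBar_supp j))
      ((wderivBar_supp j).trans hW.conj'.2.2)).restrict _)
    (fun V hV j k => closed_of_exact hD hW.conj'.1.contDiffOn hV j k)
  simp_rw [fun x j => wderivBar_conj (hW.diff x) j] at h
  have h' := congrArg conj h
  rw [← integral_conj, ← integral_conj] at h'
  simp only [map_sum, map_mul, Complex.conj_conj, Complex.conj_ofReal] at h'
  have e1 : ∀ x, ∑ j, (Real.exp (-φ x / 2) : ℂ) * wderiv W x j * ((Real.exp (-φ x / 2) : ℂ) * β j x) = ∑ j, (Real.exp (-φ x) : ℂ) * β j x * wderiv W x j := by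
    intro x; refine Finset.sum_congr rfl fun j _ => ?_
    have : (Real.exp (-φ x) : ℂ) = (Real.exp (-φ x / 2) : ℂ) * (Real.exp (-φ x / 2) : ℂ) := by
      rw [← Complex.ofReal_mul, ← Real.exp_add]; congr 2; ring
    rw [this]; ring
  simp_rw [e1] at h'
  rw [h', setIntegral_eq_integral_of_forall_compl_eq_zero (fun x hx => by simp [hW.wz _ hx]),
    setIntegral_eq_integral_of_forall_compl_eq_zero (fun x hx => by simp [(hγ _).wz _ hx])]
  have hcw : ∀ j, HasCompactSupport (fun x => wderiv W x j) := fun j => hW.2.1.of_isClosed_subset (isClosed_tsupport _) (wderiv_supp j)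
  have hcg : ∀ j, HasCompactSupport (fun x => wderiv (γ j) x j) := fun j => (hγ j).2.1.of_isClosed_subset (isClosed_tsupport _) (wderiv_supp j)
  rw [integral_finsetSum _ (fun j _ => ?_)]
  · simp_rw [Finset.sum_mul]
    rw [integral_finsetSum _ (fun j _ => ?_), ← Finset.sum_neg_distrib]
    · refine Finset.sum_congr rfl fun j _ => ?_
      rw [← ibp hD (hγ j).cd1.contDiffOn hW.cd1 hW.2.1 hW.2.2 j]
      refine integral_congr_ae (ae_of_all _ fun x => ?_)
      simp only; ring
    · exact (((hγ j).w1 j).continuous.mul hW.1.continuous).integrable_of_hasCompactSupport (hcg j).mul_right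
  · exact ((hW.w1 j).continuous.mul (hγ j).1.continuous).integrable_of_hasCompactSupport (hcw j).mul_right
end

section
open scoped ENNReal Topology

lemma mulL {n : ℕ} {D K : Set (Cn n)} {φ : Cn n → ℝ} (hφ : ContinuousOn φ D) (hK : IsCompact K) (hKD : K ⊆ D) {β c : Cn n → ℂ}
    (hβ : MemLp (fun x => (Real.exp (-φ x / 2) : ℂ) * β x) 2 ((dVol n).restrict D)) (hc : ContinuousOn c D) (hcK : ∀ x ∉ K, c x = 0) :
    MemLp (fun x => c x * β x) 2 (dVol n) ∧ Integrable (fun x => c x * β x) (dVol n) := by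
  have h1 : ContinuousOn (fun x => c x * (Real.exp (φ x / 2) : ℂ)) K :=
    (hc.mono hKD).mul (Complex.continuous_ofReal.comp_continuousOn (Real.continuous_exp.comp_continuousOn ((hφ.mono hKD).div_const 2)))
  obtain ⟨C, hC⟩ := hK.exists_bound_of_continuousOn h1
  have hβK : MemLp (fun x => (Real.exp (-φ x / 2) : ℂ) * β x) 2 ((dVol n).restrict K) := hβ.mono_measure (Measure.restrict_mono hKD le_rfl)
  have e : ∀ x, c x * β x = (c x * (Real.exp (φ x / 2) : ℂ)) * ((Real.exp (-φ x / 2) : ℂ) * β x) := by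
    intro x
    have expc : (Real.exp (φ x / 2) : ℂ) * (Real.exp (-φ x / 2) : ℂ) = 1 := by
      rw [← Complex.ofReal_mul, ← Real.exp_add]; simp [neg_div]
    linear_combination (-c x * β x) * expc
  have h2 : MemLp (fun x => c x * β x) 2 ((dVol n).restrict K) := by
    simp_rw [e]
    refine hβK.of_le_mul (c := C) ((h1.aestronglyMeasurable hK.measurableSet).mul hβK.1) ?_
    refine (ae_restrict_iff' hK.measurableSet).2 (ae_of_all _ fun x hx => ?_)
    rw [norm_mul]; gcongr; exact hC x hx
  have e2 : (fun x => c x * β x) = K.indicator (fun x => c x * β x) := by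
    symm; rw [Set.indicator_eq_self]; intro x hx; by_contra h; exact hx (by simp [hcK x h])
  constructor
  · rw [e2, memLp_indicator_iff_restrict hK.measurableSet]; exact h2
  · rw [e2, integrable_indicator_iff hK.measurableSet]
    haveI : IsFiniteMeasure ((dVol n).restrict K) := ⟨by simpa using hK.measure_lt_top⟩
    exact h2.integrable (by norm_num)

lemma cut_est {n : ℕ} {D : Set (Cn n)} (hD : IsOpen D) {φ lam h : Cn n → ℝ} (hφ : ContDiffOn ℝ 2 φ D) (hφ0 : ∀ x ∈ D, 0 ≤ φ x)
    (hl : ContinuousOn lam D) (hl1 : ∀ x ∈ D, 1 ≤ lam x) (hlev : ∀ x ∈ D, ∀ ξ, lam x * ‖ξ‖^2 ≤ leviForm φ x ξ)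
    (hh : ContDiff ℝ 2 h) (hhc : HasCompactSupport h) (hhs : tsupport h ⊆ D) {η : ℝ} (hη0 : 0 ≤ η) (hh1 : ∀ x, |h x| ≤ 1)
    (hη : ∀ x ∈ D, (∑ j, ‖wderiv (realToC h) x j‖^2)^2 ≤ η * lam x)
    {β : Fin n → Cn n → ℂ} {g : Cn n → ℂ} (hg : Continuous g) (hgc : HasCompactSupport g) (hgs : tsupport g ⊆ D)
    (hβ : ∀ j, MemLp (fun x => (Real.exp (-φ x / 2) : ℂ) * β j x) 2 ((dVol n).restrict D))
    (hcl : ∀ W, TF D W → ∀ j k, ∫ x in D, β j x * wderivBar W x k - β k x * wderivBar W x j ∂(dVol n) = 0)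
    (hadj : ∀ W, TF D W → ∫ x in D, ∑ j, (Real.exp (-φ x) : ℂ) * β j x * wderiv W x j ∂(dVol n) = - ∫ x in D, g x * W x ∂(dVol n)) :
    ∫ x in D, (h x)^4 * ∑ j, ‖(Real.exp (-φ x / 2) : ℂ) * β j x‖^2 ∂(dVol n) ≤
      4 * ∫ x in D, Real.exp (φ x) * ‖g x‖^2 ∂(dVol n) + 256 * η * ∫ x in D, ∑ j, ‖(Real.exp (-φ x / 2) : ℂ) * β j x‖^2 ∂(dVol n) := by
  set K := tsupport h with hKdef
  have hK : IsCompact K := hhc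
  set hC := realToC h with hhC
  have hCcd : ContDiff ℝ 2 hC := Complex.ofRealCLM.contDiff.comp hh
  have hz : ∀ x ∉ K, hC x = 0 := fun x hx => by simp [hhC, realToC, image_eq_zero_of_notMem_tsupport hx]
  set κ : Cn n → ℂ := fun x => hC x * hC x with hκ
  have hκcd : ContDiff ℝ 2 κ := hCcd.mul hCcd
  have hκs : tsupport κ ⊆ K := closure_minimal (by intro x hx; by_contra h'; exact hx (by simp [hκ, hz x h'])) hK.isClosed
  have hκT : TF D κ := ⟨hκcd, hK.of_isClosed_subset (isClosed_tsupport _) hκs, hκs.trans hhs⟩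
  have hκz : ∀ x ∉ K, κ x = 0 := fun x hx => by simp [hκ, hz x hx]
  have hκjz : ∀ j, ∀ x ∉ K, wderiv κ x j = 0 := fun j x hx => by
    by_contra h'; exact hx (hκs (wderiv_supp j (subset_tsupport _ h')))
  have hκj : ∀ x j, wderiv κ x j = 2 * hC x * wderiv hC x j := fun x j => by
    rw [hκ, wderiv_mul (hCcd.differentiable (by norm_num) x) (hCcd.differentiable (by norm_num) x)]; ring
  have hκb : ∀ x j, wderivBar κ x j = conj (wderiv κ x j) := fun x j => by
    rw [← wderivBar_conj (hκT.diff x)]; congr 1; ext y; simp [hκ, hhC, realToC]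
  have hφc := hφ.continuousOn
  have hWc : ContinuousOn (fun x => (Real.exp (-φ x) : ℂ)) D := Complex.continuous_ofReal.comp_continuousOn (Real.continuous_exp.comp_continuousOn hφc.neg)
  set Ep : Cn n → ℂ := fun x => (Real.exp (φ x) : ℂ) with hEp
  have hEpcd : ContDiffOn ℝ 2 Ep D := Complex.ofRealCLM.contDiff.comp_contDiffOn (Real.contDiff_exp.comp_contDiffOn hφ)
  have expc : ∀ x, (Real.exp (-φ x) : ℂ) * Ep x = 1 := by
    intro x; rw [hEp, ← Complex.ofReal_mul, ← Real.exp_add]; simp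
  have hφj : ∀ j, ContinuousOn (fun x => wderiv (realToC φ) x j) D := fun j => (wderiv_cd hD (m := 1) (realToC_cd (m := 2) hφ) j).continuousOn
  have hEj : ∀ x ∈ D, ∀ j, wderiv Ep x j = wderiv (realToC φ) x j * Ep x := by
    intro x hx j
    have e1 : DifferentiableAt ℝ φ x := (hφ.contDiffAt (hD.mem_nhds hx)).differentiableAt (by norm_num)
    have e2 : ∀ v, fderiv ℝ Ep x v = fderiv ℝ (realToC φ) x v * Ep x := by
      intro v
      have e3 : HasFDerivAt Ep (Complex.ofRealCLM.comp (Real.exp (φ x) • fderiv ℝ φ x)) x :=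
        Complex.ofRealCLM.hasFDerivAt.comp x e1.hasFDerivAt.exp
      rw [e3.fderiv, fderiv_realToC e1]; simp [hEp, mul_comm]
    simp only [wderiv, e2]; ring
  -- data for BI_L2
  set b : Fin n → Cn n → ℂ := fun j x => κ x * β j x with hb
  set Q : Cn n → ℂ := fun x => - (κ x * Ep x) * g x - ∑ j, (κ x * wderiv (realToC φ) x j + wderiv κ x j) * β j x with hQ
  set R : Fin n → Fin n → Cn n → ℂ := fun j k x => conj (wderiv κ x j) * β k x - conj (wderiv κ x k) * β j x with hR
  have ML : ∀ (c : Cn n → ℂ) j, ContinuousOn c D → (∀ x ∉ K, c x = 0) → MemLp (fun x => c x * β j x) 2 (dVol n) ∧ Integrable (fun x => c x * β j x) (dVol n) :=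
    fun c j h1 h2 => mulL hφc hK hhs (hβ j) h1 h2
  have hκc : ContinuousOn κ D := hκcd.continuous.continuousOn
  have hκjc : ∀ j, ContinuousOn (fun x => wderiv κ x j) D := fun j => (hκT.w1 j).continuous.continuousOn
  have hκjcc : ∀ j, ContinuousOn (fun x => conj (wderiv κ x j)) D := fun j => Complex.continuous_conj.comp_continuousOn (hκjc j)
  have hbL : ∀ j, MemLp (b j) 2 (dVol n) := fun j => (ML κ j hκc hκz).1
  have hQL : MemLp Q 2 (dVol n) := by
    refine MemLp.sub ?_ (memLp_finsetSum _ fun j _ => ?_)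
    · exact memLp_cs hD (f := fun x => -(κ x * Ep x)) ((hκc.mul hEpcd.continuousOn).neg) hg hgc hgs
    · exact (ML (fun x => κ x * wderiv (realToC φ) x j + wderiv κ x j) j ((hκc.mul (hφj j)).add (hκjc j)) (fun x hx => by simp [hκz x hx, hκjz j x hx])).1
  have hRL : ∀ j k, MemLp (R j k) 2 (dVol n) := fun j k =>
    (ML _ k (hκjcc j) (fun x hx => by simp [hκjz j x hx])).1.sub (ML _ j (hκjcc k) (fun x hx => by simp [hκjz k x hx])).1
  have hbK : ∀ j, ∀ x ∉ K, b j x = 0 := fun j x hx => by simp [hb, hκz x hx]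
  have hQK : ∀ x ∉ K, Q x = 0 := fun x hx => by simp [hQ, hκz x hx, hκjz _ x hx]
  have hRK : ∀ j k, ∀ x ∉ K, R j k x = 0 := fun j k x hx => by simp [hR, hκjz _ x hx]
  have hQw : ∀ w : Cn n → ℂ, ContDiff ℝ 2 w → HasCompactSupport w → ∫ x, Q x * w x ∂(dVol n) = ∑ j, ∫ x, b j x * wderiv w x j ∂(dVol n) := by
    intro w hw hwc
    have hκw : TF D (fun x => κ x * w x) := ⟨hκcd.mul hw, hκT.2.1.mul_right, (tsupport_mul_subset_left).trans hκT.2.2⟩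
    have hW : TF D (fun x => Ep x * (κ x * w x)) :=
      ⟨contDiff_mul_supp hD hEpcd hκw.1 hκw.2.2, hκw.2.1.mul_left, (tsupport_mul_subset_right).trans hκw.2.2⟩
    have hwd : ∀ x, DifferentiableAt ℝ w x := fun x => hw.differentiable (by norm_num) x
    have hwj : ∀ j, Continuous (fun x => wderiv w x j) := fun j => (wderiv_C (m := 1) (by simpa [one_add_one_eq_two] using hw) j).continuous
    have h1 := hadj _ hW
    have hWj : ∀ x ∈ D, ∀ j, wderiv (fun x => Ep x * (κ x * w x)) x j = Ep x * (wderiv (realToC φ) x j * κ x * w x + wderiv κ x j * w x + κ x * wderiv w x j) := by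
      intro x hx j
      rw [wderiv_mul ((hEpcd.contDiffAt (hD.mem_nhds hx)).differentiableAt (by norm_num)) (hκw.diff x), wderiv_mul (hκT.diff x) (hwd x), hEj x hx]; ring
    have i1 : Integrable (fun x => g x * (Ep x * (κ x * w x))) (dVol n) := (hg.mul hW.1.continuous).integrable_of_hasCompactSupport hgc.mul_right
    have i2 : ∀ j, Integrable (fun x => b j x * wderiv w x j) (dVol n) := fun j => by
      have := (ML (fun x => κ x * wderiv w x j) j (hκc.mul (hwj j).continuousOn) (fun x hx => by simp [hκz x hx])).2
      refine this.congr (ae_of_all _ fun x => ?_); simp only [hb]; ring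
    have i3 : Integrable (fun x => ∑ j, (Real.exp (-φ x) : ℂ) * β j x * wderiv (fun x => Ep x * (κ x * w x)) x j) (dVol n) := by
      refine integrable_finsetSum _ fun j _ => ?_
      have := (ML (fun x => (Real.exp (-φ x) : ℂ) * wderiv (fun x => Ep x * (κ x * w x)) x j) j (hWc.mul (hW.w1 j).continuous.continuousOn) (fun x hx => by
        have : wderiv (fun x => Ep x * (κ x * w x)) x j = 0 := by
          by_contra h'
          exact hx (hκs (((tsupport_mul_subset_right (f := Ep)).trans (tsupport_mul_subset_left (f := κ))) (wderiv_supp j (subset_tsupport _ h'))))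
        simp [this])).2
      refine this.congr (ae_of_all _ fun x => ?_); simp only; ring
    have i4 : Integrable (fun x => Q x * w x) (dVol n) := locint_mul (hQL.locallyIntegrable (by norm_num)) hw.continuous hwc
    have i5 : Integrable (fun x => ∑ j, b j x * wderiv w x j) (dVol n) := integrable_finsetSum _ fun j _ => i2 j
    rw [← integral_finsetSum _ (fun j _ => i2 j), ← sub_eq_zero, ← integral_sub i4 i5]
    rw [← setIntegral_eq_integral_of_forall_compl_eq_zero (s := D) (fun x hx => by simp [hQK x (fun h => hx (hhs h)), hbK _ x (fun h => hx (hhs h))])]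
    rw [eq_neg_iff_add_eq_zero, ← integral_add i3.integrableOn i1.integrableOn, ← neg_eq_zero, ← integral_neg] at h1
    rw [← h1]
    refine setIntegral_congr_fun hD.measurableSet fun x hx => ?_
    simp only [hWj x hx, hQ, hb]
    have : ∀ j, (Real.exp (-φ x) : ℂ) * β j x * (Ep x * (wderiv (realToC φ) x j * κ x * w x + wderiv κ x j * w x + κ x * wderiv w x j))
      = β j x * (wderiv (realToC φ) x j * κ x * w x + wderiv κ x j * w x + κ x * wderiv w x j) := fun j => by
        linear_combination (β j x * (wderiv (realToC φ) x j * κ x * w x + wderiv κ x j * w x + κ x * wderiv w x j)) * expc x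
    simp_rw [this]
    have : ∀ j, β j x * (wderiv (realToC φ) x j * κ x * w x + wderiv κ x j * w x + κ x * wderiv w x j) =
      (κ x * wderiv (realToC φ) x j + wderiv κ x j) * β j x * w x + κ x * β j x * wderiv w x j := fun j => by ring
    simp_rw [this, Finset.sum_add_distrib, sub_mul, Finset.sum_mul]; ring
  have hRw : ∀ w : Cn n → ℂ, ContDiff ℝ 2 w → HasCompactSupport w → ∀ j k, ∫ x, R j k x * w x ∂(dVol n) =
      - (∫ x, b k x * wderivBar w x j ∂(dVol n) - ∫ x, b j x * wderivBar w x k ∂(dVol n)) := by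
    intro w hw hwc j k
    have hκw : TF D (fun x => κ x * w x) := ⟨hκcd.mul hw, hκT.2.1.mul_right, (tsupport_mul_subset_left).trans hκT.2.2⟩
    have hwd : ∀ x, DifferentiableAt ℝ w x := fun x => hw.differentiable (by norm_num) x
    have hwj : ∀ j, Continuous (fun x => wderivBar w x j) := fun j => (wderivBar_C (m := 1) (by simpa [one_add_one_eq_two] using hw) j).continuous
    have h1 := hcl _ hκw j k
    have i2 : ∀ j k, Integrable (fun x => b j x * wderivBar w x k) (dVol n) := fun j k => by
      have := (ML (fun x => κ x * wderivBar w x k) j (hκc.mul (hwj k).continuousOn) (fun x hx => by simp [hκz x hx])).2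
      refine this.congr (ae_of_all _ fun x => ?_); simp only [hb]; ring
    have i4 : Integrable (fun x => R j k x * w x) (dVol n) := locint_mul ((hRL j k).locallyIntegrable (by norm_num)) hw.continuous hwc
    have i5 : Integrable (fun x => b k x * wderivBar w x j - b j x * wderivBar w x k) (dVol n) := (i2 k j).sub (i2 j k)
    rw [← integral_sub (i2 _ _) (i2 _ _), eq_neg_iff_add_eq_zero, ← integral_add i4 i5]
    rw [← setIntegral_eq_integral_of_forall_compl_eq_zero (s := D) (fun x hx => by simp [hRK j k x (fun h => hx (hhs h)), hbK _ x (fun h => hx (hhs h))])]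
    rw [← neg_eq_zero, ← integral_neg] at h1
    rw [← h1]
    refine setIntegral_congr_fun hD.measurableSet fun x hx => ?_
    simp only [wderivBar_mul (hκT.diff x) (hwd x), hR, hb, hκb]; ring
  have hmain := BI_L2 hD hφ hl (fun x hx => zero_le_one.trans (hl1 x hx)) hlev hK hhs hbL hbK hQL hQK hRL hRK hQw hRw
  have nD : ∀ x, x ∉ D → x ∉ K := fun x hx h' => hx (hhs h')
  set μ := (dVol n).restrict D with hμ
  set X : Cn n → ℝ := fun x => ∑ j, ‖(Real.exp (-φ x / 2) : ℂ) * β j x‖^2 with hX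
  have hX0 : ∀ x, 0 ≤ X x := fun x => Finset.sum_nonneg fun j _ => by positivity
  have hXe : ∀ x, X x = Real.exp (-φ x) * ∑ j, ‖β j x‖^2 := by
    intro x
    have : Real.exp (-φ x) = Real.exp (-φ x / 2) ^ 2 := by rw [← Real.exp_nat_mul]; congr 1; push_cast; ring
    simp only [hX, norm_mul, mul_pow, Finset.mul_sum, Complex.norm_real, Real.norm_eq_abs, abs_of_pos (Real.exp_pos _), this]
  have hXi : Integrable X μ := integrable_finsetSum _ fun j _ => (hβ j).norm.integrable_sq
  -- integrability
  have hexpm : AEStronglyMeasurable (fun x => Real.exp (-φ x)) μ :=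
    (Real.continuous_exp.comp_continuousOn hφc.neg).aestronglyMeasurable hD.measurableSet
  have hexpb : ∀ᵐ x ∂μ, ‖Real.exp (-φ x)‖ ≤ 1 := by
    refine (ae_restrict_iff' hD.measurableSet).2 (ae_of_all _ fun x hx => ?_)
    rw [Real.norm_eq_abs, abs_of_pos (Real.exp_pos _), Real.exp_le_one_iff]; linarith [hφ0 x hx]
  have iE : ∀ (F : Cn n → ℂ), MemLp F 2 (dVol n) → Integrable (fun x => Real.exp (-φ x) * ‖F x‖^2) μ := fun F hF =>
    Integrable.bdd_mul (hF.restrict D).norm.integrable_sq hexpm hexpb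
  have hKap : ∀ x, ‖κ x‖ = (h x)^2 := fun x => by simp [hκ, hhC, realToC, sq]
  have hFL : ∀ x, Real.exp (-φ x) * (lam x * ∑ j, ‖b j x‖^2) = (lam x * (h x)^4) * X x := by
    intro x; rw [hXe]; simp only [hb, norm_mul, mul_pow, hKap, ← Finset.mul_sum]; ring
  have iL : Integrable (fun x => (lam x * (h x)^4) * X x) μ := by
    obtain ⟨C, hC⟩ := hK.exists_bound_of_continuousOn (f := fun x => lam x * (h x)^4) ((hl.mono hhs).mul (hh.continuous.continuousOn.pow 4))
    refine Integrable.bdd_mul (c := max C 0) hXi ((hl.mul (hh.continuous.continuousOn.pow 4)).aestronglyMeasurable hD.measurableSet) (ae_of_all _ fun x => ?_)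
    by_cases hx : x ∈ K
    · exact (hC x hx).trans (le_max_left _ _)
    · have : h x = 0 := image_eq_zero_of_notMem_tsupport hx
      simp [this]
  set P : Cn n → ℂ := fun x => -(κ x * Ep x) * g x - ∑ j, wderiv κ x j * β j x with hP
  have hQP : ∀ x, Q x + ∑ j, wderiv (realToC φ) x j * b j x = P x := by
    intro x; simp only [hQ, hb, hP, add_mul, Finset.sum_add_distrib]
    have : ∀ j, wderiv (realToC φ) x j * (κ x * β j x) = κ x * wderiv (realToC φ) x j * β j x := fun j => by ring
    simp_rw [this]; ring
  have hPL : MemLp P 2 (dVol n) := by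
    refine MemLp.sub (memLp_cs hD (f := fun x => -(κ x * Ep x)) ((hκc.mul hEpcd.continuousOn).neg) hg hgc hgs) (memLp_finsetSum _ fun j _ => ?_)
    exact (ML (fun x => wderiv κ x j) j (hκjc j) (hκjz j)).1
  have hPK : ∀ x ∉ K, P x = 0 := fun x hx => by simp [hP, hκz x hx, hκjz _ x hx]
  simp_rw [hFL, hQP] at hmain
  rw [← setIntegral_eq_integral_of_forall_compl_eq_zero (s := D) (fun x hx => by
      have : h x = 0 := image_eq_zero_of_notMem_tsupport (nD x hx)
      simp [this]),
    ← setIntegral_eq_integral_of_forall_compl_eq_zero (s := D) (f := fun x => Real.exp (-φ x) * ‖P x‖^2) (fun x hx => by simp [hPK x (nD x hx)])] at hmain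
  have hRD : ∀ j k, ∫ x, Real.exp (-φ x) * ‖R j k x‖^2 ∂(dVol n) = ∫ x in D, Real.exp (-φ x) * ‖R j k x‖^2 ∂(dVol n) := fun j k => by
    rw [← setIntegral_eq_integral_of_forall_compl_eq_zero (s := D) (fun x hx => by simp [hRK j k x (nD x hx)])]
  simp_rw [hRD] at hmain
  have ig : Integrable (fun x => Real.exp (φ x) * ‖g x‖^2) μ := by
    have h1 : Continuous (fun x => Ep x * g x) := cont_mul hD hEpcd.continuousOn hg hgs
    have h2 : Integrable (fun x => ‖(Ep x * g x) * conj (g x)‖) (dVol n) :=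
      ((h1.mul (Complex.continuous_conj.comp hg)).integrable_of_hasCompactSupport (hgc.mul_left.mul_right)).norm
    refine h2.integrableOn.congr (ae_of_all _ fun x => ?_)
    simp only [norm_mul, hEp, Complex.norm_real, Real.norm_eq_abs, abs_of_pos (Real.exp_pos _), Complex.norm_conj]; ring
  have iR : ∀ j k, Integrable (fun x => Real.exp (-φ x) * ‖R j k x‖^2) μ := fun j k => iE _ (hRL j k)
  have iRk : ∀ j, Integrable (fun x => ∑ k, Real.exp (-φ x) * ‖R j k x‖^2) μ := fun j => integrable_finsetSum _ fun k _ => iR j k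
  have iRR : Integrable (fun x => ∑ j, ∑ k, Real.exp (-φ x) * ‖R j k x‖^2) μ := integrable_finsetSum _ fun j _ => iRk j
  have e1 : ∑ j, ∑ k, ∫ x in D, Real.exp (-φ x) * ‖R j k x‖^2 ∂(dVol n) = ∫ x in D, ∑ j, ∑ k, Real.exp (-φ x) * ‖R j k x‖^2 ∂(dVol n) := by
    rw [integral_finsetSum _ fun j _ => iRk j]
    exact Finset.sum_congr rfl fun j _ => (integral_finsetSum _ fun k _ => iR j k).symm
  have iRR2 : Integrable (fun x => (1/2) * ∑ j, ∑ k, Real.exp (-φ x) * ‖R j k x‖^2) μ := iRR.const_mul _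
  rw [e1, ← integral_const_mul, ← integral_add (iE P hPL) iRR2] at hmain
  have ig2 : Integrable (fun x => 2 * (Real.exp (φ x) * ‖g x‖^2)) μ := ig.const_mul 2
  have iL2 : Integrable (fun x => (1/2) * ((lam x * (h x)^4) * X x)) μ := iL.const_mul _
  have iX2 : Integrable (fun x => (128 * η) * X x) μ := hXi.const_mul _
  have igl : Integrable (fun x => 2 * (Real.exp (φ x) * ‖g x‖^2) + (1/2) * ((lam x * (h x)^4) * X x)) μ := ig2.add iL2
  have igx : Integrable (fun x => 2 * (Real.exp (φ x) * ‖g x‖^2) + (1/2) * ((lam x * (h x)^4) * X x) + (128 * η) * X x) μ := igl.add iX2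
  have hle : ∫ x in D, (Real.exp (-φ x) * ‖P x‖^2 + (1/2) * ∑ j, ∑ k, Real.exp (-φ x) * ‖R j k x‖^2) ∂(dVol n) ≤
      ∫ x in D, (2 * (Real.exp (φ x) * ‖g x‖^2) + (1/2) * ((lam x * (h x)^4) * X x) + (128 * η) * X x) ∂(dVol n) := by
    refine setIntegral_mono_on ((iE P hPL).add iRR2) igx hD.measurableSet fun x hx => ?_
    have hp := pt_alg (fun j => wderiv κ x j) (fun j => β j x) (-(κ x * Ep x) * g x)
    set u := ∑ j, ‖wderiv hC x j‖^2 with hu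
    have hku : ∑ j, ‖wderiv κ x j‖^2 = 4 * (h x)^2 * u := by
      simp only [hκj, norm_mul, mul_pow, hu, Finset.mul_sum]
      refine Finset.sum_congr rfl fun j _ => ?_
      simp only [hhC, realToC, Complex.norm_real, Complex.norm_ofNat, Real.norm_eq_abs, sq_abs]; ring
    have hE0 := Real.exp_pos (-φ x)
    have hA : Real.exp (-φ x) * ‖-(κ x * Ep x) * g x‖^2 = (h x)^4 * (Real.exp (φ x) * ‖g x‖^2) := by
      have : Real.exp (-φ x) * Real.exp (φ x) = 1 := by rw [← Real.exp_add]; simp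
      simp only [norm_mul, norm_neg, hKap, hEp, Complex.norm_real, Real.norm_eq_abs, abs_of_pos (Real.exp_pos _)]
      linear_combination ((h x)^4 * Real.exp (φ x) * ‖g x‖^2) * this
    have hh4 : (h x)^4 ≤ 1 := by
      have := pow_le_one₀ (n := 4) (abs_nonneg _) (hh1 x)
      rwa [Even.pow_abs (by decide)] at this
    have hG : 0 ≤ Real.exp (φ x) * ‖g x‖^2 := by positivity
    have hu2 := hη x hx
    have hl1x := hl1 x hx
    have hAM : 16 * (h x)^2 * u ≤ (1/2) * (lam x * (h x)^4) + 128 * η := by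
      have hu0 : 0 ≤ u := Finset.sum_nonneg fun j _ => by positivity
      have h3 : 0 ≤ (lam x * (h x)^2 - 16 * u)^2 := sq_nonneg _
      have h4 : lam x * (16 * (h x)^2 * u) ≤ lam x * ((1/2) * (lam x * (h x)^4) + 128 * η) := by nlinarith
      exact le_of_mul_le_mul_left h4 (by linarith)
    calc _ = Real.exp (-φ x) * (‖P x‖^2 + (1/2) * ∑ j, ∑ k, ‖R j k x‖^2) := by
          simp only [Finset.mul_sum]
          rw [mul_add, Finset.mul_sum]; congr 1
          refine Finset.sum_congr rfl fun j _ => ?_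
          rw [Finset.mul_sum]
          refine Finset.sum_congr rfl fun k _ => ?_
          ring
      _ ≤ Real.exp (-φ x) * (2 * ‖-(κ x * Ep x) * g x‖^2 + 4 * ((∑ j, ‖wderiv κ x j‖^2) * ∑ j, ‖β j x‖^2)) := by gcongr
      _ = 2 * ((h x)^4 * (Real.exp (φ x) * ‖g x‖^2)) + 16 * (h x)^2 * u * X x := by rw [hku, hXe, ← hA]; ring
      _ ≤ 2 * (1 * (Real.exp (φ x) * ‖g x‖^2)) + ((1/2) * (lam x * (h x)^4) + 128 * η) * X x := by
          gcongr
      _ = _ := by ring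
  rw [integral_add igl iX2, integral_add ig2 iL2, integral_const_mul, integral_const_mul, integral_const_mul] at hle
  have hfin : ∫ x in D, (h x)^4 * X x ∂(dVol n) ≤ ∫ x in D, (lam x * (h x)^4) * X x ∂(dVol n) := by
    refine setIntegral_mono_on ?_ iL hD.measurableSet fun x hx => ?_
    · refine Integrable.bdd_mul (c := 1) hXi (hh.continuous.pow 4).aestronglyMeasurable (ae_of_all _ fun x => ?_)
      rw [norm_pow]; exact pow_le_one₀ (norm_nonneg _) (hh1 x)
    · have := hl1 x hx; have := hX0 x
      gcongr
      nlinarith [show 0 ≤ h x ^ 4 by positivity]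
  linarith
end

section
open scoped ENNReal Topology

lemma cs_sum {n : ℕ} {μ : Measure (Cn n)} {a b : Fin n → Cn n → ℂ} (ha : ∀ j, MemLp (a j) 2 μ) (hb : ∀ j, MemLp (b j) 2 μ) :
    ‖∫ x, ∑ j, a j x * conj (b j x) ∂μ‖^2 ≤ (∫ x, ∑ j, ‖a j x‖^2 ∂μ) * ∫ x, ∑ j, ‖b j x‖^2 ∂μ := by
  have iA : Integrable (fun x => ∑ j, ‖a j x‖^2) μ := integrable_finsetSum _ fun j _ => (ha j).norm.integrable_sq
  have iB : Integrable (fun x => ∑ j, ‖b j x‖^2) μ := integrable_finsetSum _ fun j _ => (hb j).norm.integrable_sq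
  have iS : Integrable (fun x => ∑ j, ‖a j x‖ * ‖b j x‖) μ := integrable_finsetSum _ fun j _ => (ha j).norm.integrable_mul (hb j).norm
  set A := ∫ x, ∑ j, ‖a j x‖^2 ∂μ
  set B := ∫ x, ∑ j, ‖b j x‖^2 ∂μ
  set S := ∫ x, ∑ j, ‖a j x‖ * ‖b j x‖ ∂μ
  have h1 : ‖∫ x, ∑ j, a j x * conj (b j x) ∂μ‖ ≤ S := by
    refine norm_integral_le_of_norm_le iS (ae_of_all _ fun x => ?_)
    refine (norm_sum_le _ _).trans (Finset.sum_le_sum fun j _ => ?_)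
    rw [norm_mul, Complex.norm_conj]
  have h2 : ∀ t : ℝ, 0 ≤ A * (t * t) + (-2 * S) * t + B := by
    intro t
    have i1 : Integrable (fun x => (t*t) * ∑ j, ‖a j x‖^2) μ := iA.const_mul _
    have i2 : Integrable (fun x => (-2 * t) * ∑ j, ‖a j x‖ * ‖b j x‖) μ := iS.const_mul _
    have i3 : Integrable (fun x => (t*t) * ∑ j, ‖a j x‖^2 + (-2 * t) * ∑ j, ‖a j x‖ * ‖b j x‖) μ := i1.add i2
    have : A * (t * t) + (-2 * S) * t + B = ∫ x, ((t*t) * ∑ j, ‖a j x‖^2 + (-2 * t) * ∑ j, ‖a j x‖ * ‖b j x‖) + ∑ j, ‖b j x‖^2 ∂μ := by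
      rw [integral_add i3 iB, integral_add i1 i2, integral_const_mul, integral_const_mul]; ring
    rw [this]
    refine integral_nonneg fun x => ?_
    simp only [Pi.zero_apply, Finset.mul_sum, ← Finset.sum_add_distrib]
    exact Finset.sum_nonneg fun j _ => by nlinarith [sq_nonneg (t * ‖a j x‖ - ‖b j x‖)]
  have h3 := discrim_le_zero h2
  rw [discrim] at h3
  have : ‖∫ x, ∑ j, a j x * conj (b j x) ∂μ‖^2 ≤ S^2 := by gcongr
  nlinarith

lemma star {n : ℕ} {D : Set (Cn n)} (hD : IsOpen D) {φ lam : Cn n → ℝ} {h : ℕ → Cn n → ℝ} (hφ : ContDiffOn ℝ 2 φ D) (hφ0 : ∀ x ∈ D, 0 ≤ φ x)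
    (hl : ContinuousOn lam D) (hl1 : ∀ x ∈ D, 1 ≤ lam x) (hlev : ∀ x ∈ D, ∀ ξ, lam x * ‖ξ‖^2 ≤ leviForm φ x ξ)
    (hh : ∀ m, ContDiff ℝ 2 (h m)) (hhc : ∀ m, HasCompactSupport (h m)) (hhs : ∀ m, tsupport (h m) ⊆ D) {η : ℕ → ℝ} (hη0 : ∀ m, 0 ≤ η m) (hh1 : ∀ m x, |h m x| ≤ 1)
    (hη : ∀ m, ∀ x ∈ D, (∑ j, ‖wderiv (realToC (h m)) x j‖^2)^2 ≤ η m * lam x) (hηt : Filter.Tendsto η Filter.atTop (𝓝 0))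
    (hht : ∀ x ∈ D, Filter.Tendsto (fun m => h m x) Filter.atTop (𝓝 1))
    {γ : Fin n → Cn n → ℂ} (hγ : ∀ j, TF D (γ j)) {R : ℝ} (hR : ∀ x ∈ D, ∀ j, x ∈ tsupport (γ j) → φ x ≤ R)
    {α : Fin n → Cn n → ℂ} (hα : ∀ j, MemLp (α j) 2 ((dVol n).restrict D))
    (hαc : ∀ W, TF D W → ∀ j k, ∫ x in D, α j x * wderivBar W x k - α k x * wderivBar W x j ∂(dVol n) = 0) :
    ‖∫ x in D, ∑ j, α j x * conj (γ j x) ∂(dVol n)‖^2 ≤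
      (∫ x in D, ∑ j, ‖α j x‖^2 ∂(dVol n)) * (4 * Real.exp R * ∫ x in D, ‖∑ j, wderiv (γ j) x j‖^2 ∂(dVol n)) := by
  have hφc := hφ.continuousOn
  obtain ⟨β, hβ, hcl, hpr⟩ := proj_exists hD hφc (fun j => (hγ j).1.continuous) (fun j => (hγ j).2.1) (fun j => (hγ j).2.2)
  set g : Cn n → ℂ := fun x => ∑ j, wderiv (γ j) x j with hg
  have hgj : ∀ j, Continuous (fun x => wderiv (γ j) x j) := fun j => ((hγ j).w1 j).continuous
  have hgjc : ∀ j, HasCompactSupport (fun x => wderiv (γ j) x j) := fun j =>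
    (hγ j).2.1.of_isClosed_subset (isClosed_tsupport _) (wderiv_supp j)
  have hgcont : Continuous g := continuous_finsetSum _ fun j _ => hgj j
  set K : Set (Cn n) := ⋃ j, tsupport (γ j) with hK
  have hKc : IsCompact K := isCompact_iUnion fun j => (hγ j).2.1
  have hgz : ∀ x ∉ K, g x = 0 := fun x hx => by
    refine Finset.sum_eq_zero fun j _ => ?_
    by_contra h'
    exact hx (Set.mem_iUnion.2 ⟨j, wderiv_supp j (subset_tsupport _ h')⟩)
  have hgK : tsupport g ⊆ K := closure_minimal (by intro x hx; by_contra h'; exact hx (hgz x h')) hKc.isClosed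
  have hKD : K ⊆ D := Set.iUnion_subset fun j => (hγ j).2.2
  have hgc : HasCompactSupport g := hKc.of_isClosed_subset (isClosed_tsupport _) hgK
  set μ := (dVol n).restrict D with hμ
  set X : Cn n → ℝ := fun x => ∑ j, ‖(Real.exp (-φ x / 2) : ℂ) * β j x‖^2 with hX
  have hX0 : ∀ x, 0 ≤ X x := fun x => Finset.sum_nonneg fun j _ => by positivity
  have hXi : Integrable X μ := integrable_finsetSum _ fun j _ => (hβ j).norm.integrable_sq
  have hcut : ∀ m, ∫ x in D, (h m x)^4 * X x ∂(dVol n) ≤ 4 * ∫ x in D, Real.exp (φ x) * ‖g x‖^2 ∂(dVol n) + 256 * η m * ∫ x in D, X x ∂(dVol n) :=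
    fun m => cut_est hD hφ hφ0 hl hl1 hlev (hh m) (hhc m) (hhs m) (hη0 m) (hh1 m) (hη m) hgcont hgc (hgK.trans hKD) hβ hcl
      (fun W hW => adj_proj hD hφc hγ hpr hW)
  have t1 : Filter.Tendsto (fun m => ∫ x in D, (h m x)^4 * X x ∂(dVol n)) Filter.atTop (𝓝 (∫ x in D, X x ∂(dVol n))) := by
    refine tendsto_integral_of_dominated_convergence X (fun m => ((hh m).continuous.pow 4).aestronglyMeasurable.mul hXi.1) hXi (fun m => ae_of_all _ fun x => ?_) ?_
    · rw [norm_mul, norm_pow, Real.norm_eq_abs, Real.norm_eq_abs, abs_of_nonneg (hX0 x)]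
      exact mul_le_of_le_one_left (hX0 x) (pow_le_one₀ (abs_nonneg _) (hh1 m x))
    · refine (ae_restrict_iff' hD.measurableSet).2 (ae_of_all _ fun x hx => ?_)
      simpa using ((hht x hx).pow 4).mul_const (X x)
  have t2 : Filter.Tendsto (fun m => 4 * ∫ x in D, Real.exp (φ x) * ‖g x‖^2 ∂(dVol n) + 256 * η m * ∫ x in D, X x ∂(dVol n)) Filter.atTop
      (𝓝 (4 * ∫ x in D, Real.exp (φ x) * ‖g x‖^2 ∂(dVol n) + 256 * 0 * ∫ x in D, X x ∂(dVol n))) :=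
    ((hηt.const_mul 256).mul_const _).const_add _
  have hXle := le_of_tendsto_of_tendsto' t1 t2 hcut
  have hg2 : Integrable (fun x => ‖g x‖^2) μ :=
    ((hgcont.memLp_of_hasCompactSupport hgc).restrict D).norm.integrable_sq
  have hXle2 : ∫ x in D, X x ∂(dVol n) ≤ 4 * Real.exp R * ∫ x in D, ‖g x‖^2 ∂(dVol n) := by
    have : ∫ x in D, Real.exp (φ x) * ‖g x‖^2 ∂(dVol n) ≤ ∫ x in D, Real.exp R * ‖g x‖^2 ∂(dVol n) := by
      refine integral_mono_of_nonneg (ae_of_all _ fun x => by positivity) (hg2.const_mul _) ?_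
      refine (ae_restrict_iff' hD.measurableSet).2 (ae_of_all _ fun x hx => ?_)
      by_cases hk : x ∈ K
      · obtain ⟨j, hj⟩ := Set.mem_iUnion.1 hk
        simp only
        gcongr
        exact hR x hx j hj
      · simp [hgz x hk]
    rw [integral_const_mul] at this
    linarith
  have hαe : ∀ j, MemLp (fun x => (Real.exp (-φ x / 2) : ℂ) * α j x) 2 μ := fun j => by
    have hm : AEStronglyMeasurable (fun x => (Real.exp (-φ x / 2) : ℂ)) μ :=
      (Complex.continuous_ofReal.comp_continuousOn (Real.continuous_exp.comp_continuousOn (hφc.neg.div_const 2))).aestronglyMeasurable hD.measurableSet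
    refine (hα j).of_le (hm.mul (hα j).1) ?_
    refine (ae_restrict_iff' hD.measurableSet).2 (ae_of_all _ fun x hx => ?_)
    rw [norm_mul, Complex.norm_real, Real.norm_eq_abs, abs_of_pos (Real.exp_pos _)]
    refine mul_le_of_le_one_left (norm_nonneg _) (Real.exp_le_one_iff.2 ?_)
    linarith [hφ0 x hx]
  rw [← hpr α hαe hαc]
  refine (cs_sum hαe hβ).trans ?_
  refine mul_le_mul ?_ hXle2 (integral_nonneg hX0) (integral_nonneg fun x => Finset.sum_nonneg fun j _ => by positivity)
  refine integral_mono_of_nonneg (ae_of_all _ fun x => Finset.sum_nonneg fun j _ => by positivity) (integrable_finsetSum _ fun j _ => (hα j).norm.integrable_sq) ?_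
  refine (ae_restrict_iff' hD.measurableSet).2 (ae_of_all _ fun x hx => ?_)
  refine Finset.sum_le_sum fun j _ => ?_
  gcongr
  rw [norm_mul, Complex.norm_real, Real.norm_eq_abs, abs_of_pos (Real.exp_pos _)]
  refine mul_le_of_le_one_left (norm_nonneg _) (Real.exp_le_one_iff.2 ?_)
  linarith [hφ0 x hx]
end

section
open scoped ENNReal Topology

/-- real Hessian -/
def D2 {n : ℕ} (f : Cn n → ℝ) (w u v : Cn n) : ℝ := fderiv ℝ (fderiv ℝ f) w u v

lemma clin_smul {n : ℕ} (f : Cn n → ℂ) (hadd : ∀ u v, f (u + v) = f u + f v) (hr : ∀ (c : ℝ) u, f ((c:ℂ) • u) = c * f u) (hI : ∀ u, f (I • u) = I * f u)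
    (c : ℂ) (u : Cn n) : f (c • u) = c * f u := by
  conv_lhs => rw [← Complex.re_add_im c, add_smul, hadd, mul_comm, mul_smul, hI, hr, hr]
  conv_rhs => rw [← Complex.re_add_im c]
  ring

lemma vec_sum {n : ℕ} (ξ : Cn n) : ξ = ∑ j, ξ j • EuclideanSpace.single j (1:ℂ) := by
  have := (EuclideanSpace.basisFun (Fin n) ℂ).sum_repr ξ
  simpa using this.symm

lemma clin_expand {n : ℕ} (f : Cn n → ℂ) (hadd : ∀ u v, f (u + v) = f u + f v) (hs : ∀ (c : ℂ) u, f (c • u) = c * f u) (ξ : Cn n) :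
    f ξ = ∑ j, ξ j * f (EuclideanSpace.single j (1:ℂ)) := by
  let F : Cn n →ₗ[ℂ] ℂ := ⟨⟨f, hadd⟩, hs⟩
  have : F ξ = ∑ j, ξ j * F (EuclideanSpace.single j (1:ℂ)) := by
    conv_lhs => rw [vec_sum ξ, map_sum]
    simp
  exact this

lemma single_I {n : ℕ} (j : Fin n) : (EuclideanSpace.single j I : Cn n) = I • EuclideanSpace.single j (1:ℂ) := by
  ext k; by_cases h : k = j <;> simp [h]

lemma rsm {n : ℕ} (c : ℝ) (u : Cn n) : (c:ℂ) • u = c • u := by ext; simp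

lemma rlin {n : ℕ} (f : Cn n →L[ℝ] ℝ) (c : ℝ) (u : Cn n) : f ((c:ℂ) • u) = c * f u := by
  rw [rsm, map_smul, smul_eq_mul]

lemma smulI_comm {n : ℕ} (c : ℂ) (u : Cn n) : I • c • u = c • I • u := smul_comm _ _ _
lemma smulII {n : ℕ} (u : Cn n) : I • I • u = - u := by rw [smul_smul, Complex.I_mul_I]; simp

lemma delPair_eq {n : ℕ} {φ : Cn n → ℝ} {w : Cn n} (h : DifferentiableAt ℝ φ w) (ξ : Cn n) :
    delPair φ w ξ = (1/2) * ((fderiv ℝ φ w ξ : ℝ) - I * (fderiv ℝ φ w (I • ξ) : ℝ)) := by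
  set f : Cn n → ℂ := fun ξ => (1/2) * ((fderiv ℝ φ w ξ : ℝ) - I * (fderiv ℝ φ w (I • ξ) : ℝ)) with hf
  have hadd : ∀ u v, f (u + v) = f u + f v := by intro u v; simp [hf]; ring
  have hr : ∀ (c : ℝ) u, f ((c:ℂ) • u) = c * f u := by
    intro c u; simp only [hf, smulI_comm, rlin]; push_cast; ring
  have hI : ∀ u, f (I • u) = I * f u := by
    intro u; simp only [hf, smulII]; simp; linear_combination ((1/2) * (fderiv ℝ φ w (I • u) : ℂ)) * Complex.I_sq
  have := clin_expand f hadd (clin_smul f hadd hr hI) ξ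
  rw [show (1/2) * ((fderiv ℝ φ w ξ : ℝ) - I * (fderiv ℝ φ w (I • ξ) : ℝ)) = f ξ from rfl, this, delPair]
  refine Finset.sum_congr rfl fun j _ => ?_
  rw [wderiv, fderiv_realToC h, fderiv_realToC h, single_I]; simp only [hf]; ring

lemma fderiv2_cd {n : ℕ} {φ : Cn n → ℝ} {D : Set (Cn n)} (hD : IsOpen D) (hφ : ContDiffOn ℝ 2 φ D) : ContDiffOn ℝ 1 (fderiv ℝ φ) D :=
  hφ.fderiv_of_isOpen hD (m := 1) (by norm_num [one_add_one_eq_two])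

lemma levi_eq {n : ℕ} {φ : Cn n → ℝ} {D : Set (Cn n)} (hD : IsOpen D) (hφ : ContDiffOn ℝ 2 φ D) {w : Cn n} (hw : w ∈ D) (ξ : Cn n) :
    leviForm φ w ξ = (1/4) * (D2 φ w ξ ξ + D2 φ w (I • ξ) (I • ξ)) := by
  have hd : DifferentiableAt ℝ (fderiv ℝ φ) w := ((fderiv2_cd hD hφ).contDiffAt (hD.mem_nhds hw)).differentiableAt (by norm_num)
  set B := fderiv ℝ (fderiv ℝ φ) w with hB
  set S : Cn n → Cn n → ℂ := fun u v => (1/4) * ((B u v : ℝ) - I * (B u (I • v) : ℝ) + I * (B (I • u) v : ℝ) + (B (I • u) (I • v) : ℝ)) with hS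
  have key : ∀ u j, fderiv ℝ (fun v => wderiv (realToC φ) v j) w u = (1/2) * ((B u (EuclideanSpace.single j (1:ℂ)) : ℝ) - I * (B u (I • EuclideanSpace.single j (1:ℂ)) : ℝ)) := by
    intro u j
    have e1 : (fun v => wderiv (realToC φ) v j) =ᶠ[𝓝 w] fun v => (1/2) * ((fderiv ℝ φ v (EuclideanSpace.single j (1:ℂ)) : ℝ) - I * (fderiv ℝ φ v (I • EuclideanSpace.single j (1:ℂ)) : ℝ) : ℂ) := by
      filter_upwards [hD.mem_nhds hw] with v hv
      have : DifferentiableAt ℝ φ v := (hφ.contDiffAt (hD.mem_nhds hv)).differentiableAt (by norm_num)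
      rw [wderiv, fderiv_realToC this, fderiv_realToC this, single_I]
    have e2 : ∀ a : Cn n, HasFDerivAt (fun v => ((fderiv ℝ φ v a : ℝ) : ℂ)) (Complex.ofRealCLM.comp (B.flip a)) w := by
      intro a
      have : HasFDerivAt (fun v => fderiv ℝ φ v a) (B.flip a) w := by
        have := hd.hasFDerivAt.clm_apply (hasFDerivAt_const a w)
        rw [ContinuousLinearMap.comp_zero, zero_add] at this
        exact this
      exact Complex.ofRealCLM.hasFDerivAt.comp w this
    rw [e1.fderiv_eq]
    have e3 := ((e2 (EuclideanSpace.single j (1:ℂ))).sub ((e2 (I • EuclideanSpace.single j (1:ℂ))).const_mul I)).const_mul (1/2 : ℂ)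
    have := e3.fderiv
    simp only [Pi.sub_apply, Pi.sub_def] at this
    rw [this]; simp
  have hl : leviForm φ w ξ = (∑ j, ∑ k, S (EuclideanSpace.single k (1:ℂ)) (EuclideanSpace.single j (1:ℂ)) * ξ j * conj (ξ k)).re := by
    rw [leviForm]; congr 1
    refine Finset.sum_congr rfl fun j _ => Finset.sum_congr rfl fun k _ => ?_
    rw [wderivBar, key, key, single_I]; congr 2; simp only [hS]
    linear_combination (-(1/4) * (B (I • EuclideanSpace.single k (1:ℂ)) (I • EuclideanSpace.single j (1:ℂ)) : ℂ)) * Complex.I_sq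
  have hv : ∀ u, S u ξ = ∑ j, ξ j * S u (EuclideanSpace.single j (1:ℂ)) := by
    intro u
    refine clin_expand (S u) ?_ (clin_smul (S u) ?_ ?_ ?_) ξ
    · intro v v'; simp [hS]; ring
    · intro v v'; simp [hS]; ring
    · intro c v; simp only [hS, smulI_comm, rlin]; push_cast; ring
    · intro v; simp only [hS, smulII]; simp
      linear_combination (1/4) * (B u (I • v) : ℂ) * Complex.I_sq - (1/4) * (B (I • u) v : ℂ) * Complex.I_sq
  have hu : ∀ v, conj (S ξ v) = ∑ k, ξ k * conj (S (EuclideanSpace.single k (1:ℂ)) v) := by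
    intro v
    have := clin_expand (fun u => conj (S u v)) ?_ (clin_smul (fun u => conj (S u v)) ?_ ?_ ?_) ξ
    · exact this
    · intro u u'; simp [hS, map_ofNat]; ring
    · intro u u'; simp [hS, map_ofNat]; ring
    · intro c u
      have : ∀ (c:ℝ) (u v : Cn n), B ((c:ℂ) • u) v = c * B u v := by intro c u v; rw [rsm, map_smul]; simp
      simp only [hS, smulI_comm, this]; simp; ring
    · intro u; simp only [hS, smulII]; simp [map_ofNat]
      ring_nf; simp [Complex.I_sq]; ring
  have : leviForm φ w ξ = (S ξ ξ).re := by
    rw [hl, hv ξ]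
    congr 1
    refine Finset.sum_congr rfl fun j _ => ?_
    have h1 := hu (EuclideanSpace.single j (1:ℂ))
    have h2 := congrArg conj h1
    rw [map_sum, Complex.conj_conj] at h2
    rw [h2, Finset.mul_sum]
    refine Finset.sum_congr rfl fun k _ => ?_
    rw [map_mul, Complex.conj_conj]; ring
  rw [this]
  simp [hS, D2, ← hB]

lemma D2_comp {n : ℕ} {f : Cn n → ℝ} {D : Set (Cn n)} (hD : IsOpen D) (hf : ContDiffOn ℝ 2 f D) {w : Cn n} (hw : w ∈ D) {G G' : ℝ → ℝ} {c : ℝ}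
    (hG : ∀ x ∈ D, HasDerivAt G (G' (f x)) (f x)) (hG' : HasDerivAt G' c (f w)) (u v : Cn n) :
    D2 (fun x => G (f x)) w u v = c * fderiv ℝ f w u * fderiv ℝ f w v + G' (f w) * D2 f w u v := by
  have hd : DifferentiableAt ℝ (fderiv ℝ f) w := ((fderiv2_cd hD hf).contDiffAt (hD.mem_nhds hw)).differentiableAt (by norm_num)
  have hd1 : ∀ x ∈ D, DifferentiableAt ℝ f x := fun x hx => (hf.contDiffAt (hD.mem_nhds hx)).differentiableAt (by norm_num)
  have e1 : fderiv ℝ (fun x => G (f x)) =ᶠ[𝓝 w] fun x => G' (f x) • fderiv ℝ f x := by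
    filter_upwards [hD.mem_nhds hw] with x hx
    exact ((hG x hx).comp_hasFDerivAt x (hd1 x hx).hasFDerivAt).fderiv
  rw [D2, e1.fderiv_eq]
  have h2 : HasFDerivAt (fun x => G' (f x)) (c • fderiv ℝ f w) w := hG'.comp_hasFDerivAt w (hd1 w hw).hasFDerivAt
  rw [show fderiv ℝ (fun x => G' (f x) • fderiv ℝ f x) w = _ from (h2.smul hd.hasFDerivAt).fderiv]
  simp [D2]; ring

lemma levi_comp {n : ℕ} {f : Cn n → ℝ} {D : Set (Cn n)} (hD : IsOpen D) (hf : ContDiffOn ℝ 2 f D) {w : Cn n} (hw : w ∈ D) {G G' : ℝ → ℝ} {c : ℝ}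
    (hG : ∀ x ∈ D, HasDerivAt G (G' (f x)) (f x)) (hG' : HasDerivAt G' c (f w)) (hGf : ContDiffOn ℝ 2 (fun x => G (f x)) D) (ξ : Cn n) :
    leviForm (fun x => G (f x)) w ξ = c * ‖delPair f w ξ‖^2 + G' (f w) * leviForm f w ξ := by
  have hd1 : DifferentiableAt ℝ f w := (hf.contDiffAt (hD.mem_nhds hw)).differentiableAt (by norm_num)
  rw [levi_eq hD hGf hw, levi_eq hD hf hw, D2_comp hD hf hw hG hG', D2_comp hD hf hw hG hG', delPair_eq hd1]
  have : ‖(1/2 : ℂ) * ((fderiv ℝ f w ξ : ℝ) - I * (fderiv ℝ f w (I • ξ) : ℝ))‖^2 = (1/4) * ((fderiv ℝ f w ξ)^2 + (fderiv ℝ f w (I • ξ))^2) := by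
    rw [← Complex.normSq_eq_norm_sq, Complex.normSq_apply]; simp; ring
  rw [this]; ring

lemma levi_add {n : ℕ} {f g : Cn n → ℝ} {D : Set (Cn n)} (hD : IsOpen D) (hf : ContDiffOn ℝ 2 f D) (hg : ContDiffOn ℝ 2 g D) {w : Cn n} (hw : w ∈ D) (ξ : Cn n) :
    leviForm (fun x => f x + g x) w ξ = leviForm f w ξ + leviForm g w ξ := by
  have hd : ∀ {f : Cn n → ℝ}, ContDiffOn ℝ 2 f D → DifferentiableAt ℝ (fderiv ℝ f) w := fun hf => ((fderiv2_cd hD hf).contDiffAt (hD.mem_nhds hw)).differentiableAt (by norm_num)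
  have hd1 : ∀ {f : Cn n → ℝ}, ContDiffOn ℝ 2 f D → ∀ x ∈ D, DifferentiableAt ℝ f x := fun hf x hx => (hf.contDiffAt (hD.mem_nhds hx)).differentiableAt (by norm_num)
  rw [levi_eq hD (hf.add hg) hw, levi_eq hD hf hw, levi_eq hD hg hw]
  have e1 : fderiv ℝ (fun x => f x + g x) =ᶠ[𝓝 w] fun x => fderiv ℝ f x + fderiv ℝ g x := by
    filter_upwards [hD.mem_nhds hw] with x hx
    exact fderiv_fun_add (hd1 hf x hx) (hd1 hg x hx)
  simp only [D2]
  rw [e1.fderiv_eq, fderiv_fun_add (hd hf) (hd hg)]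
  simp; ring

lemma levi_normsq {n : ℕ} (w ξ : Cn n) : leviForm (fun x => ‖x‖^2) w ξ = ‖ξ‖^2 := by
  rw [levi_eq isOpen_univ (contDiff_norm_sq ℝ).contDiffOn (Set.mem_univ w)]
  have e : fderiv ℝ (fun x : Cn n => ‖x‖^2) = fun x => (2:ℝ) • innerSL ℝ x := by
    ext x : 1; rw [fderiv_norm_sq_apply]; first | rfl | (rw [two_smul, two_smul])
  have e2 : ∀ u, D2 (fun x : Cn n => ‖x‖^2) w u u = 2 * ‖u‖^2 := by
    intro u
    rw [D2, e]
    have : HasFDerivAt (fun x : Cn n => (2:ℝ) • innerSL ℝ x) ((2:ℝ) • (innerSL ℝ : Cn n →L[ℝ] Cn n →L[ℝ] ℝ)) w :=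
      (((2:ℝ) • (innerSL ℝ : Cn n →L[ℝ] Cn n →L[ℝ] ℝ))).hasFDerivAt
    rw [this.fderiv]
    have h3 : (innerSL ℝ : Cn n →L[ℝ] Cn n →L[ℝ] ℝ) u u = ‖u‖^2 := real_inner_self_eq_norm_sq u
    simp [h3]
  rw [e2, e2, norm_smul]; simp; ring
end

section
open scoped ENNReal Topology ContDiff Manifold

lemma bump_exists {n : ℕ} {F U : Set (Cn n)} (hF : IsClosed F) (hU : IsOpen U) (hFU : F ⊆ U) :
    ∃ κ : Cn n → ℝ, ∃ V W : Set (Cn n), ContDiff ℝ 2 κ ∧ (∀ x, 0 ≤ κ x ∧ κ x ≤ 1) ∧ IsOpen V ∧ F ⊆ V ∧ V ⊆ U ∧ (∀ x ∈ V, κ x = 1) ∧ IsOpen W ∧ W ∪ U = Set.univ ∧ ∀ x ∈ W, κ x = 0 := by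
  obtain ⟨V, hV, hFV, hVU⟩ := normal_exists_closure_subset hF hU hFU
  obtain ⟨V2, hV2, hVV2, hV2U⟩ := normal_exists_closure_subset isClosed_closure hU hVU
  obtain ⟨f, hf, hr, h0, h1⟩ := exists_contMDiff_zero_iff_one_iff_of_isClosed (n := (⊤:ℕ∞)) (I := 𝓘(ℝ, Cn n)) hV2.isClosed_compl (isClosed_closure (s := V))
    (Set.disjoint_left.2 fun x hx hx2 => hx (hVV2 hx2))
  refine ⟨f, V, (closure V2)ᶜ, hf.contDiff.of_le (WithTop.coe_le_coe.2 (le_top (a := (2:ℕ∞)))), fun x => hr ⟨x, rfl⟩, hV, hFV, subset_closure.trans hVU, fun x hx => (h1 x).1 (subset_closure hx), isClosed_closure.isOpen_compl, ?_,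
    fun x hx => (h0 x).1 fun h => hx (subset_closure h)⟩
  ext x; simp; by_cases hx : x ∈ closure V2
  · exact Or.inr (hV2U hx)
  · exact Or.inl hx

lemma D2_contOn {n : ℕ} {f : Cn n → ℝ} {D : Set (Cn n)} (hD : IsOpen D) (hf : ContDiffOn ℝ 2 f D) :
    ContinuousOn (fun q : Cn n × Cn n => D2 f q.1 q.2 q.2) (D ×ˢ Set.univ) := by
  have h1 : ContinuousOn (fderiv ℝ (fderiv ℝ f)) D :=
    ((fderiv2_cd hD hf).fderiv_of_isOpen hD (m := 0) (by norm_num)).continuousOn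
  have h2 : ContinuousOn (fun q : Cn n × Cn n => fderiv ℝ (fderiv ℝ f) q.1) (D ×ˢ Set.univ) := h1.comp continuousOn_fst (fun q hq => hq.1)
  exact (h2.clm_apply continuousOn_snd).clm_apply continuousOn_snd

lemma levi_contOn {n : ℕ} {f : Cn n → ℝ} {D : Set (Cn n)} (hD : IsOpen D) (hf : ContDiffOn ℝ 2 f D) :
    ContinuousOn (fun q : Cn n × Cn n => leviForm f q.1 q.2) (D ×ˢ Set.univ) := by
  have h := D2_contOn hD hf
  have h2 : ContinuousOn (fun q : Cn n × Cn n => D2 f q.1 (I • q.2) (I • q.2)) (D ×ˢ Set.univ) :=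
    h.comp (f := fun q : Cn n × Cn n => (q.1, I • q.2)) (by fun_prop) (fun q hq => ⟨hq.1, trivial⟩)
  refine ((continuousOn_const (c := (1/4:ℝ))).mul (h.add h2)).congr fun q hq => ?_
  rw [levi_eq hD hf hq.1]; rfl

lemma delPair_contOn {n : ℕ} {f : Cn n → ℝ} {D : Set (Cn n)} (hD : IsOpen D) (hf : ContDiffOn ℝ 2 f D) :
    ContinuousOn (fun q : Cn n × Cn n => delPair f q.1 q.2) (D ×ˢ Set.univ) := by
  have h1 : ∀ j, ContinuousOn (fun q : Cn n × Cn n => wderiv (realToC f) q.1 j) (D ×ˢ Set.univ) := fun j =>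
    (wderiv_cd hD (m := 1) (realToC_cd (m := 2) hf) j).continuousOn.comp continuousOn_fst (fun q hq => hq.1)
  unfold delPair
  refine continuousOn_finsetSum _ fun j _ => (h1 j).mul ?_
  fun_prop

lemma levi_hom {n : ℕ} {f : Cn n → ℝ} {w ξ : Cn n} (c : ℝ) : leviForm f w ((c:ℂ) • ξ) = c^2 * leviForm f w ξ := by
  have : ∀ x : ℂ, c^2 * x.re = ((c^2 : ℝ) * x).re := fun x => by rw [Complex.re_ofReal_mul]
  simp only [leviForm]
  rw [this, Finset.mul_sum]
  congr 1
  refine Finset.sum_congr rfl fun j _ => ?_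
  rw [Finset.mul_sum]
  refine Finset.sum_congr rfl fun k _ => ?_
  simp; ring

lemma levi_congr {n : ℕ} {f g : Cn n → ℝ} {w ξ : Cn n} (h : f =ᶠ[𝓝 w] g) : leviForm f w ξ = leviForm g w ξ := by
  have h1 : ∀ᶠ x in 𝓝 w, realToC f =ᶠ[𝓝 x] realToC g := by
    refine (eventually_eventually_nhds.2 h).mono fun x hx => hx.mono fun y hy => ?_
    simp [realToC, hy]
  have h2 : ∀ j, (fun v => wderiv (realToC f) v j) =ᶠ[𝓝 w] (fun v => wderiv (realToC g) v j) := fun j =>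
    h1.mono fun x hx => by simp only [wderiv, hx.fderiv_eq]
  simp only [leviForm, wderivBar, (h2 _).fderiv_eq]

/-- a global defining function, strictly psh near the boundary -/
lemma global_def {n : ℕ} (D U : Set (Cn n)) (ρ : Cn n → ℝ)
    (hDo : IsOpen D) (hDb : Bornology.IsBounded D)
    (hUo : IsOpen U) (hUb : frontier D ⊆ U)
    (hρ : ContDiffOn ℝ 2 ρ U)
    (hdef : U ∩ D = {w ∈ U | ρ w < 0})
    (hgrad : ∀ w ∈ U, fderiv ℝ ρ w ≠ 0)
    (hpsc : ∀ w ∈ frontier D, ∀ ξ : Cn n, ξ ≠ 0 → delPair ρ w ξ = 0 → 0 < leviForm ρ w ξ) :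
    ∃ r : Cn n → ℝ, ∃ c > 0, ∃ t > 0, ContDiff ℝ 2 r ∧ (∀ x, x ∈ D ↔ r x < 0) ∧
      (∀ w ∈ D, -t < r w → (∀ ξ, c * ‖ξ‖^2 ≤ leviForm r w ξ) ∧ c ≤ ‖fderiv ℝ r w‖) := by
  have hFc : IsCompact (frontier D) := Metric.isCompact_of_isClosed_isBounded isClosed_frontier ((hDb.closure).subset frontier_subset_closure)
  have hFD : ∀ x ∈ frontier D, x ∉ D := fun x hx h => by rw [hDo.frontier_eq] at hx; exact hx.2 h
  have hmem : ∀ x ∈ U, (x ∈ D ↔ ρ x < 0) := fun x hx => by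
    have := Set.ext_iff.1 hdef x; simp [hx] at this; exact this
  obtain ⟨κ, V, W, hκ, hκ01, hV, hFV, hVU, hV1, hW, hWU, hW0⟩ := bump_exists isClosed_frontier hUo hUb
  have hρ0 : ∀ x ∈ frontier D, ρ x = 0 := by
    intro x hx
    have h1 : 0 ≤ ρ x := not_lt.1 fun h => hFD x hx ((hmem x (hUb hx)).2 h)
    have hc : ContinuousAt ρ x := hρ.continuousOn.continuousAt (hUo.mem_nhds (hUb hx))
    by_contra h2
    have h3 : 0 < ρ x := lt_of_le_of_ne h1 (Ne.symm h2)
    have h4 : ∀ᶠ y in 𝓝 x, y ∉ D := by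
      filter_upwards [hc.eventually (lt_mem_nhds h3), hUo.mem_nhds (hUb hx)] with y hy hyU hyD
      exact absurd ((hmem y hyU).1 hyD) (not_lt.2 hy.le)
    have h5 : x ∈ closure D := frontier_subset_closure hx
    rw [mem_closure_iff_frequently] at h5
    exact h5 h4
  -- choice of λ
  set S := Metric.sphere (0 : Cn n) 1 with hS
  have hSc : IsCompact S := isCompact_sphere _ _
  have hFS : IsCompact (frontier D ×ˢ S) := hFc.prod hSc
  have hsub : frontier D ×ˢ S ⊆ U ×ˢ Set.univ := Set.prod_mono hUb (Set.subset_univ _)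
  have hLc : ContinuousOn (fun q : Cn n × Cn n => leviForm ρ q.1 q.2) (frontier D ×ˢ S) := (levi_contOn hUo hρ).mono hsub
  have hdc : ContinuousOn (fun q : Cn n × Cn n => ‖delPair ρ q.1 q.2‖^2) (frontier D ×ˢ S) := ((delPair_contOn hUo hρ).mono hsub).norm.pow 2
  obtain ⟨lam, hlam, hlamp⟩ : ∃ lam : ℝ, 0 < lam ∧ ∀ q ∈ frontier D ×ˢ S, 0 < leviForm ρ q.1 q.2 + lam * ‖delPair ρ q.1 q.2‖^2 := by
    set Z := (frontier D ×ˢ S) ∩ (fun q : Cn n × Cn n => leviForm ρ q.1 q.2) ⁻¹' (Set.Iic 0) with hZ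
    have hZc : IsCompact Z := hFS.of_isClosed_subset (hLc.preimage_isClosed_of_isClosed hFS.isClosed isClosed_Iic) Set.inter_subset_left
    obtain ⟨b, hb, hbZ⟩ := hZc.exists_forall_le' (a := (0:ℝ)) (hdc.mono Set.inter_subset_left) (by
      intro q hq
      have : delPair ρ q.1 q.2 ≠ 0 := fun h => by
        have h1 : q.2 ≠ 0 := fun h0 => by have := hq.1.2; rw [h0] at this; simp [hS] at this
        exact absurd (hpsc q.1 hq.1.1 q.2 h1 h) (not_lt.2 hq.2)
      positivity)
    obtain ⟨A, hA⟩ := hZc.exists_bound_of_continuousOn (hLc.mono Set.inter_subset_left)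
    refine ⟨(|A| + 1) / b, by positivity, fun q hq => ?_⟩
    by_cases hqz : q ∈ Z
    · have h1 := hA q hqz; have h2 := hbZ q hqz
      rw [Real.norm_eq_abs] at h1
      have h3 := neg_abs_le (leviForm ρ q.1 q.2)
      have h4 : |A| + 1 ≤ (|A| + 1) / b * ‖delPair ρ q.1 q.2‖^2 := by
        rw [div_mul_eq_mul_div, le_div_iff₀ hb]; gcongr
      linarith [le_abs_self A]
    · have h1 : 0 < leviForm ρ q.1 q.2 := not_le.1 fun h => hqz ⟨hq, h⟩
      positivity
  classical
  set σ : Cn n → ℝ := fun x => if x ∈ D then -1 else 1 with hσ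
  set G : ℝ → ℝ := fun x => Real.exp (lam * x) - 1 with hG
  have hGcd : ContDiff ℝ 2 G := by simp only [hG]; fun_prop
  have hGρ : ContDiffOn ℝ 2 (fun x => G (ρ x)) U := hGcd.comp_contDiffOn hρ
  set r : Cn n → ℝ := fun x => κ x * G (ρ x) + (1 - κ x) * σ x with hr
  have c1 : ContDiff ℝ 2 (fun x => κ x * G (ρ x)) := by
    rw [contDiff_iff_contDiffAt]; intro x
    by_cases hx : x ∈ U
    · exact hκ.contDiffAt.mul (hGρ.contDiffAt (hUo.mem_nhds hx))
    · have hxW : x ∈ W := by have : x ∈ W ∪ U := hWU ▸ trivial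
                             exact this.resolve_right hx
      refine (contDiffAt_const (c := (0:ℝ))).congr_of_eventuallyEq ?_
      filter_upwards [hW.mem_nhds hxW] with y hy; simp [hW0 y hy]
  have c2 : ContDiff ℝ 2 (fun x => (1 - κ x) * σ x) := by
    rw [contDiff_iff_contDiffAt]; intro x
    by_cases hx : x ∈ frontier D
    · refine (contDiffAt_const (c := (0:ℝ))).congr_of_eventuallyEq ?_
      filter_upwards [hV.mem_nhds (hFV hx)] with y hy; simp [hV1 y hy]
    · refine (contDiffAt_const.sub hκ.contDiffAt).mul ?_
      by_cases hxD : x ∈ D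
      · refine (contDiffAt_const (c := (-1:ℝ))).congr_of_eventuallyEq ?_
        filter_upwards [hDo.mem_nhds hxD] with y hy; simp [hσ, hy]
      · have hxc : x ∉ closure D := fun h => hx (by rw [hDo.frontier_eq]; exact ⟨h, hxD⟩)
        refine (contDiffAt_const (c := (1:ℝ))).congr_of_eventuallyEq ?_
        filter_upwards [isClosed_closure.isOpen_compl.mem_nhds hxc] with y hy
        have hyD : y ∉ D := fun h => hy (subset_closure h)
        simp [hσ, hyD]
  have hrcd : ContDiff ℝ 2 r := c1.add c2
  have hGneg : ∀ x, x < 0 → G x < 0 := fun x hx => by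
    have : Real.exp (lam * x) < 1 := Real.exp_lt_one_iff.2 (mul_neg_of_pos_of_neg hlam hx)
    simp only [hG]; linarith
  have hGnn : ∀ x, 0 ≤ x → 0 ≤ G x := fun x hx => by
    have := Real.one_le_exp (mul_nonneg hlam.le hx)
    simp only [hG]; linarith
  have hrD : ∀ x, x ∈ D ↔ r x < 0 := by
    intro x
    have h01 := hκ01 x
    constructor
    · intro hx
      simp only [hr, hσ, hx, if_true]
      by_cases hk : κ x = 0
      · simp [hk]
      · have hxU : x ∈ U := by
          have : x ∈ W ∪ U := hWU ▸ trivial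
          exact this.resolve_left fun h => hk (hW0 x h)
        have := hGneg _ ((hmem x hxU).1 hx)
        have hk0 : 0 < κ x := lt_of_le_of_ne h01.1 (Ne.symm hk)
        nlinarith
    · intro h; by_contra hx
      simp only [hr, hσ, hx, if_false] at h
      by_cases hk : κ x = 0
      · simp [hk] at h; linarith
      · have hxU : x ∈ U := by
          have : x ∈ W ∪ U := hWU ▸ trivial
          exact this.resolve_left fun h => hk (hW0 x h)
        have := hGnn (ρ x) (not_lt.1 fun h => hx ((hmem x hxU).2 h))
        nlinarith [mul_nonneg h01.1 this]
  have hgerm : ∀ w ∈ V, r =ᶠ[𝓝 w] fun x => G (ρ x) := fun w hw => by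
    filter_upwards [hV.mem_nhds hw] with y hy; simp [hr, hV1 y hy]
  have hGd : ∀ x, HasDerivAt G (lam * Real.exp (lam * x)) x := fun x => by
    have := ((hasDerivAt_id x).const_mul lam).exp.sub_const 1
    simpa [hG, mul_comm] using this
  have hGd2 : ∀ x, HasDerivAt (fun x => lam * Real.exp (lam * x)) (lam * (lam * Real.exp (lam * x))) x := fun x => by
    have := (((hasDerivAt_id x).const_mul lam).exp).const_mul lam
    simpa [mul_comm] using this
  have hLev : ∀ w ∈ frontier D, ∀ ξ ∈ S, 0 < leviForm r w ξ := by
    intro w hw ξ hξ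
    rw [levi_congr (hgerm w (hFV hw)), levi_comp hUo hρ (hUb hw) (fun x _ => hGd (ρ x)) (hGd2 (ρ w)) hGρ, hρ0 w hw]
    have := hlamp (w, ξ) ⟨hw, hξ⟩
    simp only [mul_zero, Real.exp_zero, mul_one] at this ⊢
    nlinarith
  have hgr : ∀ w ∈ frontier D, 0 < ‖fderiv ℝ r w‖ := by
    intro w hw
    rw [(hgerm w (hFV hw)).fderiv_eq, norm_pos_iff]
    have hd : DifferentiableAt ℝ ρ w := (hρ.contDiffAt (hUo.mem_nhds (hUb hw))).differentiableAt (by norm_num)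
    have := ((hGd (ρ w)).comp_hasFDerivAt w hd.hasFDerivAt).fderiv
    simp only [Function.comp_def] at this
    rw [this, hρ0 w hw]
    simp [hlam.ne', hgrad w (hUb hw)]
  -- uniform constants
  have hLr : Continuous (fun q : Cn n × Cn n => leviForm r q.1 q.2) := by
    have := levi_contOn isOpen_univ hrcd.contDiffOn
    rwa [Set.univ_prod_univ, continuousOn_univ] at this
  have hfr : Continuous (fun w => ‖fderiv ℝ r w‖) := (hrcd.continuous_fderiv (by norm_num)).norm
  obtain ⟨c1, hc1, hc1F⟩ := hFS.exists_forall_le' (a := (0:ℝ)) hLr.continuousOn (fun q hq => hLev q.1 hq.1 q.2 hq.2)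
  obtain ⟨c2, hc2, hc2F⟩ := hFc.exists_forall_le' (a := (0:ℝ)) hfr.continuousOn hgr
  set c := min c1 c2 / 2 with hc
  have hcpos : 0 < c := by have := lt_min hc1 hc2; positivity
  have hcc1 : c < c1 := by have := min_le_left c1 c2; have := lt_min hc1 hc2; linarith
  have hcc2 : c < c2 := by have := min_le_right c1 c2; have := lt_min hc1 hc2; linarith
  set Gd : Set (Cn n) := {w | (∀ ξ ∈ S, c < leviForm r w ξ) ∧ c < ‖fderiv ℝ r w‖} with hGds
  have hFG : ∀ w ∈ frontier D, Gd ∈ 𝓝 w := by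
    intro w hw
    have h1 : ∀ᶠ x in 𝓝 w, ∀ ξ ∈ S, c < leviForm r x ξ := by
      refine hSc.eventually_forall_of_forall_eventually fun ξ hξ => ?_
      exact hLr.continuousAt.eventually (lt_mem_nhds (hcc1.trans_le (hc1F (w, ξ) ⟨hw, hξ⟩)))
    have h2 : ∀ᶠ x in 𝓝 w, c < ‖fderiv ℝ r x‖ := hfr.continuousAt.eventually (lt_mem_nhds (hcc2.trans_le (hc2F w hw)))
    filter_upwards [h1, h2] with x a b using ⟨a, b⟩
  have hKc : IsCompact (closure D \ interior Gd) :=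
    (Metric.isCompact_of_isClosed_isBounded isClosed_closure hDb.closure).diff isOpen_interior
  obtain ⟨t, ht, htK⟩ := hKc.exists_forall_le' (f := fun x => - r x) (a := (0:ℝ)) hrcd.continuous.neg.continuousOn (by
    intro x hx
    have hxD : x ∈ D := by
      by_contra h
      exact hx.2 (mem_interior_iff_mem_nhds.2 (hFG x (by rw [hDo.frontier_eq]; exact ⟨hx.1, h⟩)))
    have := (hrD x).1 hxD
    linarith)
  refine ⟨r, c, hcpos, t, ht, hrcd, hrD, fun w hw hwt => ?_⟩
  have hwG : w ∈ Gd := by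
    by_contra h
    have := htK w ⟨subset_closure hw, fun h' => h (interior_subset h')⟩
    linarith
  refine ⟨fun ξ => ?_, hwG.2.le⟩
  by_cases hξ : ξ = 0
  · subst hξ; simp [leviForm]
  · have hn : 0 < ‖ξ‖ := norm_pos_iff.2 hξ
    have h1 : ξ = ((‖ξ‖ : ℝ) : ℂ) • ((‖ξ‖⁻¹ : ℝ) : ℂ) • ξ := by
      rw [smul_smul, ← Complex.ofReal_mul, mul_inv_cancel₀ hn.ne']; simp
    have h2 : ((‖ξ‖⁻¹ : ℝ) : ℂ) • ξ ∈ S := by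
      simp only [hS, mem_sphere_zero_iff_norm, norm_smul]; simp [hn.ne']
    have h3 := hwG.1 _ h2
    conv_rhs => rw [h1, levi_hom]
    nlinarith [sq_nonneg ‖ξ‖]
end

section
open scoped ENNReal Topology ContDiff

lemma mp_deriv (j : ℕ) (x : ℝ) : HasDerivAt (fun s : ℝ => (max s 0)^(j+2)) ((j+2) * (max x 0)^(j+1)) x := by
  rcases lt_trichotomy x 0 with h | h | h
  · have : (fun s : ℝ => (max s 0)^(j+2)) =ᶠ[𝓝 x] fun _ => 0 := by
      filter_upwards [gt_mem_nhds h] with s hs; simp [max_eq_right hs.le]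
    rw [max_eq_right h.le]; simpa using (hasDerivAt_const x (0:ℝ)).congr_of_eventuallyEq this
  · subst h
    simp only [max_self, ne_eq, Nat.add_eq_zero_iff, one_ne_zero, and_false, not_false_eq_true, zero_pow, mul_zero]
    rw [hasDerivAt_iff_isLittleO]
    simp only [max_self, sub_zero, smul_zero]
    have h1 : (fun s : ℝ => (max s 0)^(j+2) - 0^(j+2)) =O[𝓝 0] fun s : ℝ => s^2 := by
      refine Asymptotics.IsBigO.of_bound 1 ?_
      filter_upwards [gt_mem_nhds (zero_lt_one (α := ℝ))] with s hs
      have h0 : 0 ≤ max s 0 := le_max_right _ _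
      have h1 : max s 0 ≤ 1 := max_le hs.le zero_le_one
      have h2 : (max s 0)^2 ≤ s^2 := by
        rcases le_total s 0 with h | h
        · rw [max_eq_right h]; simpa using sq_nonneg s
        · rw [max_eq_left h]
      simp only [ne_eq, Nat.add_eq_zero_iff, OfNat.ofNat_ne_zero, and_false, not_false_eq_true, zero_pow, sub_zero, norm_pow, Real.norm_eq_abs, abs_of_nonneg h0, one_mul, sq_abs]
      rw [pow_add]
      exact (mul_le_of_le_one_left (by positivity) (pow_le_one₀ h0 h1)).trans h2
    have h2 : (fun s : ℝ => s^2) =o[𝓝 0] fun s : ℝ => s := Asymptotics.isLittleO_pow_id one_lt_two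
    have := h1.trans_isLittleO h2
    simpa using this
  · have : (fun s : ℝ => (max s 0)^(j+2)) =ᶠ[𝓝 x] fun s => s^(j+2) := by
      filter_upwards [lt_mem_nhds h] with s hs; simp [max_eq_left hs.le]
    rw [max_eq_left h.le]
    have h2 := (hasDerivAt_pow (j+2) x).congr_of_eventuallyEq this
    have e : ((j:ℝ) + 2) * x ^ (j+1) = ((j+2 : ℕ) : ℝ) * x ^ (j + 2 - 1) := by push_cast; rfl
    rw [e]; exact h2

lemma mp_cd : ContDiff ℝ 2 (fun s : ℝ => (max s 0)^4) := by
  have d1 : deriv (fun s : ℝ => (max s 0)^4) = fun x => 4 * (max x 0)^3 := by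
    ext x; rw [(mp_deriv 2 x).deriv]; norm_num
  have d2 : deriv (fun s : ℝ => 4 * (max s 0)^3) = fun x => 4 * (3 * (max x 0)^2) := by
    ext x; rw [((mp_deriv 1 x).const_mul 4).deriv]; norm_num
  rw [show (2 : WithTop ℕ∞) = 1 + 1 by norm_num, contDiff_succ_iff_deriv]
  refine ⟨fun x => (mp_deriv 2 x).differentiableAt, by simp, ?_⟩
  rw [d1, contDiff_one_iff_deriv]
  refine ⟨fun x => ((mp_deriv 1 x).const_mul 4).differentiableAt, ?_⟩
  rw [d2]; fun_prop

lemma st_deriv : ∃ C : ℝ, 0 < C ∧ (∀ x, |deriv Real.smoothTransition x| ≤ C) ∧ ∀ x, x ∉ Set.Icc (0:ℝ) 1 → deriv Real.smoothTransition x = 0 := by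
  have hz : ∀ x, x ∉ Set.Icc (0:ℝ) 1 → deriv Real.smoothTransition x = 0 := by
    intro x hx
    rw [Set.mem_Icc, not_and_or, not_le, not_le] at hx
    rcases hx with h | h
    · have : Real.smoothTransition =ᶠ[𝓝 x] fun _ => 0 := by
        filter_upwards [gt_mem_nhds h] with s hs; exact Real.smoothTransition.zero_of_nonpos hs.le
      rw [this.deriv_eq]; simp
    · have : Real.smoothTransition =ᶠ[𝓝 x] fun _ => 1 := by
        filter_upwards [lt_mem_nhds h] with s hs; exact Real.smoothTransition.one_of_one_le hs.le
      rw [this.deriv_eq]; simp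
  have hc : Continuous (deriv Real.smoothTransition) := (Real.smoothTransition.contDiff (n := 1)).continuous_deriv le_rfl
  obtain ⟨C, hC⟩ := (isCompact_Icc (a := (0:ℝ)) (b := 1)).exists_bound_of_continuousOn hc.continuousOn
  refine ⟨|C| + 1, by positivity, fun x => ?_, hz⟩
  by_cases hx : x ∈ Set.Icc (0:ℝ) 1
  · exact ((hC x hx).trans (le_abs_self C)).trans (by linarith)
  · rw [hz x hx]; simp; positivity

lemma wderiv_norm_le {n : ℕ} {f : Cn n → ℝ} {x : Cn n} (h : DifferentiableAt ℝ f x) (j : Fin n) : ‖wderiv (realToC f) x j‖ ≤ ‖fderiv ℝ f x‖ := by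
  rw [wderiv, fderiv_realToC h, fderiv_realToC h]
  have h1 : |fderiv ℝ f x (EuclideanSpace.single j (1:ℂ))| ≤ ‖fderiv ℝ f x‖ := by simpa using (fderiv ℝ f x).le_opNorm (EuclideanSpace.single j (1:ℂ))
  have h2 : |fderiv ℝ f x (EuclideanSpace.single j I)| ≤ ‖fderiv ℝ f x‖ := by simpa using (fderiv ℝ f x).le_opNorm (EuclideanSpace.single j I)
  rw [norm_mul]
  have h3 := norm_sub_le ((fderiv ℝ f x (EuclideanSpace.single j (1:ℂ)) : ℝ) : ℂ) (I * (fderiv ℝ f x (EuclideanSpace.single j I) : ℝ))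
  rw [norm_mul, Complex.norm_I, one_mul, Complex.norm_real, Complex.norm_real, Real.norm_eq_abs, Real.norm_eq_abs] at h3
  have : ‖(1/2:ℂ)‖ = 1/2 := by norm_num
  rw [this]; linarith

lemma star2 {n : ℕ} {D : Set (Cn n)} (hDb : Bornology.IsBounded D) {r : Cn n → ℝ} {c t : ℝ} (hc : 0 < c) (ht : 0 < t) (hr : ContDiff ℝ 2 r)
    (hrD : ∀ x, x ∈ D ↔ r x < 0) (hlev : ∀ w ∈ D, -t < r w → ∀ ξ, c * ‖ξ‖^2 ≤ leviForm r w ξ) :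
    ∃ R : ℝ, 0 < R ∧ ∀ γ α : Fin n → Cn n → ℂ, (∀ j, TF D (γ j)) → (∀ j, MemLp (α j) 2 ((dVol n).restrict D)) →
    (∀ W, TF D W → ∀ j k, ∫ x in D, α j x * wderivBar W x k - α k x * wderivBar W x j ∂(dVol n) = 0) →
    ‖∫ x in D, ∑ j, α j x * conj (γ j x) ∂(dVol n)‖^2 ≤
      (∫ x in D, ∑ j, ‖α j x‖^2 ∂(dVol n)) * (R * ∫ x in D, ‖∑ j, wderiv (γ j) x j‖^2 ∂(dVol n)) := by
  have hDe : D = r ⁻¹' Set.Iio 0 := by ext x; exact hrD x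
  have hD : IsOpen D := hDe ▸ isOpen_Iio.preimage hr.continuous
  obtain ⟨R0, hR0⟩ := hDb.exists_norm_le
  refine ⟨4 * Real.exp (R0^2), by positivity, fun γ α hγ hα hαc => ?_⟩
  obtain ⟨Cτ, hCτ, hτb, hτz⟩ := st_deriv
  have hclc : IsCompact (closure D) := Metric.isCompact_of_isClosed_isBounded isClosed_closure hDb.closure
  obtain ⟨C1, hC1⟩ := hclc.exists_bound_of_continuousOn (hr.continuous_fderiv (by norm_num)).continuousOn
  have hKc : IsCompact (⋃ j, tsupport (γ j)) := isCompact_iUnion fun j => (hγ j).2.1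
  obtain ⟨t0, ht0, ht0K⟩ := hKc.exists_forall_le' (f := fun x => - r x) (a := (0:ℝ)) hr.continuous.neg.continuousOn (by
    intro x hx
    obtain ⟨j, hj⟩ := Set.mem_iUnion.1 hx
    have := (hrD x).1 ((hγ j).2.2 hj)
    linarith)
  obtain ⟨k, hk⟩ := exists_nat_gt (max (1/t0) (1/t))
  have hk0 : (0:ℝ) < k := lt_of_lt_of_le (by positivity) ((le_max_left (1/t0) (1/t)).trans hk.le)
  have hkt0 : 1/t0 < k := (le_max_left _ _).trans_lt hk
  have hkt : 1/t < k := (le_max_right _ _).trans_lt hk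
  set g : ℝ → ℝ := fun x => (max (-x⁻¹ - k) 0)^4 with hg
  set g' : ℝ → ℝ := fun x => 4 * (max (-x⁻¹ - k) 0)^3 * (x^2)⁻¹ with hg'
  have hψd : ∀ x : ℝ, x < 0 → HasDerivAt (fun x : ℝ => -x⁻¹ - k) ((x^2)⁻¹) x := fun x hx => by
    simpa using (hasDerivAt_inv hx.ne).neg.sub_const (k:ℝ)
  have hgd : ∀ x : ℝ, x < 0 → HasDerivAt g (g' x) x := fun x hx => by
    have h1 := (mp_deriv 2 (-x⁻¹ - k)).comp x (hψd x hx)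
    have e : g' x = ((2:ℕ) + 2) * (max (-x⁻¹ - k) 0)^(2+1) * (x^2)⁻¹ := by simp only [hg']; norm_num
    rw [e]; exact h1
  have hgd2 : ∀ x : ℝ, x < 0 → ∃ a, 0 ≤ a ∧ HasDerivAt g' a x := fun x hx => by
    have h1 := (mp_deriv 1 (-x⁻¹ - k)).comp x (hψd x hx)
    have h2 : HasDerivAt (fun x : ℝ => (x^2)⁻¹) (-(2 * x) / (x^2)^2) x := by
      have := (hasDerivAt_pow 2 x).inv (pow_ne_zero 2 hx.ne)
      have e2 : HasDerivAt (fun x : ℝ => (x^2)⁻¹) (-(((2:ℕ):ℝ) * x^(2-1)) / (x^2)^2) x := this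
      simpa using e2
    have h3 := (h1.const_mul 4).mul h2
    have e : g' = fun x : ℝ => 4 * (max (-x⁻¹ - k) 0)^(1+2) * (x^2)⁻¹ := rfl
    refine ⟨_, ?_, by rw [e]; exact h3⟩
    have m0 : 0 ≤ max (-x⁻¹ - k) 0 := le_max_right _ _
    have : 0 ≤ -(2 * x) / (x^2)^2 := div_nonneg (by linarith) (by positivity)
    simp only [Function.comp]
    positivity
  set φ : Cn n → ℝ := fun x => ‖x‖^2 + g (r x) with hφ
  set lam : Cn n → ℝ := fun x => 1 + c * g' (r x) with hlam
  have hgcd : ContDiffOn ℝ 2 (fun x => g (r x)) D := by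
    have h1 : ContDiffOn ℝ 2 (fun x => - (r x)⁻¹ - k) D :=
      (((hr.contDiffOn).inv fun x hx => ((hrD x).1 hx).ne).neg).sub contDiffOn_const
    exact mp_cd.comp_contDiffOn h1
  have hncd : ContDiffOn ℝ 2 (fun x : Cn n => ‖x‖^2) D := (contDiff_norm_sq ℝ).contDiffOn
  have hg'0 : ∀ x, 0 ≤ g' x := fun x => by
    have m0 : 0 ≤ max (-x⁻¹ - k) 0 := le_max_right _ _
    simp only [hg']; positivity
  have hlc : ContinuousOn lam D := by
    have h1 : ContinuousOn (fun x => (r x)⁻¹) D := hr.continuous.continuousOn.inv₀ fun x hx => ((hrD x).1 hx).ne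
    have h2 : ContinuousOn (fun x => ((r x)^2)⁻¹) D := (hr.continuous.continuousOn.pow 2).inv₀ fun x hx => pow_ne_zero 2 ((hrD x).1 hx).ne
    have h3 : Continuous (fun s : ℝ => 4 * (max (-s - k) 0)^3) := by fun_prop
    exact continuousOn_const.add (continuousOn_const.mul ((h3.comp_continuousOn h1).mul h2))
  have hl1 : ∀ x ∈ D, 1 ≤ lam x := fun x _ => by have := mul_nonneg hc.le (hg'0 (r x)); simp only [hlam]; linarith
  have hphilev : ∀ x ∈ D, ∀ ξ, lam x * ‖ξ‖^2 ≤ leviForm φ x ξ := by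
    intro x hx ξ
    have hrx := (hrD x).1 hx
    obtain ⟨a, ha0, ha⟩ := hgd2 (r x) hrx
    rw [hφ, levi_add hD hncd hgcd hx, levi_normsq, levi_comp hD hr.contDiffOn hx (fun y hy => hgd _ ((hrD y).1 hy)) ha hgcd]
    have h1 : g' (r x) * (c * ‖ξ‖^2) ≤ g' (r x) * leviForm r x ξ := by
      by_cases hgz : g' (r x) = 0
      · simp [hgz]
      · refine mul_le_mul_of_nonneg_left (hlev x hx ?_ ξ) (hg'0 _)
        by_contra hcon
        rw [not_lt] at hcon
        apply hgz
        have h2 : -(r x)⁻¹ ≤ 1/t := by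
          rw [← inv_neg, one_div]; exact inv_anti₀ ht (by linarith)
        have : max (-(r x)⁻¹ - k) 0 = 0 := max_eq_right (by linarith)
        simp only [hg', this]; simp
    have h2 : 0 ≤ a * ‖delPair r x ξ‖^2 := by positivity
    simp only [hlam]; nlinarith
  set M : ℕ → ℝ := fun m => m + 2 * k + 1 with hM
  have hMpos : ∀ m, 0 < M m := fun m => by simp only [hM]; positivity
  set h : ℕ → Cn n → ℝ := fun m x => Real.smoothTransition (- 2 * M m * r x - 1) with hh
  have hhcd : ∀ m, ContDiff ℝ 2 (h m) := fun m =>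
    Real.smoothTransition.contDiff.comp (((contDiff_const.mul hr)).sub contDiff_const)
  have hhz : ∀ m, tsupport (h m) ⊆ r ⁻¹' Set.Iic (-(1/(2 * M m))) := by
    intro m
    refine closure_minimal ?_ (isClosed_Iic.preimage hr.continuous)
    intro x hx
    have h1 : 0 < - 2 * M m * r x - 1 := by
      by_contra hcon
      exact hx (Real.smoothTransition.zero_of_nonpos (not_lt.1 hcon))
    have h2 := hMpos m
    show r x ≤ -(1/(2 * M m))
    rw [← neg_div, le_div_iff₀ (by positivity)]; linarith
  have hhs : ∀ m, tsupport (h m) ⊆ D := fun m x hx => (hrD x).2 (lt_of_le_of_lt (hhz m hx) (by have := hMpos m; rw [neg_lt_zero]; positivity))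
  set C2 : ℝ := (n:ℝ)^2 * (2 * Cτ * |C1|)^4 with hC2
  have hfin := star (lam := lam) (h := h) (η := fun m => 2 * C2 / (c * M m)) hD (hncd.add hgcd) ?_ hlc hl1 hphilev hhcd ?_ hhs ?_ ?_ ?_ ?_ ?_ hγ (R := R0^2) ?_ hα hαc
  · exact hfin
  · intro x hx; simp only [Pi.add_apply, hg]; positivity
  · intro m; exact Metric.isCompact_of_isClosed_isBounded (isClosed_tsupport _) (hDb.subset (hhs m))
  · intro m; have := hMpos m; positivity
  · intro m x; rw [abs_of_nonneg (Real.smoothTransition.nonneg _)]; exact Real.smoothTransition.le_one _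
  · intro m x hx
    have hrx := (hrD x).1 hx
    have hMm := hMpos m
    have hd : DifferentiableAt ℝ (h m) x := (hhcd m).differentiable (by norm_num) x
    have hrd : DifferentiableAt ℝ r x := hr.differentiable (by norm_num) x
    have hst : HasDerivAt Real.smoothTransition (deriv Real.smoothTransition (-2 * M m * r x - 1)) (-2 * M m * r x - 1) :=
      ((Real.smoothTransition.contDiff (n := 1)).differentiable (by norm_num) _).hasDerivAt
    have hf : fderiv ℝ (h m) x = deriv Real.smoothTransition (-2 * M m * r x - 1) • ((-2 * M m) • fderiv ℝ r x) := by
      have h0 : HasFDerivAt (fun x => -2 * M m * r x - 1) ((-2 * M m) • fderiv ℝ r x) x :=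
        (hrd.hasFDerivAt.const_mul (-2 * M m)).sub_const 1
      exact (HasDerivAt.comp_hasFDerivAt x hst h0).fderiv
    have hwn : (∑ j, ‖wderiv (realToC (h m)) x j‖^2)^2 ≤ (n:ℝ)^2 * ‖fderiv ℝ (h m) x‖^4 := by
      have h1 : ∑ j, ‖wderiv (realToC (h m)) x j‖^2 ≤ n * ‖fderiv ℝ (h m) x‖^2 := by
        calc _ ≤ ∑ j : Fin n, ‖fderiv ℝ (h m) x‖^2 := Finset.sum_le_sum fun j _ => by gcongr; exact wderiv_norm_le hd j
          _ = _ := by simp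
      calc _ ≤ (n * ‖fderiv ℝ (h m) x‖^2)^2 := by gcongr
        _ = _ := by ring
    refine hwn.trans ?_
    have hnn : 0 ≤ 2 * C2 / (c * M m) := by positivity
    by_cases hI : -2 * M m * r x - 1 ∈ Set.Icc (0:ℝ) 1
    · have hψ : M m ≤ -(r x)⁻¹ := by
        have h1 : M m * (-r x) ≤ 1 := by nlinarith [hI.2]
        rw [← inv_neg, ← one_div, le_div_iff₀ (by linarith)]; exact h1
      have hlamge : c * M m ^ 5 / 2 ≤ lam x := by
        have h1 : M m / 2 ≤ -(r x)⁻¹ - k := by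
          have : 2 * (k:ℝ) ≤ M m := by simp only [hM]; have : (0:ℝ) ≤ m := by positivity
                                       linarith
          linarith
        have h2 : M m / 2 ≤ max (-(r x)⁻¹ - k) 0 := h1.trans (le_max_left _ _)
        have h3 : (r x ^ 2)⁻¹ = (-(r x)⁻¹)^2 := by rw [neg_sq, inv_pow]
        have h4 : 4 * (M m / 2)^3 * (M m)^2 ≤ g' (r x) := by
          simp only [hg', h3]; gcongr
        have h5 : c * (4 * (M m / 2)^3 * (M m)^2) ≤ c * g' (r x) := by gcongr
        simp only [hlam]; nlinarith
      have hfn : ‖fderiv ℝ (h m) x‖ ≤ 2 * Cτ * |C1| * M m := by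
        rw [hf, norm_smul, norm_smul, Real.norm_eq_abs, Real.norm_eq_abs, abs_mul, abs_of_pos hMm]
        have h1 := hτb (-2 * M m * r x - 1)
        have h2 := (hC1 x (subset_closure hx)).trans (le_abs_self C1)
        calc _ ≤ Cτ * (|(-2:ℝ)| * M m * |C1|) := by gcongr
          _ = _ := by norm_num; ring
      calc _ ≤ (n:ℝ)^2 * (2 * Cτ * |C1| * M m)^4 := by gcongr
        _ = 2 * C2 / (c * M m) * (c * M m ^ 5 / 2) := by rw [hC2]; field_simp
        _ ≤ _ := by gcongr
    · rw [hf, hτz _ hI]; simp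
      have := hl1 x hx; positivity
  · have h1 : Filter.Tendsto M Filter.atTop Filter.atTop :=
      Filter.tendsto_atTop_add_const_right _ _ (Filter.tendsto_atTop_add_const_right _ _ tendsto_natCast_atTop_atTop)
    exact Filter.Tendsto.div_atTop tendsto_const_nhds (h1.const_mul_atTop hc)
  · intro x hx
    have hrx := (hrD x).1 hx
    refine tendsto_const_nhds.congr' ?_
    have h1 : Filter.Tendsto M Filter.atTop Filter.atTop :=
      Filter.tendsto_atTop_add_const_right _ _ (Filter.tendsto_atTop_add_const_right _ _ tendsto_natCast_atTop_atTop)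
    filter_upwards [h1.eventually_ge_atTop (1 / (-r x))] with m hm
    symm
    apply Real.smoothTransition.one_of_one_le
    rw [div_le_iff₀ (by linarith)] at hm
    linarith
  · intro x hx j hj
    have h1 : ‖x‖ ≤ R0 := hR0 x hx
    have h2 := ht0K x (Set.mem_iUnion.2 ⟨j, hj⟩)
    have h3 : -(r x)⁻¹ ≤ 1 / t0 := by rw [← inv_neg, one_div]; exact inv_anti₀ ht0 (by linarith)
    have : max (-(r x)⁻¹ - k) 0 = 0 := max_eq_right (by linarith)
    simp only [Pi.add_apply, hg, this]
    have := norm_nonneg x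
    nlinarith
end

section
open scoped ENNReal Topology

lemma hol_of_bar {n : ℕ} {f : Cn n → ℂ} {x : Cn n} (hf : DifferentiableAt ℝ f x) (h : ∀ j, wderivBar f x j = 0) : DifferentiableAt ℂ f x := by
  rw [differentiableAt_iff_restrictScalars ℝ hf]
  have hI : ∀ j : Fin n, fderiv ℝ f x (EuclideanSpace.single j I) = I * fderiv ℝ f x (EuclideanSpace.single j (1:ℂ)) := by
    intro j
    have := h j
    rw [wderivBar] at this
    have h2 : fderiv ℝ f x (EuclideanSpace.single j (1:ℂ)) + I * fderiv ℝ f x (EuclideanSpace.single j I) = 0 := by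
      simpa using this
    linear_combination (-I) * h2 + (fderiv ℝ f x (EuclideanSpace.single j I)) * (I_sq)
  have hs : ∀ (c : ℂ) (j : Fin n), fderiv ℝ f x (c • EuclideanSpace.single j (1:ℂ)) = c * fderiv ℝ f x (EuclideanSpace.single j (1:ℂ)) := by
    intro c j
    have e : c • (EuclideanSpace.single j (1:ℂ) : Cn n) = c.re • EuclideanSpace.single j (1:ℂ) + c.im • EuclideanSpace.single j I := by
      rw [single_I, ← rsm, ← rsm, smul_smul, ← add_smul, Complex.re_add_im]
    rw [e, map_add, map_smul, map_smul, hI]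
    conv_rhs => rw [← Complex.re_add_im c]
    simp only [real_smul]; ring
  have hexp : ∀ ξ : Cn n, fderiv ℝ f x ξ = ∑ j, ξ j * fderiv ℝ f x (EuclideanSpace.single j (1:ℂ)) := by
    intro ξ
    conv_lhs => rw [vec_sum ξ, map_sum]
    exact Finset.sum_congr rfl fun j _ => hs _ _
  let F : Cn n →ₗ[ℂ] ℂ :=
    { toFun := fun ξ => ∑ j, ξ j * fderiv ℝ f x (EuclideanSpace.single j (1:ℂ))
      map_add' := fun u v => by simp [add_mul, Finset.sum_add_distrib]
      map_smul' := fun c u => by simp [Finset.mul_sum, mul_assoc] }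
  refine ⟨LinearMap.toContinuousLinearMap F, ?_⟩
  ext ξ
  exact (hexp ξ).symm

lemma bar_of_hol {n : ℕ} {f : Cn n → ℂ} {x : Cn n} (hf : DifferentiableAt ℂ f x) (j : Fin n) : wderivBar f x j = 0 := by
  have h1 : fderiv ℝ f x = (fderiv ℂ f x).restrictScalars ℝ := hf.fderiv_restrictScalars ℝ
  rw [wderivBar, h1, single_I]
  simp only [ContinuousLinearMap.coe_restrictScalars', map_smul, smul_eq_mul]
  linear_combination (1/2) * (fderiv ℂ f x (EuclideanSpace.single j (1:ℂ))) * I_sq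

lemma cs1 {X : Type*} [MeasurableSpace X] {μ : Measure X} {a b : X → ℂ} (ha : MemLp a 2 μ) (hb : MemLp b 2 μ) :
    ‖∫ x, a x * b x ∂μ‖ ≤ (eLpNorm a 2 μ).toReal * (eLpNorm b 2 μ).toReal := by
  have h1 : ‖∫ x, a x * b x ∂μ‖ₑ ≤ eLpNorm a 2 μ * eLpNorm b 2 μ := by
    refine (enorm_integral_le_lintegral_enorm _).trans ?_
    rw [← eLpNorm_one_eq_lintegral_enorm]
    have h3 : eLpNorm (a • b) 1 μ ≤ eLpNorm a 2 μ * eLpNorm b 2 μ := eLpNorm_smul_le_mul_eLpNorm hb.1 ha.1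
    exact h3
  have h2 := ENNReal.toReal_mono (ENNReal.mul_ne_top ha.2.ne hb.2.ne) h1
  rwa [ENNReal.toReal_mul, toReal_enorm] at h2

/-- Weyl lemma -/
lemma weyl {n : ℕ} {D : Set (Cn n)} (hD : IsOpen D) {h : Cn n → ℂ} (hh : MemLp h 2 ((dVol n).restrict D))
    (hw : ∀ W, TF D W → ∀ j, ∫ x in D, h x * wderivBar W x j ∂(dVol n) = 0) :
    ∃ f : Cn n → ℂ, DifferentiableOn ℂ f D ∧ f =ᵐ[(dVol n).restrict D] h := by
  set F : Cn n → ℂ := D.indicator h with hF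
  have hFL : MemLp F 2 (dVol n) := (memLp_indicator_iff_restrict hD.measurableSet).2 hh
  have hFl : LocallyIntegrable F (dVol n) := hFL.locallyIntegrable (by norm_num)
  have hol : ∀ ε > 0, ∀ x, Metric.closedBall x ε ⊆ D → DifferentiableAt ℂ (mo ε F) x := by
    intro ε hε x hx
    refine hol_of_bar ((mo_cd hε hFl (m := 1)).differentiable (by norm_num) x) fun j => ?_
    rw [mo_wderivBar hε hFl]
    have hT : TF D (tm ε x) := ⟨tm_cd (m := 2) ε x, tm_comp hε x, (tm_supp hε x).trans hx⟩
    have h1 := hw _ hT j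
    rw [← integral_indicator hD.measurableSet] at h1
    rw [neg_eq_zero, ← h1]
    congr 1; ext t
    simp only [hF, Set.indicator]
    split_ifs <;> simp
  have mv : ∀ δ > 0, ∀ x, ∀ ε > 0, ε ≤ δ → Metric.closedBall x (2*δ) ⊆ D → mo δ (mo ε F) x = mo ε F x := by
    intro δ hδ x ε hε hεδ hx
    have hcd : ContDiff ℝ 1 (mo ε F) := mo_cd hε hFl (m := 1)
    have hbal := balanced_mv (n := n) (Ω := Metric.ball 0 δ) Metric.isOpen_ball (by
      intro y hy c hc
      rw [mem_ball_zero_iff] at *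
      rw [norm_smul]; exact (mul_le_of_le_one_left (norm_nonneg _) hc).trans_lt hy) (h := fun t => mo ε F (x - t)) (by
      intro t ht
      rw [mem_ball_zero_iff] at ht
      have : DifferentiableAt ℂ (mo ε F) (x - t) := hol ε hε _ (by
        refine subset_trans ?_ hx
        intro y hy
        rw [Metric.mem_closedBall] at *
        calc dist y x ≤ dist y (x - t) + dist (x - t) x := dist_triangle _ _ _
          _ ≤ ε + δ := by gcongr; rw [dist_eq_norm]; simpa using ht.le
          _ ≤ _ := by linarith)
      exact (DifferentiableAt.comp t this ((differentiableAt_const x).sub differentiableAt_id)).differentiableWithinAt) (m := mollC δ)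
      (mollC_cd δ (m := 1)).continuous.measurable (fun y c hc => by
        simp only [mollC]; rw [moll_norm δ (x := c • y) (y := y) (by rw [norm_smul, hc, one_mul])]) ?_
    · rw [mo_flip]
      have hz : ∀ t ∉ Metric.ball (0 : Cn n) δ, mollC δ t = 0 := by
        intro t ht
        rw [mem_ball_zero_iff, not_lt] at ht
        simp [mollC, moll_zero hδ ht]
      have e1 : ∫ t in Metric.ball 0 δ, mollC δ t * mo ε F (x - t) ∂(dVol n) = ∫ t, mo ε F (x - t) * mollC δ t ∂(dVol n) := by
        rw [setIntegral_eq_integral_of_forall_compl_eq_zero (fun t ht => by rw [hz t ht, zero_mul])]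
        congr 1; ext t; ring
      have e2 : ∫ t in Metric.ball 0 δ, mollC δ t ∂(dVol n) = 1 := by
        rw [setIntegral_eq_integral_of_forall_compl_eq_zero (fun t ht => hz t ht)]
        have : ∫ t, mollC δ t ∂(dVol n) = ((∫ t, moll (n := n) δ t ∂(dVol n) : ℝ) : ℂ) := integral_ofReal
        rw [this, moll_one hδ]; simp
      rw [e1, e2] at hbal
      simpa using hbal
    · have hc : Continuous fun t => mo ε F (x - t) := hcd.continuous.comp (continuous_const.sub continuous_id)
      have := int_mul (n := n) isOpen_univ hc.continuousOn (mollC_cd δ (m := 1)).continuous (mollC_comp hδ) (Set.subset_univ _)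
      refine (this.congr (Filter.Eventually.of_forall fun t => ?_)).integrableOn
      exact mul_comm _ _
  have conv : ∀ δ > 0, ∀ x, Metric.closedBall x (2*δ) ⊆ D → Filter.Tendsto (fun m => mo (eps m) F x) Filter.atTop (𝓝 (mo δ F x)) := by
    intro δ hδ x hx
    have hmt := mo_tendsto hFL
    have hmL : ∀ m, MemLp (mo (eps m) F) 2 (dVol n) := fun m =>
      ⟨(mo_cd (eps_pos m) hFl (m := 1)).continuous.aestronglyMeasurable, (mo_L2 (eps_pos m) hFL).trans_lt hFL.2⟩
    have htm : MemLp (tm δ x) 2 (dVol n) := (tm_cd (m := 1) δ x).continuous.memLp_of_hasCompactSupport (tm_comp hδ x)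
    have h1 : Filter.Tendsto (fun m => (eLpNorm (mo (eps m) F - F) 2 (dVol n)).toReal * (eLpNorm (tm δ x) 2 (dVol n)).toReal) Filter.atTop (𝓝 0) := by
      have := ((ENNReal.tendsto_toReal ENNReal.zero_ne_top).comp hmt).mul_const (eLpNorm (tm δ x) 2 (dVol n)).toReal
      simpa using this
    have h2 : Filter.Tendsto (fun m => mo δ (mo (eps m) F) x) Filter.atTop (𝓝 (mo δ F x)) := by
      rw [tendsto_iff_norm_sub_tendsto_zero]
      refine squeeze_zero (fun _ => norm_nonneg _) (fun m => ?_) h1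
      have h3 := mo_sub hδ ((hmL m).locallyIntegrable (by norm_num)) hFl
      have h4 : mo δ (mo (eps m) F) x - mo δ F x = mo δ (mo (eps m) F - F) x := by rw [h3]; rfl
      rw [h4]
      exact cs1 ((hmL m).sub hFL) htm
    refine h2.congr' ?_
    filter_upwards [eps_tendsto.eventually (gt_mem_nhds hδ)] with m hm
    exact mv δ hδ x _ (eps_pos m) hm.le hx
  have hloc : ∀ x ∈ D, ∃ δ > 0, ∀ y, ‖y - x‖ < δ → Metric.closedBall y (2*δ) ⊆ D := by
    intro x hx
    obtain ⟨r, hr, hrD⟩ := Metric.isOpen_iff.1 hD x hx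
    refine ⟨r/4, by positivity, fun y hy => subset_trans (fun z hz => ?_) hrD⟩
    rw [Metric.mem_closedBall] at hz
    rw [Metric.mem_ball]
    calc dist z x ≤ dist z y + dist y x := dist_triangle _ _ _
      _ < 2 * (r/4) + r/4 := by rw [dist_eq_norm y x]; exact add_lt_add_of_le_of_lt hz hy
      _ ≤ r := by linarith
  choose! δ hδ hδD using hloc
  have key : ∀ x ∈ D, Filter.Tendsto (fun m => mo (eps m) F x) Filter.atTop (𝓝 (mo (δ x) F x)) := fun x hx =>
    conv (δ x) (hδ x hx) x (hδD x hx x (by simpa using hδ x hx))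
  refine ⟨fun x => mo (δ x) F x, ?_, ?_⟩
  · intro x hx
    have h1 : DifferentiableAt ℂ (mo (δ x) F) x := hol (δ x) (hδ x hx) x
      ((Metric.closedBall_subset_closedBall (by linarith [hδ x hx])).trans (hδD x hx x (by simpa using hδ x hx)))
    refine (h1.congr_of_eventuallyEq ?_).differentiableWithinAt
    filter_upwards [Metric.ball_mem_nhds x (hδ x hx), hD.mem_nhds hx] with y hy hyD
    exact tendsto_nhds_unique (key y hyD) (conv (δ x) (hδ x hx) y (hδD x hx y (by simpa [dist_eq_norm] using hy)))
  · have hmt := mo_tendsto hFL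
    have htm := tendstoInMeasure_of_tendsto_eLpNorm (by norm_num) (fun m => (mo_cd (eps_pos m) hFl (m := 1)).continuous.aestronglyMeasurable) hFL.1 hmt
    obtain ⟨ns, hns, hae⟩ := htm.exists_seq_tendsto_ae
    filter_upwards [ae_restrict_of_ae hae, ae_restrict_mem hD.measurableSet] with x hx hxD
    have h2 := tendsto_nhds_unique ((key x hxD).comp hns.tendsto_atTop) hx
    rw [h2, hF, Set.indicator_of_mem hxD]
end

section
open scoped ENNReal Topology

lemma TF.add' {n : ℕ} {D : Set (Cn n)} {W V : Cn n → ℂ} (h : TF D W) (h' : TF D V) : TF D (fun x => W x + V x) :=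
  ⟨h.1.add h'.1, h.2.1.add h'.2.1, (tsupport_add W V).trans (Set.union_subset h.2.2 h'.2.2)⟩

lemma TF.smul' {n : ℕ} {D : Set (Cn n)} {W : Cn n → ℂ} (h : TF D W) (c : ℂ) : TF D (fun x => c * W x) :=
  ⟨contDiff_const.mul h.1, h.2.1.mul_left, (tsupport_mul_subset_right (f := fun _ => c) (g := W)).trans h.2.2⟩

lemma TF.zero' {n : ℕ} {D : Set (Cn n)} : TF D (fun _ => 0) :=
  ⟨contDiff_const, HasCompactSupport.zero, by simp [tsupport]⟩

lemma wderiv_smul' {n : ℕ} {D : Set (Cn n)} {W : Cn n → ℂ} (h : TF D W) (c : ℂ) (x : Cn n) (j : Fin n) :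
    wderiv (fun x => c * W x) x j = c * wderiv W x j := by
  rw [wderiv_mul (differentiableAt_const c) (h.diff x)]
  simp [wderiv]

def dv {n : ℕ} (γ : Fin n → Cn n → ℂ) (x : Cn n) : ℂ := ∑ j, wderiv (γ j) x j

lemma dv_memLp {n : ℕ} {D : Set (Cn n)} {γ : Fin n → Cn n → ℂ} (h : ∀ j, TF D (γ j)) : MemLp (dv γ) 2 ((dVol n).restrict D) := by
  refine MemLp.restrict _ (memLp_finsetSum _ fun j _ => ?_)
  exact ((h j).w1 j).continuous.memLp_of_hasCompactSupport (HasCompactSupport.of_compactSpace' (h j) j)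
where
  HasCompactSupport.of_compactSpace' {n : ℕ} {D : Set (Cn n)} {W : Cn n → ℂ} (h : TF D W) (j : Fin n) : HasCompactSupport (fun x => wderiv W x j) :=
    h.2.1.of_isClosed_subset (isClosed_tsupport _) (wderiv_supp j)

def dvS {n : ℕ} (D : Set (Cn n)) : Submodule ℂ (Lp ℂ 2 ((dVol n).restrict D)) where
  carrier := {d | ∃ γ : Fin n → Cn n → ℂ, (∀ j, TF D (γ j)) ∧ d =ᵐ[(dVol n).restrict D] dv γ}
  zero_mem' := ⟨fun _ _ => 0, fun _ => TF.zero', by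
    filter_upwards [Lp.coeFn_zero ℂ 2 ((dVol n).restrict D)] with x hx
    rw [hx]; simp [dv, wderiv]⟩
  add_mem' := by
    rintro a b ⟨γ, hγ, h1⟩ ⟨β, hβ, h2⟩
    refine ⟨fun j x => γ j x + β j x, fun j => (hγ j).add' (hβ j), ?_⟩
    filter_upwards [h1, h2, Lp.coeFn_add a b] with x e1 e2 e3
    rw [e3, Pi.add_apply, e1, e2]
    simp only [dv, ← Finset.sum_add_distrib]
    exact Finset.sum_congr rfl fun j _ => (wderiv_add ((hγ j).diff x) ((hβ j).diff x) j).symm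
  smul_mem' := by
    rintro c a ⟨γ, hγ, h1⟩
    refine ⟨fun j x => c * γ j x, fun j => (hγ j).smul' c, ?_⟩
    filter_upwards [h1, Lp.coeFn_smul c a] with x e1 e3
    rw [e3, Pi.smul_apply, e1]
    simp only [dv, smul_eq_mul, Finset.mul_sum]
    exact Finset.sum_congr rfl fun j _ => (wderiv_smul' (hγ j) c x j).symm

lemma inner_dv {n : ℕ} {D : Set (Cn n)} {d a : Lp ℂ 2 ((dVol n).restrict D)} {γ : Fin n → Cn n → ℂ} {v : Cn n → ℂ}
    (hd : d =ᵐ[(dVol n).restrict D] dv γ) (ha : a =ᵐ[(dVol n).restrict D] v) :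
    inner ℂ d a = ∫ x in D, v x * conj (dv γ x) ∂(dVol n) := by
  rw [L2.inner_def]
  refine integral_congr_ae ?_
  filter_upwards [hd, ha] with x e1 e2
  rw [e1, e2]; simp

lemma dv_ibp {n : ℕ} {D : Set (Cn n)} (hD : IsOpen D) {γ : Fin n → Cn n → ℂ} (hγ : ∀ j, TF D (γ j)) {v : Cn n → ℂ} (hv : ContDiffOn ℝ 1 v D) :
    ∫ x in D, v x * conj (dv γ x) ∂(dVol n) = - ∫ x in D, ∑ j, wderivBar v x j * conj (γ j x) ∂(dVol n) := by
  have hz : ∀ j, ∀ x ∉ D, γ j x = 0 := fun j x hx => image_eq_zero_of_notMem_tsupport fun h => hx ((hγ j).2.2 h)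
  rw [setIntegral_eq_integral_of_forall_compl_eq_zero, setIntegral_eq_integral_of_forall_compl_eq_zero]
  · have h1 : ∀ j, ∀ x, conj (wderiv (γ j) x j) = wderivBar (fun y => conj (γ j y)) x j := fun j x => (wderivBar_conj ((hγ j).diff x) j).symm
    have e1 : (fun x => v x * conj (dv γ x)) = fun x => ∑ j, v x * wderivBar (fun y => conj (γ j y)) x j := by
      ext x; simp only [dv, map_sum, Finset.mul_sum, h1]
    have hT := fun j => (hγ j).conj'
    rw [e1, integral_finsetSum, integral_finsetSum, ← Finset.sum_neg_distrib]
    · exact Finset.sum_congr rfl fun j _ => ibpBar hD hv (hT j).cd1 (hT j).2.1 (hT j).2.2 j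
    · intro j _
      exact int_mul hD (wderivBar_cd (m := 0) hD (by simpa using hv) j).continuousOn (hT j).1.continuous (hT j).2.1 (hT j).2.2
    · intro j _
      exact int_mul hD hv.continuousOn ((hT j).wb1 j).continuous ((hT j).2.1.of_isClosed_subset (isClosed_tsupport _) (wderivBar_supp j))
        ((wderivBar_supp j).trans (hT j).2.2)
  · intro x hx
    exact Finset.sum_eq_zero fun j _ => by rw [hz j x hx]; simp
  · intro x hx
    have : dv γ x = 0 := Finset.sum_eq_zero fun j _ => (hγ j).wz j hx
    rw [this]; simp

lemma hol_cd {n : ℕ} {D : Set (Cn n)} (hD : IsOpen D) {g : Cn n → ℂ} (hg : DifferentiableOn ℂ g D) : ContDiffOn ℝ 2 g D := by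
  intro x0 hx0
  obtain ⟨r, hr, hrD⟩ := Metric.isOpen_iff.1 hD x0 hx0
  set δ := r/4 with hδdef
  have hδ : 0 < δ := by positivity
  have hcD : Metric.closedBall x0 (2*δ) ⊆ D := (Metric.closedBall_subset_ball (by linarith)).trans hrD
  set F : Cn n → ℂ := (Metric.closedBall x0 (2*δ)).indicator g with hF
  have hFi : Integrable F (dVol n) :=
    (integrable_indicator_iff measurableSet_closedBall).2 ((hg.continuousOn.mono hcD).integrableOn_compact (isCompact_closedBall _ _))
  have hm : ContDiff ℝ 2 (mo δ F) := mo_cd hδ hFi.locallyIntegrable (m := 2)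
  refine (hm.contDiffAt.congr_of_eventuallyEq ?_).contDiffWithinAt
  filter_upwards [Metric.ball_mem_nhds x0 hδ] with y hy
  rw [Metric.mem_ball] at hy
  have hin : ∀ t : Cn n, ‖t‖ ≤ δ → y - t ∈ Metric.closedBall x0 (2*δ) := by
    intro t ht
    rw [Metric.mem_closedBall]
    calc dist (y - t) x0 ≤ dist (y - t) y + dist y x0 := dist_triangle _ _ _
      _ ≤ δ + δ := by gcongr; rw [dist_eq_norm]; simpa using ht
      _ = _ := by ring
  have hz : ∀ t ∉ Metric.ball (0 : Cn n) δ, mollC δ t = 0 := by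
    intro t ht
    rw [mem_ball_zero_iff, not_lt] at ht
    simp [mollC, moll_zero hδ ht]
  have hbal := balanced_mv (n := n) (Ω := Metric.ball 0 δ) Metric.isOpen_ball (by
      intro y hy c hc
      rw [mem_ball_zero_iff] at *
      rw [norm_smul]; exact (mul_le_of_le_one_left (norm_nonneg _) hc).trans_lt hy) (h := fun t => g (y - t)) (by
      intro t ht
      rw [mem_ball_zero_iff] at ht
      have : DifferentiableAt ℂ g (y - t) := hg.differentiableAt (hD.mem_nhds (hcD (hin t ht.le)))
      exact (DifferentiableAt.comp t this ((differentiableAt_const y).sub differentiableAt_id)).differentiableWithinAt) (m := mollC δ)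
      (mollC_cd δ (m := 1)).continuous.measurable (fun y c hc => by
        simp only [mollC]; rw [moll_norm δ (x := c • y) (y := y) (by rw [norm_smul, hc, one_mul])]) (by
      have h1 : ContinuousOn (fun t => mollC δ t * g (y - t)) (Metric.closedBall 0 δ) := by
        refine (mollC_cd δ (m := 1)).continuous.continuousOn.mul ((hg.continuousOn.mono hcD).comp (by fun_prop) fun t ht => hin t ?_)
        simpa using ht
      exact (h1.integrableOn_compact (isCompact_closedBall _ _)).mono_set Metric.ball_subset_closedBall)
  have e1 : ∫ t in Metric.ball 0 δ, mollC δ t * g (y - t) ∂(dVol n) = mo δ F y := by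
    rw [setIntegral_eq_integral_of_forall_compl_eq_zero (fun t ht => by rw [hz t ht, zero_mul]), mo_flip]
    congr 1; ext t
    by_cases ht : t ∈ Metric.ball (0 : Cn n) δ
    · rw [hF, Set.indicator_of_mem (hin t (by simpa using (mem_ball_zero_iff.1 ht).le))]; ring
    · rw [hz t ht]; ring
  have e2 : ∫ t in Metric.ball 0 δ, mollC δ t ∂(dVol n) = 1 := by
    rw [setIntegral_eq_integral_of_forall_compl_eq_zero (fun t ht => hz t ht)]
    have : ∫ t, mollC δ t ∂(dVol n) = ((∫ t, moll (n := n) δ t ∂(dVol n) : ℝ) : ℂ) := integral_ofReal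
    rw [this, moll_one hδ]; simp
  rw [e1, e2] at hbal
  simpa using hbal.symm

lemma proj_hol {n : ℕ} {D : Set (Cn n)} (hD : IsOpen D) {v : Cn n → ℂ} (hv : MemLp v 2 ((dVol n).restrict D)) :
    ∃ f, DifferentiableOn ℂ f D ∧ MemLp f 2 ((dVol n).restrict D) ∧
     (∀ g, DifferentiableOn ℂ g D → MemLp g 2 ((dVol n).restrict D) → ∫ x in D, (v x - f x) * conj (g x) ∂(dVol n) = 0) ∧
     eLpNorm f 2 ((dVol n).restrict D) ≤ eLpNorm v 2 ((dVol n).restrict D) ∧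
     ∀ B : ℝ, 0 ≤ B → (∀ γ : Fin n → Cn n → ℂ, (∀ j, TF D (γ j)) → ‖∫ x in D, v x * conj (dv γ x) ∂(dVol n)‖ ≤ B * (eLpNorm (dv γ) 2 ((dVol n).restrict D)).toReal) →
       (eLpNorm (v - f) 2 ((dVol n).restrict D)).toReal ≤ B := by
  set μ := (dVol n).restrict D with hμ
  set S := (dvS D).topologicalClosure with hS
  haveI : CompleteSpace S := (dvS D).isClosed_topologicalClosure.completeSpace_coe
  set V := hv.toLp v with hV
  set u0 : Lp ℂ 2 μ := S.starProjection V with hu0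
  set F : Lp ℂ 2 μ := V - u0 with hF
  have hFo : F ∈ Sᗮ := S.sub_starProjection_mem_orthogonal V
  have hu0S : u0 ∈ S := S.starProjection_apply_mem V
  have hFL := Lp.memLp F
  obtain ⟨f, hfh, hfF⟩ := weyl hD hFL (by
    intro W hW j
    have hW' := hW.conj'
    set γ : Fin n → Cn n → ℂ := Pi.single j (fun x => conj (W x)) with hγ
    have hγT : ∀ k, TF D (γ k) := by
      intro k
      by_cases h : k = j
      · subst h; simpa [hγ] using hW'
      · simp only [hγ, Pi.single_eq_of_ne h]; exact TF.zero'
    have hmem : (dv_memLp hγT).toLp (dv γ) ∈ S := (dvS D).le_topologicalClosure ⟨γ, hγT, MemLp.coeFn_toLp _⟩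
    have h0 := (Submodule.mem_orthogonal S F).1 hFo _ hmem
    rw [inner_dv (MemLp.coeFn_toLp _) (Filter.EventuallyEq.refl _ _)] at h0
    rw [← h0]
    congr 1; ext x
    congr 1
    have : dv γ x = wderiv (fun x => conj (W x)) x j := by
      rw [dv, Finset.sum_eq_single j]
      · simp [hγ]
      · intro k _ hk; simp [hγ, hk, wderiv]
      · simp
    rw [this, wderiv_conj (hW.diff x)]; simp)
  have hfL : MemLp f 2 μ := (memLp_congr_ae hfF).2 hFL
  have hvf : ∀ᵐ x ∂μ, v x - f x = u0 x := by
    filter_upwards [hfF, hv.coeFn_toLp, Lp.coeFn_sub V u0] with x e1 e2 e3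
    rw [e1, hF, e3, Pi.sub_apply, ← hV] at *
    rw [e2]; ring
  have hnv : ‖V‖ = (eLpNorm v 2 μ).toReal := by rw [hV, Lp.norm_toLp]
  have hnF : ‖F‖ = (eLpNorm f 2 μ).toReal := by rw [Lp.norm_def, eLpNorm_congr_ae hfF]
  have hnu : ‖u0‖ = (eLpNorm (v - f) 2 μ).toReal := by
    rw [Lp.norm_def]; congr 1; exact (eLpNorm_congr_ae hvf).symm
  refine ⟨f, hfh, hfL, ?_, ?_, ?_⟩
  · intro g hg hgL
    set G := hgL.toLp g
    have hGo : G ∈ Sᗮ := by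
      rw [hS, Submodule.orthogonal_closure, Submodule.mem_orthogonal]
      rintro d ⟨γ, hγ, hd⟩
      rw [inner_dv hd (MemLp.coeFn_toLp hgL), dv_ibp hD hγ ((hol_cd hD hg).of_le (by norm_num))]
      rw [neg_eq_zero]
      refine setIntegral_eq_zero_of_forall_eq_zero fun x hx => Finset.sum_eq_zero fun j _ => ?_
      rw [bar_of_hol (hg.differentiableAt (hD.mem_nhds hx)) j, zero_mul]
    have h0 := (Submodule.mem_orthogonal' S G).1 hGo _ hu0S
    rw [L2.inner_def] at h0
    rw [← h0]
    refine integral_congr_ae ?_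
    filter_upwards [hvf, hgL.coeFn_toLp] with x e1 e2
    rw [e1, e2]; simp
  · rw [← ENNReal.toReal_le_toReal hfL.2.ne hv.2.ne, ← hnv, ← hnF]
    have h1 : ‖V‖^2 = ‖u0‖^2 + ‖F‖^2 := by
      have : V = u0 + F := by rw [hF]; abel
      have h2 := norm_add_sq_eq_norm_sq_add_norm_sq_of_inner_eq_zero (𝕜 := ℂ) u0 F ((Submodule.mem_orthogonal S F).1 hFo _ hu0S)
      rw [← this] at h2
      nlinarith
    nlinarith [norm_nonneg F, norm_nonneg V, norm_nonneg u0, sq_nonneg ‖u0‖]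
  · intro B hB0 hB
    rw [← hnu]
    have hcl : ∀ d ∈ S, ‖inner ℂ d V‖ ≤ B * ‖d‖ := by
      intro d hd
      have hclosed : IsClosed {d : Lp ℂ 2 μ | ‖inner ℂ d V‖ ≤ B * ‖d‖} :=
        isClosed_le (by fun_prop) (by fun_prop)
      refine closure_minimal ?_ hclosed hd
      rintro d ⟨γ, hγ, hd⟩
      show ‖inner ℂ d V‖ ≤ B * ‖d‖
      rw [inner_dv hd (MemLp.coeFn_toLp hv), Lp.norm_def, eLpNorm_congr_ae hd]
      exact hB γ hγ
    have h1 := hcl u0 hu0S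
    have h2 : inner ℂ u0 V = inner ℂ u0 u0 := by
      have : V = u0 + F := by rw [hF]; abel
      rw [this, inner_add_right, (Submodule.mem_orthogonal S F).1 hFo _ hu0S, add_zero]
    rw [h2, inner_self_eq_norm_sq_to_K] at h1
    have h3 : ‖u0‖^2 ≤ B * ‖u0‖ := by simpa using h1
    rcases eq_or_lt_of_le (norm_nonneg u0) with h | h
    · rw [← h]; exact hB0
    · nlinarith


lemma HH {n : ℕ} {D : Set (Cn n)} (hD : IsOpen D) {R : ℝ} (hR : 0 < R) (hstar : ∀ γ α : Fin n → Cn n → ℂ, (∀ j, TF D (γ j)) → (∀ j, MemLp (α j) 2 ((dVol n).restrict D)) →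
    (∀ W, TF D W → ∀ j k, ∫ x in D, α j x * wderivBar W x k - α k x * wderivBar W x j ∂(dVol n) = 0) →
    ‖∫ x in D, ∑ j, α j x * conj (γ j x) ∂(dVol n)‖^2 ≤
      (∫ x in D, ∑ j, ‖α j x‖^2 ∂(dVol n)) * (R * ∫ x in D, ‖∑ j, wderiv (γ j) x j‖^2 ∂(dVol n)))
    {v : Cn n → ℂ} (hv : ContDiffOn ℝ 2 v D) (hvL : MemLp v 2 ((dVol n).restrict D)) (hvb : ∀ j, MemLp (fun x => wderivBar v x j) 2 ((dVol n).restrict D)) :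
    ∃ f, DifferentiableOn ℂ f D ∧ MemLp f 2 ((dVol n).restrict D) ∧
     (∀ g, DifferentiableOn ℂ g D → MemLp g 2 ((dVol n).restrict D) → ∫ x in D, (v x - f x) * conj (g x) ∂(dVol n) = 0) ∧
     (eLpNorm (v - f) 2 ((dVol n).restrict D)).toReal ≤ Real.sqrt (R * ∫ x in D, ∑ j, ‖wderivBar v x j‖^2 ∂(dVol n)) := by
  obtain ⟨f, h1, h2, h3, -, h5⟩ := proj_hol hD hvL
  refine ⟨f, h1, h2, h3, h5 _ (Real.sqrt_nonneg _) fun γ hγ => ?_⟩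
  have h6 := hstar γ (fun j x => wderivBar v x j) hγ hvb (fun W hW j k => closed_of_exact hD hv hW j k)
  rw [dv_ibp hD hγ (hv.of_le (by norm_num)), norm_neg]
  have h7 := sq_int (dv_memLp hγ)
  have h8 : ∫ x in D, ‖∑ j, wderiv (γ j) x j‖^2 ∂(dVol n) = (eLpNorm (dv γ) 2 ((dVol n).restrict D)).toReal^2 := h7
  rw [h8] at h6
  have h9 : (0:ℝ) ≤ ∫ x in D, ∑ j, ‖wderivBar v x j‖^2 ∂(dVol n) := integral_nonneg fun x => by positivity
  refine abs_le_of_sq_le_sq' ?_ (by positivity) |>.2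
  rw [mul_pow, Real.sq_sqrt (by positivity)]
  linarith
end

section
open scoped ENNReal Topology

def lw {n : ℕ} (r : Cn n → ℝ) (w : Cn n) : Cn n →L[ℂ] ℂ := LinearMap.toContinuousLinearMap
  { toFun := delPair r w
    map_add' := fun u v => by simp [delPair, mul_add, Finset.sum_add_distrib]
    map_smul' := fun c u => by
      simp only [delPair, PiLp.smul_apply, smul_eq_mul, Finset.mul_sum, RingHom.id_apply]
      exact Finset.sum_congr rfl fun j _ => by ring }

lemma lw_apply {n : ℕ} (r : Cn n → ℝ) (w ξ : Cn n) : lw r w ξ = delPair r w ξ := rfl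

lemma lw_re {n : ℕ} {r : Cn n → ℝ} (hr : ContDiff ℝ 2 r) (w ξ : Cn n) : 2 * (lw r w ξ).re = fderiv ℝ r w ξ := by
  rw [lw_apply, delPair_eq (hr.differentiable (by norm_num) w)]
  simp

lemma lw_norm {n : ℕ} {r : Cn n → ℝ} (hr : ContDiff ℝ 2 r) (w : Cn n) : ‖lw r w‖ ≤ ‖fderiv ℝ r w‖ := by
  refine ContinuousLinearMap.opNorm_le_bound _ (norm_nonneg _) fun ξ => ?_
  rw [lw_apply, delPair_eq (hr.differentiable (by norm_num) w), norm_mul]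
  have h1 := (fderiv ℝ r w).le_opNorm ξ
  have h2 := (fderiv ℝ r w).le_opNorm (I • ξ)
  rw [norm_smul, Complex.norm_I, one_mul] at h2
  have h3 := norm_sub_le ((fderiv ℝ r w ξ : ℝ) : ℂ) (I * (fderiv ℝ r w (I • ξ) : ℝ))
  rw [norm_mul, Complex.norm_I, one_mul, Complex.norm_real, Complex.norm_real] at h3
  have : ‖(1/2:ℂ)‖ = 1/2 := by norm_num
  rw [this]; linarith

lemma nu_exists {n : ℕ} {r : Cn n → ℝ} (hr : ContDiff ℝ 2 r) {w : Cn n} {c : ℝ} (hc : 0 < c) (h : c ≤ ‖fderiv ℝ r w‖) :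
    ∃ ν, lw r w ν = 1 ∧ ‖ν‖ ≤ 4 / c := by
  obtain ⟨ξ, hξ⟩ : ∃ ξ, c/2 * ‖ξ‖ < ‖fderiv ℝ r w ξ‖ := by
    by_contra hcon
    push Not at hcon
    have := ContinuousLinearMap.opNorm_le_bound (fderiv ℝ r w) (by positivity) hcon
    linarith
  have h1 : c/4 * ‖ξ‖ < ‖lw r w ξ‖ := by
    have h2 := Complex.abs_re_le_norm (lw r w ξ)
    rw [← lw_re hr, Real.norm_eq_abs, abs_mul, abs_two] at hξ
    linarith
  have h0 : lw r w ξ ≠ 0 := by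
    intro h0
    rw [h0, norm_zero] at h1
    have : 0 ≤ c/4 * ‖ξ‖ := by positivity
    linarith
  have hp : 0 < ‖lw r w ξ‖ := norm_pos_iff.2 h0
  refine ⟨(lw r w ξ)⁻¹ • ξ, by rw [map_smul, smul_eq_mul, inv_mul_cancel₀ h0], ?_⟩
  rw [norm_smul, norm_inv, inv_mul_le_iff₀ hp, ← div_le_iff₀ (by positivity)]
  calc ‖ξ‖ / (4/c) = c/4*‖ξ‖ := by field_simp
    _ ≤ _ := h1.le

lemma D2_add_left {n : ℕ} (r : Cn n → ℝ) (w u v x : Cn n) : D2 r w (u + v) x = D2 r w u x + D2 r w v x := by simp [D2]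
lemma D2_add_right {n : ℕ} (r : Cn n → ℝ) (w u v x : Cn n) : D2 r w x (u + v) = D2 r w x u + D2 r w x v := by simp [D2]
lemma D2_symm {n : ℕ} {r : Cn n → ℝ} (hr : ContDiff ℝ 2 r) (w u v : Cn n) : D2 r w u v = D2 r w v u :=
  fderiv2_symm isOpen_univ hr.contDiffOn (Set.mem_univ w) v u
lemma D2_le {n : ℕ} (r : Cn n → ℝ) (w u v : Cn n) : |D2 r w u v| ≤ ‖fderiv ℝ (fderiv ℝ r) w‖ * ‖u‖ * ‖v‖ :=
  (fderiv ℝ (fderiv ℝ r) w).le_opNorm₂ u v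

def Hw {n : ℕ} (r : Cn n → ℝ) (w ξ : Cn n) : ℂ := (1/8) * ((D2 r w ξ ξ : ℂ) - D2 r w (I • ξ) (I • ξ) - 2 * I * D2 r w ξ (I • ξ))

lemma Hw_re {n : ℕ} {r : Cn n → ℝ} (hr : ContDiff ℝ 2 r) (w ξ : Cn n) : 2 * (Hw r w ξ).re + leviForm r w ξ = (1/2) * D2 r w ξ ξ := by
  rw [levi_eq isOpen_univ hr.contDiffOn (Set.mem_univ w), Hw]
  have : ((1/8 : ℂ) * ((D2 r w ξ ξ : ℂ) - D2 r w (I • ξ) (I • ξ) - 2 * I * D2 r w ξ (I • ξ))) =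
    (((1/8) * (D2 r w ξ ξ - D2 r w (I • ξ) (I • ξ)) : ℝ) : ℂ) + ((-(1/4) * D2 r w ξ (I • ξ) : ℝ) : ℂ) * I := by push_cast; ring
  rw [this, Complex.add_re, Complex.ofReal_re, Complex.re_ofReal_mul, Complex.I_re]; ring

lemma Hw_norm {n : ℕ} (r : Cn n → ℝ) (w ξ : Cn n) : ‖Hw r w ξ‖ ≤ ‖fderiv ℝ (fderiv ℝ r) w‖ * ‖ξ‖^2 := by
  have hI : ‖I • ξ‖ = ‖ξ‖ := by rw [norm_smul, Complex.norm_I, one_mul]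
  have h1 := D2_le r w ξ ξ
  have h2 := D2_le r w (I • ξ) (I • ξ)
  have h3 := D2_le r w ξ (I • ξ)
  rw [hI] at h2 h3
  rw [Hw, norm_mul]
  have h4 := norm_sub_le ((D2 r w ξ ξ : ℂ) - D2 r w (I • ξ) (I • ξ)) (2 * I * D2 r w ξ (I • ξ))
  have h5 := norm_sub_le (D2 r w ξ ξ : ℂ) (D2 r w (I • ξ) (I • ξ))
  simp only [norm_mul, Complex.norm_real, Complex.norm_I, Real.norm_eq_abs, Complex.norm_ofNat, mul_one] at h4 h5
  have : ‖(1/8:ℂ)‖ = 1/8 := by norm_num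
  rw [this]
  have : 0 ≤ ‖fderiv ℝ (fderiv ℝ r) w‖ * ‖ξ‖^2 := by positivity
  nlinarith

lemma levi_norm {n : ℕ} {r : Cn n → ℝ} (hr : ContDiff ℝ 2 r) (w ξ : Cn n) : leviForm r w ξ ≤ ‖fderiv ℝ (fderiv ℝ r) w‖ * ‖ξ‖^2 := by
  have hI : ‖I • ξ‖ = ‖ξ‖ := by rw [norm_smul, Complex.norm_I, one_mul]
  have h1 := (abs_le.1 (D2_le r w ξ ξ)).2
  have h2 := (abs_le.1 (D2_le r w (I • ξ) (I • ξ))).2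
  rw [hI] at h2
  rw [levi_eq isOpen_univ hr.contDiffOn (Set.mem_univ w)]
  have : 0 ≤ ‖fderiv ℝ (fderiv ℝ r) w‖ * ‖ξ‖^2 := by positivity
  nlinarith

lemma levi_homC {n : ℕ} {r : Cn n → ℝ} (w ξ : Cn n) (c : ℂ) : leviForm r w (c • ξ) = ‖c‖^2 * leviForm r w ξ := by
  rw [leviForm, leviForm]
  have : ∑ j, ∑ k, wderivBar (fun v => wderiv (realToC r) v j) w k * (c • ξ) j * conj ((c • ξ) k) =
    ((‖c‖^2 : ℝ) : ℂ) * ∑ j, ∑ k, wderivBar (fun v => wderiv (realToC r) v j) w k * ξ j * conj (ξ k) := by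
    simp only [Finset.mul_sum]
    refine Finset.sum_congr rfl fun j _ => Finset.sum_congr rfl fun k _ => ?_
    have h : ((‖c‖^2 : ℝ) : ℂ) = c * conj c := by rw [Complex.mul_conj, Complex.normSq_eq_norm_sq]
    rw [h]
    simp only [PiLp.smul_apply, smul_eq_mul, map_mul]; ring
  rw [this, Complex.re_ofReal_mul]

lemma levi_cts {n : ℕ} {r : Cn n → ℝ} (w : Cn n) : Continuous (leviForm r w) := by
  unfold leviForm; fun_prop

def Qw {n : ℕ} (r : Cn n → ℝ) (w u v : Cn n) : ℂ := (D2 r w u v : ℂ) - D2 r w (I • u) (I • v) - I * D2 r w u (I • v) - I * D2 r w (I • u) v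

lemma D2_neg_left {n : ℕ} (r : Cn n → ℝ) (w u x : Cn n) : D2 r w (-u) x = - D2 r w u x := by simp [D2]
lemma D2_neg_right {n : ℕ} (r : Cn n → ℝ) (w u x : Cn n) : D2 r w x (-u) = - D2 r w x u := by simp [D2]
lemma D2_rs_left {n : ℕ} (r : Cn n → ℝ) (w u x : Cn n) (c : ℝ) : D2 r w ((c:ℂ) • u) x = c * D2 r w u x := by simp [D2, rsm]
lemma D2_rs_right {n : ℕ} (r : Cn n → ℝ) (w u x : Cn n) (c : ℝ) : D2 r w x ((c:ℂ) • u) = c * D2 r w x u := by simp [D2, rsm]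

lemma Hw_diff {n : ℕ} {r : Cn n → ℝ} (hr : ContDiff ℝ 2 r) (w : Cn n) : Differentiable ℂ (Hw r w) := by
  have e : Hw r w = fun ξ => (1/8) * ∑ j, ξ j * ∑ k, ξ k * Qw r w (EuclideanSpace.single j (1:ℂ)) (EuclideanSpace.single k (1:ℂ)) := by
    ext ξ
    have h1 : ∀ v, Qw r w ξ v = ∑ j, ξ j * Qw r w (EuclideanSpace.single j (1:ℂ)) v := fun v => by
      refine clin_expand (fun u => Qw r w u v) ?_ (clin_smul (fun u => Qw r w u v) ?_ ?_ ?_) ξ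
      · intro u u'; simp only [Qw, smul_add, D2_add_left]; push_cast; ring
      · intro u u'; simp only [Qw, smul_add, D2_add_left]; push_cast; ring
      · intro c u; simp only [Qw, smulI_comm, D2_rs_left]; push_cast; ring
      · intro u; simp only [Qw, smulII, D2_neg_left]; push_cast
        linear_combination (- (D2 r w (I • u) (I • v) : ℂ) + D2 r w u v + D2 r w (I • u) (I • v) - D2 r w u v) * I_sq - (- (D2 r w (I • u) v : ℂ) - D2 r w u (I • v)) * I_sq
    have h2 : ∀ u, Qw r w u ξ = ∑ k, ξ k * Qw r w u (EuclideanSpace.single k (1:ℂ)) := fun u => by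
      refine clin_expand (fun v => Qw r w u v) ?_ (clin_smul (fun v => Qw r w u v) ?_ ?_ ?_) ξ
      · intro u u'; simp only [Qw, smul_add, D2_add_right]; push_cast; ring
      · intro u u'; simp only [Qw, smul_add, D2_add_right]; push_cast; ring
      · intro c u; simp only [Qw, smulI_comm, D2_rs_right]; push_cast; ring
      · intro v; simp only [Qw, smulII, D2_neg_right]; push_cast
        linear_combination - (- (D2 r w (I • u) v : ℂ) - D2 r w u (I • v)) * I_sq
    have h3 : Hw r w ξ = (1/8) * Qw r w ξ ξ := by
      rw [Hw, Qw, D2_symm hr w (I • ξ) ξ]; ring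
    rw [h3, h1]
    simp only [h2]
  rw [e]
  fun_prop

lemma Hw_zero {n : ℕ} (r : Cn n → ℝ) (w : Cn n) : Hw r w 0 = 0 := by simp [Hw, D2]

lemma taylor {n : ℕ} {D : Set (Cn n)} (hDb : Bornology.IsBounded D) {r : Cn n → ℝ} (hr : ContDiff ℝ 2 r) {ε : ℝ} (hε : 0 < ε) :
    ∃ η > 0, ∀ w ∈ D, ∀ ξ, ‖ξ‖ < η → |r (w + ξ) - r w - fderiv ℝ r w ξ - (1/2) * D2 r w ξ ξ| ≤ ε * ‖ξ‖^2 := by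
  set K := Metric.cthickening 1 (closure D)
  have hK : IsCompact K := (Metric.isCompact_of_isClosed_isBounded isClosed_closure hDb.closure).cthickening
  have hf1 : ContDiff ℝ 1 (fderiv ℝ r) := hr.fderiv_right (by norm_num)
  have hc : Continuous (fderiv ℝ (fderiv ℝ r)) := hf1.continuous_fderiv (by norm_num)
  have huc := hK.uniformContinuousOn_of_continuous hc.continuousOn
  have hiff := Metric.uniformContinuousOn_iff (f := fderiv ℝ (fderiv ℝ r)) (s := K)
  obtain ⟨η, hη, h⟩ := hiff.1 huc ε hε
  refine ⟨min η 1, by positivity, fun w hw ξ hξ => ?_⟩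
  have hwK : w ∈ K := Metric.self_subset_cthickening _ (subset_closure hw)
  have hseg : ∀ y, ‖y - w‖ ≤ ‖ξ‖ → ‖fderiv ℝ (fderiv ℝ r) y - fderiv ℝ (fderiv ℝ r) w‖ ≤ ε := by
    intro y hy
    have h1 : dist y w < min η 1 := by rw [dist_eq_norm]; exact hy.trans_lt hξ
    have hyK : y ∈ K := Metric.mem_cthickening_of_dist_le y w 1 _ (subset_closure hw) (h1.le.trans (min_le_right _ _))
    have := h y hyK w hwK (h1.trans_le (min_le_left _ _))
    have e := dist_eq_norm (fderiv ℝ (fderiv ℝ r) y) (fderiv ℝ (fderiv ℝ r) w)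
    exact e ▸ this.le
  have hgr : ∀ x ∈ Metric.closedBall w ‖ξ‖, ‖fderiv ℝ r x - fderiv ℝ r w - fderiv ℝ (fderiv ℝ r) w (x - w)‖ ≤ ε * ‖x - w‖ := by
    intro x hx
    exact (convex_closedBall w ‖ξ‖).norm_image_sub_le_of_norm_hasFDerivWithin_le' (f := fderiv ℝ r) (f' := fderiv ℝ (fderiv ℝ r))
      (fun y _ => (hf1.differentiable (by norm_num) y).hasFDerivAt.hasFDerivWithinAt) (fun y hy => hseg y (by simpa [dist_eq_norm] using hy))
      (Metric.mem_closedBall_self (norm_nonneg _)) hx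
  set g : ℝ → ℝ := fun τ => r (w + τ • ξ) - τ * fderiv ℝ r w ξ - (1/2) * τ^2 * D2 r w ξ ξ with hg
  have hgd : ∀ τ : ℝ, HasDerivAt g (fderiv ℝ r (w + τ • ξ) ξ - fderiv ℝ r w ξ - τ * D2 r w ξ ξ) τ := by
    intro τ
    have h1 : HasDerivAt (fun τ : ℝ => w + τ • ξ) ξ τ := by
      have := ((hasDerivAt_id τ).smul_const ξ).const_add w
      simpa using this
    have h2 : HasDerivAt (fun τ : ℝ => r (w + τ • ξ)) (fderiv ℝ r (w + τ • ξ) ξ) τ :=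
      (hr.differentiable (by norm_num) _).hasFDerivAt.comp_hasDerivAt τ h1
    have h3 : HasDerivAt (fun τ : ℝ => τ * fderiv ℝ r w ξ) (fderiv ℝ r w ξ) τ := by
      have := (hasDerivAt_id τ).mul_const (fderiv ℝ r w ξ)
      simpa using this
    have h4 : HasDerivAt (fun τ : ℝ => (1/2) * τ^2 * D2 r w ξ ξ) (τ * D2 r w ξ ξ) τ := by
      have := ((hasDerivAt_pow 2 τ).const_mul (1/2)).mul_const (D2 r w ξ ξ)
      have e : 1 / 2 * ((2:ℕ) * τ ^ (2 - 1)) * D2 r w ξ ξ = τ * D2 r w ξ ξ := by norm_num; left; ring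
      rw [e] at this; exact this
    exact (h2.sub h3).sub h4
  have hb := norm_image_sub_le_of_norm_deriv_le_segment_01' (f := g) (C := ε * ‖ξ‖^2) (fun τ _ => (hgd τ).hasDerivWithinAt) (by
    intro τ hτ
    have hx : w + τ • ξ ∈ Metric.closedBall w ‖ξ‖ := by
      rw [Metric.mem_closedBall, dist_eq_norm, add_sub_cancel_left, norm_smul, Real.norm_eq_abs, abs_of_nonneg hτ.1]
      exact mul_le_of_le_one_left (norm_nonneg _) hτ.2.le
    have h1 := hgr _ hx
    rw [add_sub_cancel_left] at h1
    have h2 : fderiv ℝ r (w + τ • ξ) ξ - fderiv ℝ r w ξ - τ * D2 r w ξ ξ =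
      (fderiv ℝ r (w + τ • ξ) - fderiv ℝ r w - fderiv ℝ (fderiv ℝ r) w (τ • ξ)) ξ := by simp [D2]
    rw [h2]
    refine (ContinuousLinearMap.le_opNorm _ _).trans ?_
    have h3 : ‖τ • ξ‖ ≤ ‖ξ‖ := by
      rw [norm_smul, Real.norm_eq_abs, abs_of_nonneg hτ.1]
      exact mul_le_of_le_one_left (norm_nonneg _) hτ.2.le
    calc _ ≤ (ε * ‖ξ‖) * ‖ξ‖ := by gcongr; exact h1.trans (by gcongr)
      _ = _ := by ring)
  have e : g 1 - g 0 = r (w + ξ) - r w - fderiv ℝ r w ξ - (1/2) * D2 r w ξ ξ := by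
    simp only [hg, one_smul, zero_smul, add_zero]; ring
  rw [e, Real.norm_eq_abs] at hb
  exact hb
end

section
open scoped ENNReal Topology

structure Geo {n : ℕ} (D : Set (Cn n)) (r : Cn n → ℝ) (c t C : ℝ) : Prop where
  bdd : Bornology.IsBounded D
  hr : ContDiff ℝ 2 r
  mem : ∀ x, x ∈ D ↔ r x < 0
  hc : 0 < c
  ht : 0 < t
  hC : 1 ≤ C
  levi : ∀ w ∈ D, -t < r w → ∀ ξ, c * ‖ξ‖^2 ≤ leviForm r w ξ
  grad : ∀ w ∈ D, -t < r w → ∃ ν, lw r w ν = 1 ∧ ‖ν‖ ≤ C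
  fd : ∀ w ∈ D, ‖fderiv ℝ r w‖ ≤ C
  fd2 : ∀ w ∈ D, ‖fderiv ℝ (fderiv ℝ r) w‖ ≤ C
  lip : ∀ w ∈ D, ∀ u, ‖u - w‖ ≤ 1 → |r u - r w| ≤ C * ‖u - w‖
  flip : ∀ w ∈ D, ∀ u, ‖u - w‖ ≤ 1 → ‖fderiv ℝ r u - fderiv ℝ r w‖ ≤ C * ‖u - w‖

lemma geo_exists {n : ℕ} {D : Set (Cn n)} {r : Cn n → ℝ} {c t : ℝ} (hDb : Bornology.IsBounded D) (hr : ContDiff ℝ 2 r)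
    (hmem : ∀ x, x ∈ D ↔ r x < 0) (hc : 0 < c) (ht : 0 < t)
    (h : ∀ w ∈ D, -t < r w → (∀ ξ, c * ‖ξ‖^2 ≤ leviForm r w ξ) ∧ c ≤ ‖fderiv ℝ r w‖) : ∃ C, Geo D r c t C := by
  obtain ⟨R, hR⟩ := hDb.subset_closedBall 0
  have hf1 : ContDiff ℝ 1 (fderiv ℝ r) := hr.fderiv_right (by norm_num)
  have hc1 : Continuous (fderiv ℝ r) := hf1.continuous
  have hc2 : Continuous (fderiv ℝ (fderiv ℝ r)) := hf1.continuous_fderiv (by norm_num)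
  have hK : IsCompact (Metric.closedBall (0 : Cn n) (R + 1)) := isCompact_closedBall _ _
  obtain ⟨C1, h1⟩ := hK.exists_bound_of_continuousOn hc1.continuousOn
  obtain ⟨C2, h2⟩ := hK.exists_bound_of_continuousOn (f := fderiv ℝ (fderiv ℝ r)) hc2.continuousOn
  have hDK : ∀ w ∈ D, ∀ u, ‖u - w‖ ≤ 1 → u ∈ Metric.closedBall (0 : Cn n) (R + 1) := fun w hw u hu => by
    have h3 := hR hw
    rw [mem_closedBall_zero_iff] at h3 ⊢
    calc ‖u‖ = ‖w + (u - w)‖ := by congr 1; abel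
      _ ≤ ‖w‖ + ‖u - w‖ := norm_add_le _ _
      _ ≤ _ := by linarith
  have hDK' : ∀ w ∈ D, w ∈ Metric.closedBall (0 : Cn n) (R + 1) := fun w hw => hDK w hw w (by simp)
  set C := max 1 (max (4/c) (max C1 C2)) with hC
  have hC1 : C1 ≤ C := (le_max_left C1 C2).trans ((le_max_right _ _).trans (le_max_right _ _))
  have hC2 : C2 ≤ C := (le_max_right C1 C2).trans ((le_max_right _ _).trans (le_max_right _ _))
  have hC4 : 4/c ≤ C := (le_max_left _ _).trans (le_max_right _ _)
  refine ⟨C, hDb, hr, hmem, hc, ht, le_max_left _ _, fun w hw hwt => (h w hw hwt).1, fun w hw hwt => ?_,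
    fun w hw => (h1 w (hDK' w hw)).trans hC1, fun w hw => (h2 w (hDK' w hw)).trans hC2, fun w hw u hu => ?_, fun w hw u hu => ?_⟩
  · obtain ⟨ν, h3, h4⟩ := nu_exists hr hc (h w hw hwt).2
    exact ⟨ν, h3, h4.trans hC4⟩
  · exact (convex_closedBall (0 : Cn n) (R+1)).norm_image_sub_le_of_norm_fderiv_le (𝕜 := ℝ) (fun x _ => hr.differentiable (by norm_num) x)
      (fun x hx => (h1 x hx).trans hC1) (hDK' w hw) (hDK w hw u hu)
  · exact (convex_closedBall (0 : Cn n) (R+1)).norm_image_sub_le_of_norm_fderiv_le (𝕜 := ℝ) (fun x _ => hf1.differentiable (by norm_num) x)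
      (fun x hx => (h2 x hx).trans hC2) (hDK' w hw) (hDK w hw u hu)

section
variable {n : ℕ} {D : Set (Cn n)} {r : Cn n → ℝ} {c t C : ℝ}

lemma xi_split (l : Cn n →L[ℂ] ℂ) (ν ξ : Cn n) : prl l ν ξ + l ξ • ν = ξ := by rw [prl_apply]; abel

lemma lw_lip (hg : Geo D r c t C) {w u : Cn n} (hw : w ∈ D) (hu : ‖u - w‖ ≤ 1) (ξ : Cn n) :
    ‖lw r u ξ - lw r w ξ‖ ≤ C * ‖u - w‖ * ‖ξ‖ := by
  have hd := hg.hr.differentiable (by norm_num)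
  rw [lw_apply, lw_apply, delPair_eq (hd u), delPair_eq (hd w)]
  have h := hg.flip w hw u hu
  have h1 := (fderiv ℝ r u - fderiv ℝ r w).le_opNorm ξ
  have h2 := (fderiv ℝ r u - fderiv ℝ r w).le_opNorm (I • ξ)
  rw [norm_smul, Complex.norm_I, one_mul] at h2
  have e : (1/2:ℂ) * (((fderiv ℝ r u ξ : ℝ):ℂ) - I * (fderiv ℝ r u (I • ξ) : ℝ)) - (1/2) * (((fderiv ℝ r w ξ : ℝ):ℂ) - I * (fderiv ℝ r w (I • ξ) : ℝ))
    = (1/2) * ((((fderiv ℝ r u - fderiv ℝ r w) ξ : ℝ):ℂ) - I * ((fderiv ℝ r u - fderiv ℝ r w) (I • ξ) : ℝ)) := by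
    simp only [ContinuousLinearMap.sub_apply]; push_cast; ring
  rw [e, norm_mul]
  have h3 := norm_sub_le (((fderiv ℝ r u - fderiv ℝ r w) ξ : ℝ):ℂ) (I * ((fderiv ℝ r u - fderiv ℝ r w) (I • ξ) : ℝ))
  rw [norm_mul, Complex.norm_I, one_mul, Complex.norm_real, Complex.norm_real] at h3
  have : ‖(1/2:ℂ)‖ = 1/2 := by norm_num
  rw [this]
  have h4 : ‖fderiv ℝ r u - fderiv ℝ r w‖ * ‖ξ‖ ≤ C * ‖u - w‖ * ‖ξ‖ := by gcongr
  linarith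

set_option maxHeartbeats 1000000 in
lemma KEY (hg : Geo D r c t C) {ε : ℝ} (hε : 0 < ε) : ∃ η > 0, η ≤ 1 ∧ ∃ M0 > 0, ∀ w ∈ D, -t < r w → ∀ ν, lw r w ν = 1 → ‖ν‖ ≤ C →
    ∀ ξ, ‖ξ‖ < η → |r (w + ξ) - r w - 2 * (Pfun (lw r w) ν (Hw r w) ξ).re - leviForm r w (prl (lw r w) ν ξ)| ≤
      ε * ‖prl (lw r w) ν ξ‖^2 + M0 * ‖Pfun (lw r w) ν (Hw r w) ξ‖^2 := by
  have hC := hg.hC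
  obtain ⟨η1, hη1, hT⟩ := taylor hg.bdd hg.hr (ε := ε/8) (by positivity)
  set K := C^3 + ε * C^2 + C^4/ε with hK
  have hKp : 0 < K := by positivity
  set η := min 1 (min η1 (ε / (16 * K * C^2 * (1 + C^2)^2 + ε))) with hη
  have hηp : 0 < η := by positivity
  have hηle : 2 * K * C^2 * (1 + C^2)^2 * η^2 ≤ ε/8 := by
    have h1 : η ≤ ε / (16 * K * C^2 * (1 + C^2)^2 + ε) := (min_le_right _ _).trans (min_le_right _ _)
    have h2 : η ≤ 1 := min_le_left _ _
    rw [le_div_iff₀ (by positivity)] at h1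
    have h3 : η^2 ≤ η := by nlinarith
    have h4 : 0 < 2 * K * C^2 * (1 + C^2)^2 := by positivity
    nlinarith
  refine ⟨η, hηp, min_le_left _ _, 2 * K, by positivity, fun w hw hwt ν hν hνC ξ hξ => ?_⟩
  have hl : ‖lw r w‖ ≤ C := (lw_norm hg.hr w).trans (hg.fd w hw)
  have hT := hT w hw ξ (hξ.trans_le ((min_le_right _ _).trans (min_le_left _ _)))
  set x := prl (lw r w) ν ξ with hx
  set a := lw r w ξ with ha
  have hsp : x + a • ν = ξ := xi_split _ _ _
  have hB : ∀ u v, |D2 r w u v| ≤ C * ‖u‖ * ‖v‖ := fun u v => (D2_le r w u v).trans (by gcongr; exact hg.fd2 w hw)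
  have hav : ‖a • ν‖ ≤ C * ‖a‖ := by rw [norm_smul, mul_comm]; gcongr
  have hxn : ‖x‖ ≤ (1 + C^2) * ‖ξ‖ := (prl_norm_le _ _ _).trans (by gcongr; nlinarith [norm_nonneg ν, norm_nonneg (lw r w)])
  have hξn : ‖ξ‖ ≤ ‖x‖ + C * ‖a‖ := by rw [← hsp]; exact (norm_add_le _ _).trans (by gcongr)
  have hH : ‖Hw r w x‖ ≤ C * ‖x‖^2 := (Hw_norm r w x).trans (by gcongr; exact hg.fd2 w hw)
  have hP : Pfun (lw r w) ν (Hw r w) ξ = a + Hw r w x := rfl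
  set P := Pfun (lw r w) ν (Hw r w) ξ
  have haP : ‖a‖ ≤ ‖P‖ + C * ‖x‖^2 := by
    have : a = P - Hw r w x := by rw [hP]; ring
    rw [this]; exact (norm_sub_le _ _).trans (by gcongr)
  have e1 : D2 r w ξ ξ = D2 r w x x + 2 * D2 r w x (a • ν) + D2 r w (a • ν) (a • ν) := by
    rw [← hsp]; simp only [D2_add_left, D2_add_right]; rw [D2_symm hg.hr w (a • ν) x]; ring
  have e2 := Hw_re hg.hr w x
  have e3 := lw_re hg.hr w ξ
  have eP : P.re = a.re + (Hw r w x).re := by rw [hP]; simp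
  have b1 : |D2 r w x (a • ν)| ≤ C^2 * ‖x‖ * ‖a‖ := (hB _ _).trans (by
    calc C * ‖x‖ * ‖a • ν‖ ≤ C * ‖x‖ * (C * ‖a‖) := by gcongr
      _ = _ := by ring)
  have b2 : |D2 r w (a • ν) (a • ν)| ≤ C^3 * ‖a‖^2 := (hB _ _).trans (by
    calc C * ‖a • ν‖ * ‖a • ν‖ ≤ C * (C * ‖a‖) * (C * ‖a‖) := by gcongr
      _ = _ := by ring)
  have hX : |r (w + ξ) - r w - 2 * P.re - leviForm r w x| ≤ C^2 * ‖x‖ * ‖a‖ + C^3 * ‖a‖^2 / 2 + ε/8 * ‖ξ‖^2 := by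
    have : r (w + ξ) - r w - 2 * P.re - leviForm r w x = (r (w + ξ) - r w - fderiv ℝ r w ξ - (1/2) * D2 r w ξ ξ) + D2 r w x (a • ν) + (1/2) * D2 r w (a • ν) (a • ν) := by
      rw [← e3]; linarith
    rw [this]
    rw [abs_le] at *
    constructor <;> linarith
  refine hX.trans ?_
  have c1 : C^2 * ‖x‖ * ‖a‖ ≤ ε/4 * ‖x‖^2 + C^4/ε * ‖a‖^2 := by
    have : ε/4 * ‖x‖^2 + C^4/ε * ‖a‖^2 - C^2 * ‖x‖ * ‖a‖ = (ε/2 * ‖x‖ - C^2 * ‖a‖)^2 / ε := by field_simp; ring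
    have h2 : 0 ≤ (ε/2 * ‖x‖ - C^2 * ‖a‖)^2 / ε := by positivity
    linarith
  have c2 : ‖ξ‖^2 ≤ 2 * ‖x‖^2 + 2 * C^2 * ‖a‖^2 := by
    have := pow_le_pow_left₀ (norm_nonneg ξ) hξn 2
    have h2 := sq_nonneg (‖x‖ - C * ‖a‖)
    calc _ ≤ _ := this
      _ ≤ (‖x‖ + C * ‖a‖)^2 + (‖x‖ - C * ‖a‖)^2 := by linarith
      _ = _ := by ring
  have c3 : ‖a‖^2 ≤ 2 * ‖P‖^2 + 2 * C^2 * ‖x‖^4 := by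
    have := pow_le_pow_left₀ (norm_nonneg a) haP 2
    have h2 := sq_nonneg (‖P‖ - C * ‖x‖^2)
    calc _ ≤ _ := this
      _ ≤ (‖P‖ + C * ‖x‖^2)^2 + (‖P‖ - C * ‖x‖^2)^2 := by linarith
      _ = _ := by ring
  have c4 : ‖x‖^2 ≤ (1+C^2)^2 * η^2 := by
    rw [← mul_pow]; exact pow_le_pow_left₀ (norm_nonneg x) (hxn.trans (by gcongr)) 2
  have c5 : C^2 * ‖x‖ * ‖a‖ + C^3 * ‖a‖^2 / 2 + ε/8 * ‖ξ‖^2 ≤ ε/2 * ‖x‖^2 + K * ‖a‖^2 := by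
    have : ε/8 * ‖ξ‖^2 ≤ ε/8 * (2 * ‖x‖^2 + 2 * C^2 * ‖a‖^2) := by gcongr
    have h3 : 0 ≤ C^3 * ‖a‖^2 := by positivity
    have h4 : 0 ≤ ε * C^2 * ‖a‖^2 := by positivity
    calc _ ≤ (ε/4 * ‖x‖^2 + C^4/ε * ‖a‖^2) + C^3 * ‖a‖^2 + ε/8 * (2 * ‖x‖^2 + 2 * C^2 * ‖a‖^2) + 3/4 * (ε * C^2 * ‖a‖^2) := by linarith
      _ = _ := by rw [hK]; ring
  have c6 : K * ‖a‖^2 ≤ 2 * K * ‖P‖^2 + ε/8 * ‖x‖^2 := by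
    calc K * ‖a‖^2 ≤ K * (2 * ‖P‖^2 + 2 * C^2 * ‖x‖^4) := by gcongr
      _ = 2 * K * ‖P‖^2 + 2 * K * C^2 * ‖x‖^2 * ‖x‖^2 := by ring
      _ ≤ 2 * K * ‖P‖^2 + 2 * K * C^2 * ((1+C^2)^2 * η^2) * ‖x‖^2 := by gcongr
      _ ≤ _ := by
        have := mul_le_mul_of_nonneg_right hηle (sq_nonneg ‖x‖)
        linarith
  have c7 : 0 ≤ ε * ‖x‖^2 := by positivity
  linarith
end
end

section
open scoped ENNReal Topology

def dd {n : ℕ} (r : Cn n → ℝ) (z w : Cn n) : ℝ := -r z - r w + ‖z - w‖^2 + ‖lw r w (z - w)‖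

section
variable {n : ℕ} {D : Set (Cn n)} {r : Cn n → ℝ} {c t C : ℝ}

lemma dd_pos (hg : Geo D r c t C) {z w : Cn n} (hz : z ∈ D) (hw : w ∈ D) : 0 < dd r z w := by
  have h1 := (hg.mem z).1 hz
  have h2 := (hg.mem w).1 hw
  have h3 := sq_nonneg ‖z - w‖
  have h4 := norm_nonneg (lw r w (z - w))
  unfold dd; linarith

lemma geo_basic (hg : Geo D r c t C) {w : Cn n} (hw : w ∈ D) {ν : Cn n} (hν : ‖ν‖ ≤ C) (ξ : Cn n) :
    ‖lw r w ξ‖ ≤ ‖Pfun (lw r w) ν (Hw r w) ξ‖ + C * ‖prl (lw r w) ν ξ‖^2 ∧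
    ‖Pfun (lw r w) ν (Hw r w) ξ‖ ≤ ‖lw r w ξ‖ + C * ‖prl (lw r w) ν ξ‖^2 ∧
    ‖prl (lw r w) ν ξ‖ ≤ (1 + C^2) * ‖ξ‖ ∧ ‖ξ‖ ≤ ‖prl (lw r w) ν ξ‖ + C * ‖lw r w ξ‖ ∧ ‖lw r w ξ‖ ≤ C * ‖ξ‖ := by
  have hC := hg.hC
  have hl : ‖lw r w‖ ≤ C := (lw_norm hg.hr w).trans (hg.fd w hw)
  set x := prl (lw r w) ν ξ with hx
  set a := lw r w ξ with ha
  have hsp : x + a • ν = ξ := xi_split _ _ _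
  have hav : ‖a • ν‖ ≤ C * ‖a‖ := by rw [norm_smul, mul_comm]; gcongr
  have hxn : ‖x‖ ≤ (1 + C^2) * ‖ξ‖ := (prl_norm_le _ _ _).trans (by gcongr; nlinarith [norm_nonneg ν, norm_nonneg (lw r w)])
  have hξn : ‖ξ‖ ≤ ‖x‖ + C * ‖a‖ := by rw [← hsp]; exact (norm_add_le _ _).trans (by gcongr)
  have hH : ‖Hw r w x‖ ≤ C * ‖x‖^2 := (Hw_norm r w x).trans (by gcongr; exact hg.fd2 w hw)
  have hP : Pfun (lw r w) ν (Hw r w) ξ = a + Hw r w x := rfl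
  refine ⟨?_, ?_, hxn, hξn, ((lw r w).le_opNorm ξ).trans (by gcongr)⟩
  · have : a = Pfun (lw r w) ν (Hw r w) ξ - Hw r w x := by rw [hP]; ring
    rw [this]; exact (norm_sub_le _ _).trans (by gcongr)
  · rw [hP]; exact (norm_add_le _ _).trans (by gcongr)

lemma sq_add_le2 {a b e : ℝ} (ha : 0 ≤ a) (h : a ≤ b + e) : a^2 ≤ 2 * b^2 + 2 * e^2 := by
  have := pow_le_pow_left₀ ha h 2
  nlinarith [sq_nonneg (b - e)]

lemma q_lower (hg : Geo D r c t C) : ∃ r0 > 0, r0 ≤ 1 ∧ ∃ C2 > 0, ∀ w ∈ D, -t < r w → ∀ ν, lw r w ν = 1 → ‖ν‖ ≤ C →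
    ∀ z ∈ D, ‖z - w‖ < r0 → dd r z w ≤ C2 * ‖((-r w : ℝ) : ℂ) - Pfun (lw r w) ν (Hw r w) (z - w)‖ := by
  have hC := hg.hC
  have hc := hg.hc
  obtain ⟨η, hη, hη1, M0, hM0, hk⟩ := KEY hg (ε := c/2) (by positivity)
  set C3 := C * (1 + (1 + C^2)^2) with hC3
  have hC3p : 0 < C3 := by positivity
  refine ⟨min η (1 / (2 * M0 * C3)), by positivity, (min_le_left _ _).trans hη1, 8 + 10/c + (1 + 2*C^3) * (6 + 5*C/c), by positivity,
    fun w hw hwt ν hν hνC z hz hzw => ?_⟩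
  set ξ := z - w with hξ
  have hk := hk w hw hwt ν hν hνC ξ (hzw.trans_le (min_le_left _ _))
  obtain ⟨b1, b2, b3, b4, b5⟩ := geo_basic hg hw hνC ξ
  have hL := hg.levi w hw hwt (prl (lw r w) ν ξ)
  have hwz : w + ξ = z := by rw [hξ]; abel
  rw [hwz] at hk
  set x := prl (lw r w) ν ξ
  set a := lw r w ξ
  set P := Pfun (lw r w) ν (Hw r w) ξ
  set q := ((-r w : ℝ) : ℂ) - P with hq
  have hx1 : ‖ξ‖ ≤ 1 := hzw.le.trans ((min_le_left _ _).trans hη1)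
  have hP3 : ‖P‖ ≤ C3 * ‖ξ‖ := by
    have h1 : ‖x‖^2 ≤ (1 + C^2)^2 * ‖ξ‖^2 := by rw [← mul_pow]; exact pow_le_pow_left₀ (norm_nonneg x) b3 2
    have h2 : ‖ξ‖^2 ≤ ‖ξ‖ := by nlinarith [norm_nonneg ξ]
    calc ‖P‖ ≤ C * ‖ξ‖ + C * ((1 + C^2)^2 * ‖ξ‖) := b2.trans (add_le_add b5 (by gcongr; exact h1.trans (by gcongr)))
      _ = _ := by rw [hC3]; ring
  have hP4 : M0 * ‖P‖^2 ≤ 1/2 * ‖P‖ := by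
    have h1 : ‖ξ‖ ≤ 1 / (2 * M0 * C3) := hzw.le.trans (min_le_right _ _)
    rw [le_div_iff₀ (by positivity)] at h1
    have h2 : M0 * ‖P‖ ≤ 1/2 := by
      calc M0 * ‖P‖ ≤ M0 * (C3 * ‖ξ‖) := by gcongr
        _ ≤ _ := by linarith
    nlinarith [norm_nonneg P]
  have hs : 0 < -r w := by linarith [(hg.mem w).1 hw]
  have hδ : 0 < -r z := by linarith [(hg.mem z).1 hz]
  have hPq : ‖P‖ ≤ ‖q‖ + -r w := by
    have : P = ((-r w : ℝ) : ℂ) - q := by rw [hq]; ring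
    rw [this]
    refine (norm_sub_le _ _).trans ?_
    rw [Complex.norm_real, Real.norm_eq_abs, abs_of_pos hs]; linarith
  have hqr : -r w - P.re ≤ ‖q‖ := by
    have := Complex.re_le_norm q
    simpa [hq] using this
  have h1 := (abs_le.1 hk).1
  have hA : -r w / 2 + -r z + c/2 * ‖x‖^2 ≤ 5/2 * ‖q‖ := by linarith
  have hx0 : 0 ≤ c/2 * ‖x‖^2 := by positivity
  have hx2 : ‖x‖^2 ≤ 5/c * ‖q‖ := by
    rw [div_mul_eq_mul_div, le_div_iff₀ hc]; linarith
  have ha : ‖a‖ ≤ (6 + 5*C/c) * ‖q‖ := by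
    have : C * ‖x‖^2 ≤ C * (5/c * ‖q‖) := by gcongr
    calc ‖a‖ ≤ 6 * ‖q‖ + C * (5/c * ‖q‖) := by linarith
      _ = _ := by ring
  have hξ2 := sq_add_le2 (norm_nonneg ξ) b4
  have ha2 : 2 * (C * ‖a‖)^2 ≤ 2 * C^3 * ‖a‖ := by
    have h5 : ‖a‖ ≤ C := b5.trans (by nlinarith)
    calc 2 * (C * ‖a‖)^2 = 2 * C^2 * ‖a‖ * ‖a‖ := by ring
      _ ≤ 2 * C^2 * ‖a‖ * C := by gcongr
      _ = _ := by ring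
  have hfin : (1 + 2*C^3) * ‖a‖ ≤ (1 + 2*C^3) * ((6 + 5*C/c) * ‖q‖) := by gcongr
  have hgoal : dd r z w ≤ 8 * ‖q‖ + 10/c * ‖q‖ + (1 + 2*C^3) * ((6 + 5*C/c) * ‖q‖) := by
    have : dd r z w = -r z - r w + ‖ξ‖^2 + ‖a‖ := rfl
    have e : 10/c * ‖q‖ = 2 * (5/c*‖q‖) := by ring
    rw [this, e]
    linarith
  calc _ ≤ _ := hgoal
    _ = _ := by ring

lemma B_small (hg : Geo D r c t C) {η : ℝ} (hη : 0 < η) : ∃ M1 ≥ 1, ∀ M ≥ M1, ∀ ε ≥ 0, ∀ w ∈ D, -t < r w → -r w ≤ 1/M → ∀ ν, lw r w ν = 1 → ‖ν‖ ≤ C →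
    ∀ ξ ∈ Bset (lw r w) ν (Hw r w) (fun x => leviForm r w x + ε * ‖x‖^2) (-r w) M, ‖ξ‖ < η := by
  have hC := hg.hC
  have hc := hg.hc
  set K := 6/c + 2*C^2*(12 + 2*C^2*(3/c)^2) with hK
  have hKp : 0 < K := by positivity
  refine ⟨K/η^2 + 1, by have : 0 < K/η^2 := by positivity
                        linarith, fun M hM ε hε w hw hwt hs ν hν hνC ξ hξ => ?_⟩
  have hM1 : 1 ≤ M := by
    have : 0 < K/η^2 := by positivity
    linarith
  have hM0 : 0 < M := by linarith
  obtain ⟨b1, b2, b3, b4, b5⟩ := geo_basic hg hw hνC ξ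
  have hL := hg.levi w hw hwt (prl (lw r w) ν ξ)
  have hξ' : 2 * (Pfun (lw r w) ν (Hw r w) ξ).re + M * ‖Pfun (lw r w) ν (Hw r w) ξ‖^2 + (leviForm r w (prl (lw r w) ν ξ) + ε * ‖prl (lw r w) ν ξ‖^2) < -r w := hξ
  set x := prl (lw r w) ν ξ
  set a := lw r w ξ
  set P := Pfun (lw r w) ν (Hw r w) ξ
  have hre : -‖P‖ ≤ P.re := (abs_le.1 (Complex.abs_re_le_norm P)).1
  have h0 : 0 ≤ ε * ‖x‖^2 := by positivity
  have hsq : 2 * ‖P‖ ≤ M/2 * ‖P‖^2 + 2 * (1/M) := by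
    have : M/2 * ‖P‖^2 + 2 * (1/M) - 2 * ‖P‖ = (M * ‖P‖ - 2)^2 / (2*M) := by field_simp; ring
    have h2 : 0 ≤ (M * ‖P‖ - 2)^2 / (2*M) := by positivity
    linarith
  have hmain : M/2 * ‖P‖^2 + c * ‖x‖^2 ≤ 3 * (1/M) := by linarith
  have hMi : 1/M ≤ 1 := by rw [div_le_one hM0]; exact hM1
  have hMp : 0 < 1/M := by positivity
  have hP2 : ‖P‖^2 ≤ 6 * (1/M) := by
    have h1 : 0 ≤ c * ‖x‖^2 := by positivity
    have h2 : 1 * ‖P‖^2 ≤ M * ‖P‖^2 := by gcongr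
    linarith
  have hx2 : ‖x‖^2 ≤ 3/c * (1/M) := by
    have h1 : 0 ≤ M/2 * ‖P‖^2 := by positivity
    rw [div_mul_eq_mul_div, le_div_iff₀ hc]; linarith
  have hx4 : (‖x‖^2)^2 ≤ (3/c)^2 * (1/M) := by
    calc (‖x‖^2)^2 ≤ (3/c * (1/M))^2 := by gcongr
      _ = (3/c)^2 * (1/M) * (1/M) := by ring
      _ ≤ (3/c)^2 * (1/M) * 1 := by gcongr
      _ = _ := by ring
  have ha2 := sq_add_le2 (norm_nonneg a) b1
  have hξ2 := sq_add_le2 (norm_nonneg ξ) b4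
  have hfin : ‖ξ‖^2 ≤ K * (1/M) := by
    have h1 : ‖a‖^2 ≤ (12 + 2*C^2*(3/c)^2) * (1/M) := by
      calc ‖a‖^2 ≤ 2 * ‖P‖^2 + 2 * C^2 * (‖x‖^2)^2 := by rw [mul_pow] at ha2; linarith
        _ ≤ 2 * (6 * (1/M)) + 2 * C^2 * ((3/c)^2 * (1/M)) := by gcongr
        _ = _ := by ring
    calc ‖ξ‖^2 ≤ 2 * ‖x‖^2 + 2 * C^2 * ‖a‖^2 := by rw [mul_pow] at hξ2; linarith
      _ ≤ 2 * (3/c * (1/M)) + 2 * C^2 * ((12 + 2*C^2*(3/c)^2) * (1/M)) := by gcongr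
      _ = _ := by rw [hK]; ring
  have : K * (1/M) < η^2 := by
    have h1 : K/η^2 < M := by linarith
    rw [div_lt_iff₀ (by positivity)] at h1
    rw [mul_one_div, div_lt_iff₀ hM0]; linarith
  exact lt_of_pow_lt_pow_left₀ 2 hη.le (hfin.trans_lt this)

lemma thin (hg : Geo D r c t C) : ∃ C5 > 0, ∀ ε > 0, ∀ M0 M η, (∀ w ∈ D, -t < r w → ∀ ν, lw r w ν = 1 → ‖ν‖ ≤ C →
    ∀ ξ, ‖ξ‖ < η → |r (w + ξ) - r w - 2 * (Pfun (lw r w) ν (Hw r w) ξ).re - leviForm r w (prl (lw r w) ν ξ)| ≤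
      ε * ‖prl (lw r w) ν ξ‖^2 + M0 * ‖Pfun (lw r w) ν (Hw r w) ξ‖^2) → M0 ≤ M → 1 ≤ M → η ≤ 1 →
    ∀ w ∈ D, -t < r w → ∀ ν, lw r w ν = 1 → ‖ν‖ ≤ C → ∀ u ∈ D, ‖u - w‖ < η → ‖u - w‖ ≤ ε / M →
    u - w ∉ Bset (lw r w) ν (Hw r w) (fun x => leviForm r w x + ε * ‖x‖^2) (-r w) M → -r u ≤ C5 * ε * dd r u w := by
  have hC := hg.hC
  set C3 := C * (1 + (1 + C^2)^2) with hC3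
  set C4 := 1 + C * (1 + C^2)^2 with hC4
  refine ⟨2 * (1 + C^2)^2 + 2 * C3 * C4, by positivity, fun ε hε M0 M η hk hM hM1 hη1 w hw hwt ν hν hνC u hu h1 h2 hB => ?_⟩
  set ξ := u - w with hξ
  have hk := hk w hw hwt ν hν hνC ξ h1
  obtain ⟨b1, b2, b3, b4, b5⟩ := geo_basic hg hw hνC ξ
  have hwu : w + ξ = u := by rw [hξ]; abel
  rw [hwu] at hk
  have hB' : ¬ (2 * (Pfun (lw r w) ν (Hw r w) ξ).re + M * ‖Pfun (lw r w) ν (Hw r w) ξ‖^2 + (leviForm r w (prl (lw r w) ν ξ) + ε * ‖prl (lw r w) ν ξ‖^2) < -r w) := hB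
  set x := prl (lw r w) ν ξ
  set P := Pfun (lw r w) ν (Hw r w) ξ
  have hx1 : ‖ξ‖ ≤ 1 := h1.le.trans hη1
  have hs : 0 < -r w := by linarith [(hg.mem w).1 hw]
  have hδ : 0 < -r u := by linarith [(hg.mem u).1 hu]
  have hd : dd r u w = -r u - r w + ‖ξ‖^2 + ‖lw r w ξ‖ := rfl
  have hd1 : ‖ξ‖^2 ≤ dd r u w := by rw [hd]; linarith [norm_nonneg (lw r w ξ)]
  have hd2 : ‖lw r w ξ‖ ≤ dd r u w := by rw [hd]; linarith [sq_nonneg ‖ξ‖]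
  have hd0 : 0 ≤ dd r u w := (norm_nonneg _).trans hd2
  have hx2 : ‖x‖^2 ≤ (1 + C^2)^2 * ‖ξ‖^2 := by rw [← mul_pow]; exact pow_le_pow_left₀ (norm_nonneg x) b3 2
  have hx3 : ‖x‖^2 ≤ (1 + C^2)^2 * dd r u w := hx2.trans (by gcongr)
  have hP3 : ‖P‖ ≤ C3 * ‖ξ‖ := by
    have h2 : ‖ξ‖^2 ≤ ‖ξ‖ := by nlinarith [norm_nonneg ξ]
    calc ‖P‖ ≤ C * ‖ξ‖ + C * ((1 + C^2)^2 * ‖ξ‖) := b2.trans (add_le_add b5 (by gcongr; exact hx2.trans (by gcongr)))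
      _ = _ := by rw [hC3]; ring
  have hP4 : ‖P‖ ≤ C4 * dd r u w := by
    calc ‖P‖ ≤ dd r u w + C * ((1 + C^2)^2 * dd r u w) := b2.trans (add_le_add hd2 (by gcongr))
      _ = _ := by rw [hC4]; ring
  have hMp : 0 < M := by linarith
  have hP5 : M * ‖P‖^2 ≤ C3 * C4 * ε * dd r u w := by
    calc M * ‖P‖^2 = M * (‖P‖ * ‖P‖) := by ring
      _ ≤ M * ((C3 * (ε / M)) * (C4 * dd r u w)) := by gcongr; exact hP3.trans (by gcongr)
      _ = _ := by field_simp
  have hM0P : M0 * ‖P‖^2 ≤ M * ‖P‖^2 := by gcongr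
  have hk1 := (abs_le.1 hk).1
  have hx4 : ε * ‖x‖^2 ≤ ε * ((1 + C^2)^2 * dd r u w) := by gcongr
  calc -r u ≤ 2 * (ε * ((1 + C^2)^2 * dd r u w)) + 2 * (C3 * C4 * ε * dd r u w) := by linarith
    _ = _ := by ring
end
end

section
open scoped ENNReal Topology

section
variable {n : ℕ} {D : Set (Cn n)} {r : Cn n → ℝ} {c t C : ℝ}

lemma geo_open (hg : Geo D r c t C) : IsOpen D := by
  have : D = r ⁻¹' Set.Iio 0 := by ext x; exact hg.mem x
  rw [this]; exact isOpen_Iio.preimage hg.hr.continuous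

lemma geo_fin (hg : Geo D r c t C) : dVol n D < ⊤ := hg.bdd.measure_lt_top

lemma trans_ind (w : Cn n) (B : Set (Cn n)) (f : Cn n → ℂ) :
    (fun ξ => {u | u - w ∈ B}.indicator f (w + ξ)) = B.indicator (fun ξ => f (w + ξ)) := by
  ext ξ; by_cases h : ξ ∈ B <;> simp [Set.indicator, h]

lemma trans_meas (w : Cn n) {B : Set (Cn n)} (hB : MeasurableSet B) : MeasurableSet {u | u - w ∈ B} := by
  exact (measurable_id.sub_const w) hB

lemma trans_int (w : Cn n) {B : Set (Cn n)} (hB : MeasurableSet B) (f : Cn n → ℂ) :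
    ∫ ξ in B, f (w + ξ) ∂(dVol n) = ∫ u in {u | u - w ∈ B}, f u ∂(dVol n) := by
  rw [← integral_indicator hB, ← integral_indicator (trans_meas w hB), ← trans_ind, integral_add_left_eq_self]

lemma trans_intOn (w : Cn n) {B : Set (Cn n)} (hB : MeasurableSet B) {f : Cn n → ℂ} (h : IntegrableOn f {u | u - w ∈ B} (dVol n)) :
    IntegrableOn (fun ξ => f (w + ξ)) B (dVol n) := by
  rw [← integrable_indicator_iff hB, ← trans_ind]
  exact (h.integrable_indicator (trans_meas w hB)).comp_add_left w

lemma geo_int (hg : Geo D r c t C) {s : ℝ} (hs : 0 < s) (hs1 : s ≤ 1) : ∃ Cs > 0, ∀ w ∈ D, s ≤ -r w → ∃ G : Cn n → ℂ, Measurable G ∧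
    (∀ u, ‖G u‖ ≤ Cs) ∧ ∀ g, DifferentiableOn ℂ g D → MemLp g 2 ((dVol n).restrict D) → g w = ∫ u in D, g u * conj (G u) ∂(dVol n) := by
  have hC := hg.hC
  have hD := geo_open hg
  set ρ := s / C with hρ
  have hρp : 0 < ρ := by positivity
  set V := (dVol n).real (Metric.ball 0 ρ) with hV
  have hVp : 0 < V := ENNReal.toReal_pos (Metric.measure_ball_pos _ _ hρp).ne' measure_ball_lt_top.ne
  have : IsFiniteMeasure ((dVol n).restrict D) := ⟨by simpa using geo_fin hg⟩
  refine ⟨1/V, by positivity, fun w hw hsw => ?_⟩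
  set Ω : Set (Cn n) := {u | u - w ∈ Metric.ball (0 : Cn n) ρ} with hΩ
  have hΩm : MeasurableSet Ω := trans_meas w measurableSet_ball
  have hsub : Ω ⊆ D := by
    intro u hu
    have hu' : ‖u - w‖ < ρ := by simpa [hΩ] using hu
    have h1 : ‖u - w‖ ≤ 1 := hu'.le.trans (by rw [hρ, div_le_one (by linarith)]; linarith)
    have h2 := (abs_le.1 (hg.lip w hw u h1)).2
    rw [hρ, lt_div_iff₀ (by linarith)] at hu'
    rw [hg.mem]; linarith
  refine ⟨Ω.indicator (fun _ => ((1/V : ℝ) : ℂ)), measurable_const.indicator hΩm, fun u => ?_, fun g hgd hgL => ?_⟩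
  · refine (norm_indicator_le_norm_self _ u).trans ?_
    rw [Complex.norm_real, Real.norm_eq_abs, abs_of_pos (by positivity)]
  · have hgi : IntegrableOn g D (dVol n) := hgL.integrable (by norm_num)
    have h1 : IntegrableOn (fun ξ => g (w + ξ)) (Metric.ball 0 ρ) (dVol n) := trans_intOn w measurableSet_ball (hgi.mono_set hsub)
    have hmv := balanced_mv (Ω := Metric.ball (0 : Cn n) ρ) Metric.isOpen_ball (fun x hx a ha => by
      rw [mem_ball_zero_iff] at hx ⊢
      rw [norm_smul]; exact (mul_le_of_le_one_left (norm_nonneg _) ha).trans_lt hx) (h := fun ξ => g (w + ξ)) (by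
      refine hgd.comp (by fun_prop) fun ξ hξ => hsub ?_
      simpa [hΩ] using hξ) (m := fun _ => 1) measurable_const (fun _ _ _ => rfl) (by simpa using h1)
    simp only [one_mul, add_zero] at hmv
    rw [trans_int w measurableSet_ball] at hmv
    have e : ∫ u in D, g u * conj (Ω.indicator (fun _ => ((1/V : ℝ) : ℂ)) u) ∂(dVol n) = ∫ u in Ω, g u * ((1/V : ℝ) : ℂ) ∂(dVol n) := by
      rw [← integral_indicator hD.measurableSet, ← integral_indicator hΩm]
      congr 1; ext u
      by_cases hu : u ∈ Ω
      · simp [hu, hsub hu]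
      · by_cases hu2 : u ∈ D <;> simp [hu, hu2]
    rw [e, integral_mul_const, hmv]
    have e2 : ∫ x in Metric.ball (0 : Cn n) ρ, (1:ℂ) ∂(dVol n) = V := by simp [hV]
    rw [e2]
    have : (V : ℂ) ≠ 0 := by exact_mod_cast hVp.ne'
    push_cast; field_simp

lemma cw_bound (hg : Geo D r c t C) : ∃ Cv > 0, ∀ ε ≥ 0, ε ≤ 1 → ∀ M ≥ 0, ∀ w ∈ D, -t < r w → M * (-r w) ≤ 1 → ∀ ν, lw r w ν = 1 → ‖ν‖ ≤ C →
    0 < (dVol n).real (Eset (lw r w) ν (fun x => leviForm r w x + ε * ‖x‖^2) (-r w) M) ∧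
    (-r w)^(n+1) / (dVol n).real (Eset (lw r w) ν (fun x => leviForm r w x + ε * ‖x‖^2) (-r w) M) ≤ Cv := by
  have hC := hg.hC
  set K := 2 * C^2 + (C+1) * (1 + C^2)^2 with hK
  have hKp : 0 < K := by positivity
  set ρ := 1 / (K + 1) with hρ
  have hρp : 0 < ρ := by positivity
  have hKρ : K * ρ^2 < 1 := by
    rw [hρ, div_pow, one_pow, mul_one_div, div_lt_one (by positivity)]; nlinarith
  set V := (dVol n).real (Metric.closedBall 0 ρ) with hV
  have hVp : 0 < V := ENNReal.toReal_pos (Metric.measure_closedBall_pos _ _ hρp).ne' measure_closedBall_lt_top.ne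
  refine ⟨1/V, by positivity, fun ε hε hε1 M hM w hw hwt hMs ν hν hνC => ?_⟩
  have hs : 0 < -r w := by linarith [(hg.mem w).1 hw]
  have hl : ‖lw r w‖ ≤ C := (lw_norm hg.hr w).trans (hg.fd w hw)
  have hN : ∀ (a : ℂ) x, (fun x => leviForm r w x + ε * ‖x‖^2) (a • x) = ‖a‖^2 * (fun x => leviForm r w x + ε * ‖x‖^2) x := by
    intro a x; simp only [levi_homC, norm_smul]; ring
  have h1 := E_lower hν (Nf := fun x => leviForm r w x + ε * ‖x‖^2) hs hMs hN (C := C + 1) (r := ρ) (fun x => by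
    have := levi_norm hg.hr w x
    have h2 := mul_le_mul_of_nonneg_right (hg.fd2 w hw) (sq_nonneg ‖x‖)
    have h3 := mul_le_mul_of_nonneg_right hε1 (sq_nonneg ‖x‖)
    linarith) (by linarith) (by
    refine lt_of_le_of_lt ?_ hKρ
    gcongr
    rw [hK]
    have h4 : ‖lw r w‖ * ‖ν‖ ≤ C^2 := by rw [sq]; gcongr
    gcongr)
  have h2 := E_bounded hν (Nf := fun x => leviForm r w x + ε * ‖x‖^2) hs hM hg.hc (fun x => by
    have h3 := hg.levi w hw hwt x
    have h4 : 0 ≤ c * ‖x‖^2 := mul_nonneg hg.hc.le (sq_nonneg _)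
    have h5 : 0 ≤ ε * ‖x‖^2 := by positivity
    linarith) (fun x _ => by
    have h3 := hg.levi w hw hwt x
    have h5 : 0 ≤ ε * ‖x‖^2 := by positivity
    linarith)
  have h3 := ENNReal.toReal_mono h2.ne h1
  rw [ENNReal.toReal_mul, ENNReal.toReal_ofReal (by positivity)] at h3
  have h4 : (-r w)^(n+1) * V ≤ (dVol n).real (Eset (lw r w) ν (fun x => leviForm r w x + ε * ‖x‖^2) (-r w) M) := h3
  have h5 : 0 < (-r w)^(n+1) * V := by positivity
  refine ⟨h5.trans_le h4, ?_⟩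
  rw [div_le_div_iff₀ (h5.trans_le h4) hVp, one_mul]; exact h4
end
end

section
open scoped ENNReal Topology

open Classical in
def Nk {n : ℕ} (D : Set (Cn n)) (r : Cn n → ℝ) (t r0 κ : ℝ) (z w : Cn n) : ℝ :=
  if z ∈ D ∧ w ∈ D ∧ ‖z - w‖ < r0 ∧ -t < r z ∧ -t < r w ∧ -r z ≤ κ * dd r z w then (1 / dd r z w)^(n+1) else 0

lemma cutoff (n : ℕ) {r0 : ℝ} (h0 : 0 < r0) : ∃ χ : Cn n → ℝ, ContDiff ℝ 2 χ ∧ (∀ x, 0 ≤ χ x ∧ χ x ≤ 1) ∧ (∀ x, ‖x‖ ≤ r0/2 → χ x = 1) ∧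
    (∀ x, 3*r0/4 ≤ ‖x‖ → χ x = 0) ∧ ∃ Cχ > 0, ∀ x, ‖fderiv ℝ χ x‖ ≤ Cχ := by
  let b : ContDiffBump (0 : Cn n) := ⟨r0/2, 3*r0/4, by positivity, by linarith⟩
  refine ⟨b, b.contDiff, fun x => ⟨b.nonneg, b.le_one⟩, fun x hx => b.one_of_mem_closedBall (by simpa [b] using hx),
    fun x hx => b.zero_of_le_dist (by simpa [b] using hx), ?_⟩
  have hc : HasCompactSupport (fderiv ℝ b) := b.hasCompactSupport.fderiv (𝕜 := ℝ)
  have hcont : Continuous (fderiv ℝ b) := (b.contDiff (n := 1)).continuous_fderiv (by norm_num)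
  obtain ⟨K, hK⟩ := hc.exists_bound_of_continuous hcont
  exact ⟨max K 1, by positivity, fun x => (hK x).trans (le_max_left _ _)⟩

lemma wderivBar_norm_le {n : ℕ} {f : Cn n → ℂ} {x : Cn n} (j : Fin n) : ‖wderivBar f x j‖ ≤ ‖fderiv ℝ f x‖ := by
  rw [wderivBar, norm_mul]
  have h1 : ‖fderiv ℝ f x (EuclideanSpace.single j (1:ℂ))‖ ≤ ‖fderiv ℝ f x‖ := by simpa using (fderiv ℝ f x).le_opNorm (EuclideanSpace.single j (1:ℂ))
  have h2 : ‖fderiv ℝ f x (EuclideanSpace.single j I)‖ ≤ ‖fderiv ℝ f x‖ := by simpa using (fderiv ℝ f x).le_opNorm (EuclideanSpace.single j I)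
  have h3 := norm_add_le (fderiv ℝ f x (EuclideanSpace.single j (1:ℂ))) (I * (fderiv ℝ f x (EuclideanSpace.single j I)))
  rw [norm_mul, Complex.norm_I, one_mul] at h3
  have : ‖(1/2:ℂ)‖ = 1/2 := by norm_num
  rw [this]; linarith

lemma wderivBar_ev {n : ℕ} {f g : Cn n → ℂ} {x : Cn n} (h : f =ᶠ[𝓝 x] g) (j : Fin n) : wderivBar f x j = wderivBar g x j := by
  rw [wderivBar, wderivBar, h.fderiv_eq]

/-- properties of the cut off holomorphic function -/
lemma cut_hol {n : ℕ} {D : Set (Cn n)} {w : Cn n} {r0 : ℝ} (h0 : 0 < r0) {χ : Cn n → ℝ} (hχ : ContDiff ℝ 2 χ) (hχ1 : ∀ x, ‖x‖ ≤ r0/2 → χ x = 1)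
    (hχ0 : ∀ x, 3*r0/4 ≤ ‖x‖ → χ x = 0) {Cχ : ℝ} (hCχ : ∀ x, ‖fderiv ℝ χ x‖ ≤ Cχ) {h : Cn n → ℂ}
    (hh : ∀ u ∈ D, ‖u - w‖ < r0 → ∀ᶠ v in 𝓝 u, DifferentiableAt ℂ h v) {B : ℝ} (hB : 0 ≤ B) (hhB : ∀ u ∈ D, ‖u - w‖ < r0 → r0/2 ≤ ‖u - w‖ → ‖h u‖ ≤ B) :
    ContDiffOn ℝ 2 (fun u => ((χ (u - w) : ℝ) : ℂ) * h u) D ∧ ∀ u ∈ D, ∀ j, ‖wderivBar (fun u => ((χ (u - w) : ℝ) : ℂ) * h u) u j‖ ≤ Cχ * B := by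
  have hCχ0 : 0 ≤ Cχ := (norm_nonneg _).trans (hCχ 0)
  have hfar : ∀ u, 3*r0/4 < ‖u - w‖ → (fun u => ((χ (u - w) : ℝ) : ℂ) * h u) =ᶠ[𝓝 u] fun _ => 0 := by
    intro u hu
    have : {v : Cn n | 3*r0/4 < ‖v - w‖} ∈ 𝓝 u := (isOpen_lt continuous_const (by fun_prop)).mem_nhds hu
    filter_upwards [this] with v hv
    rw [hχ0 _ (le_of_lt hv)]; simp
  have hcχ : ContDiff ℝ 2 (fun u => ((χ (u - w) : ℝ) : ℂ)) :=
    Complex.ofRealCLM.contDiff.comp (hχ.comp (contDiff_id.sub contDiff_const))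
  constructor
  · intro u hu
    by_cases h1 : ‖u - w‖ < r0
    · obtain ⟨O, hO1, hO2, hO3⟩ := eventually_nhds_iff.1 (hh u hu h1)
      have h2 : ContDiffOn ℝ 2 h O := hol_cd hO2 (fun v hv => (hO1 v hv).differentiableWithinAt)
      exact (hcχ.contDiffAt.mul (h2.contDiffAt (hO2.mem_nhds hO3))).contDiffWithinAt
    · exact ((contDiffAt_const (c := (0:ℂ))).congr_of_eventuallyEq (hfar u (by linarith))).contDiffWithinAt
  · intro u hu j
    by_cases h1 : ‖u - w‖ < r0
    · have hd : DifferentiableAt ℂ h u := (hh u hu h1).self_of_nhds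
      have e := wderivBar_mul (hcχ.differentiable (by norm_num) u) (hd.restrictScalars ℝ) j
      rw [e, bar_of_hol hd, mul_zero, add_zero, norm_mul]
      by_cases h2 : ‖u - w‖ < r0/2
      · have : (fun u => ((χ (u - w) : ℝ) : ℂ)) =ᶠ[𝓝 u] fun _ => 1 := by
          have : {v : Cn n | ‖v - w‖ < r0/2} ∈ 𝓝 u := (isOpen_lt (by fun_prop) continuous_const).mem_nhds h2
          filter_upwards [this] with v hv
          rw [hχ1 _ (le_of_lt hv)]; simp
        rw [wderivBar_ev this]
        have : wderivBar (fun _ : Cn n => (1:ℂ)) u j = 0 := by simp [wderivBar]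
        rw [this, norm_zero, zero_mul]; positivity
      · have h3 : ‖wderivBar (fun u => ((χ (u - w) : ℝ) : ℂ)) u j‖ ≤ Cχ := by
          refine (wderivBar_norm_le j).trans ?_
          have h4 : HasFDerivAt (fun u => ((χ (u - w) : ℝ) : ℂ)) (Complex.ofRealCLM.comp (fderiv ℝ χ (u - w))) u := by
            have h5 : HasFDerivAt (fun u => χ (u - w)) (fderiv ℝ χ (u - w)) u := by
              have := (hχ.differentiable (by norm_num) (u - w)).hasFDerivAt
              exact this.comp u ((hasFDerivAt_id u).sub_const w)
            exact Complex.ofRealCLM.hasFDerivAt.comp u h5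
          rw [h4.fderiv]
          refine (ContinuousLinearMap.opNorm_comp_le _ _).trans ?_
          rw [Complex.ofRealCLM_norm, one_mul]; exact hCχ _
        exact mul_le_mul h3 (hhB u hu h1 (not_lt.1 h2)) (norm_nonneg _) hCχ0
    · rw [wderivBar_ev (hfar u (by linarith))]
      have : wderivBar (fun _ : Cn n => (0:ℂ)) u j = 0 := by simp [wderivBar]
      rw [this, norm_zero]; positivity
end

section
open scoped ENNReal Topology

structure TAG {n : ℕ} (D : Set (Cn n)) (r : Cn n → ℝ) (t r0 κ C0 Ck : ℝ) (w : Cn n) (T A G : Cn n → ℂ) : Prop where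
  repr : ∀ g, DifferentiableOn ℂ g D → MemLp g 2 ((dVol n).restrict D) → g w = ∫ u in D, g u * conj (T u + A u + G u) ∂(dVol n)
  cd : ContDiffOn ℝ 2 T D
  mA : Measurable A
  mG : Measurable G
  bT : ∀ z ∈ D, ‖T z‖ ≤ C0 * Nk D r t r0 1 z w
  bdT : ∀ z ∈ D, ∀ j, ‖wderivBar T z j‖ ≤ Ck
  bA : ∀ z ∈ D, ‖A z‖ ≤ C0 * Nk D r t r0 κ z w
  bG : ∀ z ∈ D, ‖G z‖ ≤ Ck

section
variable {n : ℕ} {D : Set (Cn n)} {r : Cn n → ℝ} {c t C : ℝ}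

lemma Nk_nonneg (hg : Geo D r c t C) {r0 κ : ℝ} (z w : Cn n) : 0 ≤ Nk D r t r0 κ z w := by
  unfold Nk; split_ifs with h
  · have := dd_pos hg h.1 h.2.1
    positivity
  · exact le_rfl

lemma Bset_open (hg : Geo D r c t C) (w ν : Cn n) (ε M : ℝ) :
    IsOpen (Bset (lw r w) ν (Hw r w) (fun x => leviForm r w x + ε * ‖x‖^2) (-r w) M) := by
  have hH : Continuous (Hw r w) := (Hw_diff hg.hr w).continuous
  have hP : Continuous (Pfun (lw r w) ν (Hw r w)) := by
    unfold Pfun; exact (lw r w).continuous.add (hH.comp (prl (lw r w) ν).continuous)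
  have hL : Continuous (fun ξ => leviForm r w (prl (lw r w) ν ξ)) := (levi_cts w).comp (prl (lw r w) ν).continuous
  refine isOpen_lt ?_ continuous_const
  have := Complex.continuous_re.comp hP
  have h2 : Continuous fun ξ => ‖prl (lw r w) ν ξ‖ := (prl (lw r w) ν).continuous.norm
  exact ((continuous_const.mul this).add (continuous_const.mul (hP.norm.pow 2))).add (hL.add (continuous_const.mul (h2.pow 2)))

lemma geo_bd (hg : Geo D r c t C) : ∃ C0 > 0, ∃ r0 > 0, r0 ≤ 1 ∧ r0 ≤ t / (2 * C) ∧ r0 ≤ 1 / C^2 ∧ ∀ κ > 0, ∃ Ck > 0, ∃ s0 > 0, s0 ≤ 1 ∧ ∀ w ∈ D, -r w < s0 →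
    ∃ T A G, TAG D r t r0 κ C0 Ck w T A G := by
  have hC := hg.hC
  have ht := hg.ht
  have hD := geo_open hg
  obtain ⟨r1, hr1, hr11, C2, hC2, hq⟩ := q_lower hg
  obtain ⟨Cv, hCv, hcw⟩ := cw_bound hg
  obtain ⟨C5, hC5, hthin⟩ := thin hg
  set r0 := min (min r1 (1/C^2)) (t / (2 * C)) with hr0
  have hr0p : 0 < r0 := by positivity
  obtain ⟨χ, hχ, hχ01, hχ1, hχ0, Cχ, hCχ, hχb⟩ := cutoff n hr0p
  set C0 := Cv * C2^(n+1) with hC0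
  have hC0p : 0 < C0 := by positivity
  refine ⟨C0, hC0p, r0, hr0p, (min_le_left _ _).trans ((min_le_left _ _).trans hr11), min_le_right _ _, (min_le_left _ _).trans (min_le_right _ _), fun κ hκ => ?_⟩
  set ε := min 1 (κ / C5) with hε
  have hεp : 0 < ε := by positivity
  obtain ⟨η, hη, hη1, M0, hM0, hkey⟩ := KEY hg hεp
  obtain ⟨M1, hM1, hBs⟩ := B_small hg (η := min η (r0/2)) (by positivity)
  set M := max M0 M1 with hM
  have hM1' : 1 ≤ M := hM1.trans (le_max_right _ _)
  have hMp : 0 < M := by linarith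
  set s0 := min (1/M) (t/2) with hs0
  set η' := min η (ε / M) with hη'
  have hη'p : 0 < η' := by positivity
  set B0 := C0 * (1/(r0/2)^2)^(n+1) with hB0
  refine ⟨C0 * (1/η'^2)^(n+1) + Cχ * B0, by positivity, s0, by positivity, (min_le_left _ _).trans (by rw [div_le_one hMp]; exact hM1'), fun w hw hws => ?_⟩
  have hwt : -t < r w := by have := min_le_right (1/M) (t/2); linarith
  have hsM : -r w ≤ 1/M := hws.le.trans (min_le_left _ _)
  have hs : 0 < -r w := by linarith [(hg.mem w).1 hw]
  obtain ⟨ν, hν, hνC⟩ := hg.grad w hw hwt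
  set Nf : Cn n → ℝ := fun x => leviForm r w x + ε * ‖x‖^2 with hNf
  set B := Bset (lw r w) ν (Hw r w) Nf (-r w) M with hB
  have hBo : IsOpen B := Bset_open hg w ν ε M
  set B' : Set (Cn n) := {u | u - w ∈ B} with hB'
  have hB'm : MeasurableSet B' := trans_meas w hBo.measurableSet
  have hBsm : ∀ ξ ∈ B, ‖ξ‖ < min η (r0/2) := hBs M (le_max_right _ _) ε hεp.le w hw hwt hsM ν hν hνC
  have hBD : B' ⊆ D := by
    intro u hu
    have h1 := hBsm _ hu
    have h2 := hkey w hw hwt ν hν hνC (u - w) (h1.trans_le (min_le_left _ _))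
    have h3 : 2 * (Pfun (lw r w) ν (Hw r w) (u-w)).re + M * ‖Pfun (lw r w) ν (Hw r w) (u-w)‖^2 + (leviForm r w (prl (lw r w) ν (u-w)) + ε * ‖prl (lw r w) ν (u-w)‖^2) < -r w := hu
    have h4 : M0 * ‖Pfun (lw r w) ν (Hw r w) (u-w)‖^2 ≤ M * ‖Pfun (lw r w) ν (Hw r w) (u-w)‖^2 := by gcongr; exact le_max_left _ _
    have h5 := (abs_le.1 h2).2
    rw [add_sub_cancel] at h5
    rw [hg.mem]; linarith
  set E := (dVol n).real (Eset (lw r w) ν Nf (-r w) M) with hE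
  obtain ⟨hEp, hEb⟩ := hcw ε hεp.le (min_le_left _ _) M hMp.le w hw hwt (by
    have := mul_le_mul_of_nonneg_left hsM hMp.le
    rwa [mul_one_div_cancel hMp.ne'] at this) ν hν hνC
  set cw : ℝ := (-r w)^(n+1) / E with hcwd
  have hcw0 : 0 ≤ cw := by positivity
  set q : Cn n → ℂ := fun u => ((-r w : ℝ) : ℂ) - Pfun (lw r w) ν (Hw r w) (u - w) with hqd
  have hqdiff : Differentiable ℂ q := by
    have h1 := Hw_diff hg.hr w
    have h2 : Differentiable ℂ (Pfun (lw r w) ν (Hw r w)) := by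
      unfold Pfun; exact (lw r w).differentiable.add (h1.comp (prl (lw r w) ν).differentiable)
    exact (differentiable_const _).sub (h2.comp (differentiable_id.sub_const w))
  set h : Cn n → ℂ := fun u => (cw : ℂ) * ((q u)⁻¹)^(n+1) with hh
  have hqm : Measurable q := hqdiff.continuous.measurable
  have hhm : Measurable h := measurable_const.mul (hqm.inv.pow_const _)
  have hqb : ∀ u ∈ D, ‖u - w‖ < r0 → 0 < ‖q u‖ ∧ ‖h u‖ ≤ C0 * (1 / dd r u w)^(n+1) := by
    intro u hu huw
    have h1 := hq w hw hwt ν hν hνC u hu (huw.trans_le ((min_le_left _ _).trans (min_le_left _ _)))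
    have h2 := dd_pos hg hu hw
    have h3 : 0 < ‖q u‖ := by
      by_contra hcon
      have : ‖q u‖ = 0 := le_antisymm (not_lt.1 hcon) (norm_nonneg _)
      rw [show ‖((-r w : ℝ) : ℂ) - Pfun (lw r w) ν (Hw r w) (u - w)‖ = ‖q u‖ from rfl, this] at h1
      linarith
    refine ⟨h3, ?_⟩
    rw [hh]; simp only [norm_mul, norm_pow, norm_inv, Complex.norm_real, Real.norm_eq_abs, abs_of_nonneg hcw0]
    rw [hC0, mul_assoc, ← mul_pow]
    gcongr
    rw [mul_one_div, inv_eq_one_div, div_le_div_iff₀ h3 h2, one_mul]; exact h1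
  have hhd : ∀ u ∈ D, ‖u - w‖ < r0 → ∀ᶠ v in 𝓝 u, DifferentiableAt ℂ h v := by
    intro u hu huw
    have h1 : q u ≠ 0 := norm_pos_iff.1 (hqb u hu huw).1
    filter_upwards [hqdiff.continuous.continuousAt.eventually_ne h1] with v hv
    exact ((hqdiff v).inv hv |>.pow (n+1)).const_mul _
  have hdsq : ∀ u ∈ D, ‖u - w‖^2 ≤ dd r u w := by
    intro u hu
    have h1 := (hg.mem u).1 hu
    have h4 := norm_nonneg (lw r w (u - w))
    unfold dd; linarith
  have hfarb : ∀ u ∈ D, ‖u - w‖ < r0 → ∀ a > 0, a ≤ ‖u - w‖ → ‖h u‖ ≤ C0 * (1/a^2)^(n+1) := by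
    intro u hu huw a ha hau
    refine (hqb u hu huw).2.trans ?_
    have h1 : a^2 ≤ dd r u w := (pow_le_pow_left₀ ha.le hau 2).trans (hdsq u hu)
    have h2 := dd_pos hg hu hw
    gcongr
  obtain ⟨hTc, hTb⟩ := cut_hol (w := w) hr0p hχ hχ1 hχ0 hχb hhd (B := B0) (by positivity) (fun u hu h1 h2 => hfarb u hu h1 _ (by positivity) h2)
  set T : Cn n → ℂ := fun u => ((χ (u - w) : ℝ) : ℂ) * h u with hT
  have hTm : Measurable T := by
    have : Measurable fun u => ((χ (u - w) : ℝ) : ℂ) := Complex.measurable_ofReal.comp (hχ.continuous.measurable.comp (measurable_id.sub_const w))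
    exact this.mul hhm
  have hT0 : ∀ u, ¬ ‖u - w‖ < r0 → T u = 0 := fun u hu => by
    rw [hT]; simp only; rw [hχ0 _ (by linarith)]; simp
  have hTh : ∀ u, ‖T u‖ ≤ ‖h u‖ := fun u => by
    rw [hT]; simp only [norm_mul, Complex.norm_real, Real.norm_eq_abs, abs_of_nonneg (hχ01 (u - w)).1]
    exact mul_le_of_le_one_left (norm_nonneg _) (hχ01 _).2
  set Sn : Set (Cn n) := {u | u ∈ D ∧ ‖u - w‖ < η'} \ B' with hSn
  set Sf : Set (Cn n) := {u | u ∈ D ∧ ¬ ‖u - w‖ < η'} \ B' with hSf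
  have hnm : MeasurableSet {u : Cn n | ‖u - w‖ < η'} := (isOpen_lt (by fun_prop) continuous_const).measurableSet
  have hSnm : MeasurableSet Sn := (hD.measurableSet.inter hnm).diff hB'm
  have hSfm : MeasurableSet Sf := (hD.measurableSet.inter hnm.compl).diff hB'm
  have hrz : ∀ u ∈ D, ‖u - w‖ < r0 → -t < r u := by
    intro u hu huw
    have h1 := (abs_le.1 (hg.lip w hw u (huw.le.trans ((min_le_left _ _).trans ((min_le_left _ _).trans hr11))))).1
    have h2 : ‖u - w‖ < t / (2*C) := huw.trans_le (min_le_right _ _)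
    rw [lt_div_iff₀ (by positivity)] at h2
    have h3 := min_le_right (1/M) (t/2)
    linarith
  have hNkT : ∀ κ', ∀ z ∈ D, (‖z - w‖ < r0 → -r z ≤ κ' * dd r z w) → ‖T z‖ ≤ C0 * Nk D r t r0 κ' z w := by
    intro κ' z hz hthin'
    by_cases h1 : ‖z - w‖ < r0
    · rw [Nk, if_pos ⟨hz, hw, h1, hrz z hz h1, hwt, hthin' h1⟩]
      exact (hTh z).trans (hqb z hz h1).2
    · rw [hT0 z h1, norm_zero]; exact mul_nonneg hC0p.le (Nk_nonneg hg _ _)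
  refine ⟨T, Sn.indicator (fun u => -T u), Sf.indicator (fun u => -T u), ⟨?_, hTc, hTm.neg.indicator hSnm, hTm.neg.indicator hSfm, ?_, ?_, ?_, ?_⟩⟩
  · intro g hgd hgL
    have : IsFiniteMeasure ((dVol n).restrict D) := ⟨by simpa using geo_fin hg⟩
    have hgi : IntegrableOn g D (dVol n) := hgL.integrable (by norm_num)
    have e1 : ∫ u in D, g u * conj (T u + Sn.indicator (fun u => -T u) u + Sf.indicator (fun u => -T u) u) ∂(dVol n) = ∫ u in B', g u * conj (h u) ∂(dVol n) := by
      rw [← integral_indicator hD.measurableSet, ← integral_indicator hB'm]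
      congr 1; ext u
      by_cases hu : u ∈ D
      · by_cases hu2 : u ∈ B'
        · have h1 : u ∉ Sn := fun hh => hh.2 hu2
          have h2 : u ∉ Sf := fun hh => hh.2 hu2
          have h3 : T u = h u := by
            have := (hBsm _ hu2).trans_le (min_le_right _ _)
            rw [hT]; simp only; rw [hχ1 _ this.le]; simp
          simp [hu, hu2, h1, h2, h3]
        · by_cases hu3 : ‖u - w‖ < η'
          · have h1 : u ∈ Sn := ⟨⟨hu, hu3⟩, hu2⟩
            have h2 : u ∉ Sf := fun hh => hh.1.2 hu3
            simp [hu, hu2, h1, h2]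
          · have h1 : u ∉ Sn := fun hh => hu3 hh.1.2
            have h2 : u ∈ Sf := ⟨⟨hu, hu3⟩, hu2⟩
            simp [hu, hu2, h1, h2]
      · have hu2 : u ∉ B' := fun h => hu (hBD h)
        simp [hu, hu2]
    have hbd : IntegrableOn (fun u => g u * conj (h u)) B' (dVol n) := by
      have h1 : IntegrableOn g B' (dVol n) := hgi.mono_set hBD
      refine h1.mul_bdd (c := C0 * (1/(-r w))^(n+1)) (Complex.continuous_conj.measurable.comp hhm).aestronglyMeasurable ?_
      filter_upwards [ae_restrict_mem hB'm] with u hu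
      have hur : ‖u - w‖ < r0 := ((hBsm _ hu).trans_le (min_le_right _ _)).trans (by linarith)
      have := (hqb u (hBD hu) hur).2
      rw [RCLike.norm_conj]
      refine this.trans ?_
      have h3 : -r w ≤ dd r u w := by
        have h1 := (hg.mem u).1 (hBD hu)
        have h4 := norm_nonneg (lw r w (u - w))
        have := sq_nonneg ‖u - w‖
        unfold dd; linarith
      have h5 := dd_pos hg (hBD hu) hw
      have h6 : 0 ≤ 1 / dd r u w := by positivity
      gcongr
    have hE0 : (E : ℂ) ≠ 0 := by exact_mod_cast hEp.ne'
    have e2 : ∀ ξ, ((-r w : ℝ):ℂ)^(n+1) * ((starRingEnd ℂ) (((-r w : ℝ):ℂ) - Pfun (lw r w) ν (Hw r w) ξ))⁻¹^(n+1) * g (w + ξ) = (E:ℂ) * (g (w + ξ) * conj (h (w + ξ))) := by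
      intro ξ
      simp only [hh, hqd, add_sub_cancel_left, map_mul, map_pow, map_inv₀, Complex.conj_ofReal, hcwd]
      push_cast; field_simp
    have hfi := (trans_intOn w hBo.measurableSet hbd).const_mul (E:ℂ)
    have hrep := repro_formula hν hs hMp.le (Nf := Nf) (fun x => by
      have h3 := hg.levi w hw hwt x
      have h4 : 0 ≤ c * ‖x‖^2 := mul_nonneg hg.hc.le (sq_nonneg _)
      have h5 : 0 ≤ ε * ‖x‖^2 := by positivity
      simp only [hNf]; linarith) (fun a x => by simp only [hNf, levi_homC, norm_smul]; ring) (by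
      have := levi_cts (r := r) w
      simp only [hNf]; fun_prop) (Hw_diff hg.hr w) (Hw_zero r w) (f := g) (z := w) (by
      refine hgd.comp (by fun_prop) fun ξ hξ => hBD ?_
      simpa [hB'] using hξ) (by
      simp only [e2]; exact hfi)
    simp only [e2] at hrep
    rw [integral_const_mul, trans_int w hBo.measurableSet (fun u => g u * conj (h u))] at hrep
    rw [e1]
    have : (E:ℂ) * g w = (E:ℂ) * ∫ u in B', g u * conj (h u) ∂(dVol n) := by rw [hB', hrep, hE]; ring
    exact mul_left_cancel₀ hE0 this
  · intro z hz
    refine hNkT 1 z hz fun _ => ?_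
    have h4 := norm_nonneg (lw r w (z - w))
    have := sq_nonneg ‖z - w‖
    unfold dd; linarith
  · intro z hz j
    have : 0 ≤ C0 * (1/η'^2)^(n+1) := by positivity
    linarith [hTb z hz j]
  · intro z hz
    by_cases h1 : z ∈ Sn
    · rw [Set.indicator_of_mem h1, norm_neg]
      refine hNkT κ z hz fun _ => ?_
      have h2 := hthin ε hεp M0 M η hkey (le_max_left _ _) hM1' hη1 w hw hwt ν hν hνC z hz (h1.1.2.trans_le (min_le_left _ _))
        (h1.1.2.le.trans (min_le_right _ _)) h1.2
      refine h2.trans ?_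
      have h3 : C5 * ε ≤ κ := by
        have := min_le_right 1 (κ / C5)
        calc C5 * ε ≤ C5 * (κ / C5) := by gcongr
          _ = κ := by field_simp
      have := dd_pos hg hz hw
      gcongr
    · rw [Set.indicator_of_notMem h1, norm_zero]; exact mul_nonneg hC0p.le (Nk_nonneg hg _ _)
  · intro z hz
    have hb2 : 0 ≤ Cχ * B0 := by positivity
    by_cases h1 : z ∈ Sf
    · rw [Set.indicator_of_mem h1, norm_neg]
      by_cases h2 : ‖z - w‖ < r0
      · have := hfarb z hz h2 η' hη'p (not_lt.1 h1.1.2)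
        linarith [hTh z]
      · rw [hT0 z h2, norm_zero]; positivity
    · rw [Set.indicator_of_notMem h1, norm_zero]; positivity
end
end

section
open scoped ENNReal Topology

section
variable {n : ℕ} {D : Set (Cn n)} {r : Cn n → ℝ} {c t C : ℝ}

lemma geo_all (hg : Geo D r c t C) : ∃ C0 > 0, ∃ r0 > 0, r0 ≤ 1 ∧ r0 ≤ 1 / C^2 ∧ ∀ κ > 0, ∃ Ck > 0, ∀ w ∈ D,
    ∃ T A G, TAG D r t r0 κ C0 Ck w T A G := by
  obtain ⟨C0, hC0, r0, hr0, hr1, -, hrC, h⟩ := geo_bd hg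
  refine ⟨C0, hC0, r0, hr0, hr1, hrC, fun κ hκ => ?_⟩
  obtain ⟨Ck, hCk, s0, hs0, hs01, h⟩ := h κ hκ
  obtain ⟨Cs, hCs, hi⟩ := geo_int hg hs0 hs01
  refine ⟨max Ck Cs, by positivity, fun w hw => ?_⟩
  rcases lt_or_ge (-r w) s0 with h1 | h1
  · obtain ⟨T, A, G, hh⟩ := h w hw h1
    exact ⟨T, A, G, hh.repr, hh.cd, hh.mA, hh.mG, hh.bT, fun z hz j => (hh.bdT z hz j).trans (le_max_left _ _), hh.bA,
      fun z hz => (hh.bG z hz).trans (le_max_left _ _)⟩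
  · obtain ⟨G, hG, hGb, hGr⟩ := hi w hw h1
    refine ⟨0, 0, G, fun g h1 h2 => ?_, contDiffOn_const, measurable_const, hG, fun z hz => ?_, fun z hz j => ?_, fun z hz => ?_, fun z hz => (hGb z).trans (le_max_right _ _)⟩
    · simpa using hGr g h1 h2
    · simpa using mul_nonneg hC0.le (Nk_nonneg hg z w)
    · have : wderivBar (0 : Cn n → ℂ) z j = 0 := by
        have := wderivBar_norm_le (f := (0 : Cn n → ℂ)) (x := z) j
        simpa using this
      rw [this, norm_zero]; positivity
    · simpa using mul_nonneg hC0.le (Nk_nonneg hg z w)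

lemma vol_layer (hg : Geo D r c t C) : ∃ Cv > 0, ∀ x ∈ D, -t < r x → ∀ τ > 0, ∀ κ > 0,
    dVol n {y | y ∈ D ∧ ‖y - x‖ < 1 / C^2 ∧ ‖y - x‖^2 ≤ τ ∧ ‖lw r x (y - x)‖ ≤ (1 + C) * τ ∧ -r y ≤ κ * τ} ≤ ENNReal.ofReal (Cv * κ * τ^(n+1)) := by
  have hC := hg.hC
  have hD := geo_open hg
  set R := (1 + C * C) * (1 + C) + (2 + C) * C with hR
  have hRC : 1 + C ≤ R := by nlinarith
  have hVp : 0 < (dVol n).real (Metric.closedBall 0 R) := ENNReal.toReal_pos (Metric.measure_closedBall_pos _ _ (by linarith)).ne' measure_closedBall_lt_top.ne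
  have hVe : dVol n (Metric.closedBall 0 R) = ENNReal.ofReal ((dVol n).real (Metric.closedBall 0 R)) := (ENNReal.ofReal_toReal measure_closedBall_lt_top.ne).symm
  refine ⟨_, hVp, fun x hx hxt τ hτ κ hκ => ?_⟩
  set V := (dVol n).real (Metric.closedBall 0 R)
  obtain ⟨ν, hν, hνC⟩ := hg.grad x hx hxt
  set S : Set (Cn n) := {y | y ∈ D ∧ ‖y - x‖ < 1 / C^2 ∧ ‖y - x‖^2 ≤ τ ∧ ‖lw r x (y - x)‖ ≤ (1 + C) * τ ∧ -r y ≤ κ * τ} with hS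
  have hcl : Continuous fun y : Cn n => ‖lw r x (y - x)‖ := ((lw r x).continuous.comp (continuous_id.sub continuous_const)).norm
  have hcn : Continuous fun y : Cn n => ‖y - x‖ := (continuous_id.sub continuous_const).norm
  have hrc := hg.hr.continuous
  have hSm : MeasurableSet S := hD.measurableSet.inter ((measurableSet_lt hcn.measurable measurable_const).inter
    ((measurableSet_le (hcn.pow 2).measurable measurable_const).inter ((measurableSet_le hcl.measurable measurable_const).inter
    (measurableSet_le hrc.neg.measurable measurable_const))))
  have h2 : ∀ y ∈ S, ∀ s : ℝ, 0 ≤ s → y + s • ν ∈ S → s ≤ κ * τ := by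
    intro y hy s hs hys
    have hd := hg.hr.differentiable (by norm_num)
    have hC2 : 1 / C^2 ≤ 1 := by rw [div_le_one (by positivity)]; nlinarith
    have hder : ∀ u ∈ Set.Icc 0 s, HasDerivAt (fun u : ℝ => r (y + u • ν)) (fderiv ℝ r (y + u • ν) ν) u := by
      intro u _
      have h1 : HasDerivAt (fun u : ℝ => y + u • ν) ν u := by
        simpa using ((hasDerivAt_id u).smul_const ν).const_add y
      exact (hd _).hasFDerivAt.comp_hasDerivAt u h1
    have hge : ∀ u ∈ Set.Icc 0 s, 1 ≤ fderiv ℝ r (y + u • ν) ν := by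
      intro u hu
      have hball : y + u • ν ∈ Metric.ball x (1/C^2) := by
        have hseg := (convex_ball x (1/C^2)).segment_subset (x := y) (y := y + s • ν) (by simpa [dist_eq_norm] using hy.2.1) (by simpa [dist_eq_norm] using hys.2.1)
        rcases hs.eq_or_lt with h0 | h0
        · have : u = 0 := le_antisymm (h0 ▸ hu.2) hu.1
          rw [this]; simpa [dist_eq_norm] using hy.2.1
        · apply hseg
          rw [segment_eq_image']
          refine ⟨u/s, ⟨by have := hu.1; positivity, by rw [div_le_one h0]; exact hu.2⟩, ?_⟩
          simp only [add_sub_cancel_left, smul_smul]; rw [div_mul_cancel₀ _ h0.ne']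
      rw [Metric.mem_ball, dist_eq_norm] at hball
      have h3 := hg.flip x hx _ (hball.le.trans hC2)
      have h4 : fderiv ℝ r x ν = 2 := by
        have := lw_re hg.hr x ν
        rw [hν] at this; simp at this; linarith
      have h5 : |fderiv ℝ r (y + u • ν) ν - fderiv ℝ r x ν| ≤ 1 := by
        calc _ = ‖(fderiv ℝ r (y + u • ν) - fderiv ℝ r x) ν‖ := by simp
          _ ≤ ‖fderiv ℝ r (y + u • ν) - fderiv ℝ r x‖ * ‖ν‖ := ContinuousLinearMap.le_opNorm _ _
          _ ≤ (C * (1/C^2)) * C := by gcongr; exact h3.trans (by gcongr)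
          _ = 1 := by field_simp
      have := (abs_le.1 h5).1
      linarith
    have hmvt := (convex_Icc 0 s).mul_sub_le_image_sub_of_le_deriv (f := fun u : ℝ => r (y + u • ν)) (C := 1)
      (fun u hu => (hder u hu).continuousAt.continuousWithinAt) (fun u hu => (hder u (interior_subset hu)).differentiableAt.differentiableWithinAt)
      (fun u hu => by rw [(hder u (interior_subset hu)).deriv]; exact hge u (interior_subset hu)) 0 (by simp [hs]) s (by simp [hs]) hs
    have h6 := (hg.mem _).1 hys.1
    have h7 := hy.2.2.2.2
    simp at hmvt
    linarith
  have hsub : ∀ y s, lw r x (y - s • ν - x) = lw r x (y - x) - (s:ℝ) := fun y s => by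
    have : y - s • ν - x = (y - x) - (s:ℂ) • ν := by simp; abel
    rw [this, map_sub, map_smul, hν]; simp
  rcases le_or_gt τ 1 with hτ1 | hτ1
  · set Q0 : Set (Cn n) := {ξ | ‖ξ‖ ≤ (1 + C) * Real.sqrt τ ∧ ‖lw r x ξ‖ ≤ (2 + C) * τ} with hQ0
    have hQ0m : MeasurableSet Q0 := (measurableSet_le continuous_norm.measurable measurable_const).inter (measurableSet_le (lw r x).continuous.norm.measurable measurable_const)
    have hmp : Measurable (fun y : Cn n => y - x) := (continuous_id.sub continuous_const).measurable
    have hsq : τ ≤ Real.sqrt τ := Real.le_sqrt_of_sq_le (by nlinarith)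
    have hl := layer_measure (Q := (fun y => y - x) ⁻¹' Q0) hSm (hmp hQ0m) ν hτ (fun y hy s hs hst => by
      constructor
      · have e : y - s • ν - x = (y - x) - s • ν := by abel
        have h4 : ‖y - x‖ ≤ Real.sqrt τ := Real.le_sqrt_of_sq_le hy.2.2.1
        simp only [e]
        calc _ ≤ ‖y - x‖ + ‖s • ν‖ := norm_sub_le _ _
          _ ≤ Real.sqrt τ + Real.sqrt τ * C := by
            rw [norm_smul, Real.norm_of_nonneg hs]; gcongr; linarith
          _ = _ := by ring
      · simp only [hsub]
        have h5 := norm_sub_le (lw r x (y - x)) (s:ℂ)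
        have h6 := hy.2.2.2.1
        rw [Complex.norm_real, Real.norm_of_nonneg hs] at h5
        linarith) h2
    have hm : dVol n ((fun y => y - x) ⁻¹' Q0) = dVol n Q0 := by
      simp only [sub_eq_add_neg]; exact measure_preimage_add_right _ _ _
    have hv := vol_box (l := lw r x) (ν := ν) (R := R) hν (a := 1 + C) (b := 2 + C) hτ (by
      have : ‖lw r x‖ ≤ C := (lw_norm hg.hr x).trans (hg.fd x hx)
      rw [hR]; gcongr)
    rw [hm] at hl
    have h8 : ENNReal.ofReal τ * dVol n S ≤ ENNReal.ofReal τ * ENNReal.ofReal (V * κ * τ^(n+1)) := by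
      refine hl.trans ((mul_le_mul_right hv _).trans_eq ?_)
      rw [hVe, ← ENNReal.ofReal_mul (by positivity), ← ENNReal.ofReal_mul (by positivity), ← ENNReal.ofReal_mul (by positivity)]
      congr 1; ring
    exact (ENNReal.mul_le_mul_iff_right (by simpa using hτ) ENNReal.ofReal_ne_top).1 h8
  · have hl := layer_measure (Q := Metric.closedBall x R) hSm Metric.isClosed_closedBall.measurableSet ν one_pos (fun y hy s hs hst => by
      have hC2 : 1 / C^2 ≤ 1 := by rw [div_le_one (by positivity)]; nlinarith
      rw [Metric.mem_closedBall, dist_eq_norm]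
      have e : y - s • ν - x = (y - x) - s • ν := by abel
      rw [e]
      calc _ ≤ ‖y - x‖ + ‖s • ν‖ := norm_sub_le _ _
        _ ≤ 1 + 1 * C := by
          rw [norm_smul, Real.norm_of_nonneg hs]; gcongr; linarith [hy.2.1]
        _ ≤ R := by linarith) h2
    have hm : dVol n (Metric.closedBall x R) = dVol n (Metric.closedBall 0 R) := Measure.addHaar_closedBall_center _ _ _
    rw [hm, hVe, ENNReal.ofReal_one, one_mul, ← ENNReal.ofReal_mul (by positivity)] at hl
    refine hl.trans (ENNReal.ofReal_le_ofReal ?_)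
    have : τ ≤ τ^(n+1) := le_self_pow₀ hτ1.le (by omega)
    calc κ * τ * V ≤ κ * τ^(n+1) * V := by gcongr
      _ = _ := by ring
end
end

section
open scoped ENNReal Topology

section
variable {n : ℕ} {D : Set (Cn n)} {r : Cn n → ℝ} {c t C : ℝ}

lemma dd_cont (hg : Geo D r c t C) : Continuous (fun p : Cn n × Cn n => dd r p.1 p.2) := by
  have hd := hg.hr.differentiable (by norm_num)
  have hc := hg.hr.continuous
  have hf : Continuous (fderiv ℝ r) := hg.hr.continuous_fderiv (by norm_num)
  have h1 : Continuous fun p : Cn n × Cn n => lw r p.2 (p.1 - p.2) := by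
    simp only [lw_apply, delPair_eq (hd _)]
    have e1 : Continuous fun p : Cn n × Cn n => fderiv ℝ r p.2 (p.1 - p.2) := (hf.comp continuous_snd).clm_apply (continuous_fst.sub continuous_snd)
    have e2 : Continuous fun p : Cn n × Cn n => fderiv ℝ r p.2 (I • (p.1 - p.2)) := (hf.comp continuous_snd).clm_apply ((continuous_fst.sub continuous_snd).const_smul I)
    fun_prop
  unfold dd
  exact (((hc.comp continuous_fst).neg.sub (hc.comp continuous_snd)).add ((continuous_fst.sub continuous_snd).norm.pow 2)).add h1.norm

lemma Nk_meas (hg : Geo D r c t C) (r0 κ : ℝ) : Measurable (fun p : Cn n × Cn n => Nk D r t r0 κ p.1 p.2) := by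
  have hc := hg.hr.continuous
  have hd := (dd_cont hg).measurable
  have hD := (geo_open hg).measurableSet
  have m1 : Measurable fun p : Cn n × Cn n => r p.1 := (hc.comp continuous_fst).measurable
  have m2 : Measurable fun p : Cn n × Cn n => r p.2 := (hc.comp continuous_snd).measurable
  have m3 : Measurable fun p : Cn n × Cn n => ‖p.1 - p.2‖ := (continuous_fst.sub continuous_snd).norm.measurable
  unfold Nk
  refine Measurable.ite ?_ ((measurable_const.div hd).pow_const _) measurable_const
  exact (measurable_fst hD).inter ((measurable_snd hD).inter ((measurableSet_lt m3 measurable_const).inter ((measurableSet_lt measurable_const m1).inter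
    ((measurableSet_lt measurable_const m2).inter (measurableSet_le m1.neg (measurable_const.mul hd))))))

lemma sch_gen (hg : Geo D r c t C) {a : ℝ} (ha : 0 < a) (ha1 : a < 1) : ∃ K > 0, ∀ x ∈ D, -t < r x → ∀ (d : Cn n → ℝ) (A : Set (Cn n)) (τ : ℝ),
    Measurable d → MeasurableSet A → 0 < τ → (∀ y ∈ A, y ∈ D ∧ ‖y - x‖ < 1 / C^2 ∧ -r y ≤ d y ∧ τ ≤ d y ∧ ‖y - x‖^2 ≤ d y ∧ ‖lw r x (y - x)‖ ≤ (1 + C) * d y) →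
    ∫⁻ y in A, ENNReal.ofReal ((-r y)^(-a) * (1/d y)^(n+1)) ∂(dVol n) ≤ ENNReal.ofReal (K * τ^(-a)) := by
  obtain ⟨Cv, hCv, hv⟩ := vol_layer hg
  have hC := hg.hC
  have h1 : (1/2:ℝ)^(1-a) < 1 := Real.rpow_lt_one (by norm_num) (by norm_num) (by linarith)
  have h2 : (1/2:ℝ)^a < 1 := Real.rpow_lt_one (by norm_num) (by norm_num) ha
  refine ⟨Cv * (2^(((n+1:ℕ):ℝ)+a) * ((1 - (1/2:ℝ)^(1-a))⁻¹ * (1 - (1/2:ℝ)^a)⁻¹)), ?_, fun x hx hxt d A τ hd hA hτ h => ?_⟩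
  · have := inv_pos.2 (sub_pos.2 h1)
    have := inv_pos.2 (sub_pos.2 h2)
    positivity
  refine dyadic_int (μ := dVol n) (δ := fun y => -r y) (d := d) hA hg.hr.continuous.neg.measurable hd (n+1) hτ hCv.le ha ha1
    (fun y hy => by linarith [(hg.mem y).1 (h y hy).1]) (fun y hy => (h y hy).2.2.1) (fun y hy => (h y hy).2.2.2.1) fun s κ hs hκ _ => ?_
  refine le_trans (measure_mono ?_) (hv x hx hxt s hs κ hκ)
  rintro y ⟨hy, hy1, hy2⟩
  obtain ⟨h1, h2, h3, h4, h5, h6⟩ := h y hy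
  exact ⟨h1, h2, h5.trans hy1, h6.trans (by gcongr), hy2⟩

lemma sch_int (hg : Geo D r c t C) {r0 : ℝ} (hr0 : r0 ≤ 1 / C^2) {a : ℝ} (ha : 0 < a) (ha1 : a < 1) : ∃ K > 0, ∀ κ > 0,
    (∀ w ∈ D, ∫⁻ z in D, ENNReal.ofReal (Nk D r t r0 κ z w) * ENNReal.ofReal ((-r z)^(-a)) ∂(dVol n) ≤ ENNReal.ofReal K * ENNReal.ofReal ((-r w)^(-a))) ∧
    (∀ z ∈ D, ∫⁻ w in D, ENNReal.ofReal (Nk D r t r0 κ z w) * ENNReal.ofReal ((-r w)^(-a)) ∂(dVol n) ≤ ENNReal.ofReal (K * κ^a) * ENNReal.ofReal ((-r z)^(-a))) := by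
  obtain ⟨K, hK, h⟩ := sch_gen hg ha ha1
  have hC := hg.hC
  have hD := (geo_open hg).measurableSet
  have hdc := dd_cont hg
  have hC2 : 1 / C^2 ≤ 1 := by rw [div_le_one (by positivity)]; nlinarith
  have hpos : ∀ y ∈ D, 0 < -r y := fun y hy => by linarith [(hg.mem y).1 hy]
  refine ⟨K, hK, fun κ hκ => ⟨fun w hw => ?_, fun z hz => ?_⟩⟩
  · rcases le_or_gt (r w) (-t) with hwt | hwt
    · have : ∀ z, Nk D r t r0 κ z w = 0 := fun z => if_neg fun hh => by linarith [hh.2.2.2.2.1]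
      simp [this]
    have hdm : Measurable fun z => dd r z w := (hdc.comp (continuous_id.prodMk continuous_const)).measurable
    set A := D ∩ {z | ‖z - w‖ < r0} with hA
    have hAm : MeasurableSet A := hD.inter (measurableSet_lt (continuous_id.sub continuous_const).norm.measurable measurable_const)
    have h1 := h w hw hwt (fun z => dd r z w) A (-r w) hdm hAm (hpos w hw) (fun y hy => by
      have h1 := hpos w hw
      have h2 := hpos y hy.1
      have h3 := norm_nonneg (lw r w (y - w))
      have h4 := sq_nonneg ‖y - w‖
      refine ⟨hy.1, hy.2.trans_le hr0, ?_, ?_, ?_, ?_⟩ <;> unfold dd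
      · linarith
      · linarith
      · linarith
      · nlinarith)
    rw [← ENNReal.ofReal_mul hK.le]
    refine le_trans ?_ h1
    rw [← lintegral_indicator hD, ← lintegral_indicator hAm]
    refine lintegral_mono fun z => ?_
    by_cases hzD : z ∈ D
    · rw [Set.indicator_of_mem hzD]
      by_cases hzA : z ∈ A
      · rw [Set.indicator_of_mem hzA, mul_comm, ← ENNReal.ofReal_mul (Real.rpow_nonneg (hpos z hzD).le _)]
        apply ENNReal.ofReal_le_ofReal
        have := Real.rpow_nonneg (hpos z hzD).le (-a)
        have h5 := dd_pos hg hzD hw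
        gcongr
        unfold Nk; split_ifs
        · exact le_rfl
        · positivity
      · have : Nk D r t r0 κ z w = 0 := if_neg fun hh => hzA ⟨hzD, hh.2.2.1⟩
        simp [this]
    · simp [hzD]
  · rcases le_or_gt (r z) (-t) with hzt | hzt
    · have : ∀ w, Nk D r t r0 κ z w = 0 := fun w => if_neg fun hh => by linarith [hh.2.2.2.1]
      simp [this]
    have hdm : Measurable fun w => dd r z w := (hdc.comp (continuous_const.prodMk continuous_id)).measurable
    set A := D ∩ ({w | ‖z - w‖ < r0} ∩ {w | -r z ≤ κ * dd r z w}) with hA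
    have hAm : MeasurableSet A := hD.inter ((measurableSet_lt (continuous_const.sub continuous_id).norm.measurable measurable_const).inter
      (measurableSet_le measurable_const (measurable_const.mul hdm)))
    have h1 := h z hz hzt (fun w => dd r z w) A (-r z / κ) hdm hAm (div_pos (hpos z hz) hκ) (fun y hy => by
      have h1 := hpos z hz
      have h2 := hpos y hy.1
      have h3 := norm_nonneg (lw r y (z - y))
      have h4 := sq_nonneg ‖z - y‖
      have h5 : ‖z - y‖ < r0 := hy.2.1
      have h6 : -r z ≤ κ * dd r z y := hy.2.2
      have h7 := lw_lip hg hy.1 (h5.le.trans (hr0.trans hC2)) (z - y)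
      have h8 : ‖lw r z (z - y)‖ ≤ ‖lw r y (z - y)‖ + C * ‖z - y‖ * ‖z - y‖ := by
        have := norm_add_le (lw r y (z-y)) (lw r z (z - y) - lw r y (z - y))
        rw [add_sub_cancel] at this; linarith
      have h9 : ‖lw r z (y - z)‖ = ‖lw r z (z - y)‖ := by rw [← neg_sub z y, map_neg, norm_neg]
      refine ⟨hy.1, ?_, ?_, ?_, ?_, ?_⟩
      · rw [norm_sub_rev]; exact h5.trans_le hr0
      · unfold dd; linarith
      · rw [div_le_iff₀ hκ]; linarith
      · rw [norm_sub_rev]; unfold dd; linarith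
      · rw [h9]; unfold dd
        refine h8.trans ?_
        nlinarith [mul_nonneg (by linarith : 0 ≤ C) h1.le, mul_nonneg (by linarith : 0 ≤ C) h2.le, mul_nonneg (by linarith : 0 ≤ C) h3])
    have e : K * (-r z / κ)^(-a) = (K * κ^a) * (-r z)^(-a) := by
      rw [Real.div_rpow (hpos z hz).le hκ.le, Real.rpow_neg hκ.le, div_inv_eq_mul]; ring
    rw [← ENNReal.ofReal_mul (by positivity), ← e]
    refine le_trans ?_ h1
    rw [← lintegral_indicator hD, ← lintegral_indicator hAm]
    refine lintegral_mono fun w => ?_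
    by_cases hwD : w ∈ D
    · rw [Set.indicator_of_mem hwD]
      by_cases hwA : w ∈ A
      · rw [Set.indicator_of_mem hwA, mul_comm, ← ENNReal.ofReal_mul (Real.rpow_nonneg (hpos w hwD).le _)]
        apply ENNReal.ofReal_le_ofReal
        have := Real.rpow_nonneg (hpos w hwD).le (-a)
        have h5 := dd_pos hg hz hwD
        gcongr
        unfold Nk; split_ifs
        · exact le_rfl
        · positivity
      · have : Nk D r t r0 κ z w = 0 := if_neg fun hh => hwA ⟨hwD, hh.2.2.1, hh.2.2.2.2.2⟩
        simp [this]
    · simp [hwD]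

lemma sch_fin (hg : Geo D r c t C) {r0 : ℝ} (hr0 : r0 ≤ 1 / C^2) {p q : ℝ} (hpq : p.HolderConjugate q) : ∃ K > 0, ∃ a : ℝ, 0 < a ∧ ∀ κ > 0, ∀ f : Cn n → ℝ≥0∞, Measurable f →
    ∫⁻ x in D, (∫⁻ y in D, ENNReal.ofReal (Nk D r t r0 κ x y) * f y ∂(dVol n))^p ∂(dVol n) ≤ ENNReal.ofReal (K * κ^a) * ∫⁻ x in D, f x ^ p ∂(dVol n) := by
  have hp := hpq.pos
  have hq := hpq.symm.pos
  obtain ⟨K1, hK1, h1⟩ := sch_int hg hr0 (a := 1/p) (by positivity) (by rw [div_lt_one hp]; exact hpq.lt)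
  obtain ⟨K2, hK2, h2⟩ := sch_int hg hr0 (a := 1/q) (by positivity) (by rw [div_lt_one hq]; exact hpq.symm.lt)
  have hD := (geo_open hg).measurableSet
  have hpos : ∀ y ∈ D, 0 < -r y := fun y hy => by linarith [(hg.mem y).1 hy]
  refine ⟨K1^(p/q) * K2, by positivity, 1/q, by positivity, fun κ hκ f hf => ?_⟩
  have hφ : ∀ x ∈ D, ∀ b > 0, (ENNReal.ofReal ((-r x)^(-(1/(p*q)))))^b = ENNReal.ofReal ((-r x)^(-(b/(p*q)))) := fun x hx b hb => by
    rw [ENNReal.ofReal_rpow_of_pos (Real.rpow_pos_of_pos (hpos x hx) _), ← Real.rpow_mul (hpos x hx).le]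
    congr 2; ring
  have eq1 : q/(p*q) = 1/p := by field_simp
  have eq2 : p/(p*q) = 1/q := by field_simp
  have := schur_test (μ := (dVol n).restrict D) (k := fun x y => ENNReal.ofReal (Nk D r t r0 κ x y)) (Nk_meas hg r0 κ).ennreal_ofReal
    (φ := fun x => ENNReal.ofReal ((-r x)^(-(1/(p*q))))) (hg.hr.continuous.neg.measurable.pow_const _).ennreal_ofReal
    (by filter_upwards [ae_restrict_mem hD] with x hx; simpa using Real.rpow_pos_of_pos (hpos x hx) _)
    (by simp) hpq (A := ENNReal.ofReal (K1 * κ^(1/p))) (B := ENNReal.ofReal K2)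
    (by
      filter_upwards [ae_restrict_mem hD] with x hx
      rw [hφ x hx q hq, eq1]
      refine le_trans (le_of_eq ?_) ((h1 κ hκ).2 x hx)
      refine setLIntegral_congr_fun hD fun y hy => ?_
      rw [hφ y hy q hq, eq1])
    (by
      filter_upwards [ae_restrict_mem hD] with x hx
      rw [hφ x hx p hp, eq2]
      refine le_trans (le_of_eq ?_) ((h2 κ hκ).1 x hx)
      refine setLIntegral_congr_fun hD fun y hy => ?_
      rw [hφ y hy p hp, eq2]) hf
  refine this.trans_eq ?_
  rw [ENNReal.ofReal_rpow_of_pos (by positivity), ← ENNReal.ofReal_mul (by positivity), Real.mul_rpow hK1.le (by positivity), ← Real.rpow_mul hκ.le]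
  congr 2
  have : 1/p * (p/q) = 1/q := by field_simp
  rw [this]; ring
end
end

section
open scoped ENNReal Topology

structure Berg {n : ℕ} (D : Set (Cn n)) (𝒦 : Cn n → Cn n → ℂ) : Prop where
  ker : ∀ z ∈ D, DifferentiableOn ℂ (fun w => (starRingEnd ℂ) (𝒦 z w)) D ∧
      MemLp (fun w => (starRingEnd ℂ) (𝒦 z w)) 2 ((dVol n).restrict D)
  rep : ∀ f : Cn n → ℂ, DifferentiableOn ℂ f D → MemLp f 2 ((dVol n).restrict D) →
      ∀ z ∈ D, f z = ∫ w in D, 𝒦 z w * f w ∂(dVol n)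

open Classical in
/-- The absolute kernel, cut off to `D × D`. -/
def kk {n : ℕ} (D : Set (Cn n)) (𝒦 : Cn n → Cn n → ℂ) (z w : Cn n) : ℝ≥0∞ := if z ∈ D ∧ w ∈ D then ‖𝒦 z w‖ₑ else 0

section
variable {n : ℕ} {D : Set (Cn n)} {𝒦 : Cn n → Cn n → ℂ}

lemma Berg.sym (hB : Berg D 𝒦) {z w : Cn n} (hz : z ∈ D) (hw : w ∈ D) : 𝒦 z w = conj (𝒦 w z) := by
  have h1 := hB.rep _ (hB.ker z hz).1 (hB.ker z hz).2 w hw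
  have h2 := hB.rep _ (hB.ker w hw).1 (hB.ker w hw).2 z hz
  rw [h2, ← Complex.conj_conj (𝒦 z w), h1, ← integral_conj]
  congr 1; ext u; simp [mul_comm]

lemma Berg.memLp (hB : Berg D 𝒦) {z : Cn n} (hz : z ∈ D) : MemLp (𝒦 z) 2 ((dVol n).restrict D) := by
  have h := (hB.ker z hz).2.star
  have e : star (fun w => conj (𝒦 z w)) = 𝒦 z := by ext w; simp
  rwa [e] at h

lemma kk_sym (hB : Berg D 𝒦) (z w : Cn n) : kk D 𝒦 z w = kk D 𝒦 w z := by
  unfold kk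
  by_cases h : z ∈ D ∧ w ∈ D
  · rw [if_pos h, if_pos h.symm, hB.sym h.1 h.2]; simp [enorm_eq_nnnorm]
  · rw [if_neg h, if_neg fun h' => h h'.symm]

lemma kk_meas (hB : Berg D 𝒦) (hD : IsOpen D) : Measurable (Function.uncurry (kk D 𝒦)) := by
  classical
  have hc1 : ∀ z ∈ D, ContinuousOn (𝒦 z) D := fun z hz => by
    simpa [Function.comp_def] using Complex.continuous_conj.comp_continuousOn (hB.ker z hz).1.continuousOn
  have hc2 : ∀ w ∈ D, ContinuousOn (fun z => 𝒦 z w) D := fun w hw =>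
    (hB.ker w hw).1.continuousOn.congr fun z hz => hB.sym hz hw
  set u : D → Cn n → ℂ := fun i x => if x ∈ D then 𝒦 i x else 0 with hu
  have h1 : Measurable (Function.uncurry u) := by
    refine measurable_uncurry_of_continuous_of_measurable (fun x => ?_) fun i => ?_
    · by_cases hx : x ∈ D
      · simp only [hu, hx, if_true]; exact continuousOn_iff_continuous_domRestrict.1 (hc2 x hx)
      · simp only [hu, hx, if_false]; exact continuous_const
    · exact (hc1 i i.2).measurable_piecewise (g := fun _ => (0:ℂ)) continuousOn_const hD.measurableSet
  refine measurable_of_restrict_of_restrict_compl (s := Prod.fst ⁻¹' D) (measurable_fst hD.measurableSet) ?_ ?_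
  · have h2 : Measurable (fun p : (Prod.fst ⁻¹' D : Set (Cn n × Cn n)) => ((⟨p.1.1, p.2⟩ : D), p.1.2)) := by
      exact ((measurable_fst.comp measurable_subtype_coe).subtype_mk).prodMk (measurable_snd.comp measurable_subtype_coe)
    have h3 := (h1.comp h2).enorm
    convert h3 using 1
    ext p
    have hp : p.1.1 ∈ D := p.2
    by_cases hp2 : p.1.2 ∈ D <;> simp [kk, hu, Function.uncurry, hp, hp2]
  · convert (measurable_const : Measurable fun _ => (0:ℝ≥0∞)) using 1
    ext p
    have hp : p.1.1 ∉ D := p.2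
    simp [kk, Function.uncurry, hp]

/-- `f` is the Bergman projection of `v`, so integrating `v` against the kernel gives `f`. -/
lemma Berg.proj (hB : Berg D 𝒦) {v f : Cn n → ℂ} (hv : MemLp v 2 ((dVol n).restrict D)) (hf : DifferentiableOn ℂ f D)
    (hf2 : MemLp f 2 ((dVol n).restrict D))
    (h : ∀ g, DifferentiableOn ℂ g D → MemLp g 2 ((dVol n).restrict D) → ∫ x in D, (v x - f x) * conj (g x) ∂(dVol n) = 0) {z : Cn n} (hz : z ∈ D) :
    ∫ u in D, 𝒦 z u * v u ∂(dVol n) = f z := by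
  rw [hB.rep f hf hf2 z hz]
  have h1 := h _ (hB.ker z hz).1 (hB.ker z hz).2
  have hk := hB.memLp hz
  have i1 : Integrable (fun u => 𝒦 z u * v u) ((dVol n).restrict D) := hk.integrable_mul hv
  have i2 : Integrable (fun u => 𝒦 z u * f u) ((dVol n).restrict D) := hk.integrable_mul hf2
  rw [← sub_eq_zero, ← integral_sub i1 i2, ← h1]
  congr 1; ext u; simp; ring

lemma bdd_memLp (hfin : dVol n D < ⊤) (hD : IsOpen D) {f : Cn n → ℂ} (hf : AEStronglyMeasurable f ((dVol n).restrict D)) {B : ℝ}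
    (hb : ∀ z ∈ D, ‖f z‖ ≤ B) : MemLp f 2 ((dVol n).restrict D) := by
  have : IsFiniteMeasure ((dVol n).restrict D) := ⟨by simpa using hfin⟩
  refine MemLp.of_bound hf B ?_
  filter_upwards [ae_restrict_mem hD.measurableSet] with z hz using hb z hz

variable {r : Cn n → ℝ} {c t C : ℝ}

lemma Nk_le (hg : Geo D r c t C) {r0 κ : ℝ} {z w : Cn n} (hz : z ∈ D) (hw : w ∈ D) : Nk D r t r0 κ z w ≤ (1/(-r w))^(n+1) := by
  have h1 := (hg.mem z).1 hz
  have h2 := (hg.mem w).1 hw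
  have h0 : 0 < -r w := by linarith
  unfold Nk; split_ifs
  · have h3 : -r w ≤ dd r z w := by
      have h4 := norm_nonneg (lw r w (z - w))
      have := sq_nonneg ‖z - w‖
      unfold dd; linarith
    have := dd_pos hg hz hw
    gcongr
  · positivity

lemma key_dec (hg : Geo D r c t C) (hB : Berg D 𝒦) {r0 κ C0 Ck : ℝ} (hC0 : 0 < C0) (hCk : 0 < Ck)
    (hT : ∀ w ∈ D, ∃ T A G, TAG D r t r0 κ C0 Ck w T A G) :
    ∃ Ce : ℝ≥0∞, Ce ≠ ⊤ ∧ ∀ w ∈ D, ∃ e : Cn n → ℝ≥0∞, ∫⁻ z in D, e z ^ (2:ℝ) ∂(dVol n) ≤ Ce ∧ ∀ z ∈ D,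
      kk D 𝒦 z w ≤ (ENNReal.ofReal (C0 * Nk D r t r0 1 z w) + ∫⁻ u in D, kk D 𝒦 z u * ENNReal.ofReal (C0 * Nk D r t r0 κ u w) ∂(dVol n)) + e z := by
  have hD := geo_open hg
  have hfin := geo_fin hg
  have : IsFiniteMeasure ((dVol n).restrict D) := ⟨by simpa using hfin⟩
  obtain ⟨R, hR, hstar⟩ := star2 hg.bdd hg.hc hg.ht hg.hr hg.mem hg.levi
  set V := ((dVol n).restrict D).real Set.univ with hV
  set B := ENNReal.ofReal (Real.sqrt (R * (V * (n * Ck^2)))) + (dVol n).restrict D Set.univ ^ (1/2:ℝ) * ENNReal.ofReal Ck with hBd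
  have hBt : B ≠ ⊤ := by simp [hBd, ENNReal.mul_eq_top, hfin.ne]
  refine ⟨B^(2:ℝ), by simp [hBt], fun w hw => ?_⟩
  obtain ⟨T, A, G, hh⟩ := hT w hw
  have hb : ∀ κ', ∀ z ∈ D, C0 * Nk D r t r0 κ' z w ≤ C0 * (1/(-r w))^(n+1) := fun κ' z hz => by
    have := Nk_le hg (r0 := r0) (κ := κ') hz hw
    gcongr
  have mT : MemLp T 2 ((dVol n).restrict D) := bdd_memLp hfin hD (hh.cd.continuousOn.aestronglyMeasurable hD.measurableSet)
    fun z hz => (hh.bT z hz).trans (hb 1 z hz)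
  have mA : MemLp A 2 ((dVol n).restrict D) := bdd_memLp hfin hD hh.mA.aestronglyMeasurable fun z hz => (hh.bA z hz).trans (hb κ z hz)
  have mG : MemLp G 2 ((dVol n).restrict D) := bdd_memLp hfin hD hh.mG.aestronglyMeasurable hh.bG
  have mdT : ∀ j, MemLp (fun x => wderivBar T x j) 2 ((dVol n).restrict D) := fun j => by
    have : ContinuousOn (fun x => wderivBar T x j) D := (wderivBar_cd hD (m := 1) (by norm_num; exact hh.cd) j).continuousOn
    exact bdd_memLp hfin hD (this.aestronglyMeasurable hD.measurableSet) fun z hz => hh.bdT z hz j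
  obtain ⟨fT, hfT, hfT2, hfTo, hfTb⟩ := HH hD hR hstar hh.cd mT mdT
  obtain ⟨fG, hfG, hfG2, hfGo, hfGb, -⟩ := proj_hol hD mG
  have b1 : eLpNorm (T - fT) 2 ((dVol n).restrict D) ≤ ENNReal.ofReal (Real.sqrt (R * (V * (n * Ck^2)))) := by
    rw [← ENNReal.ofReal_toReal (mT.sub hfT2).2.ne]
    refine ENNReal.ofReal_le_ofReal (hfTb.trans (Real.sqrt_le_sqrt ?_))
    gcongr
    have := norm_setIntegral_le_of_norm_le_const (f := fun x => ∑ j, ‖wderivBar T x j‖^2) (C := n * Ck^2) (s := D) (μ := dVol n) hfin (fun x hx => by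
      rw [Real.norm_of_nonneg (by positivity)]
      calc _ ≤ ∑ j : Fin n, Ck^2 := Finset.sum_le_sum fun j _ => by have := hh.bdT x hx j; gcongr
        _ = _ := by simp)
    refine (le_abs_self _).trans (this.trans_eq ?_)
    rw [hV]; simp [Measure.real]; ring
  have b2 : eLpNorm fG 2 ((dVol n).restrict D) ≤ (dVol n).restrict D Set.univ ^ (1/2:ℝ) * ENNReal.ofReal Ck := by
    refine hfGb.trans ((eLpNorm_le_of_ae_bound (C := Ck) ?_).trans_eq ?_)
    · filter_upwards [ae_restrict_mem hD.measurableSet] with z hz using hh.bG z hz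
    · norm_num
  refine ⟨fun z => ‖‖(T - fT) z‖ + ‖fG z‖‖ₑ, ?_, fun z hz => ?_⟩
  · have h1 := eLpNorm_add_le (mT.sub hfT2).norm.1 hfG2.norm.1 (p := 2) (by norm_num)
    rw [eLpNorm_norm, eLpNorm_norm] at h1
    have h2 := h1.trans (add_le_add b1 b2)
    rw [eLpNorm_eq_lintegral_rpow_enorm_toReal (by norm_num) (by norm_num)] at h2
    have h3 := ENNReal.rpow_le_rpow h2 (z := 2) (by norm_num)
    rw [← ENNReal.rpow_mul] at h3
    norm_num at h3
    simpa [hBd] using h3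
  · have h1 := hh.repr _ (hB.ker z hz).1 (hB.ker z hz).2
    have hk := hB.memLp hz
    have iT : Integrable (fun u => 𝒦 z u * T u) ((dVol n).restrict D) := hk.integrable_mul mT
    have iA : Integrable (fun u => 𝒦 z u * A u) ((dVol n).restrict D) := hk.integrable_mul mA
    have iG : Integrable (fun u => 𝒦 z u * G u) ((dVol n).restrict D) := hk.integrable_mul mG
    have h2 : 𝒦 z w = fT z + ∫ u in D, 𝒦 z u * A u ∂(dVol n) + fG z := by
      rw [← hB.proj mT hfT hfT2 hfTo hz, ← hB.proj mG hfG hfG2 hfGo hz, ← integral_add iT iA, ← integral_add (f := fun u => 𝒦 z u * T u + 𝒦 z u * A u) (iT.add iA) iG,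
        ← Complex.conj_conj (𝒦 z w), h1, ← integral_conj]
      congr 1; ext u; simp; ring
    have h3 : ‖∫ u in D, 𝒦 z u * A u ∂(dVol n)‖ₑ ≤ ∫⁻ u in D, kk D 𝒦 z u * ENNReal.ofReal (C0 * Nk D r t r0 κ u w) ∂(dVol n) := by
      refine (enorm_integral_le_lintegral_enorm _).trans (setLIntegral_mono_ae' hD.measurableSet ?_)
      refine ae_of_all _ fun u hu => ?_
      rw [enorm_mul, kk, if_pos ⟨hz, hu⟩]
      gcongr
      rw [← ofReal_norm_eq_enorm]
      exact ENNReal.ofReal_le_ofReal (hh.bA u hu)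
    have h4 : ‖T z‖ₑ ≤ ENNReal.ofReal (C0 * Nk D r t r0 1 z w) := by
      rw [← ofReal_norm_eq_enorm]
      exact ENNReal.ofReal_le_ofReal (hh.bT z hz)
    have h5 : ‖‖(T - fT) z‖ + ‖fG z‖‖ₑ = ‖(T - fT) z‖ₑ + ‖fG z‖ₑ := by
      rw [Real.enorm_of_nonneg (by positivity), ENNReal.ofReal_add (by positivity) (by positivity), ofReal_norm_eq_enorm, ofReal_norm_eq_enorm]
    simp only [h5]
    rw [kk, if_pos ⟨hz, hw⟩]
    have h6 : 𝒦 z w = (T z - (T - fT) z) + (∫ u in D, 𝒦 z u * A u ∂(dVol n)) + fG z := by rw [h2]; simp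
    rw [h6]
    calc _ ≤ (‖T z‖ₑ + ‖(T - fT) z‖ₑ) + ‖∫ u in D, 𝒦 z u * A u ∂(dVol n)‖ₑ + ‖fG z‖ₑ := by
          refine (enorm_add_le _ _).trans (add_le_add ((enorm_add_le _ _).trans (add_le_add enorm_sub_le le_rfl)) le_rfl)
      _ ≤ (ENNReal.ofReal (C0 * Nk D r t r0 1 z w) + ‖(T - fT) z‖ₑ) + (∫⁻ u in D, kk D 𝒦 z u * ENNReal.ofReal (C0 * Nk D r t r0 κ u w) ∂(dVol n)) + ‖fG z‖ₑ := by gcongr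
      _ = _ := by ring
end
end

section
open scoped ENNReal Topology

lemma small_exists {K a C0 p : ℝ} (ha : 0 < a) (hp : 0 < p) : ∃ κ0 > 0, ∀ κ > 0, κ ≤ κ0 → C0^p * (K * κ^a) ≤ (1/2:ℝ)^p := by
  have h1 : Filter.Tendsto (fun κ : ℝ => C0^p * (K * κ^a)) (𝓝 0) (𝓝 (C0^p * (K * 0^a))) :=
    ((Real.continuousAt_rpow_const 0 a (Or.inr ha.le)).tendsto.const_mul K).const_mul _
  rw [Real.zero_rpow ha.ne', mul_zero, mul_zero] at h1
  have h2 := h1.eventually (gt_mem_nhds (show (0:ℝ) < (1/2:ℝ)^p by positivity))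
  obtain ⟨ε, hε, h3⟩ := Metric.eventually_nhds_iff.1 h2
  refine ⟨ε/2, by positivity, fun κ hκ hκ2 => (h3 ?_).le⟩
  rw [Real.dist_eq, sub_zero, abs_of_pos hκ]; linarith

section
variable {n : ℕ} {D : Set (Cn n)} {𝒦 : Cn n → Cn n → ℂ} {r : Cn n → ℝ} {c t C : ℝ}

lemma sch_C0 (hg : Geo D r c t C) {r0 κ C0 K p : ℝ} (hC0 : 0 < C0) (hK : 0 ≤ K) (hp : 0 < p)
    (h : ∀ f : Cn n → ℝ≥0∞, Measurable f → ∫⁻ x in D, (∫⁻ y in D, ENNReal.ofReal (Nk D r t r0 κ x y) * f y ∂(dVol n))^p ∂(dVol n) ≤ ENNReal.ofReal K * ∫⁻ x in D, f x ^ p ∂(dVol n))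
    (f : Cn n → ℝ≥0∞) (hf : Measurable f) :
    ∫⁻ x in D, (∫⁻ y in D, ENNReal.ofReal (C0 * Nk D r t r0 κ x y) * f y ∂(dVol n))^p ∂(dVol n) ≤ ENNReal.ofReal (C0^p * K) * ∫⁻ x in D, f x ^ p ∂(dVol n) := by
  have hm := (Nk_meas hg r0 κ).ennreal_ofReal
  have e : ∀ x, (∫⁻ y in D, ENNReal.ofReal (C0 * Nk D r t r0 κ x y) * f y ∂(dVol n))^p = ENNReal.ofReal (C0^p) * (∫⁻ y in D, ENNReal.ofReal (Nk D r t r0 κ x y) * f y ∂(dVol n))^p := fun x => by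
    rw [← ENNReal.ofReal_rpow_of_pos hC0, ← ENNReal.mul_rpow_of_nonneg _ _ hp.le, ← lintegral_const_mul]
    · simp_rw [ENNReal.ofReal_mul hC0.le, mul_assoc]
    · exact (hm.comp measurable_prodMk_left).mul hf
  simp_rw [e]
  rw [lintegral_const_mul _ ((kint_meas (k := fun x y => ENNReal.ofReal (Nk D r t r0 κ x y)) hm hf).pow_const p), ENNReal.ofReal_mul (by positivity), mul_assoc]
  exact mul_le_mul_right (h f hf) _

lemma bound_le2 (hg : Geo D r c t C) (hB : Berg D 𝒦) {p : ℝ} (hp : 1 < p) (hp2 : p ≤ 2) : ∃ Cp : ℝ≥0∞, Cp ≠ ⊤ ∧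
    ∀ f : Cn n → ℝ≥0∞, Measurable f → (∀ x, f x ≠ ⊤) →
      ∫⁻ x in D, (∫⁻ y in D, kk D 𝒦 x y * f y ∂(dVol n))^p ∂(dVol n) ≤ Cp * ∫⁻ x in D, f x ^ p ∂(dVol n) := by
  have hD := geo_open hg
  have hfin := geo_fin hg
  have : IsFiniteMeasure ((dVol n).restrict D) := ⟨by simpa using hfin⟩
  have hpq := Real.HolderConjugate.conjExponent hp
  have h22 : (2:ℝ).HolderConjugate 2 := Real.HolderConjugate.two_two
  obtain ⟨C0, hC0, r0, hr0, hr1, hrC, hT⟩ := geo_all hg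
  obtain ⟨K1, hK1, a1, ha1, h1⟩ := sch_fin hg hrC hpq
  obtain ⟨K2, hK2, a2, ha2, h2⟩ := sch_fin hg hrC h22
  obtain ⟨κ1, hκ1, s1⟩ := small_exists (K := K1) (C0 := C0) ha1 (p := p) (by linarith)
  obtain ⟨κ2, hκ2, s2⟩ := small_exists (K := K2) (C0 := C0) ha2 (p := 2) (by norm_num)
  set κ := min κ1 κ2 with hκd
  have hκ : 0 < κ := by positivity
  obtain ⟨Ck, hCk, hT⟩ := hT κ hκ
  obtain ⟨Ce, hCe, hdec⟩ := key_dec hg hB hC0 hCk hT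
  set k := kk D 𝒦 with hk
  set N : Cn n → Cn n → ℝ≥0∞ := fun z w => ENNReal.ofReal (C0 * Nk D r t r0 1 z w) with hN
  set M : Cn n → Cn n → ℝ≥0∞ := fun z w => ENNReal.ofReal (C0 * Nk D r t r0 κ z w) with hM
  set e : Cn n → Cn n → ℝ≥0∞ := fun z w => k z w - (N z w + ∫⁻ u in D, k z u * M u w ∂(dVol n)) with he
  have hkm : Measurable (Function.uncurry k) := kk_meas hB hD
  have hNm : Measurable (Function.uncurry N) := ((Nk_meas hg r0 1).const_mul C0).ennreal_ofReal
  have hMm : Measurable (Function.uncurry M) := ((Nk_meas hg r0 κ).const_mul C0).ennreal_ofReal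
  have hIm : Measurable (fun q : Cn n × Cn n => ∫⁻ u in D, k q.1 u * M u q.2 ∂(dVol n)) := by
    refine Measurable.lintegral_prod_right (f := fun (q : Cn n × Cn n) u => k q.1 u * M u q.2) ?_
    have a1 : Measurable (fun q : (Cn n × Cn n) × Cn n => k q.1.1 q.2) := hkm.comp ((measurable_fst.comp measurable_fst).prodMk measurable_snd)
    have a2 : Measurable (fun q : (Cn n × Cn n) × Cn n => M q.2 q.1.2) := hMm.comp (measurable_snd.prodMk (measurable_snd.comp measurable_fst))
    exact a1.mul a2
  have hem : Measurable (Function.uncurry e) := hkm.sub (hNm.add hIm)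
  have hp0 : 0 < p := by linarith
  have hCe' : ∀ᵐ w ∂((dVol n).restrict D), ∫⁻ z in D, e z w ^ (2:ℝ) ∂(dVol n) ≤ Ce := by
    filter_upwards [ae_restrict_mem hD.measurableSet] with w hw
    obtain ⟨e', h3, h4⟩ := hdec w hw
    refine le_trans (setLIntegral_mono_ae' hD.measurableSet (ae_of_all _ fun z hz => ?_)) h3
    exact ENNReal.rpow_le_rpow (tsub_le_iff_left.2 (h4 z hz)) (by norm_num)
  have hker : ∀ᵐ z ∂((dVol n).restrict D), ∀ᵐ w ∂((dVol n).restrict D), k z w ≤ N z w + e z w + ∫⁻ u in D, k z u * M u w ∂(dVol n) := by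
    refine ae_of_all _ fun z => ae_of_all _ fun w => ?_
    have : k z w ≤ (N z w + ∫⁻ u in D, k z u * M u w ∂(dVol n)) + e z w := le_add_tsub
    exact this.trans_eq (by ring)
  have hk2 : ∀ᵐ z ∂((dVol n).restrict D), ∫⁻ w in D, k z w ^ (2:ℝ) ∂(dVol n) ≠ ⊤ := by
    filter_upwards [ae_restrict_mem hD.measurableSet] with z hz
    have h3 := (hB.memLp hz).2
    have h4 := (eLpNorm_lt_top_iff_lintegral_rpow_enorm_lt_top (by norm_num) (by norm_num)).1 h3
    refine ne_of_lt (lt_of_le_of_lt (setLIntegral_mono_ae' hD.measurableSet (ae_of_all _ fun w hw => ?_)) h4)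
    simp only [hk, kk, if_pos (And.intro hz hw)]
    norm_num
  have half : ∀ b : ℝ, 0 < b → ENNReal.ofReal ((1/2:ℝ)^b) = (1/2:ℝ≥0∞)^b := fun b hb => by
    rw [← ENNReal.ofReal_rpow_of_pos (by norm_num)]
    congr 1
    rw [ENNReal.ofReal_div_of_pos (by norm_num)]; simp
  have hMp : ∀ g : Cn n → ℝ≥0∞, Measurable g →
      ∫⁻ x in D, (∫⁻ y in D, M x y * g y ∂(dVol n))^p ∂(dVol n) ≤ (1/2:ℝ≥0∞)^p * ∫⁻ x in D, g x ^ p ∂(dVol n) := fun g hgm => by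
    refine (sch_C0 hg hC0 (by positivity) hp0 (h1 κ hκ) g hgm).trans (mul_le_mul_left ?_ _)
    rw [← half p hp0]
    exact ENNReal.ofReal_le_ofReal (s1 κ hκ (min_le_left _ _))
  have hM2 : ∀ g : Cn n → ℝ≥0∞, Measurable g →
      ∫⁻ x in D, (∫⁻ y in D, M x y * g y ∂(dVol n))^(2:ℝ) ∂(dVol n) ≤ (1/2:ℝ≥0∞)^(2:ℝ) * ∫⁻ x in D, g x ^ (2:ℝ) ∂(dVol n) := fun g hgm => by
    refine (sch_C0 hg hC0 (by positivity) (by norm_num) (h2 κ hκ) g hgm).trans (mul_le_mul_left ?_ _)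
    rw [← half 2 (by norm_num)]
    exact ENNReal.ofReal_le_ofReal (s2 κ hκ (min_le_right _ _))
  have hCN := sch_C0 hg hC0 (by positivity) hp0 (h1 1 one_pos)
  refine ⟨2^(p-1) * (ENNReal.ofReal (C0^p * (K1 * 1^a1)) + Ce^(p/2) * ((dVol n).restrict D Set.univ)^(p/2)) * 2^p, ?_, fun f hf hft => ?_⟩
  · have h3 : Ce^(p/2) ≠ ⊤ := ENNReal.rpow_ne_top_of_nonneg (by positivity) hCe
    have h4 : ((dVol n).restrict D Set.univ)^(p/2) ≠ ⊤ := ENNReal.rpow_ne_top_of_nonneg (by positivity) (measure_ne_top _ _)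
    have h5 : (2:ℝ≥0∞)^(p-1) ≠ ⊤ := ENNReal.rpow_ne_top_of_nonneg (by linarith) (by norm_num)
    have h6 : (2:ℝ≥0∞)^p ≠ ⊤ := ENNReal.rpow_ne_top_of_nonneg (by linarith) (by norm_num)
    exact ENNReal.mul_ne_top (ENNReal.mul_ne_top h5 (ENNReal.add_ne_top.2 ⟨ENNReal.ofReal_ne_top, ENNReal.mul_ne_top h3 h4⟩)) h6
  · exact bdd_to_all hkm hp.le (fun f hf m hfm => iter_bdd hkm hNm hMm hem hker hk2 hCe' hp.le hp2 hCN hMp hM2 hf hfm) hf hft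

lemma bound_all (hg : Geo D r c t C) (hB : Berg D 𝒦) {p : ℝ} (hp : 1 < p) : ∃ Cp : ℝ≥0∞, Cp ≠ ⊤ ∧
    ∀ f : Cn n → ℝ≥0∞, Measurable f → (∀ x, f x ≠ ⊤) →
      ∫⁻ x in D, (∫⁻ y in D, kk D 𝒦 x y * f y ∂(dVol n))^p ∂(dVol n) ≤ Cp * ∫⁻ x in D, f x ^ p ∂(dVol n) := by
  rcases le_or_gt p 2 with h | h
  · exact bound_le2 hg hB hp h
  have hfin := geo_fin hg
  have : IsFiniteMeasure ((dVol n).restrict D) := ⟨by simpa using hfin⟩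
  have hpq := Real.HolderConjugate.conjExponent hp
  set q := p.conjExponent with hq
  have hq2 : q ≤ 2 := by
    rw [hq, Real.conjExponent, div_le_iff₀ (by linarith)]; linarith
  obtain ⟨Cp, hCp, hh⟩ := bound_le2 hg hB hpq.symm.lt hq2
  refine ⟨Cp^(p/q), ENNReal.rpow_ne_top_of_nonneg (div_nonneg hpq.nonneg hpq.symm.nonneg) hCp, fun f hf _ => ?_⟩
  exact dual_bound (kk_meas hB (geo_open hg)) (ae_of_all _ fun z => ae_of_all _ fun w => kk_sym hB w z) hpq hh hf

lemma final_bound (hg : Geo D r c t C) (hB : Berg D 𝒦) {p : ℝ} (hp : 1 < p) : ∃ C : ℝ, ∀ f : Cn n → ℂ,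
      MemLp f (ENNReal.ofReal p) ((dVol n).restrict D) →
      MemLp (fun z => ∫ w in D, ‖𝒦 z w‖ * ‖f w‖ ∂(dVol n))
          (ENNReal.ofReal p) ((dVol n).restrict D) ∧
      eLpNorm (fun z => ∫ w in D, ‖𝒦 z w‖ * ‖f w‖ ∂(dVol n))
          (ENNReal.ofReal p) ((dVol n).restrict D)
        ≤ ENNReal.ofReal C * eLpNorm f (ENNReal.ofReal p) ((dVol n).restrict D) := by
  have hD := geo_open hg
  have hfin := geo_fin hg
  have : IsFiniteMeasure ((dVol n).restrict D) := ⟨by simpa using hfin⟩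
  obtain ⟨Cp, hCp, h⟩ := bound_all hg hB hp
  have hp0 : 0 < p := by linarith
  have hCp' : Cp^(1/p) ≠ ⊤ := ENNReal.rpow_ne_top_of_nonneg (by positivity) hCp
  refine ⟨(Cp^(1/p)).toReal, fun f hf => ?_⟩
  rw [ENNReal.ofReal_toReal hCp']
  set f' := hf.1.mk f with hf'
  have hfm : Measurable f' := hf.1.stronglyMeasurable_mk.measurable
  have hff : f =ᵐ[(dVol n).restrict D] f' := hf.1.ae_eq_mk
  set g : Cn n → ℝ≥0∞ := fun w => ‖f' w‖ₑ with hgd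
  have hgm : Measurable g := hfm.enorm
  have h1 := h g hgm (fun x => by simp [hgd])
  set F : Cn n → ℝ≥0∞ := fun z => ∫⁻ y in D, kk D 𝒦 z y * g y ∂(dVol n) with hF
  have hFm : Measurable F := kint_meas (kk_meas hB hD) hgm
  have e1 : (fun z => ∫ w in D, ‖𝒦 z w‖ * ‖f w‖ ∂(dVol n)) =ᵐ[(dVol n).restrict D] fun z => (F z).toReal := by
    filter_upwards [ae_restrict_mem hD.measurableSet] with z hz
    have hm : AEStronglyMeasurable (fun w => ‖𝒦 z w‖ * ‖f w‖) ((dVol n).restrict D) := (hB.memLp hz).1.norm.mul hf.1.norm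
    rw [integral_eq_lintegral_of_nonneg_ae (ae_of_all _ fun w => by positivity) hm]
    congr 1
    refine lintegral_congr_ae ?_
    filter_upwards [hff, ae_restrict_mem hD.measurableSet] with w hw hwD
    rw [kk, if_pos ⟨hz, hwD⟩, hgd, ENNReal.ofReal_mul (norm_nonneg _), ofReal_norm_eq_enorm, ofReal_norm_eq_enorm, hw]
  have e2 : eLpNorm (fun z => ∫ w in D, ‖𝒦 z w‖ * ‖f w‖ ∂(dVol n)) (ENNReal.ofReal p) ((dVol n).restrict D)
        ≤ Cp^(1/p) * eLpNorm f (ENNReal.ofReal p) ((dVol n).restrict D) := by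
    rw [eLpNorm_congr_ae e1, eLpNorm_congr_ae hff, eLpNorm_eq_lintegral_rpow_enorm_toReal (by simpa using hp0) ENNReal.ofReal_ne_top,
      eLpNorm_eq_lintegral_rpow_enorm_toReal (by simpa using hp0) ENNReal.ofReal_ne_top, ENNReal.toReal_ofReal hp0.le, ← ENNReal.mul_rpow_of_nonneg _ _ (by positivity)]
    refine ENNReal.rpow_le_rpow (le_trans (lintegral_mono fun z => ENNReal.rpow_le_rpow ?_ hp0.le) h1) (by positivity)
    rw [Real.enorm_of_nonneg ENNReal.toReal_nonneg]
    exact ENNReal.ofReal_toReal_le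
  refine ⟨⟨hFm.ennreal_toReal.aestronglyMeasurable.congr e1.symm, lt_of_le_of_lt e2 (ENNReal.mul_lt_top hCp'.lt_top hf.2)⟩, e2⟩
end
end

theorem absolute_bergman_Lp_bounded
    {n : ℕ} (hn : 1 ≤ n) (D U : Set (Cn n)) (ρ : Cn n → ℝ)
    (hDo : IsOpen D) (hDconn : IsConnected D) (hDb : Bornology.IsBounded D)
    (hUo : IsOpen U) (hUb : frontier D ⊆ U)
    (hρ : ContDiffOn ℝ 2 ρ U)
    (hdef : U ∩ D = {w ∈ U | ρ w < 0})
    (hgrad : ∀ w ∈ U, fderiv ℝ ρ w ≠ 0)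
    (hpsc : ∀ w ∈ frontier D, ∀ ξ : Cn n, ξ ≠ 0 → delPair ρ w ξ = 0 → 0 < leviForm ρ w ξ)
    (𝒦 : Cn n → Cn n → ℂ)
    (hker : ∀ z ∈ D, DifferentiableOn ℂ (fun w => (starRingEnd ℂ) (𝒦 z w)) D ∧
      MemLp (fun w => (starRingEnd ℂ) (𝒦 z w)) 2 ((dVol n).restrict D))
    (hrepr : ∀ f : Cn n → ℂ, DifferentiableOn ℂ f D → MemLp f 2 ((dVol n).restrict D) →
      ∀ z ∈ D, f z = ∫ w in D, 𝒦 z w * f w ∂(dVol n))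
    (p : ℝ) (hp : 1 < p) :
    ∃ C : ℝ, ∀ f : Cn n → ℂ,
      MemLp f (ENNReal.ofReal p) ((dVol n).restrict D) →
      MemLp (fun z => ∫ w in D, ‖𝒦 z w‖ * ‖f w‖ ∂(dVol n))
          (ENNReal.ofReal p) ((dVol n).restrict D) ∧
      eLpNorm (fun z => ∫ w in D, ‖𝒦 z w‖ * ‖f w‖ ∂(dVol n))
          (ENNReal.ofReal p) ((dVol n).restrict D)
        ≤ ENNReal.ofReal C * eLpNorm f (ENNReal.ofReal p) ((dVol n).restrict D) := by
  obtain ⟨r, c, hc, t, ht, hr, hmem, h⟩ := global_def D U ρ hDo hDb hUo hUb hρ hdef hgrad hpsc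
  obtain ⟨C, hg⟩ := geo_exists hDb hr hmem hc ht h
  exact final_bound hg ⟨hker, hrepr⟩ hp

end
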